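/- Brillhart–Morton: for every prime p ≥ 5, N₁(p, ⌊p/4⌋) = (1/4)·(2 + (1 − (−1|p))·(4 + (−2|p)))·h(√−p) − ε, and N₁(p, ⌊p/3⌋) = δ·(2L(p) − 1), where L(p) = (1/4)·(2 + (1 − (−1|p))·(2 + (−2|p)))·h(√−p). -/

import Mathlib

open Polynomial

noncomputable section

/-- The class number h(√-d) of the imaginary quadratic field ℚ(√-d),
realized as the subfield of ℂ generated by i·√d. -/
def classNumberSqrtNeg (d : ℕ) : ℕ :=
  haveI : FiniteDimensional ℚ (IntermediateField.adjoin ℚ {(Complex.I * Real.sqrt d : ℂ)}) :=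
    IntermediateField.adjoin.finiteDimensional
      ⟨X ^ 2 + C (d : ℚ), monic_X_pow_add_C _ (by norm_num), by
        have h : (Complex.I * (Real.sqrt d : ℂ)) ^ 2 = -(d : ℂ) := by
          rw [mul_pow, Complex.I_sq, ← Complex.ofReal_pow, Real.sq_sqrt (Nat.cast_nonneg d)]
          simp
        simp [h]⟩
  haveI : NumberField (IntermediateField.adjoin ℚ {(Complex.I * Real.sqrt d : ℂ)}) := ⟨⟩
  NumberField.classNumber (IntermediateField.adjoin ℚ {(Complex.I * Real.sqrt d : ℂ)})

variable (p : ℕ) [Fact p.Prime]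

/-- ε = (1 - (-1|p))/2 -/
def eps : ℕ := ((1 - legendreSym p (-1)) / 2).toNat
/-- δ = (1 - (-3|p))/2 -/
def del : ℕ := ((1 - legendreSym p (-3)) / 2).toNat
/-- ν = (1 - (-2|p))/2 -/
def nu : ℕ := ((1 - legendreSym p (-2)) / 2).toNat

/-- The Pochhammer symbol (x)_n = x(x+1)⋯(x+n-1) in 𝔽_p. -/
def poch (x : ZMod p) (n : ℕ) : ZMod p := (ascPochhammer (ZMod p) n).eval x

/-- W_m(X) = Σ_{r=0}^{m} C(m,r)² X^r ∈ ℤ[X]. -/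
def W (m : ℕ) : ℤ[X] := ∑ r ∈ Finset.range (m + 1), C ((m.choose r : ℤ) ^ 2) * X ^ r

/-- N₁(p,m): the number of distinct roots in 𝔽_p of W_m(X) reduced mod p. -/
def N1 (m : ℕ) : ℕ := (((W m).map (Int.castRingHom (ZMod p))).roots.toFinset.card)

namespace BM

set_option linter.unusedSimpArgs false

section

open scoped Manifold UpperHalfPlane Topology
open UpperHalfPlane Filter Function.Periodic

variable {R : Type*} [CommRing R] [Algebra R ℂ] {h : ℝ} {f g : ℍ → ℂ} {F G : PowerSeries R}

/-- `f` is given on the upper half plane by the power series `F` in `exp (2 π i τ / h)`. -/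
def HasPS (h : ℝ) (f : ℍ → ℂ) (F : PowerSeries R) : Prop :=
  ∀ τ : ℍ, HasSum (fun n => algebraMap R ℂ (F.coeff n) * qParam h τ ^ n) (f τ)

namespace HasPS

lemma congr' (hf : HasPS h f F) (e : ∀ τ, g τ = f τ) : HasPS h g F := by
  intro τ; rw [e]; exact hf τ

lemma map {S : Type*} [CommRing S] [Algebra S ℂ] (φ : R →+* S)
    (hφ : ∀ r, algebraMap S ℂ (φ r) = algebraMap R ℂ r) (hf : HasPS h f F) :
    HasPS h f (PowerSeries.map φ F) := by
  intro τ
  simpa [hφ] using hf τ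

lemma toComplex (hf : HasPS h f F) : HasPS h f (PowerSeries.map (algebraMap R ℂ) F) :=
  hf.map _ (fun _ => rfl)

lemma ofInt {F : PowerSeries ℤ} (hf : HasPS h f F) (R : Type*) [CommRing R] [Algebra R ℂ] :
    HasPS h f (PowerSeries.map (Int.castRingHom R) F) :=
  hf.map _ (fun r => by simp)

lemma const (c : R) : HasPS h (fun _ => algebraMap R ℂ c) (PowerSeries.C c) := by
  intro τ
  convert hasSum_ite_eq 0 (algebraMap R ℂ c) using 2 with n
  by_cases hn : n = 0 <;> simp [PowerSeries.coeff_C, hn]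

lemma one : HasPS h (fun _ => 1) (1 : PowerSeries R) := by
  simpa using const (h := h) (1 : R)

lemma zero : HasPS h (fun _ => 0) (0 : PowerSeries R) := by
  simpa using const (h := h) (0 : R)

lemma qpow (m : ℕ) : HasPS h (fun τ => qParam h τ ^ m) (PowerSeries.X ^ m : PowerSeries R) := by
  intro τ
  convert hasSum_ite_eq m (qParam h τ ^ m) using 2 with n
  by_cases hn : n = m <;> simp [PowerSeries.coeff_X_pow, hn]

lemma q : HasPS h (fun τ => qParam h τ) (PowerSeries.X : PowerSeries R) := by
  simpa using qpow (R := R) (h := h) 1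

lemma add (hf : HasPS h f F) (hg : HasPS h g G) : HasPS h (fun τ => f τ + g τ) (F + G) := by
  intro τ
  simpa [add_mul] using (hf τ).add (hg τ)

lemma neg (hf : HasPS h f F) : HasPS h (fun τ => - f τ) (-F) := by
  intro τ
  simpa using (hf τ).neg

lemma sub (hf : HasPS h f F) (hg : HasPS h g G) : HasPS h (fun τ => f τ - g τ) (F - G) := by
  simpa [sub_eq_add_neg] using hf.add hg.neg

lemma mul (hf : HasPS h f F) (hg : HasPS h g G) : HasPS h (fun τ => f τ * g τ) (F * G) := by
  intro τ
  have a := (hf τ).summable.norm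
  have b := (hg τ).summable.norm
  have hs := summable_norm_sum_mul_antidiagonal_of_summable_norm a b
  have e := tsum_mul_tsum_eq_tsum_sum_antidiagonal_of_summable_norm a b
  rw [(hf τ).tsum_eq, (hg τ).tsum_eq] at e
  have := hs.of_norm.hasSum
  rw [← e] at this
  refine this.congr_fun fun n => ?_
  rw [PowerSeries.coeff_mul, map_sum, Finset.sum_mul]
  refine Finset.sum_congr rfl fun x hx => ?_
  rw [← Finset.HasAntidiagonal.mem_antidiagonal.1 hx, map_mul, pow_add]; ring

lemma cmul (c : R) (hf : HasPS h f F) :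
    HasPS h (fun τ => algebraMap R ℂ c * f τ) (PowerSeries.C c * F) := (const c).mul hf

lemma pow (hf : HasPS h f F) (n : ℕ) : HasPS h (fun τ => f τ ^ n) (F ^ n) := by
  induction n with
  | zero => simpa using one
  | succ n ih => simpa [pow_succ] using ih.mul hf

lemma prod {ι : Type*} (s : Finset ι) {f : ι → ℍ → ℂ} {F : ι → PowerSeries R}
    (hf : ∀ i ∈ s, HasPS h (f i) (F i)) : HasPS h (fun τ => ∏ i ∈ s, f i τ) (∏ i ∈ s, F i) := by
  classical
  induction s using Finset.induction_on with
  | empty => simpa using one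
  | insert a s ha ih =>
    simp only [Finset.prod_insert ha]
    exact (hf a (by simp)).mul (ih fun i hi => hf i (by simp [hi]))

lemma sum {ι : Type*} (s : Finset ι) {f : ι → ℍ → ℂ} {F : ι → PowerSeries R}
    (hf : ∀ i ∈ s, HasPS h (f i) (F i)) : HasPS h (fun τ => ∑ i ∈ s, f i τ) (∑ i ∈ s, F i) := by
  classical
  induction s using Finset.induction_on with
  | empty => simpa using zero
  | insert a s ha ih =>
    simp only [Finset.sum_insert ha]
    exact (hf a (by simp)).add (ih fun i hi => hf i (by simp [hi]))

/-- Division by the parameter. -/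
lemma of_q_mul (hf : HasPS h (fun τ => qParam h τ * f τ) (PowerSeries.X * F)) : HasPS h f F := by
  intro τ
  have h1 := hf τ
  rw [← hasSum_nat_add_iff' 1] at h1
  simp only [Finset.range_one, Finset.sum_singleton, PowerSeries.coeff_zero_X_mul, map_zero,
    zero_mul, sub_zero, PowerSeries.coeff_succ_X_mul] at h1
  have h2 := h1.mul_left (qParam h τ)⁻¹
  rw [inv_mul_cancel_left₀ (qParam_ne_zero _)] at h2
  refine h2.congr_fun fun n => ?_
  rw [pow_succ]
  have := qParam_ne_zero (h := h) τ
  field_simp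

lemma of_pow (hf : HasPS h f F) {N : ℕ} (hN : N ≠ 0) {k : ℝ} (hk : ∀ τ : ℍ, qParam h τ = qParam k τ ^ N) :
    HasPS k f (PowerSeries.expand N hN F) := by
  intro τ
  have h1 := hf τ
  simp only [hk, ← pow_mul] at h1
  have hi : Function.Injective (fun n : ℕ => N * n) := mul_right_injective₀ hN
  rw [← hi.hasSum_iff (f := fun n => algebraMap R ℂ ((PowerSeries.expand N hN F).coeff n) *
      qParam k τ ^ n)]
  · refine h1.congr_fun fun n => ?_
    simp [PowerSeries.coeff_expand_mul]
  · intro n hn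
    rw [PowerSeries.coeff_expand_of_not_dvd, map_zero, zero_mul]
    rintro ⟨m, rfl⟩
    exact hn ⟨m, rfl⟩

/-- Rescaling the parameter along a map of the upper half plane. -/
lemma comp_rescale (hf : HasPS h f F) (φ : ℍ → ℍ) (z : R) {k : ℝ}
    (hz : ∀ τ : ℍ, qParam h (φ τ) = algebraMap R ℂ z * qParam k τ) :
    HasPS k (fun τ => f (φ τ)) (PowerSeries.rescale z F) := by
  intro τ
  refine (hf (φ τ)).congr_fun fun n => ?_
  rw [hz, PowerSeries.coeff_rescale, map_mul, map_pow, mul_pow]; ring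

lemma comp_expand (hf : HasPS h f F) (φ : ℍ → ℍ) {N : ℕ} (hN : N ≠ 0) {k : ℝ}
    (hz : ∀ τ : ℍ, qParam h (φ τ) = qParam k τ ^ N) :
    HasPS k (fun τ => f (φ τ)) (PowerSeries.expand N hN F) := by
  intro τ
  have h1 := hf (φ τ)
  simp only [hz, ← pow_mul] at h1
  have hi : Function.Injective (fun n : ℕ => N * n) := mul_right_injective₀ hN
  rw [← hi.hasSum_iff (f := fun n => algebraMap R ℂ ((PowerSeries.expand N hN F).coeff n) *
      qParam k τ ^ n)]
  · refine h1.congr_fun fun n => ?_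
    simp [PowerSeries.coeff_expand_mul]
  · intro n hn
    rw [PowerSeries.coeff_expand_of_not_dvd, map_zero, zero_mul]
    rintro ⟨m, rfl⟩
    exact hn ⟨m, rfl⟩

lemma periodic (hf : HasPS h f F) (hh : h ≠ 0) : Function.Periodic (f ∘ ofComplex) h := by
  intro w
  by_cases hw : 0 < w.im
  · have h2 : 0 < (w + h).im := by simp [hw]
    simp only [Function.comp_apply, ofComplex_apply_of_im_pos hw, ofComplex_apply_of_im_pos h2]
    have := hf ⟨w + h, h2⟩
    have e : qParam h (w + h) = qParam h w := by
      simp only [Function.Periodic.qParam]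
      rw [mul_add, add_div, mul_div_assoc _ (h : ℂ), div_self (by exact_mod_cast hh), mul_one,
        Complex.exp_add, Complex.exp_two_pi_mul_I, mul_one]
    simp only [e] at this
    exact this.unique (hf ⟨w, hw⟩)
  · have h2 : (w + h).im ≤ 0 := by simpa using hw
    simp [ofComplex_apply_of_im_nonpos (not_lt.1 hw), ofComplex_apply_of_im_nonpos h2]

/-- The sum of a power series on the unit disc. -/
def psSum (F : PowerSeries R) (z : ℂ) : ℂ := ∑' n, algebraMap R ℂ (F.coeff n) * z ^ n

lemma psSum_zero (F : PowerSeries R) : psSum F 0 = algebraMap R ℂ (F.coeff 0) := by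
  rw [psSum, tsum_eq_single 0]
  · simp
  · intro n hn
    simp [hn]

lemma psSum_qParam (hf : HasPS h f F) (τ : ℍ) : psSum F (qParam h τ) = f τ := (hf τ).tsum_eq

lemma summable_psSum (hf : HasPS h f F) (hh : 0 < h) {z : ℂ} (hz : ‖z‖ < 1) :
    Summable (fun n => algebraMap R ℂ (F.coeff n) * z ^ n) := by
  rcases eq_or_ne z 0 with rfl | h0
  · refine summable_of_ne_finset_zero (s := {0}) fun n hn => ?_
    rw [zero_pow (by simpa using hn), mul_zero]
  · have := (hf ⟨invQParam h z, im_invQParam_pos_of_norm_lt_one hh hz h0⟩).summable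
    simpa [qParam_right_inv hh.ne' h0] using this

lemma hasFPowerSeriesOnBall_psSum (hf : HasPS h f F) (hh : 0 < h) :
    HasFPowerSeriesOnBall (psSum F) (.ofScalars ℂ fun n => algebraMap R ℂ (F.coeff n)) 0 1 := by
  constructor
  · refine le_of_forall_lt_imp_le_of_dense fun r hr ↦ ?_
    rcases eq_or_ne r 0 with rfl | hr'
    · simp
    · lift r to NNReal using hr.ne_top
      apply FormalMultilinearSeries.le_radius_of_summable
      have := (hf.summable_psSum hh (z := (r : ℂ)) (by simpa using hr)).norm
      simpa [norm_mul, mul_comm, mul_left_comm, mul_assoc] using this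
  · simp
  · intro y hy
    rw [← ENNReal.coe_one, Metric.eball_coe, NNReal.coe_one, mem_ball_zero_iff] at hy
    simpa [psSum, mul_comm] using (hf.summable_psSum hh hy).hasSum

lemma differentiableAt_psSum (hf : HasPS h f F) (hh : 0 < h) {z : ℂ} (hz : ‖z‖ < 1) :
    DifferentiableAt ℂ (psSum F) z := by
  have := (hf.hasFPowerSeriesOnBall_psSum hh).differentiableOn
  rw [← ENNReal.coe_one, Metric.eball_coe, NNReal.coe_one] at this
  exact this.differentiableAt (Metric.isOpen_ball.mem_nhds (by simpa using hz))

lemma mdiff (hf : HasPS h f F) (hh : 0 < h) : MDiff f := by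
  rw [UpperHalfPlane.mdifferentiable_iff]
  have h1 : DifferentiableOn ℂ (fun z => psSum F (qParam h z)) {z | 0 < z.im} := fun z hz =>
    ((hf.differentiableAt_psSum hh (norm_qParam_lt_one hh hz)).comp z
      (differentiable_qParam z)).differentiableWithinAt
  refine h1.congr fun z hz => ?_
  simp only [Function.comp_apply, ofComplex_apply_of_im_pos hz]
  exact (hf.psSum_qParam ⟨z, hz⟩).symm

lemma tendsto (hf : HasPS h f F) (hh : 0 < h) :
    Tendsto f atImInfty (𝓝 (algebraMap R ℂ (F.coeff 0))) := by
  have h1 : f = fun τ : ℍ => psSum F (qParam h τ) := funext fun τ => (hf.psSum_qParam τ).symm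
  rw [h1, ← psSum_zero]
  exact (hf.differentiableAt_psSum hh (by simp)).continuousAt.tendsto.comp
    (qParam_tendsto_atImInfty hh)

lemma bounded (hf : HasPS h f F) (hh : 0 < h) : IsBoundedAtImInfty f :=
  (hf.tendsto hh).isBigO_one ℝ

lemma eq_zero (hh : 0 < h) (hf : HasPS h f F) (h0 : ∀ τ, f τ = 0)
    (hR : Function.Injective (algebraMap R ℂ)) : F = 0 := by
  have h1 := hf.hasFPowerSeriesOnBall_psSum hh
  have hz : ∀ z : ℂ, ‖z‖ < 1 → z ≠ 0 → psSum F z = 0 := by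
    intro z hz hz0
    have := hf.psSum_qParam ⟨invQParam h z, im_invQParam_pos_of_norm_lt_one hh hz hz0⟩
    simpa [qParam_right_inv hh.ne' hz0, h0] using this
  have hev : ∀ᶠ z in 𝓝[≠] (0 : ℂ), psSum F z = 0 := by
    filter_upwards [self_mem_nhdsWithin, mem_nhdsWithin_of_mem_nhds (Metric.ball_mem_nhds 0 one_pos)]
      with z h2 h3 using hz z (by simpa using h3) h2
  have hev2 : psSum F =ᶠ[𝓝 0] 0 :=
    (h1.hasFPowerSeriesAt.continuousAt.eventuallyEq_nhds_iff_eventuallyEq_nhdsNE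
      continuousAt_const).1 hev
  have h3 := (h1.hasFPowerSeriesAt.congr hev2).eq_zero
  ext n
  have := congr_arg (FormalMultilinearSeries.coeff · n) h3
  apply hR
  have h5 : FormalMultilinearSeries.coeff (0 : FormalMultilinearSeries ℂ ℂ ℂ) n = 0 := rfl
  simpa [h5] using this

lemma unique (hh : 0 < h) (hf : HasPS h f F) (hg : HasPS h f G)
    (hR : Function.Injective (algebraMap R ℂ)) : F = G :=
  sub_eq_zero.1 ((hf.sub hg).eq_zero hh (fun _ => sub_self _) hR)

end HasPS

lemma exists_hasPS (hh : 0 < h) (hper : ∀ τ : ℍ, f (h +ᵥ τ) = f τ) (hd : MDiff f)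
    (hb : IsBoundedAtImInfty f) : ∃ F : PowerSeries ℂ, HasPS h f F := by
  refine ⟨qExpansion h f, fun τ => ?_⟩
  refine hasSum_qExpansion hh ?_ hd hb τ
  intro w
  by_cases hw : 0 < w.im
  · have h2 : 0 < (w + h).im := by simp [hw]
    simp only [Function.comp_apply, ofComplex_apply_of_im_pos hw, ofComplex_apply_of_im_pos h2]
    rw [← hper ⟨w, hw⟩]
    congr 1
    ext
    simp [add_comm]
  · have h2 : (w + h).im ≤ 0 := by simpa using hw
    simp [ofComplex_apply_of_im_nonpos (not_lt.1 hw), ofComplex_apply_of_im_nonpos h2]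

lemma HasPS.vadd (hf : HasPS h f F) (hh : h ≠ 0) (τ : ℍ) : f (h +ᵥ τ) = f τ := by
  have := hf.periodic hh τ
  simp only [Function.comp_apply, ofComplex_apply] at this
  rw [← this]
  congr 1
  rw [← ofComplex_apply (h +ᵥ τ)]
  simp [add_comm]

lemma HasPS.inv (hf : HasPS h f F) (hh : 0 < h) (hne : ∀ τ, f τ ≠ 0) {G : PowerSeries R}
    (hFG : F * G = 1) :
    HasPS h (fun τ => (f τ)⁻¹) G := by
  have hu : algebraMap R ℂ (F.coeff 0) ≠ 0 := by
    have := congr_arg (fun H => PowerSeries.coeff 0 H) hFG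
    simp only [PowerSeries.coeff_zero_eq_constantCoeff_apply, map_mul, map_one] at this
    intro h0
    have h1 := congr_arg (algebraMap R ℂ) this
    rw [PowerSeries.coeff_zero_eq_constantCoeff_apply] at h0
    simp [h0] at h1
  obtain ⟨H, hH⟩ := exists_hasPS (f := fun τ => (f τ)⁻¹) hh
    (fun τ => by rw [hf.vadd hh.ne']) (by
      have := (hf.mdiff hh)
      rw [UpperHalfPlane.mdifferentiable_iff] at this ⊢
      exact this.inv fun z _ => hne _) (((hf.tendsto hh).inv₀ hu).isBigO_one ℝ)
  have h1 := (hf.toComplex.mul hH).congr' (g := fun _ => 1) (fun τ => (mul_inv_cancel₀ (hne τ)).symm)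
  have h2 := h1.unique hh HasPS.one (fun _ _ h => h)
  have h3 : H = PowerSeries.map (algebraMap R ℂ) G := by
    have h4 := congr_arg (PowerSeries.map (algebraMap R ℂ)) hFG
    rw [map_mul, map_one] at h4
    calc H = (PowerSeries.map (algebraMap R ℂ) F * PowerSeries.map (algebraMap R ℂ) G) * H := by
            rw [h4, one_mul]
      _ = (PowerSeries.map (algebraMap R ℂ) F * H) * PowerSeries.map (algebraMap R ℂ) G := by ring
      _ = _ := by rw [h2, one_mul]
  intro τ
  simpa [h3] using hH τ

end

section

open scoped Manifold UpperHalfPlane Topology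
open UpperHalfPlane Filter Function.Periodic

/-- Euler's product `∏ (1 - q ^ (n + 1))` on the upper half plane. -/
def euler (τ : ℍ) : ℂ := ∏' n : ℕ, (1 - qParam 1 τ ^ (n + 1))

def eulerPS : PowerSeries ℤ := PowerSeries.pentagonalSeries ℤ

lemma iterate_deriv_polynomial (P : Polynomial ℂ) (k : ℕ) :
    iteratedDeriv k (fun z => P.eval z) = fun z => (Polynomial.derivative^[k] P).eval z := by
  induction k with
  | zero => simp
  | succ k ih => 
    rw [iteratedDeriv_succ, ih, Function.iterate_succ_apply']
    ext z
    simp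

lemma iterate_deriv_tprod (k : ℕ) :
    iteratedDeriv k (fun q : ℂ => ∏' n : ℕ, (1 - q ^ (n + 1))) 0 =
      k.factorial * (eulerPS.coeff k : ℂ) := by
  set P : Finset ℕ → Polynomial ℂ := fun s => ∏ n ∈ s, (1 - Polynomial.X ^ (n + 1)) with hP
  have h0 : TendstoLocallyUniformlyOn (fun s z => (P s).eval z)
      (fun q : ℂ => ∏' n : ℕ, (1 - q ^ (n + 1))) atTop (Metric.ball 0 1) := by
    have := ModularForm.multipliableLocallyUniformlyOn_one_sub_pow.hasProdLocallyUniformlyOn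
    rw [hasProdLocallyUniformlyOn_iff_tendstoLocallyUniformlyOn] at this
    refine this.congr fun s z _ => ?_
    simp [hP, Polynomial.eval_prod]
  have h1 : ∀ k, TendstoLocallyUniformlyOn (fun s => iteratedDeriv k (fun z => (P s).eval z))
      (iteratedDeriv k (fun q : ℂ => ∏' n : ℕ, (1 - q ^ (n + 1)))) atTop (Metric.ball 0 1) := by
    intro k
    induction k with
    | zero => simpa using h0
    | succ k ih =>
      simp only [iteratedDeriv_succ]
      refine ih.deriv (Eventually.of_forall fun s => ?_) Metric.isOpen_ball
      rw [iterate_deriv_polynomial]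
      exact (Polynomial.differentiable _).differentiableOn
  have h2 := (h1 k).tendsto_at (Metric.mem_ball_self one_pos)
  refine tendsto_nhds_unique h2 (tendsto_nhds_of_eventually_eq ?_)
  filter_upwards [PowerSeries.coeff_prod_one_sub_X_pow_eventually_eq ℤ k] with s hs
  rw [iterate_deriv_polynomial]
  simp only [eulerPS]
  rw [← hs, ← Polynomial.coeff_zero_eq_eval_zero, Polynomial.coeff_iterate_derivative, zero_add,
    Nat.descFactorial_self, nsmul_eq_mul]
  congr 1
  have e : P s = Polynomial.map (Int.castRingHom ℂ) (∏ n ∈ s, (1 - Polynomial.X ^ (n + 1))) := by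
    simp [hP, Polynomial.map_prod]
  have e2 : (∏ n ∈ s, (1 - PowerSeries.X ^ (n + 1)) : PowerSeries ℤ) =
      ((∏ n ∈ s, (1 - Polynomial.X ^ (n + 1)) : Polynomial ℤ) : PowerSeries ℤ) := by
    rw [← Polynomial.coeToPowerSeries.ringHom_apply, map_prod]
    simp
  rw [e, Polynomial.coeff_map, e2, Polynomial.coeff_coe]
  simp

lemma euler_hasPS : HasPS 1 euler eulerPS := by
  intro τ
  have hq : qParam 1 τ ∈ Metric.ball (0 : ℂ) 1 := by
    simpa using norm_qParam_lt_one (h := 1) one_pos τ.im_pos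
  have := Complex.hasSum_taylorSeries_on_ball
    ModularForm.differentiableOn_tprod_one_sub_pow (r := 1) (by simpa using hq)
  refine (this.congr_fun fun n => ?_)
  rw [iterate_deriv_tprod]
  have : (n.factorial : ℂ) ≠ 0 := by exact_mod_cast n.factorial_ne_zero
  simp
  field_simp

lemma euler_ne_zero (τ : ℍ) : euler τ ≠ 0 := by
  simpa [euler, ModularForm.eta_q] using ModularForm.eta_tprod_ne_zero τ.2

lemma constCoeff_eulerPS : PowerSeries.constantCoeff eulerPS = 1 := by
  have := iterate_deriv_tprod 0
  simp at this
  exact_mod_cast this.symm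

end

section

open scoped Manifold UpperHalfPlane Topology
open UpperHalfPlane Filter Function.Periodic

/-- Integral two by two matrices. -/
abbrev M2 := Matrix (Fin 2) (Fin 2) ℤ

open Classical in
def toGL (A : M2) : GL (Fin 2) ℝ :=
  if h : (A.map (Int.cast : ℤ → ℝ)).det ≠ 0 then Matrix.GeneralLinearGroup.mkOfDetNeZero _ h else 1

lemma det_map_cast (A : M2) : (A.map (Int.cast : ℤ → ℝ)).det = (A.det : ℝ) := by
  simp [Matrix.det_fin_two]

lemma coe_toGL {A : M2} (hA : 0 < A.det) : (toGL A).val = A.map (Int.cast : ℤ → ℝ) := by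
  have : (A.map (Int.cast : ℤ → ℝ)).det ≠ 0 := by
    rw [det_map_cast]; exact_mod_cast hA.ne'
  rw [toGL, dif_pos this]
  rfl

lemma toGL_det {A : M2} (hA : 0 < A.det) : 0 < (toGL A).det.val := by
  have : (toGL A).det.val = (A.det : ℝ) := by
    rw [← det_map_cast, ← coe_toGL hA]; rfl
  rw [this]
  exact_mod_cast hA

lemma toGL_mul {A B : M2} (hA : 0 < A.det) (hB : 0 < B.det) : toGL (A * B) = toGL A * toGL B := by
  apply Units.ext
  rw [Units.val_mul, coe_toGL hA, coe_toGL hB, coe_toGL (by rw [Matrix.det_mul]; positivity)]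
  ext i j
  simp [Matrix.mul_apply]

/-- The action of integral matrices on the upper half plane. -/
def mob (A : M2) (τ : ℍ) : ℍ := toGL A • τ

def jf (A : M2) (τ : ℍ) : ℂ := A 1 0 * τ + A 1 1

variable {A B : M2} {τ : ℍ}

lemma mob_mul (hA : 0 < A.det) (hB : 0 < B.det) : mob (A * B) τ = mob A (mob B τ) := by
  rw [mob, toGL_mul hA hB, mul_smul]; rfl

lemma denom_toGL (hA : 0 < A.det) : denom (toGL A) τ = jf A τ := by
  simp [denom, jf, coe_toGL hA]

lemma coe_mob (hA : 0 < A.det) : (mob A τ : ℂ) = (A 0 0 * τ + A 0 1) / jf A τ := by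
  rw [mob, coe_smul_of_det_pos (toGL_det hA), denom_toGL hA]
  simp [num, coe_toGL hA]

lemma jf_ne_zero (hA : 0 < A.det) : jf A τ ≠ 0 := by
  rw [← denom_toGL hA]; exact denom_ne_zero _ _

lemma jf_mul (_hA : 0 < A.det) (hB : 0 < B.det) : jf (A * B) τ = jf A (mob B τ) * jf B τ := by
  have := jf_ne_zero hB (τ := τ)
  rw [jf, jf, coe_mob hB]
  field_simp
  simp [Matrix.mul_apply, jf]
  ring

lemma im_mob (hA : 0 < A.det) : (mob A τ).im = A.det * τ.im / Complex.normSq (jf A τ) := by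
  rw [mob, im_smul_eq_div_normSq, denom_toGL hA]
  have : (toGL A).det.val = (A.det : ℝ) := by
    rw [← det_map_cast, ← coe_toGL hA]; rfl
  rw [this, abs_of_pos (by exact_mod_cast hA)]

lemma mob_mdiff (hA : 0 < A.det) : MDiff (fun τ => mob A τ) := mdifferentiable_smul (toGL_det hA)

lemma jf_mdiff : MDiff (fun τ => jf A τ) := by
  simp only [jf]
  exact (mdifferentiable_const.mul mdifferentiable_coe).add mdifferentiable_const

lemma MDiff.comp_mob {f : ℍ → ℂ} (hf : MDiff f) (hA : 0 < A.det) : MDiff (fun τ => f (mob A τ)) :=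
  MDifferentiable.comp hf (mob_mdiff hA)

lemma mob_one : mob 1 τ = τ := by
  ext; rw [coe_mob (by simp)]; simp [jf]

/-- The matrix of a modular transformation. -/
lemma mob_SL (γ : Matrix.SpecialLinearGroup (Fin 2) ℤ) : mob γ.1 τ = γ • τ := by
  ext
  rw [coe_mob (by simp), coe_specialLinearGroup_apply]
  simp [jf]

lemma mob_inv (hA : A.det = 1) : mob A.adjugate (mob A τ) = τ := by
  rw [← mob_mul (by simp [Matrix.det_adjugate, hA]) (by simp [hA]), Matrix.adjugate_mul, hA, one_smul, mob_one]

/-- Upper triangular matrices. -/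
def tri (a b d : ℤ) : M2 := !![a, b; 0, d]

lemma det_tri (a b d : ℤ) : (tri a b d).det = a * d := by simp [tri, Matrix.det_fin_two]

lemma coe_mob_tri {a b d : ℤ} (h : 0 < a * d) : (mob (tri a b d) τ : ℂ) = (a * τ + b) / d := by
  rw [coe_mob (by rwa [det_tri])]; simp [tri, jf]

def matS : M2 := !![0, -1; 1, 0]

lemma det_matS : matS.det = 1 := by simp [matS, Matrix.det_fin_two]

lemma coe_mob_S : (mob matS τ : ℂ) = - (τ : ℂ)⁻¹ := by
  rw [coe_mob (by simp [det_matS])]; simp [matS, jf, neg_div]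

lemma qParam_tri {h : ℝ} {a b d : ℤ} (had : 0 < a * d) :
    qParam h (mob (tri a b d) τ) = Complex.exp (2 * Real.pi * Complex.I * b / (h * d)) *
      Complex.exp (2 * Real.pi * Complex.I * a * τ / (h * d)) := by
  rw [Function.Periodic.qParam, coe_mob_tri had, ← Complex.exp_add]
  congr 1
  have : (d : ℂ) ≠ 0 := by
    have : d ≠ 0 := by rintro rfl; simp at had
    exact_mod_cast this
  by_cases hh : (h : ℂ) = 0
  · simp [hh]
  · field_simp
    ring

end

section

open scoped Manifold UpperHalfPlane Topology
open UpperHalfPlane Filter Function.Periodic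

variable {τ : ℍ} {A : M2}

/-- The twelfth power of the Dedekind eta function. -/
def eta12 (τ : ℍ) : ℂ := qParam 2 τ * euler τ ^ 12

lemma eta12_eq (τ : ℍ) : eta12 τ = ModularForm.eta τ ^ 12 := by
  rw [eta12, ModularForm.eta, mul_pow]
  congr 1
  rw [Function.Periodic.qParam, Function.Periodic.qParam, ← Complex.exp_nat_mul]
  congr 1
  push_cast
  ring

lemma eta12_ne_zero (τ : ℍ) : eta12 τ ≠ 0 :=
  mul_ne_zero (Complex.exp_ne_zero _) (pow_ne_zero _ (euler_ne_zero τ))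

lemma delta_eq (τ : ℍ) : ModularForm.discriminant τ = eta12 τ ^ 2 := by
  rw [eta12_eq, ← pow_mul]; rfl

lemma csqrt_pow_two {z : ℂ} (hz : z ≠ 0) : Complex.sqrt z ^ 2 = z := by
  rw [_root_.sqrt_eq_exp hz, ← Complex.exp_nat_mul]
  convert Complex.exp_log hz using 2
  push_cast
  ring

lemma eta12_S (τ : ℍ) : eta12 (mob matS τ) = - (τ : ℂ) ^ 6 * eta12 τ := by
  have he : ModularForm.eta (-(τ : ℂ)⁻¹) =
      (Complex.sqrt Complex.I)⁻¹ * (Complex.sqrt τ * ModularForm.eta τ) := by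
    simpa [neg_div] using ModularForm.eta_comp_eq_csqrt_I_inv τ.2
  rw [eta12_eq, eta12_eq, coe_mob_S, he, mul_pow, mul_pow, inv_pow,
    show 12 = 2 * 6 from rfl, pow_mul, pow_mul (Complex.sqrt τ), csqrt_pow_two τ.ne_zero,
    csqrt_pow_two Complex.I_ne_zero, show Complex.I ^ 6 = -1 by
      rw [show 6 = 2 * 3 from rfl, pow_mul, Complex.I_sq]; norm_num]
  ring

def matT (b : ℤ) : M2 := tri 1 b 1

lemma det_matT (b : ℤ) : (matT b).det = 1 := by simp [matT, det_tri]

lemma coe_mob_T (b : ℤ) : (mob (matT b) τ : ℂ) = τ + b := by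
  rw [matT, coe_mob_tri (by norm_num)]; simp

lemma mob_T (b : ℤ) : mob (matT b) τ = (b : ℝ) +ᵥ τ := by
  ext; rw [coe_mob_T]; simp [add_comm]

lemma HasPS.mob_T {R : Type*} [CommRing R] [Algebra R ℂ] {f : ℍ → ℂ} {F : PowerSeries R}
    (hf : HasPS 1 f F) (b : ℤ) (τ : ℍ) : f (mob (matT b) τ) = f τ := by
  have h1 : ∀ τ, f ((1 : ℝ) +ᵥ τ) = f τ := fun τ => hf.vadd one_ne_zero τ
  rw [BM.mob_T]
  induction b using Int.induction_on generalizing τ with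
  | zero => simp
  | succ n ih =>
    rw [Int.cast_add, Int.cast_one, add_vadd, ih, h1]
  | pred n ih =>
    rw [Int.cast_sub, Int.cast_one, sub_eq_add_neg, add_vadd, ih, ← h1, vadd_vadd]
    simp

/-- The exponent of the sign character of the modular group. -/
def sgnExp (a b c d : ZMod 2) : ZMod 2 := (1 + a + d) * (b + c + b * c)

/-- The sign character of the modular group. -/
def sgn (A : M2) : ℂ := if sgnExp (A 0 0) (A 0 1) (A 1 0) (A 1 1) = 0 then 1 else -1

lemma sgn_sq (A : M2) : sgn A ^ 2 = 1 := by unfold sgn; split_ifs <;> simp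

lemma sgnExp_S : ∀ a b c d : ZMod 2, a * d - b * c = 1 →
    (sgnExp (-c) (-d) a b = 0 ↔ sgnExp a b c d ≠ 0) := by decide

lemma sgnExp_T : ∀ a b c d : ZMod 2, a * d - b * c = 1 →
    (sgnExp (a + c) (b + d) c d = 0 ↔ sgnExp a b c d ≠ 0) := by decide

lemma det_cast (hA : A.det = 1) : ((A 0 0 : ℤ) : ZMod 2) * (A 1 1 : ℤ) - (A 0 1 : ℤ) * (A 1 0 : ℤ) = 1 := by
  rw [Matrix.det_fin_two] at hA
  exact_mod_cast congrArg (Int.cast : ℤ → ZMod 2) hA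

lemma sgn_S (hA : A.det = 1) : sgn (matS * A) = - sgn A := by
  have := sgnExp_S _ _ _ _ (det_cast hA)
  have e : sgn (matS * A) = if sgnExp (-(A 1 0 : ℤ)) (-(A 1 1 : ℤ)) (A 0 0 : ℤ) (A 0 1 : ℤ) = 0 then 1 else -1 := by
    simp [sgn, matS, Matrix.mul_apply]
  rw [e, sgn]
  split_ifs <;> simp_all

lemma sgn_T (hA : A.det = 1) : sgn (matT 1 * A) = - sgn A := by
  have := sgnExp_T _ _ _ _ (det_cast hA)
  have e : sgn (matT 1 * A) = if sgnExp (A 0 0 + A 1 0 : ℤ) (A 0 1 + A 1 1 : ℤ) (A 1 0 : ℤ) (A 1 1 : ℤ) = 0 then 1 else -1 := by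
    simp [sgn, matT, tri, Matrix.mul_apply]
  rw [e, sgn]
  split_ifs <;> simp_all

lemma sgn_one : sgn 1 = 1 := by simp [sgn, sgnExp]

lemma eta12_T (τ : ℍ) : eta12 (mob (matT 1) τ) = - eta12 τ := by
  rw [eta12, eta12, euler_hasPS.mob_T, matT, qParam_tri (by norm_num), Function.Periodic.qParam]
  have : (2 * Real.pi * Complex.I * ((1 : ℤ) : ℂ) / (((2 : ℝ) : ℂ) * ((1 : ℤ) : ℂ))) = Real.pi * Complex.I := by
    push_cast; ring
  rw [this, Complex.exp_pi_mul_I]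
  push_cast
  ring_nf

/-- Induction on elements of the modular group. -/
lemma sl_induction {P : M2 → Prop} (h1 : P 1) (hS : ∀ A : M2, A.det = 1 → P A → P (matS * A))
    (hS' : ∀ A : M2, A.det = 1 → P A → P (-(matS * A)))
    (hT : ∀ A : M2, A.det = 1 → P A → P (matT 1 * A))
    (hT' : ∀ A : M2, A.det = 1 → P A → P (matT (-1) * A)) (hA : A.det = 1) : P A := by
  have h : ∀ γ : Matrix.SpecialLinearGroup (Fin 2) ℤ, P γ.1 := by
    intro γ
    have hγ : γ ∈ Subgroup.closure {ModularGroup.S, ModularGroup.T} := by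
      simp [SpecialLinearGroup.SL2Z_generators]
    induction hγ using Subgroup.closure_induction_left with
    | one => exact h1
    | mul_left x hx y hy ih =>
      rcases hx with rfl | rfl
      · exact hS _ y.2 ih
      · exact hT _ y.2 ih
    | inv_mul_cancel x hx y hy ih =>
      rcases hx with rfl | rfl
      · have e : (ModularGroup.S⁻¹ * y).1 = -(matS * y.1) := by
          rw [Matrix.SpecialLinearGroup.coe_mul, Matrix.SpecialLinearGroup.SL2_inv_expl, ← neg_mul]
          congr 1
          ext i j
          fin_cases i <;> fin_cases j <;> simp [ModularGroup.S, matS]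
        rw [e]
        exact hS' _ y.2 ih
      · have e : (ModularGroup.T⁻¹ * y).1 = matT (-1) * y.1 := by
          rw [Matrix.SpecialLinearGroup.coe_mul, Matrix.SpecialLinearGroup.SL2_inv_expl]
          congr 1
        rw [e]
        exact hT' _ y.2 ih
  exact h ⟨A, hA⟩

lemma mob_neg (hA : 0 < A.det) : mob (-A) τ = mob A τ := by
  ext
  have h : 0 < (-A).det := by rw [Matrix.det_neg]; simpa
  rw [coe_mob h, coe_mob hA]
  have : jf (-A) τ = - jf A τ := by simp [jf]; ring
  rw [this]
  simp only [Matrix.neg_apply, Int.cast_neg]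
  rw [← neg_div_neg_eq]
  ring

lemma jf_neg : jf (-A) τ = - jf A τ := by simp [jf]; ring

lemma eta12_mob (hA : A.det = 1) : ∀ τ, eta12 (mob A τ) = sgn A * jf A τ ^ 6 * eta12 τ := by
  refine sl_induction (P := fun A => ∀ τ, eta12 (mob A τ) = sgn A * jf A τ ^ 6 * eta12 τ)
    ?_ ?_ ?_ ?_ ?_ hA
  · intro τ; simp [mob_one, sgn_one, jf]
  · intro A hA ih τ
    rw [mob_mul (by simp [det_matS]) (by simp [hA]), eta12_S, ih, sgn_S hA,
      jf_mul (by simp [det_matS]) (by simp [hA])]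
    simp [jf, matS]; ring
  · intro A hA ih τ
    have e : sgn (-(matS * A)) = sgn (matS * A) := by
      simp [sgn, CharTwo.neg_eq]
    rw [mob_neg (by simp [det_matS, hA]), mob_mul (by simp [det_matS]) (by simp [hA]), eta12_S, ih,
      e, sgn_S hA, jf_neg, jf_mul (by simp [det_matS]) (by simp [hA])]
    simp [jf, matS]; ring
  · intro A hA ih τ
    rw [mob_mul (by simp [det_matT]) (by simp [hA]), eta12_T, ih, sgn_T hA,
      jf_mul (by simp [det_matT]) (by simp [hA])]
    simp [jf, matT, tri]
  · intro A hA ih τ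
    have h0 : (matT (-1) * A).det = 1 := by simp [det_matT, hA]
    have hT : matT 1 * (matT (-1) * A) = A := by
      rw [← mul_assoc]
      convert one_mul A
      ext i j
      fin_cases i <;> fin_cases j <;> simp [matT, tri, Matrix.mul_apply]
    have h1 := eta12_T (mob (matT (-1) * A) τ)
    rw [← mob_mul (by simp [det_matT]) (by simp [h0]), hT, ih] at h1
    have h2 := sgn_T h0
    rw [hT] at h2
    rw [h2] at h1
    have h3 : jf A τ = jf (matT (-1) * A) τ := by
      rw [jf_mul (by simp [det_matT]) (by simp [hA])]; simp [jf, matT, tri]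
    rw [← h3]
    linear_combination h1

lemma delta_mob (hA : A.det = 1) : ModularForm.discriminant (mob A τ) = jf A τ ^ 12 * ModularForm.discriminant τ := by
  rw [delta_eq, delta_eq, eta12_mob hA, mul_pow, mul_pow, sgn_sq]
  ring

end

section

open scoped Manifold UpperHalfPlane Topology
open UpperHalfPlane Filter Function.Periodic

variable {τ : ℍ} {A : M2} {N e : ℕ}

/-- The two levels together with the exponents of the eta quotients. -/
def Lv (N e : ℕ) : Prop := (N = 2 ∧ e = 2) ∨ (N = 3 ∧ e = 1)

lemma Lv.pos (h : Lv N e) : 0 < N := by rcases h with ⟨rfl, rfl⟩ | ⟨rfl, rfl⟩ <;> norm_num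

lemma Lv.exp (h : Lv N e) : N * e = e + 2 := by rcases h with ⟨rfl, rfl⟩ | ⟨rfl, rfl⟩ <;> norm_num

/-- The Hauptmodul of level `N`. -/
def hv (N e : ℕ) (τ : ℍ) : ℂ := (eta12 τ / eta12 (mob (tri N 0 1) τ)) ^ e

def eulerInv : PowerSeries ℤ := PowerSeries.invOfUnit eulerPS 1

lemma euler_mul_inv : eulerPS * eulerInv = 1 :=
  PowerSeries.mul_invOfUnit _ _ (by simp [constCoeff_eulerPS])

lemma constCoeff_eulerInv : PowerSeries.constantCoeff eulerInv = 1 := by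
  simp [eulerInv]

open Classical in
/-- The expansion of the Hauptmodul of level `N`. -/
def hU (N e : ℕ) : PowerSeries ℤ :=
  if hN : N ≠ 0 then (eulerPS * PowerSeries.expand N hN eulerInv) ^ (12 * e) else 1

lemma constCoeff_hU : PowerSeries.constantCoeff (hU N e) = 1 := by
  unfold hU
  split_ifs <;> simp [constCoeff_eulerPS, constCoeff_eulerInv]

lemma qParam_mul {h : ℝ} (hN : 0 < N) : qParam h (mob (tri N 0 1) τ) = qParam h τ ^ N := by
  rw [qParam_tri (by simpa), Function.Periodic.qParam, ← Complex.exp_nat_mul]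
  simp
  ring_nf

lemma qParam_div (hN : 0 < N) : qParam 1 (mob (tri 1 0 N) τ) = qParam N τ := by
  rw [qParam_tri (by simpa), Function.Periodic.qParam]
  simp

lemma mdiff_inv {f : ℍ → ℂ} (hf : MDiff f) (h : ∀ τ, f τ ≠ 0) : MDiff (fun τ => (f τ)⁻¹) := by
  have := UpperHalfPlane.mdifferentiable_iff.mp hf
  exact UpperHalfPlane.mdifferentiable_iff.mpr (this.inv fun z _ => h _)

lemma euler_mdiff : MDiff euler := euler_hasPS.mdiff one_pos

lemma eta12_mdiff : MDiff eta12 := by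
  unfold eta12
  refine MDifferentiable.mul ?_ (euler_mdiff.pow 12)
  rw [UpperHalfPlane.mdifferentiable_iff]
  refine DifferentiableOn.congr (f := qParam 2) ?_ ?_
  · exact (differentiable_qParam).differentiableOn
  · intro z hz
    simp [ofComplex_apply_of_im_pos hz]

lemma hv_ne_zero (τ : ℍ) : hv N e τ ≠ 0 := pow_ne_zero _ (div_ne_zero (eta12_ne_zero _) (eta12_ne_zero _))

lemma hv_mdiff (hN : 0 < N) : MDiff (hv N e) := by
  unfold hv
  simp only [div_eq_mul_inv]
  refine MDifferentiable.pow (eta12_mdiff.mul ?_) e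
  refine mdiff_inv (MDiff.comp_mob eta12_mdiff (by simpa [det_tri])) fun τ => eta12_ne_zero _

lemma hv_hasPS (h : Lv N e) : HasPS 1 (fun τ => qParam 1 τ * hv N e τ) (hU N e) := by
  have hN := h.pos
  have h1 : HasPS 1 (fun τ => (euler τ)⁻¹) eulerInv :=
    euler_hasPS.inv one_pos euler_ne_zero euler_mul_inv
  have h2 : HasPS 1 (fun τ => (euler (mob (tri N 0 1) τ))⁻¹) (PowerSeries.expand N hN.ne' eulerInv) :=
    h1.comp_expand (φ := fun τ => mob (tri N 0 1) τ) hN.ne' fun τ => qParam_mul hN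
  rw [hU, dif_pos hN.ne']
  refine ((euler_hasPS.mul h2).pow _).congr' fun τ => ?_
  simp only [hv, eta12, qParam_mul hN]
  have e1 : qParam 1 τ = qParam 2 τ ^ 2 := by
    rw [Function.Periodic.qParam, Function.Periodic.qParam, ← Complex.exp_nat_mul]
    congr 1; push_cast; ring
  have h0 : qParam 2 τ ≠ 0 := Complex.exp_ne_zero _
  have h3 := euler_ne_zero (mob (tri N 0 1) τ)
  rw [e1, pow_mul, div_pow]
  field_simp
  rw [div_pow, mul_pow, mul_pow, ← pow_mul (qParam 2 τ), h.exp, pow_add]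
  field_simp

lemma tri_mul_gamma0 (hc : (N : ℤ) ∣ A 1 0) :
    tri N 0 1 * A = !![A 0 0, N * A 0 1; A 1 0 / N, A 1 1] * tri N 0 1 := by
  ext i j
  fin_cases i <;> fin_cases j <;> simp [tri, Matrix.mul_apply, Int.ediv_mul_cancel hc, mul_comm]

lemma sgn_gamma0 (h : Lv N e) (hc : (N : ℤ) ∣ A 1 0) :
    sgn !![A 0 0, N * A 0 1; A 1 0 / N, A 1 1] ^ e = sgn A ^ e := by
  rcases h with ⟨rfl, rfl⟩ | ⟨rfl, rfl⟩
  · rw [sgn_sq, sgn_sq]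
  · obtain ⟨c, hc⟩ := hc
    have h3 : (3 : ZMod 2) = 1 := by decide
    simp [sgn, hc, h3]

lemma hv_gamma0 (h : Lv N e) (hA : A.det = 1) (hc : (N : ℤ) ∣ A 1 0) (τ : ℍ) :
    hv N e (mob A τ) = hv N e τ := by
  have hN := h.pos
  have hN' : 0 < (tri N 0 1).det := by simpa [det_tri]
  set A' : M2 := !![A 0 0, N * A 0 1; A 1 0 / N, A 1 1] with hA'
  have hd : A'.det = 1 := by
    have := congrArg Matrix.det (tri_mul_gamma0 hc)
    rw [Matrix.det_mul, Matrix.det_mul, hA, det_tri] at this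
    have hN0 : (N : ℤ) ≠ 0 := by exact_mod_cast hN.ne'
    rw [← hA'] at this
    exact mul_right_cancel₀ hN0 (by linarith)
  have h1 : mob (tri N 0 1) (mob A τ) = mob A' (mob (tri N 0 1) τ) := by
    rw [← mob_mul hN' (by simp [hA]), tri_mul_gamma0 hc, mob_mul (by rw [hd]; norm_num) hN']
  have h2 : jf A' (mob (tri N 0 1) τ) = jf A τ := by
    have := jf_mul (A := A') (B := tri N 0 1) (τ := τ) (by rw [hd]; norm_num) hN'
    rw [← tri_mul_gamma0 hc, jf_mul hN' (by simp [hA])] at this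
    simpa [jf, tri] using this.symm
  have h3 := sgn_gamma0 h hc
  have h4 := jf_ne_zero (A := A) (τ := τ) (by simp [hA])
  have h5 := eta12_ne_zero (mob (tri N 0 1) τ)
  have h6 : sgn A ^ e ≠ 0 := pow_ne_zero _ fun h => by simpa [h] using sgn_sq A
  rw [hv, hv, h1, eta12_mob hA, eta12_mob hd, h2, div_pow, div_pow, mul_pow, mul_pow, mul_pow _ (eta12 _), mul_pow, h3]
  field_simp

lemma hv_S (h : Lv N e) (τ : ℍ) : hv N e (mob matS τ) = N ^ (6 * e) / hv N e (mob (tri 1 0 N) τ) := by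
  have hN := h.pos
  have hN0 : (N : ℂ) ≠ 0 := by exact_mod_cast hN.ne'
  have h1 : mob (tri N 0 1) (mob matS τ) = mob matS (mob (tri 1 0 N) τ) := by
    ext
    rw [coe_mob_tri (by simpa), coe_mob_S, coe_mob_S, coe_mob_tri (by simpa)]
    simp
    ring
  have h2 : mob (tri N 0 1) (mob (tri 1 0 N) τ) = τ := by
    ext
    rw [coe_mob_tri (by simpa), coe_mob_tri (by simpa)]
    simp
    field_simp
  rw [hv, hv, h1, h2, eta12_S, eta12_S, coe_mob_tri (by simpa), pow_mul, ← div_pow]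
  have := eta12_ne_zero τ
  have := eta12_ne_zero (mob (tri 1 0 N) τ)
  have := τ.ne_zero
  congr 1
  simp
  field_simp

end

section

open scoped Manifold UpperHalfPlane Topology
open UpperHalfPlane Filter Function.Periodic ModularForm

variable {τ : ℍ} {A : M2} {N e : ℕ}

/-- Invariance under the group of level `N`. -/
def Inv0 (N : ℕ) (f : ℍ → ℂ) : Prop :=
  ∀ A : M2, A.det = 1 → (N : ℤ) ∣ A 1 0 → ∀ τ, f (mob A τ) = f τ

lemma slash_zero_eq (f : ℍ → ℂ) (γ : Matrix.SpecialLinearGroup (Fin 2) ℤ) :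
    (f ∣[(0 : ℤ)] γ) = fun τ => f (mob γ.1 τ) := by
  ext τ
  rw [ModularForm.SL_slash_apply, mob_SL]
  simp

lemma const_of_bounded [NeZero N] {f : ℍ → ℂ} (hf : MDiff f) (hinv : Inv0 N f)
    (hb : ∀ A : M2, A.det = 1 → IsBoundedAtImInfty (fun τ => f (mob A τ))) (τ σ : ℍ) :
    f τ = f σ := by
  let F : ModularForm ((CongruenceSubgroup.Gamma0 N).map (Matrix.SpecialLinearGroup.mapGL ℝ)) 0 :=
    { toFun := f
      holo' := hf
      slash_action_eq' := by
        rintro _ ⟨γ, hγ, rfl⟩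
        refine (slash_zero_eq f γ).trans ?_
        ext τ
        exact hinv γ.1 γ.2 ((ZMod.intCast_zmod_eq_zero_iff_dvd _ _).mp hγ) τ
      bdd_at_cusps' := by
        intro c hc
        have hc' := (Subgroup.IsArithmetic.isCusp_iff_isCusp_SL2Z _).mp hc
        rw [OnePoint.isBoundedAt_iff_forall_SL2Z hc']
        intro γ _
        rw [slash_zero_eq]
        exact hb γ.1 γ.2 }
  obtain ⟨c, hc⟩ := ModularForm.eq_const_of_weight_zero F
  have : f = Function.const ℍ c := hc
  rw [this]; rfl

/-- Decomposition of the modular group for a prime level. -/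
lemma sl_decomp (hN : N.Prime) (hA : A.det = 1) (h : ¬ (N : ℤ) ∣ A 1 0) :
    ∃ G : M2, ∃ b : ℤ, G.det = 1 ∧ (N : ℤ) ∣ G 1 0 ∧ A = G * matS * matT b := by
  have := Fact.mk hN
  have hco : IsCoprime (A 1 0) (N : ℤ) :=
    ((Nat.prime_iff_prime_int.mp hN).coprime_iff_not_dvd.mpr h).symm
  obtain ⟨x, y, hxy⟩ := hco
  rw [Matrix.det_fin_two] at hA
  refine ⟨!![A 0 0 * (x * A 1 1) - A 0 1, A 0 0; A 1 0 * (x * A 1 1) - A 1 1, A 1 0], x * A 1 1, ?_, ?_, ?_⟩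
  · simp [Matrix.det_fin_two]; linarith
  · simp only [Matrix.of_apply, Matrix.cons_val', Matrix.cons_val_zero, Matrix.cons_val_one]
    exact ⟨- (y * A 1 1), by linear_combination (A 1 1) * hxy⟩
  · ext i j
    fin_cases i <;> fin_cases j <;> simp [matS, matT, tri, Matrix.mul_apply]

lemma IsBoundedAtImInfty.comp_T {f : ℍ → ℂ} (hf : IsBoundedAtImInfty f) (b : ℤ) :
    IsBoundedAtImInfty (fun τ => f (mob (matT b) τ)) := by
  rw [isBoundedAtImInfty_iff] at hf ⊢
  obtain ⟨M, B, h⟩ := hf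
  exact ⟨M, B, fun z hz => h _ (by rwa [mob_T, vadd_im])⟩

lemma const_of_bounded_prime (hN : N.Prime) {f : ℍ → ℂ} (hf : MDiff f) (hinv : Inv0 N f)
    (h1 : IsBoundedAtImInfty f) (h2 : IsBoundedAtImInfty (fun τ => f (mob matS τ))) (τ σ : ℍ) :
    f τ = f σ := by
  have : NeZero N := ⟨hN.ne_zero⟩
  refine const_of_bounded hf hinv (fun A hA => ?_) τ σ
  by_cases h : (N : ℤ) ∣ A 1 0
  · simpa only [hinv A hA h] using h1
  · obtain ⟨G, b, hG, hc, rfl⟩ := sl_decomp hN hA h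
    have e : ∀ τ, f (mob (G * matS * matT b) τ) = f (mob matS (mob (matT b) τ)) := fun τ => by
      rw [mul_assoc, mob_mul (by simp [hG]) (by simp [det_matS, det_matT]), hinv G hG hc,
        mob_mul (by simp [det_matS]) (by simp [det_matT])]
    simp only [e]
    exact IsBoundedAtImInfty.comp_T h2 b

end

section

open scoped Manifold UpperHalfPlane Topology
open UpperHalfPlane Filter Function.Periodic

variable {τ : ℍ} {A : M2} {N e : ℕ} {f g : ℍ → ℂ}

/-- The derivation `q d/dq`. -/
def dq (f : ℍ → ℂ) (τ : ℍ) : ℂ := (2 * Real.pi * Complex.I)⁻¹ * deriv (f ∘ ofComplex) τ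

lemma MDiff.hasDerivAt (hf : MDiff f) (τ : ℍ) :
    HasDerivAt (f ∘ ofComplex) (2 * Real.pi * Complex.I * dq f τ) τ := by
  have h1 := (UpperHalfPlane.mdifferentiable_iff.mp hf).differentiableAt
    (isOpen_upperHalfPlaneSet.mem_nhds τ.im_pos)
  rw [dq, mul_inv_cancel_left₀ Complex.two_pi_I_ne_zero]
  exact h1.hasDerivAt

lemma dq_of_hasDerivAt {a : ℂ} (h : HasDerivAt (f ∘ ofComplex) (2 * Real.pi * Complex.I * a) τ) :
    dq f τ = a := by
  rw [dq, h.deriv, inv_mul_cancel_left₀ Complex.two_pi_I_ne_zero]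

lemma dq_mul (hf : MDiff f) (hg : MDiff g) :
    dq (fun τ => f τ * g τ) τ = dq f τ * g τ + f τ * dq g τ := by
  refine dq_of_hasDerivAt (((MDiff.hasDerivAt hf τ).mul (MDiff.hasDerivAt hg τ)).congr_deriv ?_)
  simp only [Function.comp_apply, ofComplex_apply]
  ring

lemma dq_add (hf : MDiff f) (hg : MDiff g) :
    dq (fun τ => f τ + g τ) τ = dq f τ + dq g τ := by
  refine dq_of_hasDerivAt (((MDiff.hasDerivAt hf τ).add (MDiff.hasDerivAt hg τ)).congr_deriv ?_)
  ring

lemma dq_const (c : ℂ) : dq (fun _ => c) τ = 0 := by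
  refine dq_of_hasDerivAt ?_
  rw [mul_zero]
  exact hasDerivAt_const _ _

lemma dq_pow (hf : MDiff f) (n : ℕ) :
    dq (fun τ => f τ ^ n) τ = n * f τ ^ (n - 1) * dq f τ := by
  refine dq_of_hasDerivAt (((MDiff.hasDerivAt hf τ).pow n).congr_deriv ?_)
  simp only [Function.comp_apply, ofComplex_apply]
  ring

lemma dq_inv (hf : MDiff f) (h0 : ∀ τ, f τ ≠ 0) :
    dq (fun τ => (f τ)⁻¹) τ = - dq f τ / f τ ^ 2 := by
  refine dq_of_hasDerivAt (((MDiff.hasDerivAt hf τ).inv (h0 _)).congr_deriv ?_)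
  simp only [Function.comp_apply, ofComplex_apply]
  ring

lemma dq_mdiff (hf : MDiff f) : MDiff (dq f) := by
  have h1 := ((UpperHalfPlane.mdifferentiable_iff.mp hf).deriv isOpen_upperHalfPlaneSet).const_mul
    (2 * Real.pi * Complex.I)⁻¹
  refine UpperHalfPlane.mdifferentiable_iff.mpr (h1.congr fun z hz => ?_)
  simp [dq, ofComplex_apply_of_im_pos hz]

lemma hasDerivAt_mob (hA : 0 < A.det) (τ : ℍ) :
    HasDerivAt (fun z : ℂ => ((mob A (ofComplex z) : ℍ) : ℂ)) (A.det / jf A τ ^ 2) τ := by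
  have hj := jf_ne_zero hA (τ := τ)
  have h1 : HasDerivAt (fun z : ℂ => ((A 0 0 : ℂ) * z + A 0 1) / ((A 1 0 : ℂ) * z + A 1 1))
      (A.det / jf A τ ^ 2) τ := by
    refine (HasDerivAt.div (((hasDerivAt_id' (τ : ℂ)).const_mul (A 0 0 : ℂ)).add_const _)
      (((hasDerivAt_id' (τ : ℂ)).const_mul (A 1 0 : ℂ)).add_const _) hj).congr_deriv ?_
    rw [Matrix.det_fin_two, jf]
    push_cast
    ring
  refine h1.congr_of_eventuallyEq ?_
  filter_upwards [isOpen_upperHalfPlaneSet.mem_nhds τ.im_pos] with z hz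
  rw [coe_mob hA, ofComplex_apply_of_im_pos hz]
  rfl

lemma dq_comp_mob (hf : MDiff f) (hA : 0 < A.det) :
    dq (fun τ => f (mob A τ)) τ = A.det / jf A τ ^ 2 * dq f (mob A τ) := by
  refine dq_of_hasDerivAt ?_
  have h1 := MDiff.hasDerivAt hf (mob A τ)
  have h2 := hasDerivAt_mob hA τ
  have h3 : ((mob A (ofComplex (τ : ℂ)) : ℍ) : ℂ) = (mob A τ : ℂ) := by rw [ofComplex_apply]
  rw [← h3] at h1
  refine ((h1.comp (τ : ℂ) h2).congr_deriv ?_).congr_of_eventuallyEq ?_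
  · ring
  · filter_upwards with z
    simp [ofComplex_apply]

lemma dq_jf : dq (fun τ => jf A τ) τ = (2 * Real.pi * Complex.I)⁻¹ * A 1 0 := by
  refine dq_of_hasDerivAt ?_
  rw [mul_inv_cancel_left₀ Complex.two_pi_I_ne_zero]
  have h1 : HasDerivAt (fun z : ℂ => (A 1 0 : ℂ) * z + A 1 1) (A 1 0) τ := by
    simpa using ((hasDerivAt_id' (τ : ℂ)).const_mul (A 1 0 : ℂ)).add_const (A 1 1 : ℂ)
  refine h1.congr_of_eventuallyEq ?_
  filter_upwards [isOpen_upperHalfPlaneSet.mem_nhds τ.im_pos] with z hz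
  simp [jf, ofComplex_apply_of_im_pos hz]

/-- The logarithmic derivative with respect to `q d/dq`. -/
def lg (f : ℍ → ℂ) (τ : ℍ) : ℂ := dq f τ / f τ

lemma lg_mul (hf : MDiff f) (hg : MDiff g) (hf0 : f τ ≠ 0) (hg0 : g τ ≠ 0) :
    lg (fun τ => f τ * g τ) τ = lg f τ + lg g τ := by
  rw [lg, dq_mul hf hg, lg, lg]
  field_simp

lemma lg_pow (hf : MDiff f) (hf0 : f τ ≠ 0) (n : ℕ) :
    lg (fun τ => f τ ^ n) τ = n * lg f τ := by
  rw [lg, dq_pow hf, lg]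
  rcases n with _ | n
  · simp
  · rw [Nat.add_sub_cancel, pow_succ]
    field_simp

lemma lg_const (c : ℂ) : lg (fun _ => c) τ = 0 := by simp [lg, dq_const]

lemma lg_inv (hf : MDiff f) (hf0 : ∀ τ, f τ ≠ 0) :
    lg (fun τ => (f τ)⁻¹) τ = - lg f τ := by
  have := hf0 τ
  rw [lg, dq_inv hf hf0, lg]
  field_simp

lemma lg_comp_mob (hf : MDiff f) (hA : 0 < A.det) :
    lg (fun τ => f (mob A τ)) τ = A.det / jf A τ ^ 2 * lg f (mob A τ) := by
  rw [lg, dq_comp_mob hf hA, lg, mul_div_assoc]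

lemma lg_mdiff (hf : MDiff f) (hf0 : ∀ τ, f τ ≠ 0) : MDiff (lg f) := by
  unfold lg
  simp only [div_eq_mul_inv]
  exact (dq_mdiff hf).mul (mdiff_inv hf hf0)

section PowerSeries

variable {R : Type*} [CommRing R] [Algebra R ℂ] {F : PowerSeries R}

/-- The derivation `X d/dX` on power series. -/
def dX (F : PowerSeries R) : PowerSeries R := PowerSeries.X * PowerSeries.derivative R F

omit [Algebra R ℂ] in
lemma coeff_dX (n : ℕ) : (dX F).coeff n = n * F.coeff n := by
  rcases n with _ | n
  · simp [dX]
  · rw [dX, PowerSeries.coeff_succ_X_mul, PowerSeries.coeff_derivative]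
    push_cast
    ring

lemma HasPS.dq (hf : HasPS 1 f F) : HasPS 1 (dq f) (dX F) := by
  intro τ
  set U : Set ℂ := {z | τ.im / 2 < z.im} with hU
  have hUo : IsOpen U := isOpen_lt continuous_const Complex.continuous_im
  have hτ : (τ : ℂ) ∈ U := by
    have := τ.im_pos
    simp only [hU, Set.mem_ofPred_eq, coe_im]
    linarith
  have hp : 0 < τ.im / 2 := by have := τ.im_pos; linarith
  set σ : ℍ := ⟨Complex.I * (τ.im / 2 : ℝ), by simpa using hp⟩ with hσ
  have hs := (hf σ).summable.norm
  have hq : ∀ (n : ℕ) (z : ℂ), HasDerivAt (fun z : ℂ => algebraMap R ℂ (F.coeff n) * qParam 1 z ^ n)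
      (2 * Real.pi * Complex.I * (algebraMap R ℂ ((dX F).coeff n) * qParam 1 z ^ n)) z := by
    intro n z
    have h1 : HasDerivAt (fun z : ℂ => algebraMap R ℂ (F.coeff n) *
        Complex.exp (2 * Real.pi * Complex.I * n * z))
        (algebraMap R ℂ (F.coeff n) * (Complex.exp (2 * Real.pi * Complex.I * n * z) *
          (2 * Real.pi * Complex.I * n))) z := by
      refine (HasDerivAt.cexp ?_).const_mul _
      simpa using (hasDerivAt_id' z).const_mul (2 * Real.pi * Complex.I * n : ℂ)
    have h2 : ∀ z : ℂ, qParam 1 z ^ n = Complex.exp (2 * Real.pi * Complex.I * n * z) := by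
      intro z
      rw [Function.Periodic.qParam, ← Complex.exp_nat_mul]
      congr 1
      push_cast
      ring
    simp only [h2]
    refine h1.congr_deriv ?_
    rw [coeff_dX, map_mul, map_natCast]
    ring
  have key := Complex.hasSum_deriv_of_summable_norm (U := U)
    (F := fun n z => algebraMap R ℂ (F.coeff n) * qParam 1 z ^ n) hs
    (fun n z _ => (hq n z).differentiableAt.differentiableWithinAt) hUo
    (by
      intro n z hz
      rw [norm_mul, norm_mul, norm_pow, norm_pow]
      gcongr
      rw [Function.Periodic.norm_qParam, Function.Periodic.norm_qParam]
      simp only [hU, Set.mem_ofPred_eq] at hz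
      have : (σ : ℂ).im = τ.im / 2 := by simp [hσ]
      rw [this]
      apply Real.exp_le_exp.mpr
      simp only [div_one]
      nlinarith [Real.pi_pos]) hτ
  have e1 : deriv (fun w : ℂ => ∑' n, algebraMap R ℂ (F.coeff n) * qParam 1 w ^ n) τ =
      deriv (f ∘ ofComplex) τ := by
    apply Filter.EventuallyEq.deriv_eq
    filter_upwards [isOpen_upperHalfPlaneSet.mem_nhds τ.im_pos] with z hz
    rw [Function.comp_apply, ← hf.psSum_qParam, ofComplex_apply_of_im_pos hz]
    rfl
  rw [e1] at key
  simp only [(hq _ _).deriv] at key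
  have := key.mul_left (2 * Real.pi * Complex.I)⁻¹
  simp only [inv_mul_cancel_left₀ Complex.two_pi_I_ne_zero] at this
  exact this

/-- The logarithmic derivative of a power series with constant coefficient `1`. -/
def lgX (F : PowerSeries R) : PowerSeries R := dX F * PowerSeries.invOfUnit F 1

omit [Algebra R ℂ] in
lemma lgX_mul (h0 : PowerSeries.constantCoeff F = 1) : lgX F * F = dX F := by
  rw [lgX, mul_assoc, PowerSeries.invOfUnit_mul _ _ (by simpa using h0), mul_one]

lemma HasPS.lg (hf : HasPS 1 f F) (h0 : PowerSeries.constantCoeff F = 1) (hf0 : ∀ τ, f τ ≠ 0) :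
    HasPS 1 (lg f) (lgX F) :=
  (hf.dq.mul (hf.inv one_pos hf0 (PowerSeries.mul_invOfUnit _ _ (by simpa using h0)))).congr'
    fun τ => by rw [BM.lg, div_eq_mul_inv]

end PowerSeries

end

section

open scoped Manifold UpperHalfPlane Topology
open UpperHalfPlane Filter Function.Periodic

variable {τ : ℍ} {A : M2} {N e : ℕ} {f g : ℍ → ℂ}

/-- The discriminant. -/
def dl (τ : ℍ) : ℂ := eta12 τ ^ 2

lemma dl_ne_zero (τ : ℍ) : dl τ ≠ 0 := pow_ne_zero _ (eta12_ne_zero τ)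

lemma dl_mdiff : MDiff dl := eta12_mdiff.pow 2

lemma dl_mob (hA : A.det = 1) (τ : ℍ) : dl (mob A τ) = jf A τ ^ 12 * dl τ := by
  rw [dl, ← delta_eq, delta_mob hA, delta_eq, dl]

lemma dl_eq (τ : ℍ) : dl τ = qParam 1 τ * euler τ ^ 24 := by
  rw [dl, eta12, mul_pow, ← pow_mul, Function.Periodic.qParam, Function.Periodic.qParam,
    ← Complex.exp_nat_mul]
  congr 2
  push_cast
  ring

lemma qParam_mdiff {h : ℝ} : MDiff (fun τ : ℍ => qParam h τ) := by
  rw [UpperHalfPlane.mdifferentiable_iff]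
  refine ((differentiable_qParam (h := h)).differentiableOn).congr fun z hz => ?_
  simp [ofComplex_apply_of_im_pos hz]

lemma lg_q : lg (fun τ : ℍ => qParam 1 τ) τ = 1 := by
  have h0 : qParam 1 τ ≠ 0 := Complex.exp_ne_zero _
  have h1 : dq (fun τ : ℍ => qParam 1 τ) τ = qParam 1 τ := by
    refine ((HasPS.q (R := ℂ) (h := 1)).dq.psSum_qParam τ).symm.trans ?_
    rw [dX, PowerSeries.derivative_X, mul_one]
    exact (HasPS.q (R := ℂ) (h := 1)).psSum_qParam τ
  rw [lg, h1, div_self h0]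

/-- The logarithmic derivative of the discriminant. -/
def lD : ℍ → ℂ := lg dl

lemma lD_mdiff : MDiff lD := lg_mdiff dl_mdiff dl_ne_zero

lemma lD_hasPS : HasPS 1 lD (1 + 24 * lgX eulerPS) := by
  have h1 := euler_hasPS.lg constCoeff_eulerPS euler_ne_zero
  refine ((HasPS.one (R := ℤ)).add (h1.cmul 24)).congr' fun τ => ?_
  have e1 : dl = fun τ : ℍ => qParam 1 τ * euler τ ^ 24 := funext dl_eq
  have hm : MDiff (fun τ => euler τ ^ 24) := euler_mdiff.pow 24
  rw [lD, e1, lg_mul qParam_mdiff hm (Complex.exp_ne_zero _)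
    (pow_ne_zero _ (euler_ne_zero _)), lg_q, lg_pow euler_mdiff (euler_ne_zero _)]
  simp

lemma lD_mob (hA : A.det = 1) (τ : ℍ) :
    lD (mob A τ) = jf A τ ^ 2 * lD τ + 12 * ((2 * Real.pi * Complex.I)⁻¹ * A 1 0) * jf A τ := by
  have hA' : 0 < A.det := by simp [hA]
  have h1 := lg_comp_mob (τ := τ) dl_mdiff hA'
  have e1 : (fun τ => dl (mob A τ)) = fun τ => jf A τ ^ 12 * dl τ := funext (dl_mob hA)
  have hj := jf_ne_zero hA' (τ := τ)
  have hm : MDiff (fun τ => jf A τ ^ 12) := jf_mdiff.pow 12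
  rw [e1, lg_mul hm dl_mdiff (pow_ne_zero _ hj) (dl_ne_zero _),
    lg_pow jf_mdiff hj, hA] at h1
  rw [lg, dq_jf] at h1
  rw [lD]
  field_simp at h1 ⊢
  push_cast at h1
  linear_combination -h1

/-- A modular form of weight `4`. -/
def wM (τ : ℍ) : ℂ := lD τ ^ 2 - 12 * dq lD τ

lemma wM_mdiff : MDiff wM :=
  (lD_mdiff.pow 2).sub (mdifferentiable_const.mul (dq_mdiff lD_mdiff))

lemma wM_mob (hA : A.det = 1) (τ : ℍ) : wM (mob A τ) = jf A τ ^ 4 * wM τ := by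
  have hA' : 0 < A.det := by simp [hA]
  have hj := jf_ne_zero hA' (τ := τ)
  have h1 := dq_comp_mob (τ := τ) lD_mdiff hA'
  have e1 : (fun τ => lD (mob A τ)) = fun τ => jf A τ ^ 2 * lD τ +
      12 * ((2 * Real.pi * Complex.I)⁻¹ * A 1 0) * jf A τ := funext (lD_mob hA)
  rw [wM, wM, lD_mob hA]
  set c := (2 * Real.pi * Complex.I : ℂ)⁻¹ * A 1 0 with hc
  have hm : MDiff (fun τ => jf A τ ^ 2) := jf_mdiff.pow 2
  have hm2 : MDiff (fun τ => jf A τ ^ 2 * lD τ) := hm.mul lD_mdiff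
  have hm3 : MDiff (fun τ => 12 * c * jf A τ) := mdifferentiable_const.mul jf_mdiff
  rw [e1, dq_add hm2 hm3,
    dq_mul hm lD_mdiff, dq_mul mdifferentiable_const jf_mdiff, dq_const,
    dq_pow jf_mdiff, dq_jf, ← hc, hA] at h1
  rw [zero_mul, zero_add, Int.cast_one, one_div, eq_inv_mul_iff_mul_eq₀ (pow_ne_zero 2 hj)] at h1
  rw [← h1]
  norm_num
  ring

/-- The power series of `wM`. -/
def wMX : PowerSeries ℤ := (1 + 24 * lgX eulerPS) ^ 2 - 12 * dX (1 + 24 * lgX eulerPS)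

lemma wM_hasPS : HasPS 1 wM wMX :=
  ((lD_hasPS.pow 2).sub (lD_hasPS.dq.cmul 12)).congr' fun τ => by simp [wM]

/-- A modular form of weight `2` and level `N`. -/
def kE (N e : ℕ) (τ : ℍ) : ℂ := - lg (hv N e) τ

lemma kE_mdiff (hN : 0 < N) : MDiff (kE N e) := (lg_mdiff (hv_mdiff hN) hv_ne_zero).neg

lemma kE_gamma0 (h : Lv N e) (hA : A.det = 1) (hc : (N : ℤ) ∣ A 1 0) (τ : ℍ) :
    kE N e (mob A τ) = jf A τ ^ 2 * kE N e τ := by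
  have hA' : 0 < A.det := by simp [hA]
  have hj := jf_ne_zero hA' (τ := τ)
  have h1 := lg_comp_mob (τ := τ) (hv_mdiff (e := e) h.pos) hA'
  have e1 : (fun τ => hv N e (mob A τ)) = hv N e := funext (hv_gamma0 h hA hc)
  rw [e1, hA] at h1
  rw [kE, kE, h1]
  field_simp
  simp

lemma kE_S (h : Lv N e) (τ : ℍ) :
    kE N e (mob matS τ) = - (jf matS τ ^ 2 / N) * kE N e (mob (tri 1 0 N) τ) := by
  have hN := h.pos
  have hN0 : (N : ℂ) ≠ 0 := by exact_mod_cast hN.ne'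
  have hS : 0 < matS.det := by simp [det_matS]
  have hB : 0 < (tri 1 0 N).det := by simpa [det_tri]
  have hj := jf_ne_zero hS (τ := τ)
  have h1 := lg_comp_mob (τ := τ) (hv_mdiff (e := e) h.pos) hS
  have h2 := lg_comp_mob (τ := τ) (hv_mdiff (e := e) h.pos) hB
  have e1 : (fun τ => hv N e (mob matS τ)) =
      fun τ => (N : ℂ) ^ (6 * e) * (hv N e (mob (tri 1 0 N) τ))⁻¹ :=
    funext fun τ => by rw [hv_S h, div_eq_mul_inv]
  have e2 : MDiff (fun τ => hv N e (mob (tri 1 0 N) τ)) := MDiff.comp_mob (hv_mdiff hN) hB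
  rw [e1, lg_mul mdifferentiable_const (mdiff_inv e2 fun _ => hv_ne_zero _) (pow_ne_zero _ hN0)
    (inv_ne_zero (hv_ne_zero _)), lg_const, lg_inv e2 fun _ => hv_ne_zero _, h2, det_matS] at h1
  have e3 : jf (tri 1 0 N) τ = N := by simp [jf, tri]
  have e4 : (tri 1 0 N).det = N := by simp [det_tri]
  rw [e3, e4] at h1
  rw [kE, kE]
  field_simp at h1 ⊢
  push_cast at h1
  refine mul_left_cancel₀ hN0 ?_
  linear_combination h1

/-- The power series of `kE`. -/
def kEX (N e : ℕ) : PowerSeries ℤ := 1 - lgX (hU N e)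

lemma kE_hasPS (h : Lv N e) : HasPS 1 (kE N e) (kEX N e) := by
  have h0 : ∀ τ : ℍ, qParam 1 τ * hv N e τ ≠ 0 := fun τ => mul_ne_zero (Complex.exp_ne_zero _) (hv_ne_zero _)
  refine ((HasPS.one (R := ℤ)).sub ((hv_hasPS h).lg constCoeff_hU h0)).congr' fun τ => ?_
  rw [lg_mul qParam_mdiff (hv_mdiff h.pos) (Complex.exp_ne_zero _) (hv_ne_zero _), lg_q, kE]
  ring

lemma HasPS.comp_tri {R : Type*} [CommRing R] [Algebra R ℂ] {F : PowerSeries R}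
    (hf : HasPS 1 f F) (hN : 0 < N) : HasPS N (fun τ => f (mob (tri 1 0 N) τ)) F := by
  intro τ
  simpa only [qParam_div hN] using hf (mob (tri 1 0 N) τ)

lemma hU_inv (h : Lv N e) :
    HasPS N (fun τ => (qParam N τ * hv N e (mob (tri 1 0 N) τ))⁻¹)
      (PowerSeries.invOfUnit (hU N e) 1) :=
  ((((hv_hasPS h).inv one_pos
    (fun τ => mul_ne_zero (Complex.exp_ne_zero _) (hv_ne_zero _))
    (PowerSeries.mul_invOfUnit _ 1 (by simp [constCoeff_hU])))).comp_tri h.pos).congr'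
    fun τ => by rw [qParam_div h.pos]

lemma hv_S_bounded (h : Lv N e) :
    IsBoundedAtImInfty (fun τ => hv N e (mob matS τ)) := by
  have hN := h.pos
  have h1 := hU_inv h
  have hN' : (0 : ℝ) < N := by exact_mod_cast hN
  have h2 := ((HasPS.q (R := ℤ) (h := N)).mul h1).cmul ((N : ℤ) ^ (6 * e))
  have h5 := h2.congr' (g := fun τ => hv N e (mob matS τ)) fun τ => ?_
  · exact h5.bounded hN'
  have h3 : qParam N τ ≠ 0 := Complex.exp_ne_zero _
  have h4 := hv_ne_zero (N := N) (e := e) (mob (tri 1 0 N) τ)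
  rw [hv_S h]
  simp only [map_pow, map_natCast]
  field_simp

/-- A bound for the pole of `hv ^ N / dl` at the cusp `0`. -/
lemma hv_pow_div_dl_S_bounded (h : Lv N e) :
    IsBoundedAtImInfty (fun τ => (hv N e (mob matS τ)) ^ N * jf matS τ ^ 12 / dl (mob matS τ)) := by
  have hN := h.pos
  have h1 := hU_inv h
  have h2 := euler_hasPS.inv one_pos euler_ne_zero euler_mul_inv
  have hq : ∀ τ : ℍ, qParam 1 τ = qParam N τ ^ N := fun τ => by
    have : (N : ℂ) ≠ 0 := by exact_mod_cast hN.ne'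
    rw [Function.Periodic.qParam, Function.Periodic.qParam, ← Complex.exp_nat_mul]
    congr 1
    push_cast
    field_simp
  have h3 := h2.of_pow hN.ne' hq
  have hN' : (0 : ℝ) < N := by exact_mod_cast hN
  have h4 := ((h1.pow N).mul (h3.pow 24)).cmul (((N : ℤ) ^ (6 * e)) ^ N)
  have h5 := h4.congr' (g := fun τ => (hv N e (mob matS τ)) ^ N * jf matS τ ^ 12 / dl (mob matS τ))
    fun τ => ?_
  · exact h5.bounded hN'
  have h3 : qParam N τ ≠ 0 := Complex.exp_ne_zero _
  have h4 := hv_ne_zero (N := N) (e := e) (mob (tri 1 0 N) τ)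
  have h5 := jf_ne_zero (A := matS) (by simp [det_matS]) (τ := τ)
  have h6 := euler_ne_zero τ
  rw [hv_S h, dl_mob det_matS, dl_eq, hq]
  simp only [map_pow, map_natCast]
  rw [div_pow, inv_pow, mul_pow]
  field_simp

lemma HasPS.of_q_pow_mul {R : Type*} [CommRing R] [Algebra R ℂ] {F : PowerSeries R} (n : ℕ)
    (hf : HasPS 1 (fun τ => qParam 1 τ ^ n * f τ) (PowerSeries.X ^ n * F)) : HasPS 1 f F := by
  induction n with
  | zero => simpa using hf
  | succ n ih =>
    refine ih (HasPS.of_q_mul ?_)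
    simpa only [pow_succ', mul_assoc] using hf

/-- A weight `12` form of level `N` is determined by its first coefficients. -/
lemma sturm (h : Lv N e) {a b : ℍ → ℂ} {aP bP : PowerSeries ℤ} (ha : MDiff a)
    (hwt : ∀ A : M2, A.det = 1 → (N : ℤ) ∣ A 1 0 → ∀ τ, a (mob A τ) = jf A τ ^ 12 * a τ)
    (haS : IsBoundedAtImInfty (fun τ => a (mob matS τ) / jf matS τ ^ 12))
    (hb : MDiff b) (hbi : Inv0 N b) (hbS : IsBoundedAtImInfty (fun τ => b (mob matS τ)))
    (haP : HasPS 1 a aP) (hbP : HasPS 1 (fun τ => qParam 1 τ ^ (N + 1) * b τ) bP)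
    (hd : PowerSeries.X ^ (N + 2) ∣ aP * hU N e ^ N * eulerInv ^ 24 - bP) (τ : ℍ) :
    a τ * hv N e τ ^ N = b τ * dl τ := by
  have hN := h.pos
  set G : ℍ → ℂ := fun τ => a τ * hv N e τ ^ N * (dl τ)⁻¹ - b τ with hG
  obtain ⟨H, hH⟩ := hd
  have hGP : HasPS 1 G (PowerSeries.X * H) := by
    refine HasPS.of_q_pow_mul (N + 1) ?_
    rw [← mul_assoc, ← pow_succ, ← hH]
    refine (((haP.mul ((hv_hasPS h).pow N)).mul
      ((euler_hasPS.inv one_pos euler_ne_zero euler_mul_inv).pow 24)).sub hbP).congr' fun τ => ?_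
    have h3 : qParam 1 τ ≠ 0 := Complex.exp_ne_zero _
    have h6 := euler_ne_zero τ
    simp only [hG, dl_eq]
    field_simp
    rw [mul_pow]
    ring
  have hGm : MDiff G := (((ha.mul ((hv_mdiff hN).pow N)).mul (mdiff_inv dl_mdiff dl_ne_zero))).sub hb
  have hGi : Inv0 N G := by
    intro A hA hc τ
    have hj := jf_ne_zero (A := A) (by simp [hA]) (τ := τ)
    have := dl_ne_zero τ
    simp only [hG]
    rw [hwt A hA hc, hv_gamma0 h hA hc, dl_mob hA, hbi A hA hc]
    field_simp
  have hGS : IsBoundedAtImInfty (fun τ => G (mob matS τ)) := by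
    have h1 := (haS.mul (hv_pow_div_dl_S_bounded h)).sub hbS
    refine h1.congr_left fun τ => ?_
    have hj := jf_ne_zero (A := matS) (by simp [det_matS]) (τ := τ)
    have := dl_ne_zero (mob matS τ)
    simp only [hG, Pi.mul_apply]
    field_simp
  have hN' : N.Prime := by rcases h with ⟨rfl, _⟩ | ⟨rfl, _⟩ <;> norm_num
  have hc := const_of_bounded_prime hN' hGm hGi (hGP.bounded one_pos) hGS
  have h0 : G τ = 0 := by
    have t1 := hGP.tendsto one_pos
    have e1 : G = fun _ => G τ := funext fun σ => hc σ τ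
    rw [e1] at t1
    have := tendsto_nhds_unique tendsto_const_nhds t1
    simpa using this
  have := dl_ne_zero τ
  simp only [hG] at h0
  field_simp at h0
  linear_combination h0

end

section

open scoped Manifold UpperHalfPlane Topology
open UpperHalfPlane Filter Function.Periodic

section

local notation "𝕏" => (PowerSeries.X : PowerSeries ℤ)

/-- Congruence of power series modulo a power of `X`. -/
def Cg (n : ℕ) (F G : PowerSeries ℤ) : Prop := 𝕏 ^ n ∣ F - G

namespace Cg

variable {n : ℕ} {F F' G G' f g h : PowerSeries ℤ}

lemma refl (F : PowerSeries ℤ) : Cg n F F := by simp [Cg]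

lemma symm (hF : Cg n F f) : Cg n f F := by
  have := dvd_neg.mpr hF
  rwa [neg_sub] at this

lemma trans (hF : Cg n F f) (hf : Cg n f g) : Cg n F g := by
  have := dvd_add hF hf
  rwa [sub_add_sub_cancel] at this

lemma add (hF : Cg n F f) (hG : Cg n G g) : Cg n (F + G) (f + g) := by
  have := dvd_add hF hG
  rwa [sub_add_sub_comm] at this

lemma sub (hF : Cg n F f) (hG : Cg n G g) : Cg n (F - G) (f - g) := by
  have := dvd_sub hF hG
  rwa [sub_sub_sub_comm] at this

lemma mul (hF : Cg n F f) (hG : Cg n G g) : Cg n (F * G) (f * g) := by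
  have := dvd_add (hF.mul_right G) (hG.mul_left f)
  rw [Cg]
  convert this using 1
  ring

lemma congr (hF : Cg n F f) (e : F' = F) : Cg n F' f := e ▸ hF

lemma congr' (hF : Cg n F f) (e : f = g) : Cg n F g := e ▸ hF

lemma congr2 (hF : Cg n F f) (e : F' = F) (e' : g = f) : Cg n F' g := e ▸ e' ▸ hF

lemma red (hF : Cg n F f) (c : PowerSeries ℤ) (e : f = h + 𝕏 ^ n * c) : Cg n F h :=
  hF.trans ⟨c, by rw [e]; ring⟩

lemma dX (hF : Cg n F f) : Cg n (dX F) (dX f) := by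
  rw [Cg, PowerSeries.X_pow_dvd_iff] at hF ⊢
  intro m hm
  have := hF m hm
  rw [map_sub] at this ⊢
  rw [coeff_dX, coeff_dX, ← mul_sub, this, mul_zero]

lemma inv (hF : Cg n F f) (hG : F * G = 1) (c : PowerSeries ℤ)
    (e : f * g = 1 + 𝕏 ^ n * c) : Cg n G g := by
  have h1 : Cg n (G * (F * g)) (G * 1) :=
    (refl G).mul ((hF.mul (refl g)).red c e)
  refine symm (h1.congr2 ?_ (mul_one G).symm)
  rw [← mul_assoc, mul_comm G, hG, one_mul]

lemma lgX (hF : Cg n F f) (h0 : PowerSeries.constantCoeff F = 1) (c : PowerSeries ℤ)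
    (e : g * f = BM.dX f + 𝕏 ^ n * c) : Cg n (lgX F) g := by
  have hFI : F * PowerSeries.invOfUnit F 1 = 1 := PowerSeries.mul_invOfUnit _ _ (by simpa using h0)
  have h1 : Cg n (g * F) (BM.dX F) := (((refl g).mul hF).red c e).trans hF.dX.symm
  have h2 := h1.mul (refl (PowerSeries.invOfUnit F 1))
  exact h2.symm.congr' (by rw [mul_assoc, hFI, mul_one])

lemma expand {N : ℕ} (hN : N ≠ 0) (hF : Cg n F f) :
    Cg n (PowerSeries.expand N hN F) (PowerSeries.expand N hN f) := by
  obtain ⟨c, hc⟩ := hF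
  rw [Cg, ← map_sub, hc, map_mul, map_pow, PowerSeries.expand_X, ← pow_mul, mul_comm N, pow_mul]
  exact (dvd_pow_self _ hN).mul_right _

end Cg

lemma cg_euler {n : ℕ} (hn : n ≤ 5) : Cg n eulerPS (1 - 𝕏 - 𝕏 ^ 2) := by
  rw [Cg, PowerSeries.X_pow_dvd_iff]
  intro m hm
  have h0 : PowerSeries.coeff 0 eulerPS = 1 := by simpa using constCoeff_eulerPS
  have h1 : PowerSeries.coeff 1 eulerPS = -1 := by
    have := PowerSeries.coeff_pentagonalSeries_pentagonal ℤ 1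
    rwa [show pentagonal 1 = 1 by decide, Int.negOnePow_one] at this
  have h2 : PowerSeries.coeff 2 eulerPS = -1 := by
    have := PowerSeries.coeff_pentagonalSeries_pentagonal ℤ (-1)
    rwa [show pentagonal (-1) = 2 by decide, Int.negOnePow_neg, Int.negOnePow_one] at this
  have h3 (n : ℕ) (hn : n = 3 ∨ n = 4) : PowerSeries.coeff n eulerPS = 0 := by
    refine PowerSeries.coeff_pentagonalSeries_eq_zero ℤ ?_
    rintro ⟨k, rfl⟩
    have h4 := two_mul_natCast_pentagonal k
    have h8 : (pentagonal k : ℤ) ≤ 4 := by omega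
    have h5 : k < 3 := by nlinarith
    have h6 : -3 < k := by nlinarith
    interval_cases k <;> omega
  have h7 : m < 5 := by omega
  rw [map_sub, map_sub, map_sub, PowerSeries.coeff_one, PowerSeries.coeff_X, PowerSeries.coeff_X_pow]
  interval_cases m <;> simp [h0, h1, h2, h3]

lemma dX_add (F G : PowerSeries ℤ) : dX (F + G) = dX F + dX G := by simp [dX, mul_add]

lemma dX_sub (F G : PowerSeries ℤ) : dX (F - G) = dX F - dX G := by simp [dX, mul_sub]

lemma dX_ofNat_mul (k : ℕ) [k.AtLeastTwo] (F : PowerSeries ℤ) :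
    dX ((ofNat(k) : PowerSeries ℤ) * F) = ofNat(k) * dX F := by
  have h : (ofNat(k) : PowerSeries ℤ) = PowerSeries.C (ofNat(k) : ℤ) := (map_ofNat PowerSeries.C k).symm
  rw [h]
  ext n
  rw [coeff_dX, PowerSeries.coeff_C_mul, PowerSeries.coeff_C_mul, coeff_dX]
  ring

lemma dX_one : dX (1 : PowerSeries ℤ) = 0 := by simp [dX]

lemma dX_X : dX 𝕏 = 𝕏 := by simp [dX]

lemma dX_X_pow (k : ℕ) : dX (𝕏 ^ k) = (k : PowerSeries ℤ) * 𝕏 ^ k := by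
  ext n
  rw [coeff_dX, ← map_natCast (PowerSeries.C (R := ℤ)) k, PowerSeries.coeff_C_mul, PowerSeries.coeff_X_pow]
  split_ifs with h
  · simp [h]
  · simp

lemma ps_identities_two :
    Cg 4 (kEX 2 2 ^ 6 * hU 2 2 ^ 2 * eulerInv ^ 24) ((hU 2 2 + 64 * 𝕏) ^ 3) ∧
    Cg 4 (wMX * kEX 2 2 ^ 4 * hU 2 2 ^ 2 * eulerInv ^ 24)
      ((hU 2 2 + 64 * 𝕏) ^ 2 * (hU 2 2 + 256 * 𝕏)) := by
  have hE : Cg 4 eulerPS (1 - 𝕏 - 𝕏 ^ 2) := cg_euler (by norm_num)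
  have hI : Cg 4 eulerInv (1 + 𝕏 + 2 * 𝕏 ^ 2 + 3 * 𝕏 ^ 3) := hE.inv euler_mul_inv (-5 - 3 * 𝕏) (by ring)
  have hJ : Cg 4 (PowerSeries.expand 2 (by norm_num) eulerInv) (1 + 𝕏 ^ 2) := by
    refine (hI.expand (by norm_num)).red (h := 1 + 𝕏 ^ 2) (2 + 3 * 𝕏 ^ 2) ?_
    simp only [map_add, map_sub, map_mul, map_pow, map_one, map_ofNat, PowerSeries.expand_X]; ring
  have hB := (hE.mul hJ).red (h := 1 - 𝕏 - 𝕏 ^ 3) (-1) (by ring)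
  have hB2 := (hB.mul hB).red (h := 1 - 2 * 𝕏 + 𝕏 ^ 2 - 2 * 𝕏 ^ 3) (2 + 𝕏 ^ 2) (by ring)
  have hB3 := (hB2.mul hB).red (h := 1 - 3 * 𝕏 + 3 * 𝕏 ^ 2 - 4 * 𝕏 ^ 3) (4 - 𝕏 + 2 * 𝕏 ^ 2) (by ring)
  have hB6 := (hB3.mul hB3).red (h := 1 - 6 * 𝕏 + 15 * 𝕏 ^ 2 - 26 * 𝕏 ^ 3) (33 - 24 * 𝕏 + 16 * 𝕏 ^ 2) (by ring)
  have hB12 := (hB6.mul hB6).red (h := 1 - 12 * 𝕏 + 66 * 𝕏 ^ 2 - 232 * 𝕏 ^ 3) (537 - 780 * 𝕏 + 676 * 𝕏 ^ 2) (by ring)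
  have hB24 := (hB12.mul hB12).red (h := 1 - 24 * 𝕏 + 276 * 𝕏 ^ 2 - 2048 * 𝕏 ^ 3) (9924 - 30624 * 𝕏 + 53824 * 𝕏 ^ 2) (by ring)
  have hU : Cg 4 (BM.hU 2 2) (1 - 24 * 𝕏 + 276 * 𝕏 ^ 2 - 2048 * 𝕏 ^ 3) := by
    refine hB24.congr ?_
    rw [BM.hU, dif_pos (by norm_num)]; ring
  have hk : Cg 4 (kEX 2 2) (1 + 24 * 𝕏 + 24 * 𝕏 ^ 2 + 96 * 𝕏 ^ 3) := by
    refine ((Cg.refl 1).sub (hU.lgX constCoeff_hU (g := -24 * 𝕏 - 24 * 𝕏 ^ 2 - 96 * 𝕏 ^ 3) (44832 + 22656 * 𝕏 + 196608 * 𝕏 ^ 2) ?_)).congr' ?_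
    · simp only [dX_add, dX_sub, dX_ofNat_mul, dX_one, dX_X, dX_X_pow]; push_cast; ring
    · ring
  have hk2 := (hk.mul hk).red (h := 1 + 48 * 𝕏 + 624 * 𝕏 ^ 2 + 1344 * 𝕏 ^ 3) (5184 + 4608 * 𝕏 + 9216 * 𝕏 ^ 2) (by ring)
  have hk4 := (hk2.mul hk2).red (h := 1 + 96 * 𝕏 + 3552 * 𝕏 ^ 2 + 62592 * 𝕏 ^ 3) (518400 + 1677312 * 𝕏 + 1806336 * 𝕏 ^ 2) (by ring)
  have hk6 := (hk4.mul hk2).red (h := 1 + 144 * 𝕏 + 8784 * 𝕏 ^ 2 + 294336 * 𝕏 ^ 3) (5349888 + 43831296 * 𝕏 + 84123648 * 𝕏 ^ 2) (by ring)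
  have hU2 := (hU.mul hU).red (h := 1 - 48 * 𝕏 + 1128 * 𝕏 ^ 2 - 17344 * 𝕏 ^ 3) (174480 - 1130496 * 𝕏 + 4194304 * 𝕏 ^ 2) (by ring)
  have hI2 := (hI.mul hI).red (h := 1 + 2 * 𝕏 + 5 * 𝕏 ^ 2 + 10 * 𝕏 ^ 3) (10 + 12 * 𝕏 + 9 * 𝕏 ^ 2) (by ring)
  have hI3 := (hI2.mul hI).red (h := 1 + 3 * 𝕏 + 9 * 𝕏 ^ 2 + 22 * 𝕏 ^ 3) (26 + 35 * 𝕏 + 30 * 𝕏 ^ 2) (by ring)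
  have hI6 := (hI3.mul hI3).red (h := 1 + 6 * 𝕏 + 27 * 𝕏 ^ 2 + 98 * 𝕏 ^ 3) (213 + 396 * 𝕏 + 484 * 𝕏 ^ 2) (by ring)
  have hI12 := (hI6.mul hI6).red (h := 1 + 12 * 𝕏 + 90 * 𝕏 ^ 2 + 520 * 𝕏 ^ 3) (1905 + 5292 * 𝕏 + 9604 * 𝕏 ^ 2) (by ring)
  have hI24 := (hI12.mul hI12).red (h := 1 + 24 * 𝕏 + 324 * 𝕏 ^ 2 + 3200 * 𝕏 ^ 3) (20580 + 93600 * 𝕏 + 270400 * 𝕏 ^ 2) (by ring)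
  have hT := (hU2.mul hI24).red (h := 1 - 24 * 𝕏 + 300 * 𝕏 ^ 2 - 2624 * 𝕏 ^ 3) (-204384 - 2009856 * 𝕏 - 55500800 * 𝕏 ^ 2) (by ring)
  have hA1 := (hk6.mul hT).red (h := 1 + 120 * 𝕏 + 5628 * 𝕏 ^ 2 + 124096 * 𝕏 ^ 3) (-4806720 + 65251584 * 𝕏 - 772337664 * 𝕏 ^ 2) (by ring)
  have hl : Cg 4 (lgX eulerPS) (-𝕏 - 3 * 𝕏 ^ 2 - 4 * 𝕏 ^ 3) := by
    refine hE.lgX constCoeff_eulerPS (7 + 4 * 𝕏) ?_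
    simp only [dX_add, dX_sub, dX_ofNat_mul, dX_one, dX_X, dX_X_pow]; push_cast; ring
  have hL : Cg 4 (1 + 24 * lgX eulerPS) (1 - 24 * 𝕏 - 72 * 𝕏 ^ 2 - 96 * 𝕏 ^ 3) := by
    refine ((Cg.refl 1).add ((Cg.refl 24).mul hl)).congr' ?_; ring
  have hL2 := (hL.mul hL).red (h := 1 - 48 * 𝕏 + 432 * 𝕏 ^ 2 + 3264 * 𝕏 ^ 3) (9792 + 13824 * 𝕏 + 9216 * 𝕏 ^ 2) (by ring)
  have hw : Cg 4 wMX (1 + 240 * 𝕏 + 2160 * 𝕏 ^ 2 + 6720 * 𝕏 ^ 3) := by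
    refine ((hL2.congr (F' := (1 + 24 * lgX eulerPS) ^ 2) (by ring)).sub ((Cg.refl 12).mul hL.dX)).congr' ?_
    simp only [dX_add, dX_sub, dX_ofNat_mul, dX_one, dX_X, dX_X_pow]; push_cast; ring
  have hwk := (hw.mul hk4).red (h := 1 + 336 * 𝕏 + 28752 * 𝕏 ^ 2 + 1129152 * 𝕏 ^ 3) (23339520 + 159068160 * 𝕏 + 420618240 * 𝕏 ^ 2) (by ring)
  have hA2 := (hwk.mul hT).red (h := 1 + 312 * 𝕏 + 20988 * 𝕏 ^ 2 + 537280 * 𝕏 ^ 3) (-19355712 + 263300352 * 𝕏 - 2962894848 * 𝕏 ^ 2) (by ring)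
  have hV1 : Cg 4 (BM.hU 2 2 + 64 * 𝕏) (1 + 40 * 𝕏 + 276 * 𝕏 ^ 2 - 2048 * 𝕏 ^ 3) := by
    refine (hU.add (Cg.refl (64 * 𝕏))).congr' ?_; ring
  have hV2 : Cg 4 (BM.hU 2 2 + 256 * 𝕏) (1 + 232 * 𝕏 + 276 * 𝕏 ^ 2 - 2048 * 𝕏 ^ 3) := by
    refine (hU.add (Cg.refl (256 * 𝕏))).congr' ?_; ring
  have hV12 := (hV1.mul hV1).red (h := 1 + 80 * 𝕏 + 2152 * 𝕏 ^ 2 + 17984 * 𝕏 ^ 3) (-87664 - 1130496 * 𝕏 + 4194304 * 𝕏 ^ 2) (by ring)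
  have hR1 := (hV12.mul hV1).red (h := 1 + 120 * 𝕏 + 5628 * 𝕏 ^ 2 + 124096 * 𝕏 ^ 3) (1149472 + 556288 * 𝕏 - 36831232 * 𝕏 ^ 2) (by ring)
  have hR2 := (hV12.mul hV2).red (h := 1 + 312 * 𝕏 + 20988 * 𝕏 ^ 2 + 537280 * 𝕏 ^ 3) (4602400 + 556288 * 𝕏 - 36831232 * 𝕏 ^ 2) (by ring)
  exact ⟨(hA1.trans hR1.symm).congr2 (by ring) (by ring), (hA2.trans hR2.symm).congr2 (by ring) (by ring)⟩

lemma ps_identities_three :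
    Cg 5 (kEX 3 1 ^ 6 * hU 3 1 ^ 3 * eulerInv ^ 24) ((hU 3 1 + 27 * 𝕏) ^ 4) ∧
    Cg 5 (wMX * kEX 3 1 ^ 4 * hU 3 1 ^ 3 * eulerInv ^ 24)
      ((hU 3 1 + 27 * 𝕏) ^ 3 * (hU 3 1 + 243 * 𝕏)) := by
  have hE : Cg 5 eulerPS (1 - 𝕏 - 𝕏 ^ 2) := cg_euler (by norm_num)
  have hI : Cg 5 eulerInv (1 + 𝕏 + 2 * 𝕏 ^ 2 + 3 * 𝕏 ^ 3 + 5 * 𝕏 ^ 4) := hE.inv euler_mul_inv (-8 - 5 * 𝕏) (by ring)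
  have hJ : Cg 5 (PowerSeries.expand 3 (by norm_num) eulerInv) (1 + 𝕏 ^ 3) := by
    refine (hI.expand (by norm_num)).red (h := 1 + 𝕏 ^ 3) (2 * 𝕏 + 3 * 𝕏 ^ 4 + 5 * 𝕏 ^ 7) ?_
    simp only [map_add, map_sub, map_mul, map_pow, map_one, map_ofNat, PowerSeries.expand_X]; ring
  have hB := (hE.mul hJ).red (h := 1 - 𝕏 - 𝕏 ^ 2 + 𝕏 ^ 3 - 𝕏 ^ 4) (-1) (by ring)
  have hB2 := (hB.mul hB).red (h := 1 - 2 * 𝕏 - 𝕏 ^ 2 + 4 * 𝕏 ^ 3 - 3 * 𝕏 ^ 4) (3 * 𝕏 - 2 * 𝕏 ^ 2 + 𝕏 ^ 3) (by ring)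
  have hB3 := (hB2.mul hB).red (h := 1 - 3 * 𝕏 + 8 * 𝕏 ^ 3 - 9 * 𝕏 ^ 4) (8 * 𝕏 - 7 * 𝕏 ^ 2 + 3 * 𝕏 ^ 3) (by ring)
  have hB6 := (hB3.mul hB3).red (h := 1 - 6 * 𝕏 + 9 * 𝕏 ^ 2 + 16 * 𝕏 ^ 3 - 66 * 𝕏 ^ 4) (54 + 64 * 𝕏 - 144 * 𝕏 ^ 2 + 81 * 𝕏 ^ 3) (by ring)
  have hB12 := (hB6.mul hB6).red (h := 1 - 12 * 𝕏 + 54 * 𝕏 ^ 2 - 76 * 𝕏 ^ 3 - 243 * 𝕏 ^ 4) (1080 - 932 * 𝕏 - 2112 * 𝕏 ^ 2 + 4356 * 𝕏 ^ 3) (by ring)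
  have hU : Cg 5 (BM.hU 3 1) (1 - 12 * 𝕏 + 54 * 𝕏 ^ 2 - 76 * 𝕏 ^ 3 - 243 * 𝕏 ^ 4) := by
    refine hB12.congr ?_
    rw [BM.hU, dif_pos (by norm_num)]; ring
  have hk : Cg 5 (kEX 3 1) (1 + 12 * 𝕏 + 36 * 𝕏 ^ 2 + 12 * 𝕏 ^ 3 + 84 * 𝕏 ^ 4) := by
    refine ((Cg.refl 1).sub (hU.lgX constCoeff_hU (g := -12 * 𝕏 - 36 * 𝕏 ^ 2 - 12 * 𝕏 ^ 3 - 84 * 𝕏 ^ 4) (6012 + 5124 * 𝕏 + 9300 * 𝕏 ^ 2 + 20412 * 𝕏 ^ 3) ?_)).congr' ?_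
    · simp only [dX_add, dX_sub, dX_ofNat_mul, dX_one, dX_X, dX_X_pow]; push_cast; ring
    · ring
  have hk2 := (hk.mul hk).red (h := 1 + 24 * 𝕏 + 216 * 𝕏 ^ 2 + 888 * 𝕏 ^ 3 + 1752 * 𝕏 ^ 4) (2880 + 6192 * 𝕏 + 2016 * 𝕏 ^ 2 + 7056 * 𝕏 ^ 3) (by ring)
  have hk4 := (hk2.mul hk2).red (h := 1 + 48 * 𝕏 + 1008 * 𝕏 ^ 2 + 12144 * 𝕏 ^ 3 + 92784 * 𝕏 ^ 4) (467712 + 1545408 * 𝕏 + 3111552 * 𝕏 ^ 2 + 3069504 * 𝕏 ^ 3) (by ring)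
  have hk6 := (hk4.mul hk2).red (h := 1 + 72 * 𝕏 + 2376 * 𝕏 ^ 2 + 47592 * 𝕏 ^ 3 + 646344 * 𝕏 ^ 4) (5829120 + 32591232 * 𝕏 + 103668480 * 𝕏 ^ 2 + 162557568 * 𝕏 ^ 3) (by ring)
  have hU2 := (hU.mul hU).red (h := 1 - 24 * 𝕏 + 252 * 𝕏 ^ 2 - 1448 * 𝕏 ^ 3 + 4254 * 𝕏 ^ 4) (-2376 - 20468 * 𝕏 + 36936 * 𝕏 ^ 2 + 59049 * 𝕏 ^ 3) (by ring)
  have hU3 := (hU2.mul hU).red (h := 1 - 36 * 𝕏 + 594 * 𝕏 ^ 2 - 5844 * 𝕏 ^ 3 + 36819 * 𝕏 ^ 4) (-142560 + 278528 * 𝕏 + 28560 * 𝕏 ^ 2 - 1033722 * 𝕏 ^ 3) (by ring)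
  have hI2 := (hI.mul hI).red (h := 1 + 2 * 𝕏 + 5 * 𝕏 ^ 2 + 10 * 𝕏 ^ 3 + 20 * 𝕏 ^ 4) (22 + 29 * 𝕏 + 30 * 𝕏 ^ 2 + 25 * 𝕏 ^ 3) (by ring)
  have hI3 := (hI2.mul hI).red (h := 1 + 3 * 𝕏 + 9 * 𝕏 ^ 2 + 22 * 𝕏 ^ 3 + 51 * 𝕏 ^ 4) (65 + 95 * 𝕏 + 110 * 𝕏 ^ 2 + 100 * 𝕏 ^ 3) (by ring)
  have hI6 := (hI3.mul hI3).red (h := 1 + 6 * 𝕏 + 27 * 𝕏 ^ 2 + 98 * 𝕏 ^ 3 + 315 * 𝕏 ^ 4) (702 + 1402 * 𝕏 + 2244 * 𝕏 ^ 2 + 2601 * 𝕏 ^ 3) (by ring)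
  have hI12 := (hI6.mul hI6).red (h := 1 + 12 * 𝕏 + 90 * 𝕏 ^ 2 + 520 * 𝕏 ^ 3 + 2535 * 𝕏 ^ 4) (9072 + 26614 * 𝕏 + 61740 * 𝕏 ^ 2 + 99225 * 𝕏 ^ 3) (by ring)
  have hI24 := (hI12.mul hI12).red (h := 1 + 24 * 𝕏 + 324 * 𝕏 ^ 2 + 3200 * 𝕏 ^ 3 + 25650 * 𝕏 ^ 4) (154440 + 726700 * 𝕏 + 2636400 * 𝕏 ^ 2 + 6426225 * 𝕏 ^ 3) (by ring)
  have hT := (hU3.mul hI24).red (h := 1 - 12 * 𝕏 + 54 * 𝕏 ^ 2 - 52 * 𝕏 ^ 3 - 531 * 𝕏 ^ 4) (-32400 + 8464656 * 𝕏 - 32077800 * 𝕏 ^ 2 + 944407350 * 𝕏 ^ 3) (by ring)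
  have hA1 := (hk6.mul hT).red (h := 1 + 60 * 𝕏 + 1566 * 𝕏 ^ 2 + 22916 * 𝕏 ^ 3 + 199269 * 𝕏 ^ 4) (-5347944 + 31166136 * 𝕏 - 58881240 * 𝕏 ^ 2 - 343208664 * 𝕏 ^ 3) (by ring)
  have hl : Cg 5 (lgX eulerPS) (-𝕏 - 3 * 𝕏 ^ 2 - 4 * 𝕏 ^ 3 - 7 * 𝕏 ^ 4) := by
    refine hE.lgX constCoeff_eulerPS (11 + 7 * 𝕏) ?_
    simp only [dX_add, dX_sub, dX_ofNat_mul, dX_one, dX_X, dX_X_pow]; push_cast; ring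
  have hL : Cg 5 (1 + 24 * lgX eulerPS) (1 - 24 * 𝕏 - 72 * 𝕏 ^ 2 - 96 * 𝕏 ^ 3 - 168 * 𝕏 ^ 4) := by
    refine ((Cg.refl 1).add ((Cg.refl 24).mul hl)).congr' ?_; ring
  have hL2 := (hL.mul hL).red (h := 1 - 48 * 𝕏 + 432 * 𝕏 ^ 2 + 3264 * 𝕏 ^ 3 + 9456 * 𝕏 ^ 4) (21888 + 33408 * 𝕏 + 32256 * 𝕏 ^ 2 + 28224 * 𝕏 ^ 3) (by ring)
  have hw : Cg 5 wMX (1 + 240 * 𝕏 + 2160 * 𝕏 ^ 2 + 6720 * 𝕏 ^ 3 + 17520 * 𝕏 ^ 4) := by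
    refine ((hL2.congr (F' := (1 + 24 * lgX eulerPS) ^ 2) (by ring)).sub ((Cg.refl 12).mul hL.dX)).congr' ?_
    simp only [dX_add, dX_sub, dX_ofNat_mul, dX_one, dX_X, dX_X_pow]; push_cast; ring
  have hwk := (hw.mul hk4).red (h := 1 + 288 * 𝕏 + 14688 * 𝕏 ^ 2 + 364464 * 𝕏 ^ 3 + 5524704 * 𝕏 ^ 4) (56113920 + 299681280 * 𝕏 + 836271360 * 𝕏 ^ 2 + 1625575680 * 𝕏 ^ 3) (by ring)
  have hA2 := (hwk.mul hT).red (h := 1 + 276 * 𝕏 + 11286 * 𝕏 ^ 2 + 203708 * 𝕏 ^ 3 + 1928781 * 𝕏 ^ 4) (-47532096 + 271582560 * 𝕏 - 480814992 * 𝕏 ^ 2 - 2933617824 * 𝕏 ^ 3) (by ring)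
  have hV1 : Cg 5 (BM.hU 3 1 + 27 * 𝕏) (1 + 15 * 𝕏 + 54 * 𝕏 ^ 2 - 76 * 𝕏 ^ 3 - 243 * 𝕏 ^ 4) := by
    refine (hU.add (Cg.refl (27 * 𝕏))).congr' ?_; ring
  have hV2 : Cg 5 (BM.hU 3 1 + 243 * 𝕏) (1 + 231 * 𝕏 + 54 * 𝕏 ^ 2 - 76 * 𝕏 ^ 3 - 243 * 𝕏 ^ 4) := by
    refine (hU.add (Cg.refl (243 * 𝕏))).congr' ?_; ring
  have hV12 := (hV1.mul hV1).red (h := 1 + 30 * 𝕏 + 333 * 𝕏 ^ 2 + 1468 * 𝕏 ^ 3 + 150 * 𝕏 ^ 4) (-15498 - 20468 * 𝕏 + 36936 * 𝕏 ^ 2 + 59049 * 𝕏 ^ 3) (by ring)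
  have hV13 := (hV12.mul hV1).red (h := 1 + 45 * 𝕏 + 837 * 𝕏 ^ 2 + 8007 * 𝕏 ^ 3 + 37629 * 𝕏 ^ 4) (48924 - 184387 * 𝕏 - 368124 * 𝕏 ^ 2 - 36450 * 𝕏 ^ 3) (by ring)
  have hR1 := (hV13.mul hV1).red (h := 1 + 60 * 𝕏 + 1566 * 𝕏 ^ 2 + 22916 * 𝕏 ^ 3 + 199269 * 𝕏 ^ 4) (922266 + 1220043 * 𝕏 - 4805505 * 𝕏 ^ 2 - 9143847 * 𝕏 ^ 3) (by ring)
  have hR2 := (hV13.mul hV2).red (h := 1 + 276 * 𝕏 + 11286 * 𝕏 ^ 2 + 203708 * 𝕏 ^ 3 + 1928781 * 𝕏 ^ 4) (9050130 + 1220043 * 𝕏 - 4805505 * 𝕏 ^ 2 - 9143847 * 𝕏 ^ 3) (by ring)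
  exact ⟨(hA1.trans hR1.symm).congr2 (by ring) (by ring), (hA2.trans hR2.symm).congr2 (by ring) (by ring)⟩

end

end

section

open scoped Manifold UpperHalfPlane Topology
open UpperHalfPlane Filter Function.Periodic

variable {τ : ℍ} {A : M2} {N e : ℕ}

/-- The value of `-hv` at the elliptic point. -/
def kap (N e : ℕ) : ℕ := N ^ (3 * e)

lemma bdd_const (c : ℂ) : IsBoundedAtImInfty (fun _ : ℍ => c) := const_boundedAtFilter atImInfty c

lemma bdd_mul {f g : ℍ → ℂ} (hf : IsBoundedAtImInfty f) (hg : IsBoundedAtImInfty g) :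
    IsBoundedAtImInfty (fun τ => f τ * g τ) := hf.mul hg

lemma bdd_pow {f : ℍ → ℂ} (hf : IsBoundedAtImInfty f) (n : ℕ) :
    IsBoundedAtImInfty (fun τ => f τ ^ n) := by
  induction n with
  | zero => simpa using bdd_const 1
  | succ n ih => simpa only [pow_succ] using bdd_mul ih hf

lemma hv_add_hasPS (h : Lv N e) (c : ℤ) :
    HasPS 1 (fun τ => qParam 1 τ * (hv N e τ + c)) (hU N e + PowerSeries.C c * PowerSeries.X) :=
  ((hv_hasPS h).add ((HasPS.q (R := ℤ)).cmul c)).congr' fun τ => by simp; ring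

lemma hv_add_S_bounded (h : Lv N e) (c : ℂ) :
    IsBoundedAtImInfty (fun τ => hv N e (mob matS τ) + c) :=
  (hv_S_bounded h).add (bdd_const c)

lemma hv_add_mdiff (h : Lv N e) (c : ℂ) : MDiff (fun τ => hv N e τ + c) :=
  (hv_mdiff h.pos).add mdifferentiable_const

lemma kE_S_bounded (h : Lv N e) :
    IsBoundedAtImInfty (fun τ => kE N e (mob matS τ) / jf matS τ ^ 2) := by
  have hN' : (0 : ℝ) < N := by exact_mod_cast h.pos
  have h1 := ((kE_hasPS h).comp_tri h.pos).bounded hN'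
  refine (bdd_mul (bdd_const (-(N : ℂ)⁻¹)) h1).congr_left fun τ => ?_
  have hj := jf_ne_zero (A := matS) (by simp [det_matS]) (τ := τ)
  have hN0 : (N : ℂ) ≠ 0 := by exact_mod_cast h.pos.ne'
  simp only [Pi.mul_apply, kE_S h]
  field_simp

lemma ps_identities (h : Lv N e) :
    Cg (N + 2) (kEX N e ^ 6 * hU N e ^ N * eulerInv ^ 24)
      ((hU N e + PowerSeries.C (kap N e : ℤ) * PowerSeries.X) ^ (N + 1)) ∧
    Cg (N + 2) (wMX * kEX N e ^ 4 * hU N e ^ N * eulerInv ^ 24)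
      ((hU N e + PowerSeries.C (kap N e : ℤ) * PowerSeries.X) ^ N *
        (hU N e + PowerSeries.C (kap N e * N ^ 2 : ℤ) * PowerSeries.X)) := by
  rcases h with ⟨rfl, rfl⟩ | ⟨rfl, rfl⟩
  · simpa [kap] using ps_identities_two
  · simpa [kap] using ps_identities_three

lemma kE_pow_six (h : Lv N e) (τ : ℍ) :
    kE N e τ ^ 6 * hv N e τ ^ N = (hv N e τ + kap N e) ^ (N + 1) * dl τ := by
  refine sturm h (a := fun τ => kE N e τ ^ 6) (b := fun τ => (hv N e τ + kap N e) ^ (N + 1))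
    ((kE_mdiff h.pos).pow 6) ?_ ?_ ((hv_add_mdiff h _).pow _) ?_
    (bdd_pow (hv_add_S_bounded h _) _) ((kE_hasPS h).pow 6)
    (((hv_add_hasPS h (kap N e)).pow (N + 1)).congr' fun τ => by simp [mul_pow])
    (ps_identities h).1 τ
  · intro A hA hc τ
    rw [kE_gamma0 h hA hc]
    ring
  · refine (bdd_pow (kE_S_bounded h) 6).congr_left fun τ => ?_
    rw [div_pow, ← pow_mul]
  · intro A hA hc τ
    simp only [hv_gamma0 h hA hc]

lemma wM_mul_kE_pow_four (h : Lv N e) (τ : ℍ) :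
    wM τ * kE N e τ ^ 4 * hv N e τ ^ N =
      (hv N e τ + kap N e) ^ N * (hv N e τ + kap N e * N ^ 2) * dl τ := by
  refine sturm h (a := fun τ => wM τ * kE N e τ ^ 4)
    (b := fun τ => (hv N e τ + kap N e) ^ N * (hv N e τ + kap N e * N ^ 2))
    (wM_mdiff.mul ((kE_mdiff h.pos).pow 4)) ?_ ?_
    (((hv_add_mdiff h _).pow _).mul (hv_add_mdiff h _)) ?_
    (bdd_mul (bdd_pow (hv_add_S_bounded h _) _) (hv_add_S_bounded h _))
    (wM_hasPS.mul ((kE_hasPS h).pow 4))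
    ((((hv_add_hasPS h (kap N e)).pow N).mul (hv_add_hasPS h (kap N e * N ^ 2))).congr'
      fun τ => by simp [mul_pow]; ring)
    (ps_identities h).2 τ
  · intro A hA hc τ
    rw [kE_gamma0 h hA hc, wM_mob hA]
    ring
  · have hw : IsBoundedAtImInfty (fun τ => wM (mob matS τ) / jf matS τ ^ 4) := by
      refine (wM_hasPS.bounded one_pos).congr_left fun τ => ?_
      have hj := jf_ne_zero (A := matS) (by simp [det_matS]) (τ := τ)
      rw [wM_mob det_matS]
      field_simp
    refine (bdd_mul hw (bdd_pow (kE_S_bounded h) 4)).congr_left fun τ => ?_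
    have hj := jf_ne_zero (A := matS) (by simp [det_matS]) (τ := τ)
    field_simp
  · intro A hA hc τ
    simp only [hv_gamma0 h hA hc]

lemma algebraMap_int_injective : Function.Injective (algebraMap ℤ ℂ) :=
  (algebraMap ℤ ℂ).injective_int

lemma kEX_pow_six (h : Lv N e) :
    kEX N e ^ 6 * hU N e ^ N =
      (hU N e + PowerSeries.C (kap N e : ℤ) * PowerSeries.X) ^ (N + 1) * eulerPS ^ 24 := by
  refine HasPS.unique one_pos (((kE_hasPS h).pow 6).mul ((hv_hasPS h).pow N))
    ((((hv_add_hasPS h (kap N e)).pow (N + 1)).mul (euler_hasPS.pow 24)).congr' fun τ => ?_)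
    algebraMap_int_injective
  have := kE_pow_six h τ
  have h1 : qParam 1 τ ≠ 0 := Complex.exp_ne_zero _
  rw [dl_eq] at this
  rw [mul_pow, mul_pow, mul_left_comm, this]
  push_cast
  ring

lemma wMX_mul_kEX_pow_four (h : Lv N e) :
    wMX * kEX N e ^ 4 * hU N e ^ N =
      (hU N e + PowerSeries.C (kap N e : ℤ) * PowerSeries.X) ^ N *
        (hU N e + PowerSeries.C (kap N e * N ^ 2 : ℤ) * PowerSeries.X) * eulerPS ^ 24 := by
  refine HasPS.unique one_pos ((wM_hasPS.mul ((kE_hasPS h).pow 4)).mul ((hv_hasPS h).pow N))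
    (((((hv_add_hasPS h (kap N e)).pow N).mul (hv_add_hasPS h (kap N e * N ^ 2))).mul
      (euler_hasPS.pow 24)).congr' fun τ => ?_) algebraMap_int_injective
  have := wM_mul_kE_pow_four h τ
  have h1 : qParam 1 τ ≠ 0 := Complex.exp_ne_zero _
  rw [dl_eq] at this
  rw [mul_pow, mul_pow, mul_left_comm, this]
  push_cast
  ring

end

section

open scoped Manifold UpperHalfPlane Topology
open UpperHalfPlane Filter Function.Periodic

variable {τ : ℍ} {A : M2} {N e : ℕ}

section

variable {R : Type*} [CommRing R]

/-- The power series `X ^ n * P (U / X)`. -/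
def homPS (n : ℕ) (P : Polynomial R) (U : PowerSeries R) : PowerSeries R :=
  ∑ i ∈ Finset.range (n + 1), PowerSeries.C (P.coeff i) * U ^ i * PowerSeries.X ^ (n - i)

lemma homPS_map {S : Type*} [CommRing S] (φ : R →+* S) (n : ℕ) (P : Polynomial R)
    (U : PowerSeries R) :
    PowerSeries.map φ (homPS n P U) = homPS n (P.map φ) (PowerSeries.map φ U) := by
  simp [homPS, map_sum, Polynomial.coeff_map]

lemma homPS_eq {K : Type*} [Field K] (φ : PowerSeries R →+* K)
    (hX : φ PowerSeries.X ≠ 0) {n : ℕ} {P : Polynomial R} (hP : P.natDegree ≤ n)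
    (U : PowerSeries R) :
    φ (homPS n P U) =
      φ PowerSeries.X ^ n * P.eval₂ (φ.comp PowerSeries.C) (φ U / φ PowerSeries.X) := by
  rw [homPS, map_sum, Polynomial.eval₂_eq_sum_range' _ (Nat.lt_succ_of_le hP), Finset.mul_sum]
  refine Finset.sum_congr rfl fun i hi => ?_
  have hi' : i ≤ n := Nat.lt_succ_iff.mp (Finset.mem_range.mp hi)
  obtain ⟨j, rfl⟩ := Nat.exists_eq_add_of_le hi'
  simp only [map_mul, map_pow, Nat.add_sub_cancel_left, RingHom.comp_apply]
  rw [div_pow, pow_add]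
  field_simp

lemma homPS_hasPS [Algebra R ℂ] {v : ℍ → ℂ} {U : PowerSeries R}
    (hv : HasPS 1 (fun τ => qParam 1 τ * v τ) U) {n : ℕ} {P : Polynomial R} (hP : P.natDegree ≤ n) :
    HasPS 1 (fun τ => qParam 1 τ ^ n * Polynomial.aeval (v τ) P) (homPS n P U) := by
  refine (HasPS.sum (Finset.range (n + 1)) fun i _ =>
    (((HasPS.const (P.coeff i)).mul (hv.pow i)).mul (HasPS.qpow (n - i)))).congr' fun τ => ?_
  rw [Polynomial.aeval_eq_sum_range' (Nat.lt_succ_of_le hP), Finset.mul_sum]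
  refine Finset.sum_congr rfl fun i hi => ?_
  have hi' : i ≤ n := Nat.lt_succ_iff.mp (Finset.mem_range.mp hi)
  obtain ⟨j, rfl⟩ := Nat.exists_eq_add_of_le hi'
  rw [Nat.add_sub_cancel_left, Algebra.smul_def]
  ring

lemma eval_div_X_injective {k K : Type*} [Field k] [Field K] (φ : PowerSeries k →+* K)
    (hφ : Function.Injective φ) {U : PowerSeries k} (hU : PowerSeries.constantCoeff U = 1)
    {P : Polynomial k}
    (h : P.eval₂ (φ.comp PowerSeries.C) (φ U / φ PowerSeries.X) = 0) : P = 0 := by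
  have hX : φ PowerSeries.X ≠ 0 := by
    rw [Ne, map_eq_zero_iff φ hφ]; exact PowerSeries.X_ne_zero
  have h1 := homPS_eq φ hX le_rfl U (P := P)
  rw [h, mul_zero, map_eq_zero_iff φ hφ] at h1
  have h2 := congrArg PowerSeries.constantCoeff h1
  rw [homPS, Finset.sum_range_succ] at h2
  simp only [map_add, map_sum, map_mul, map_pow, PowerSeries.constantCoeff_C, hU,
    PowerSeries.constantCoeff_X, one_pow, mul_one, Nat.sub_self, pow_zero, map_zero] at h2
  rw [Finset.sum_eq_zero, zero_add] at h2
  · exact Polynomial.leadingCoeff_eq_zero.mp h2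
  · intro i hi
    have := Finset.mem_range.mp hi
    rw [zero_pow (by omega), mul_zero]

/-- A weakly holomorphic function of level `N` with only a pole at infinity is a polynomial
in the Hauptmodul. -/
lemma exists_polynomial (h : Lv N e) [Algebra R ℂ] (n : ℕ) {f : ℍ → ℂ} {G : PowerSeries R}
    (hf : MDiff f) (hi : Inv0 N f) (hS : IsBoundedAtImInfty (fun τ => f (mob matS τ)))
    (hG : HasPS 1 (fun τ => qParam 1 τ ^ n * f τ) G) :
    ∃ P : Polynomial R, P.natDegree ≤ n ∧ P.coeff n = PowerSeries.constantCoeff G ∧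
      ∀ τ, f τ = Polynomial.aeval (hv N e τ) P := by
  induction n generalizing f G with
  | zero =>
    have hG' : HasPS 1 f G := hG.congr' fun τ => by simp
    refine ⟨Polynomial.C (PowerSeries.constantCoeff G), by simp, by simp, fun τ => ?_⟩
    have hN' : N.Prime := by rcases h with ⟨rfl, _⟩ | ⟨rfl, _⟩ <;> norm_num
    have hc := const_of_bounded_prime hN' hf hi (hG'.bounded one_pos) hS
    have t1 := hG'.tendsto one_pos
    have e1 : f = fun _ => f τ := funext fun σ => hc σ τ
    rw [e1] at t1
    simpa using tendsto_nhds_unique tendsto_const_nhds t1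
  | succ n ih =>
    set c := PowerSeries.constantCoeff G with hc
    have hu := (hv_hasPS h).ofInt R
    have h1 := hG.sub ((hu.pow (n + 1)).cmul c)
    have h2 : PowerSeries.X ∣ G - PowerSeries.C c *
        PowerSeries.map (Int.castRingHom R) (hU N e) ^ (n + 1) := by
      rw [PowerSeries.X_dvd_iff]
      have : PowerSeries.constantCoeff (PowerSeries.map (Int.castRingHom R) (hU N e)) = 1 := by
        rw [← PowerSeries.coeff_zero_eq_constantCoeff_apply, PowerSeries.coeff_map,
          PowerSeries.coeff_zero_eq_constantCoeff_apply, constCoeff_hU, map_one]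
      simp [this, hc]
    obtain ⟨G', hG'⟩ := h2
    rw [hG'] at h1
    have h3 : HasPS 1 (fun τ => qParam 1 τ ^ n * (f τ - algebraMap R ℂ c * hv N e τ ^ (n + 1))) G' := by
      refine HasPS.of_q_mul (h1.congr' fun τ => ?_)
      ring
    have hm : MDiff (fun τ => f τ - algebraMap R ℂ c * hv N e τ ^ (n + 1)) :=
      hf.sub (mdifferentiable_const.mul ((hv_mdiff h.pos).pow _))
    have hS' : IsBoundedAtImInfty
        (fun τ => f (mob matS τ) - algebraMap R ℂ c * hv N e (mob matS τ) ^ (n + 1)) :=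
      hS.sub (bdd_mul (bdd_const _) (bdd_pow (hv_S_bounded h) _))
    obtain ⟨P, hP1, -, hP3⟩ := ih hm
      (fun A hA hc τ => by simp only [hv_gamma0 h hA hc, hi A hA hc]) hS' h3
    refine ⟨P + Polynomial.C c * Polynomial.X ^ (n + 1), ?_, ?_, fun τ => ?_⟩
    · exact Polynomial.natDegree_add_le_of_degree_le (by omega)
        (Polynomial.natDegree_C_mul_X_pow_le _ _)
    · simp [Polynomial.coeff_eq_zero_of_natDegree_lt (Nat.lt_succ_of_le hP1)]
    · have := hP3 τ
      simp only [map_add, map_mul, map_pow, Polynomial.aeval_C, Polynomial.aeval_X, ← this]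
      ring

end

lemma exists_hv_eq (h : Lv N e) {c : ℂ} (hc : c ≠ 0) : ∃ τ, hv N e τ = c := by
  by_contra! hne
  have h0 : ∀ τ, hv N e τ - c ≠ 0 := fun τ => sub_ne_zero.mpr (hne τ)
  have hm : MDiff (fun τ => (hv N e τ - c)⁻¹) :=
    mdiff_inv ((hv_mdiff h.pos).sub mdifferentiable_const) h0
  have hN' : (0 : ℝ) < N := by exact_mod_cast h.pos
  have h1 : HasPS 1 (fun τ => qParam 1 τ * (hv N e τ - c))
      (PowerSeries.map (Int.castRingHom ℂ) (hU N e) - PowerSeries.C c * PowerSeries.X) :=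
    (((hv_hasPS h).ofInt ℂ).sub ((HasPS.q (R := ℂ)).cmul c)).congr' fun τ => by simp; ring
  have e1 : PowerSeries.constantCoeff (PowerSeries.map (Int.castRingHom ℂ) (hU N e) -
      PowerSeries.C c * PowerSeries.X) = ((1 : ℂˣ) : ℂ) := by
    rw [map_sub, ← PowerSeries.coeff_zero_eq_constantCoeff_apply, PowerSeries.coeff_map,
      PowerSeries.coeff_zero_eq_constantCoeff_apply, constCoeff_hU]
    simp
  have h2 := (HasPS.q (R := ℂ)).mul (h1.inv one_pos
    (fun τ => mul_ne_zero (Complex.exp_ne_zero _) (h0 τ)) (PowerSeries.mul_invOfUnit _ 1 e1))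
  have h3 := h2.congr' (g := fun τ => (hv N e τ - c)⁻¹) fun τ => by
    have : qParam 1 τ ≠ 0 := Complex.exp_ne_zero _
    have := h0 τ
    field_simp
  have h4 : HasPS N (fun τ => hv N e (mob matS τ) - c)
      (PowerSeries.X * PowerSeries.map (Int.castRingHom ℂ) (PowerSeries.invOfUnit (hU N e) 1 *
        PowerSeries.C ((N : ℤ) ^ (6 * e))) - PowerSeries.C c) := by
    refine (((HasPS.q (R := ℂ)).mul (((hU_inv h).mul
      (HasPS.const ((N : ℤ) ^ (6 * e)))).ofInt ℂ)).sub (HasPS.const c)).congr' fun τ => ?_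
    have h3 : qParam N τ ≠ 0 := Complex.exp_ne_zero _
    have h4 := hv_ne_zero (N := N) (e := e) (mob (tri 1 0 N) τ)
    rw [hv_S h]
    simp only [map_pow, map_natCast, Algebra.algebraMap_self, RingHom.id_apply]
    field_simp
  have e2 : PowerSeries.constantCoeff
      (PowerSeries.X * PowerSeries.map (Int.castRingHom ℂ) (PowerSeries.invOfUnit (hU N e) 1 *
        PowerSeries.C ((N : ℤ) ^ (6 * e))) - PowerSeries.C c) =
      ((Units.mk0 (-c) (neg_ne_zero.mpr hc) : ℂˣ) : ℂ) := by simp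
  have h5 := h4.inv hN' (fun τ => h0 _) (PowerSeries.mul_invOfUnit _ _ e2)
  have hN'' : N.Prime := by rcases h with ⟨rfl, _⟩ | ⟨rfl, _⟩ <;> norm_num
  have hcst := const_of_bounded_prime hN'' hm
    (fun A hA hc τ => by simp only [hv_gamma0 h hA hc]) (h3.bounded one_pos) (h5.bounded hN')
  have t1 := h3.tendsto one_pos
  have e3 : (fun τ => (hv N e τ - c)⁻¹) = fun _ => (hv N e I - c)⁻¹ := funext fun σ => hcst σ I
  rw [e3] at t1
  have := tendsto_nhds_unique tendsto_const_nhds t1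
  simp [h0] at this

end

section

open scoped Manifold UpperHalfPlane Topology
open UpperHalfPlane Filter Function.Periodic

variable {τ : ℍ} {A B : M2} {N e : ℕ}

/-- Membership in the congruence subgroup of level `N`. -/
def G0 (N : ℕ) (A : M2) : Prop := A.det = 1 ∧ (N : ℤ) ∣ A 1 0

namespace G0

lemma det_pos (hA : G0 N A) : 0 < A.det := by simp [hA.1]

lemma one : G0 N 1 := by simp [G0]

lemma mul (hA : G0 N A) (hB : G0 N B) : G0 N (A * B) := by
  refine ⟨by simp [hA.1, hB.1], ?_⟩
  rw [Matrix.mul_apply, Fin.sum_univ_two]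
  exact dvd_add (hA.2.mul_right _) (hB.2.mul_left _)

lemma inv (hA : G0 N A) : G0 N A.adjugate := by
  refine ⟨by simp [Matrix.det_adjugate, hA.1], ?_⟩
  rw [Matrix.adjugate_fin_two]
  simpa using hA.2

lemma T (b : ℤ) : G0 N (matT b) := ⟨det_matT b, by simp [matT, tri]⟩

lemma adjugate_mul (hA : G0 N A) : A.adjugate * A = 1 := by
  rw [Matrix.adjugate_mul, hA.1, one_smul]

lemma mul_adjugate (hA : G0 N A) : A * A.adjugate = 1 := by
  rw [Matrix.mul_adjugate, hA.1, one_smul]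

end G0

lemma Inv0.apply {f : ℍ → ℂ} (hf : Inv0 N f) (hA : G0 N A) (τ : ℍ) : f (mob A τ) = f τ :=
  hf A hA.1 hA.2 τ

lemma hv_G0 (h : Lv N e) : Inv0 N (hv N e) := fun _ hA hc τ => hv_gamma0 h hA hc τ

section Hecke

variable {p : ℕ} [Fact p.Prime]

/-- Representatives of the Hecke correspondence of degree `p`. -/
def al (p : ℕ) : Option (ZMod p) → M2
  | none => tri p 0 1
  | some b => tri 1 b.val p

lemma det_al (i : Option (ZMod p)) : (al p i).det = p := by
  cases i <;> simp [al, det_tri]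

lemma det_al_pos (i : Option (ZMod p)) : 0 < (al p i).det := by
  rw [det_al]; exact_mod_cast (Fact.out : p.Prime).pos

lemma al_one_zero (i : Option (ZMod p)) : al p i 1 0 = 0 := by
  cases i <;> simp [al, tri]

lemma exists_eq_mul_al (hpN : ¬ p ∣ N) (hdet : A.det = p) (hc : (N : ℤ) ∣ A 1 0) :
    ∃ i G, G0 N G ∧ A = G * al p i := by
  have hp := (Fact.out : p.Prime)
  have hp0 : (p : ℤ) ≠ 0 := by exact_mod_cast hp.ne_zero
  have hpN' : IsCoprime (N : ℤ) p := by
    rw [Nat.isCoprime_iff_coprime]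
    exact ((Nat.Prime.coprime_iff_not_dvd hp).mpr hpN).symm
  rw [Matrix.det_fin_two] at hdet
  have key : ∀ b : ℤ, (p : ℤ) ∣ A 0 1 - A 0 0 * b → (p : ℤ) ∣ A 1 1 - A 1 0 * b →
      ∃ G, G0 N G ∧ A = G * tri 1 b p := by
    rintro b ⟨x, hx⟩ ⟨y, hy⟩
    refine ⟨!![A 0 0, x; A 1 0, y], ⟨?_, by simpa using hc⟩, ?_⟩
    · rw [Matrix.det_fin_two]
      refine mul_left_cancel₀ hp0 ?_
      simp only [Matrix.of_apply, Matrix.cons_val', Matrix.cons_val_zero, Matrix.cons_val_one,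
        Matrix.cons_val_fin_one]
      linear_combination hdet - (A 0 0) * hy + A 1 0 * hx
    · ext i j
      fin_cases i <;> fin_cases j <;> simp [tri, Matrix.mul_apply]
      · linear_combination hx
      · linear_combination hy
  have zm : ∀ a : ℤ, ((p : ℤ) ∣ a ↔ (a : ZMod p) = 0) := fun a =>
    (ZMod.intCast_zmod_eq_zero_iff_dvd a p).symm
  have hdz : (A 0 0 : ZMod p) * A 1 1 - A 0 1 * A 1 0 = 0 := by
    have := congrArg (Int.cast : ℤ → ZMod p) hdet
    push_cast at this
    simpa using this
  by_cases h0 : (A 0 0 : ZMod p) = 0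
  · by_cases h1 : (A 1 0 : ZMod p) = 0
    · refine ⟨none, ?_⟩
      obtain ⟨x, hx⟩ := (zm _).2 h0
      obtain ⟨y, hy⟩ := (zm _).2 h1
      refine ⟨!![x, A 0 1; y, A 1 1], ⟨?_, ?_⟩, ?_⟩
      · rw [Matrix.det_fin_two]
        refine mul_left_cancel₀ hp0 ?_
        simp only [Matrix.of_apply, Matrix.cons_val', Matrix.cons_val_zero, Matrix.cons_val_one,
          Matrix.cons_val_fin_one]
        linear_combination hdet - (A 1 1) * hx + A 0 1 * hy
      · rw [hy] at hc
        simpa using hpN'.dvd_of_dvd_mul_left hc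
      · ext i j
        fin_cases i <;> fin_cases j <;> simp [al, tri, Matrix.mul_apply]
        · linear_combination hx
        · linear_combination hy
    · refine ⟨some ((A 1 1 : ZMod p) / A 1 0), key _ ?_ ?_⟩
      · rw [zm]; push_cast
        rw [ZMod.natCast_zmod_val]
        field_simp
        rw [h0]; ring_nf
        rw [h0] at hdz
        linear_combination -hdz
      · rw [zm]; push_cast
        rw [ZMod.natCast_zmod_val]
        field_simp
        ring
  · refine ⟨some ((A 0 1 : ZMod p) / A 0 0), key _ ?_ ?_⟩
    · rw [zm]; push_cast
      rw [ZMod.natCast_zmod_val]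
      field_simp
      ring
    · rw [zm]; push_cast
      rw [ZMod.natCast_zmod_val]
      field_simp
      linear_combination hdz

lemma al_injective {i j : Option (ZMod p)} {G : M2} (h : al p i = G * al p j) :
    i = j := by
  have hp := (Fact.out : p.Prime)
  have hp0 : (p : ℤ) ≠ 0 := by exact_mod_cast hp.ne_zero
  have h00 := congrFun (congrFun h 0) 0
  have h01 := congrFun (congrFun h 0) 1
  have h10 := congrFun (congrFun h 1) 0
  have h11 := congrFun (congrFun h 1) 1
  have hu : ¬ IsUnit (p : ℤ) := (Nat.prime_iff_prime_int.mp hp).not_isUnit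
  cases i with
  | none =>
    cases j with
    | none => rfl
    | some b =>
      simp [al, tri, Matrix.mul_apply] at h00 h01 h10 h11
      rw [← h10] at h11
      exact (hu (IsUnit.of_mul_eq_one (G 1 1) (by linear_combination -h11))).elim
  | some a =>
    cases j with
    | none =>
      simp [al, tri, Matrix.mul_apply] at h00 h01 h10 h11
      exact (hu (IsUnit.of_mul_eq_one (G 0 0) (by linear_combination -h00))).elim
    | some b =>
      simp [al, tri, Matrix.mul_apply, -ZMod.natCast_val] at h00 h01 h10 h11
      rw [← h00] at h01
      have := congrArg (Int.cast : ℤ → ZMod p) h01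
      push_cast at this
      simpa using this

lemma exists_perm (hpN : ¬ p ∣ N) (hA : G0 N A) :
    ∃ π : Equiv.Perm (Option (ZMod p)), ∀ i, ∃ G, G0 N G ∧ al p i * A = G * al p (π i) := by
  have h1 : ∀ i, ∃ j G, G0 N G ∧ al p i * A = G * al p j := fun i => by
    refine exists_eq_mul_al hpN (by rw [Matrix.det_mul, det_al, hA.1, mul_one]) ?_
    rw [Matrix.mul_apply, Fin.sum_univ_two, al_one_zero]
    simpa using hA.2.mul_left _
  choose π hπ using h1
  have hinj : Function.Injective π := by
    intro i j hij
    obtain ⟨G, hG, e1⟩ := hπ i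
    obtain ⟨G', hG', e2⟩ := hπ j
    refine al_injective (G := G * G'.adjugate) ?_
    have e3 : al p (π j) = G'.adjugate * (al p j * A) := by
      rw [e2, ← mul_assoc, hG'.adjugate_mul, one_mul]
    have e4 : al p i * A = G * G'.adjugate * al p j * A := by
      rw [e1, hij, e3]; simp only [mul_assoc]
    calc al p i = al p i * A * A.adjugate := by rw [mul_assoc, hA.mul_adjugate, mul_one]
      _ = _ := by rw [e4, mul_assoc _ A, hA.mul_adjugate, mul_one]
  exact ⟨Equiv.ofBijective π (Finite.injective_iff_bijective.mp hinj), hπ⟩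

lemma exists_mul_S_eq (hpN : ¬ p ∣ N) (i : Option (ZMod p)) :
    ∃ G a b d, G0 N G ∧ 0 < a ∧ 0 < d ∧ al p i * matS = G * (matS * tri a b d) := by
  have hp := (Fact.out : p.Prime)
  have hp0 : (0 : ℤ) < p := by exact_mod_cast hp.pos
  cases i with
  | none =>
    refine ⟨1, 1, 0, p, G0.one, one_pos, hp0, ?_⟩
    ext i j
    fin_cases i <;> fin_cases j <;> simp [al, tri, matS, Matrix.mul_apply]
  | some b =>
    by_cases hb : b = 0
    · refine ⟨1, p, 0, 1, G0.one, hp0, one_pos, ?_⟩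
      ext i j
      fin_cases i <;> fin_cases j <;> simp [al, tri, matS, Matrix.mul_apply, hb]
    · have hco : IsCoprime ((b.val : ℤ) * N) p := by
        refine IsCoprime.mul_left ?_ ?_ <;> rw [Nat.isCoprime_iff_coprime, Nat.coprime_comm]
        · rw [Nat.Prime.coprime_iff_not_dvd hp]
          intro hd
          rw [← ZMod.natCast_eq_zero_iff, ZMod.natCast_zmod_val] at hd
          exact hb hd
        · exact (Nat.Prime.coprime_iff_not_dvd hp).mpr hpN
      obtain ⟨x, y, hxy⟩ := hco
      simp only [al]
      generalize (b.val : ℤ) = m at hxy ⊢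
      refine ⟨!![y, m; - (x * N), p], 1, - (x * N), p, ⟨?_, ?_⟩, one_pos, hp0, ?_⟩
      · simp [Matrix.det_fin_two]; linear_combination hxy
      · simp
      · ext i j
        fin_cases i <;> fin_cases j <;> simp [tri, matS, Matrix.mul_apply]
        · linear_combination hxy
        · ring

lemma prod_comp_al {f : ℍ → ℂ} (hf : Inv0 N f) (hpN : ¬ p ∣ N) (g : ℂ → ℂ) :
    Inv0 N (fun τ => ∏ i, g (f (mob (al p i) τ))) := by
  intro A hA hc τ
  have hA' : G0 N A := ⟨hA, hc⟩
  obtain ⟨π, hπ⟩ := exists_perm hpN hA'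
  change ∏ i, g (f (mob (al p i) (mob A τ))) = ∏ i, g (f (mob (al p i) τ))
  rw [← Equiv.prod_comp π (fun i => g (f (mob (al p i) τ)))]
  refine Finset.prod_congr rfl fun i _ => ?_
  obtain ⟨G, hG, e1⟩ := hπ i
  rw [← mob_mul (det_al_pos i) hA'.det_pos, e1, mob_mul hG.det_pos (det_al_pos _), hf.apply hG]

end Hecke

lemma bdd_comp_tri {f : ℍ → ℂ} (hf : IsBoundedAtImInfty f) {a b d : ℤ} (ha : 0 < a) (hd : 0 < d) :
    IsBoundedAtImInfty (fun τ => f (mob (tri a b d) τ)) := by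
  rw [isBoundedAtImInfty_iff] at hf ⊢
  obtain ⟨M, B, h⟩ := hf
  refine ⟨M, d / a * B, fun z hz => h _ ?_⟩
  have ha' : (0 : ℝ) < a := by exact_mod_cast ha
  have hd' : (0 : ℝ) < d := by exact_mod_cast hd
  have : jf (tri a b d) z = ((d : ℝ) : ℂ) := by simp [jf, tri]
  rw [im_mob (by rw [det_tri]; positivity), this, Complex.normSq_ofReal, det_tri]
  push_cast
  rw [div_mul_eq_mul_div, div_le_iff₀ ha'] at hz
  rw [le_div_iff₀ (by positivity)]
  nlinarith

lemma hv_al_S_bounded (h : Lv N e) {p : ℕ} [Fact p.Prime] (hpN : ¬ p ∣ N) (i : Option (ZMod p)) :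
    IsBoundedAtImInfty (fun τ => hv N e (mob (al p i) (mob matS τ))) := by
  obtain ⟨G, a, b, d, hG, ha, hd, e1⟩ := exists_mul_S_eq hpN i
  refine (bdd_comp_tri (b := b) (hv_S_bounded h) ha hd).congr_left fun τ => ?_
  have hS : 0 < matS.det := by simp [det_matS]
  have ht : 0 < (tri a b d).det := by rw [det_tri]; positivity
  rw [← mob_mul (det_al_pos i) hS, e1, mob_mul hG.det_pos (by rw [Matrix.det_mul]; positivity),
    (hv_G0 h).apply hG, mob_mul hS ht]

end

section

open scoped Manifold UpperHalfPlane Topology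
open UpperHalfPlane Filter Function.Periodic

variable {τ : ℍ} {A B : M2} {N e : ℕ}

section PowerSeries

variable {R : Type*} [CommRing R] [Algebra R ℂ] {f : ℍ → ℂ} {F : PowerSeries R} {h : ℝ}

lemma HasPS.exists_bound (hf : HasPS h f F) (hh : 0 < h) {r : ℝ} (hr : 0 < r) :
    ∃ M, ∀ τ : ℍ, r ≤ τ.im → ‖f τ‖ ≤ M := by
  set ρ := Real.exp (-2 * Real.pi * r / h) with hρ
  have hρ1 : ρ < 1 := by
    rw [hρ, Real.exp_lt_one_iff]
    have := Real.pi_pos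
    rw [div_neg_iff]
    right
    exact ⟨by nlinarith [mul_pos this hr], hh⟩
  have hc : ContinuousOn (psSum F) (Metric.closedBall 0 ρ) := fun z hz =>
    (hf.differentiableAt_psSum hh
      ((by simpa using hz : ‖z‖ ≤ ρ).trans_lt hρ1)).continuousAt.continuousWithinAt
  obtain ⟨M, hM⟩ := (isCompact_closedBall (0 : ℂ) ρ).exists_bound_of_continuousOn hc
  refine ⟨M, fun τ hτ => ?_⟩
  rw [← hf.psSum_qParam τ]
  refine hM _ ?_
  rw [mem_closedBall_zero_iff, norm_qParam, hρ, Real.exp_le_exp]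
  have := Real.pi_pos
  have h2 : (τ : ℂ).im = τ.im := rfl
  rw [h2]
  gcongr ?_ / h
  nlinarith

lemma HasPS.exists_injOn (hf : HasPS h f F) (hh : 0 < h) (hF : algebraMap R ℂ (F.coeff 1) ≠ 0) :
    ∃ ε > 0, ∀ z w : ℂ, ‖z‖ < ε → ‖w‖ < ε → psSum F z = psSum F w → z = w := by
  have h1 := (hf.hasFPowerSeriesOnBall_psSum hh).hasFPowerSeriesAt.hasStrictDerivAt
  have h2 := h1.isLittleO
  have h3 := h2.def (c := ‖algebraMap R ℂ (F.coeff 1)‖ / 2) (by positivity)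
  rw [Metric.eventually_nhds_iff] at h3
  obtain ⟨ε, hε, h4⟩ := h3
  refine ⟨ε, hε, fun z w hz hw e => ?_⟩
  have h5 := @h4 (z, w) (by
    rw [Prod.dist_eq]; simp [hz, hw])
  have h6 : (FormalMultilinearSeries.ofScalars ℂ fun n => algebraMap R ℂ (F.coeff n)).coeff 1
      = algebraMap R ℂ (F.coeff 1) := by simp
  simp only [e, sub_self, zero_sub, norm_neg] at h5
  by_contra hne
  have h7 : 0 < ‖z - w‖ := norm_pos_iff.2 (sub_ne_zero.2 hne)
  have h8 : 0 < ‖algebraMap R ℂ (F.coeff 1)‖ := norm_pos_iff.2 hF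
  simp at h5
  nlinarith [mul_pos h7 h8]

end PowerSeries

lemma exists_polynomial_complex (h : Lv N e) (n : ℕ) {f : ℍ → ℂ} (hf : MDiff f) (hi : Inv0 N f)
    (hS : IsBoundedAtImInfty (fun τ => f (mob matS τ)))
    (hb : IsBoundedAtImInfty (fun τ => qParam 1 τ ^ n * f τ)) :
    ∃ P : Polynomial ℂ, ∀ τ, f τ = P.eval (hv N e τ) := by
  have hq : HasPS (R := ℂ) 1 (fun τ => qParam 1 τ ^ n) (PowerSeries.X ^ n) := HasPS.qpow n
  have hper : ∀ τ : ℍ, f ((1 : ℝ) +ᵥ τ) = f τ := fun τ => by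
    have := hi.apply (G0.T 1) τ
    rw [mob_T] at this
    simpa using this
  obtain ⟨G, hG⟩ := exists_hasPS (f := fun τ => qParam 1 τ ^ n * f τ) one_pos
    (fun τ => by rw [hq.vadd one_ne_zero, hper]) (by
      have h1 := hq.mdiff one_pos
      rw [UpperHalfPlane.mdifferentiable_iff] at h1 hf ⊢
      exact h1.mul hf) hb
  obtain ⟨P, -, -, hP⟩ := exists_polynomial h n hf hi hS hG
  exact ⟨P, fun τ => by rw [hP, Polynomial.coe_aeval_eq_eval]⟩

lemma bdd_prod {ι : Type*} {s : Finset ι} {f : ι → ℍ → ℂ}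
    (hf : ∀ i ∈ s, IsBoundedAtImInfty (f i)) : IsBoundedAtImInfty (fun τ => ∏ i ∈ s, f i τ) := by
  classical
  induction s using Finset.induction_on with
  | empty => simpa using bdd_const 1
  | insert a s ha ih =>
    simp only [Finset.prod_insert ha]
    exact bdd_mul (hf a (by simp)) (ih fun i hi => hf i (by simp [hi]))

lemma one_le_normSq_jf {p : ℕ} [Fact p.Prime] (i : Option (ZMod p)) :
    1 ≤ Complex.normSq (jf (al p i) τ) := by
  cases i with
  | none => simp [jf, al, tri]
  | some b =>
    have : (1 : ℝ) ≤ p := by exact_mod_cast (Fact.out : p.Prime).one_lt.le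
    have h1 : jf (al p (some b)) τ = ((p : ℝ) : ℂ) := by simp [jf, al, tri]
    rw [h1, Complex.normSq_ofReal]
    nlinarith

lemma norm_qParam_pow_le {p : ℕ} [Fact p.Prime] (i : Option (ZMod p)) :
    ‖qParam 1 τ ^ p‖ ≤ ‖qParam 1 (mob (al p i) τ)‖ := by
  rw [norm_pow, norm_qParam, norm_qParam, ← Real.exp_nat_mul, Real.exp_le_exp]
  change _ ≤ -2 * Real.pi * (mob (al p i) τ).im / 1
  have h2 : (τ : ℂ).im = τ.im := rfl
  rw [im_mob (det_al_pos i), det_al, h2]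
  have h1 := one_le_normSq_jf (τ := τ) i
  have : ((p : ℤ) : ℝ) * τ.im / Complex.normSq (jf (al p i) τ) ≤ p * τ.im := by
    push_cast
    exact div_le_self (by have := τ.im_pos; positivity) h1
  have h3 := Real.pi_pos
  nlinarith

lemma bdd_qpow_mul_hv_al (h : Lv N e) {p : ℕ} [Fact p.Prime] (i : Option (ZMod p)) :
    IsBoundedAtImInfty (fun τ => qParam 1 τ ^ p * hv N e (mob (al p i) τ)) := by
  have hp := (Fact.out : p.Prime).pos
  have h1 : IsBoundedAtImInfty
      (fun τ => qParam 1 (mob (al p i) τ) * hv N e (mob (al p i) τ)) := by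
    have := (hv_hasPS h).bounded one_pos
    cases i with
    | none => exact bdd_comp_tri this (by exact_mod_cast hp) one_pos
    | some b => exact bdd_comp_tri this one_pos (by exact_mod_cast hp)
  rw [isBoundedAtImInfty_iff] at h1 ⊢
  obtain ⟨M, B, h2⟩ := h1
  refine ⟨M, B, fun τ hτ => le_trans ?_ (h2 τ hτ)⟩
  rw [norm_mul, norm_mul]
  gcongr
  exact norm_qParam_pow_le i

lemma hv_inv_hasPS (h : Lv N e) :
    HasPS 1 (fun τ => (hv N e τ)⁻¹) (PowerSeries.X * PowerSeries.invOfUnit (hU N e) 1) := by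
  refine ((HasPS.q (R := ℤ) (h := 1)).mul ((hv_hasPS h).inv one_pos
    (fun τ => mul_ne_zero (Complex.exp_ne_zero _) (hv_ne_zero _))
    (PowerSeries.mul_invOfUnit _ 1 (by simp [constCoeff_hU])))).congr' fun τ => ?_
  have := qParam_ne_zero (h := 1) τ
  field_simp

lemma exists_im_ge (hN : N.Prime) (τ : ℍ) : ∃ σ : ℍ, 1 / 2 ≤ σ.im ∧
    ∃ G, G0 N G ∧ (τ = mob G σ ∨ τ = mob G (mob matS σ)) := by
  obtain ⟨γ, hγ⟩ := ModularGroup.exists_one_half_le_im_smul τ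
  set A : M2 := (γ⁻¹).1 with hA
  have hdet : A.det = 1 := (γ⁻¹).2
  have hτ : τ = mob A (γ • τ) := by rw [hA, mob_SL, inv_smul_smul]
  by_cases hc : (N : ℤ) ∣ A 1 0
  · exact ⟨γ • τ, hγ, A, ⟨hdet, hc⟩, .inl hτ⟩
  · obtain ⟨G, b, hG, hc', e1⟩ := sl_decomp hN hdet hc
    refine ⟨mob (matT b) (γ • τ), ?_, G, ⟨hG, hc'⟩, .inr ?_⟩
    · rw [mob_T]; simpa using hγ
    · rw [e1, mul_assoc, mob_mul (by simp [hG]) (by simp [det_matS, det_matT]),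
        mob_mul (by simp [det_matS]) (by simp [det_matT])] at hτ
      exact hτ

lemma Lv.prime (h : Lv N e) : N.Prime := by
  rcases h with ⟨rfl, -⟩ | ⟨rfl, -⟩ <;> norm_num

lemma exists_equiv_of_large (h : Lv N e) : ∃ K : ℝ, ∀ τ₁ τ₂ : ℍ, K < ‖hv N e τ₁‖ →
    hv N e τ₁ = hv N e τ₂ → ∃ G, G0 N G ∧ mob G τ₁ = τ₂ := by
  have hN' : (0 : ℝ) < N := by exact_mod_cast h.pos
  obtain ⟨ε, hε, hinj⟩ := (hv_inv_hasPS h).exists_injOn one_pos (by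
    rw [show (1 : ℕ) = 0 + 1 from rfl, PowerSeries.coeff_succ_X_mul]; simp)
  obtain ⟨M₁, hM₁⟩ := (hv_hasPS h).exists_bound one_pos (r := 1 / 2) (by norm_num)
  obtain ⟨M₂, hM₂⟩ := ((hv_inv_hasPS h).comp_tri h.pos).exists_bound hN' (r := 1 / 2) (by norm_num)
  have hM₁0 : 0 ≤ M₁ := (norm_nonneg _).trans (hM₁ (UpperHalfPlane.I) (by norm_num))
  have key : ∀ τ, max ((N : ℝ) ^ (6 * e) * M₂) (M₁ / ε) < ‖hv N e τ‖ →
      ∃ σ G, G0 N G ∧ τ = mob G σ ∧ ‖qParam 1 σ‖ < ε ∧ hv N e τ = hv N e σ := by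
    intro τ hτ
    obtain ⟨σ, hσ, G, hG, rfl | rfl⟩ := exists_im_ge h.prime τ
    · have e1 : hv N e (mob G σ) = hv N e σ := (hv_G0 h).apply hG σ
      refine ⟨σ, G, hG, rfl, ?_, e1⟩
      have h1 := hM₁ σ hσ
      have h2 := (le_max_right _ _).trans_lt hτ
      rw [e1, div_lt_iff₀ hε] at h2
      rw [norm_mul] at h1
      have h3 : 0 < ‖hv N e σ‖ := norm_pos_iff.2 (hv_ne_zero _)
      refine lt_of_mul_lt_mul_right (h1.trans_lt (h2.trans_eq (mul_comm _ _))) h3.le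
    · exfalso
      have h2 := (le_max_left _ _).trans_lt hτ
      rw [(hv_G0 h).apply hG, hv_S h, div_eq_mul_inv, norm_mul, norm_pow, Complex.norm_natCast] at h2
      have h1 := hM₂ σ hσ
      have : (N : ℝ) ^ (6 * e) * ‖(hv N e (mob (tri 1 0 N) σ))⁻¹‖ ≤ (N : ℝ) ^ (6 * e) * M₂ := by
        gcongr
      linarith
  refine ⟨max ((N : ℝ) ^ (6 * e) * M₂) (M₁ / ε), fun τ₁ τ₂ h1 h2 => ?_⟩
  obtain ⟨σ₁, G₁, hG₁, rfl, hs₁, e₁⟩ := key τ₁ h1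
  obtain ⟨σ₂, G₂, hG₂, rfl, hs₂, e₂⟩ := key τ₂ (h2 ▸ h1)
  have h3 := hinj _ _ hs₁ hs₂ (by
    rw [(hv_inv_hasPS h).psSum_qParam, (hv_inv_hasPS h).psSum_qParam, ← e₁, ← e₂, h2])
  obtain ⟨n, hn⟩ : ∃ n : ℤ, (σ₂ : ℂ) = σ₁ + n := by
    simp only [Function.Periodic.qParam] at h3
    obtain ⟨n, hn⟩ := Complex.exp_eq_exp_iff_exists_int.1 h3.symm
    refine ⟨n, ?_⟩
    have := Complex.two_pi_I_ne_zero
    simp only [Complex.ofReal_one, div_one] at hn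
    refine mul_left_cancel₀ this ?_
    rw [hn]; ring
  have hσ : mob (matT n) σ₁ = σ₂ := by ext; rw [coe_mob_T, hn]
  refine ⟨G₂ * matT n * G₁.adjugate, (hG₂.mul (G0.T n)).mul hG₁.inv, ?_⟩
  rw [mob_mul ((hG₂.mul (G0.T n)).det_pos) hG₁.inv.det_pos, mob_inv hG₁.1,
    mob_mul hG₂.det_pos (G0.T (N := N) n).det_pos, hσ]

lemma exists_equiv_of_im_large (h : Lv N e) : ∃ Y : ℝ, ∀ τ₁ τ₂ : ℍ, Y < τ₁.im →
    hv N e τ₁ = hv N e τ₂ → ∃ G, G0 N G ∧ mob G τ₁ = τ₂ := by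
  obtain ⟨K, hK⟩ := exists_equiv_of_large h
  have h1 := (hv_inv_hasPS h).tendsto one_pos
  simp only [PowerSeries.coeff_zero_X_mul, map_zero] at h1
  have h2 := h1.eventually (Metric.ball_mem_nhds (0 : ℂ) (ε := (|K| + 1)⁻¹) (by positivity))
  rw [UpperHalfPlane.atImInfty, Filter.eventually_comap] at h2
  obtain ⟨Y, hY⟩ := Filter.eventually_atTop.1 h2
  refine ⟨Y, fun τ₁ τ₂ h3 h4 => hK _ _ ?_ h4⟩
  have h5 := hY _ h3.le τ₁ rfl
  rw [dist_zero_right, norm_inv, inv_lt_inv₀ (norm_pos_iff.2 (hv_ne_zero _)) (by positivity)] at h5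
  have := le_abs_self K
  linarith

/-- The correspondence of degree `ℓ` relates points with the same value of the Hauptmodul. -/
lemma exists_mob_eq_mul (h : Lv N e) {ℓ : ℕ} (hℓ : ℓ.Prime) (hℓN : ¬ ℓ ∣ N) {τ₁ τ₂ : ℍ}
    (h12 : hv N e τ₁ = hv N e τ₂)
    (hl : ∀ σ, hv N e (mob (tri ℓ 0 1) τ₁) = hv N e σ →
      ∃ G, G0 N G ∧ mob G (mob (tri ℓ 0 1) τ₁) = σ) :
    ∃ H : M2, H.det = ℓ ∧ (N : ℤ) ∣ H 1 0 ∧ mob H τ₂ = mob (tri ℓ 0 1) τ₁ := by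
  have := Fact.mk hℓ
  set x := hv N e (mob (tri ℓ 0 1) τ₁) with hx
  have hm : ∀ i : Option (ZMod ℓ), MDiff (fun τ => x - hv N e (mob (al ℓ i) τ)) := fun i => by
    have h1 := MDiff.comp_mob (hv_mdiff (e := e) h.pos) (det_al_pos i)
    rw [UpperHalfPlane.mdifferentiable_iff] at h1 ⊢
    exact (differentiableOn_const x).sub h1
  have hm' : ∀ s : Finset (Option (ZMod ℓ)),
      MDiff (fun τ => ∏ i ∈ s, (x - hv N e (mob (al ℓ i) τ))) := fun s => by
    simp only [UpperHalfPlane.mdifferentiable_iff] at hm ⊢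
    exact DifferentiableOn.fun_finsetProd fun i _ => hm i
  obtain ⟨P, hP⟩ := exists_polynomial_complex h (ℓ * (ℓ + 1)) (hm' Finset.univ)
    (prod_comp_al (hv_G0 h) hℓN (fun y => x - y))
    (by
      refine bdd_prod fun i _ => ?_
      exact (bdd_const x).sub (hv_al_S_bounded h hℓN i))
    (by
      have e1 : ∀ τ : ℍ, qParam 1 τ ^ (ℓ * (ℓ + 1)) * ∏ i, (x - hv N e (mob (al ℓ i) τ)) =
          ∏ i, (x * qParam 1 τ ^ ℓ - qParam 1 τ ^ ℓ * hv N e (mob (al ℓ i) τ)) := fun τ => by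
        rw [pow_mul, show ℓ + 1 = Fintype.card (Option (ZMod ℓ)) by
          rw [Fintype.card_option, ZMod.card], ← Finset.card_univ, ← Finset.prod_const,
          ← Finset.prod_mul_distrib]
        refine Finset.prod_congr rfl fun i _ => by ring
      simp only [e1]
      refine bdd_prod fun i _ => ?_
      exact (bdd_mul (bdd_const x) ((HasPS.qpow (R := ℂ) (h := 1) ℓ).bounded one_pos)).sub
        (bdd_qpow_mul_hv_al h i))
  have h1 : ∏ i, (x - hv N e (mob (al ℓ i) τ₁)) = 0 :=
    Finset.prod_eq_zero (Finset.mem_univ none) (by simp [al, hx])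
  have h2 : ∏ i, (x - hv N e (mob (al ℓ i) τ₂)) = 0 := by rw [hP, ← h12, ← hP, h1]
  obtain ⟨i, -, hi⟩ := Finset.prod_eq_zero_iff.1 h2
  obtain ⟨G, hG, e1⟩ := hl _ (sub_eq_zero.1 hi)
  refine ⟨G.adjugate * al ℓ i, by rw [Matrix.det_mul, det_al, hG.inv.1, one_mul], ?_, ?_⟩
  · rw [Matrix.mul_apply, Fin.sum_univ_two, al_one_zero]
    simpa using hG.inv.2.mul_right _
  · rw [mob_mul hG.inv.det_pos (det_al_pos i), ← e1, mob_inv hG.1]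

lemma finite_jf_eq (τ : ℍ) (c : ℝ) :
    {x : ℤ × ℤ | Complex.normSq (x.1 * τ + x.2) = c}.Finite := by
  have h0 := τ.im_pos
  set B₁ : ℤ := ⌈(|c| + 1) / τ.im⌉
  set B₂ : ℤ := ⌈|c| + 1 + B₁ * |τ.re|⌉
  refine ((Set.finite_Icc (-B₁) B₁).prod (Set.finite_Icc (-B₂) B₂)).subset ?_
  rintro ⟨x, y⟩ hxy
  have e1 : Complex.normSq (x * τ + y) = (x * τ.re + y) ^ 2 + (x * τ.im) ^ 2 := by
    rw [Complex.normSq_apply]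
    simp
    ring
  change Complex.normSq (x * τ + y) = c at hxy
  rw [e1] at hxy
  have hc : c ≤ (|c| + 1) ^ 2 := by nlinarith [le_abs_self c, abs_nonneg c]
  have h1 : |(x : ℝ) * τ.im| ≤ |c| + 1 :=
    abs_le_of_sq_le_sq (by nlinarith [sq_nonneg (x * τ.re + y)]) (by positivity)
  have h2 : |x * τ.re + y| ≤ |c| + 1 :=
    abs_le_of_sq_le_sq (by nlinarith [sq_nonneg (x * τ.im)]) (by positivity)
  have h3 : |(x : ℝ)| ≤ B₁ := by
    rw [abs_mul, abs_of_pos h0, ← le_div_iff₀ h0] at h1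
    exact h1.trans (Int.le_ceil _)
  have h4 : |(y : ℝ)| ≤ B₂ := by
    refine le_trans ?_ (Int.le_ceil _)
    calc |(y : ℝ)| = |(x * τ.re + y) - x * τ.re| := by ring_nf
      _ ≤ |x * τ.re + y| + |x * τ.re| := abs_sub _ _
      _ ≤ _ := by
        rw [abs_mul]
        gcongr
  exact ⟨Set.mem_Icc.2 (abs_le.1 (by exact_mod_cast h3)),
    Set.mem_Icc.2 (abs_le.1 (by exact_mod_cast h4))⟩

/-- The Hauptmodul separates orbits. -/
theorem hv_injective (h : Lv N e) {τ₁ τ₂ : ℍ} (h12 : hv N e τ₁ = hv N e τ₂) :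
    ∃ G, G0 N G ∧ mob G τ₁ = τ₂ := by
  obtain ⟨Y, hY⟩ := exists_equiv_of_im_large h
  set S : Set ℕ := {ℓ | ℓ.Prime ∧ N < ℓ ∧ Y < ℓ * τ₁.im} with hS
  have hinf : S.Infinite := by
    obtain ⟨m, hm⟩ := exists_nat_gt (Y / τ₁.im)
    rw [div_lt_iff₀ τ₁.im_pos] at hm
    rw [Set.infinite_iff_exists_gt]
    intro a
    obtain ⟨ℓ, h1, h2⟩ := Nat.exists_infinite_primes (a + N + m + 1)
    refine ⟨ℓ, ⟨h2, by omega, hm.trans_le ?_⟩, by omega⟩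
    have : (m : ℝ) ≤ ℓ := by exact_mod_cast (by omega : m ≤ ℓ)
    have := τ₁.im_pos
    gcongr
  have key : ∀ ℓ ∈ S, ∃ H : M2, H.det = ℓ ∧ (N : ℤ) ∣ H 1 0 ∧ mob H τ₂ = mob (tri ℓ 0 1) τ₁ := by
    rintro ℓ ⟨hℓ, hℓN, hℓY⟩
    refine exists_mob_eq_mul h hℓ (fun hd => absurd (Nat.le_of_dvd h.pos hd) (by omega)) h12
      fun σ hσ => hY _ _ ?_ hσ
    have hp : (0 : ℤ) < ℓ * 1 := by exact_mod_cast (by simpa using hℓ.pos)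
    have : (mob (tri ℓ 0 1) τ₁ : ℂ).im = ℓ * τ₁.im := by
      rw [coe_mob_tri hp]; simp
    exact hℓY.trans_eq this.symm
  choose! H hHdet hHc hH using key
  have hmaps : Set.MapsTo (fun ℓ => (H ℓ 1 0, H ℓ 1 1)) S
      {x : ℤ × ℤ | Complex.normSq (x.1 * τ₂ + x.2) = τ₂.im / τ₁.im} := by
    intro ℓ hℓ
    have hℓ0 : (0 : ℝ) < ℓ := by exact_mod_cast hℓ.1.pos
    have hpos : 0 < (H ℓ).det := by rw [hHdet ℓ hℓ]; exact_mod_cast hℓ.1.pos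
    have hp : (0 : ℤ) < ℓ * 1 := by exact_mod_cast (by simpa using hℓ.1.pos)
    have h1 := congrArg UpperHalfPlane.im (hH ℓ hℓ)
    rw [im_mob hpos, hHdet ℓ hℓ, im_mob (by rwa [det_tri]), det_tri] at h1
    have h2 : 0 < Complex.normSq (jf (H ℓ) τ₂) := Complex.normSq_pos.2 (jf_ne_zero hpos)
    have h3 : jf (tri ℓ 0 1) τ₁ = 1 := by simp [jf, tri]
    rw [h3] at h1
    have h4 := τ₁.im_pos
    simp only [mul_one, map_one, div_one] at h1
    push_cast at h1
    change Complex.normSq (jf (H ℓ) τ₂) = _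
    rw [div_eq_iff h2.ne'] at h1
    rw [eq_div_iff h4.ne']
    refine mul_left_cancel₀ hℓ0.ne' ?_
    linear_combination -h1
  obtain ⟨ℓ, hℓ, m, hm, hne, heq⟩ :=
    hinf.exists_ne_map_eq_of_mapsTo hmaps (finite_jf_eq τ₂ _)
  simp only [Prod.mk.injEq] at heq
  obtain ⟨hc, hd⟩ := heq
  have hco : IsCoprime (ℓ : ℤ) m := by
    rw [Nat.isCoprime_iff_coprime]
    exact (Nat.coprime_primes hℓ.1 hm.1).2 hne
  obtain ⟨u, v, huv⟩ := hco
  have d1 := hHdet ℓ hℓ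
  have d2 := hHdet m hm
  rw [Matrix.det_fin_two] at d1 d2
  rw [← hc, ← hd] at d2
  set G : M2 := !![u * H ℓ 0 0 + v * H m 0 0, u * H ℓ 0 1 + v * H m 0 1; H ℓ 1 0, H ℓ 1 1] with hG
  have hG0 : G0 N G := by
    refine ⟨?_, by simpa [hG] using hHc ℓ hℓ⟩
    rw [Matrix.det_fin_two]
    simp [hG]
    linear_combination u * d1 + v * d2 + huv
  refine ⟨G.adjugate, hG0.inv, ?_⟩
  have e : ∀ n ∈ S, (H n 0 0 * τ₂ + H n 0 1 : ℂ) = n * τ₁ * jf (H n) τ₂ := fun n hn => by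
    have hpos : 0 < (H n).det := by rw [hHdet n hn]; exact_mod_cast hn.1.pos
    have hp : (0 : ℤ) < n * 1 := by exact_mod_cast (by simpa using hn.1.pos)
    have h1 := congrArg (fun σ : ℍ => (σ : ℂ)) (hH n hn)
    simp only [coe_mob hpos, coe_mob_tri hp] at h1
    rw [div_eq_iff (jf_ne_zero hpos)] at h1
    rw [h1]; simp
  have hτ : mob G τ₂ = τ₁ := by
    ext
    rw [coe_mob hG0.det_pos, div_eq_iff (jf_ne_zero hG0.det_pos)]
    have hj1 : jf (H m) τ₂ = jf (H ℓ) τ₂ := by simp [jf, hc, hd]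
    have hj2 : jf G τ₂ = jf (H ℓ) τ₂ := by simp [jf, hG]
    have huv' : (u * ℓ + v * m : ℂ) = 1 := by exact_mod_cast huv
    have e1 := e ℓ hℓ
    have e2 := e m hm
    rw [hj1] at e2
    rw [hj2]
    simp only [hG, Matrix.of_apply, Matrix.cons_val', Matrix.cons_val_zero, Matrix.cons_val_one,
      Matrix.cons_val_fin_one]
    push_cast
    linear_combination u * e1 + v * e2 + (τ₁ * jf (H ℓ) τ₂) * huv'
  rw [← hτ, mob_inv hG0.1]

end

section

open scoped Manifold UpperHalfPlane Topology
open UpperHalfPlane Filter Function.Periodic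

variable {τ : ℍ} {A B : M2} {N e : ℕ}

lemma mob_eq_self_iff (hA : 0 < A.det) :
    mob A τ = τ ↔ (A 1 0 * τ ^ 2 + (A 1 1 - A 0 0) * τ - A 0 1 : ℂ) = 0 := by
  rw [UpperHalfPlane.ext_iff, coe_mob hA, div_eq_iff (jf_ne_zero hA), jf]
  constructor <;> intro h <;> linear_combination -h

/-- Integral matrices with a common fixed point have proportional traceless parts. -/
lemma fix_proportional (hA : 0 < A.det) (hB : 0 < B.det) (h1 : mob A τ = τ) (h2 : mob B τ = τ) :
    B 1 0 * A 0 1 = A 1 0 * B 0 1 ∧ B 1 0 * (A 1 1 - A 0 0) = A 1 0 * (B 1 1 - B 0 0) := by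
  rw [mob_eq_self_iff hA] at h1
  rw [mob_eq_self_iff hB] at h2
  have h3 : (((B 1 0 * (A 1 1 - A 0 0) - A 1 0 * (B 1 1 - B 0 0) : ℤ) : ℝ) : ℂ) * τ =
      ((B 1 0 * A 0 1 - A 1 0 * B 0 1 : ℤ) : ℝ) := by
    push_cast
    linear_combination (B 1 0 : ℂ) * h1 - (A 1 0 : ℂ) * h2
  have h4 := congrArg Complex.im h3
  rw [Complex.im_ofReal_mul, Complex.ofReal_im] at h4
  have h5 := (mul_eq_zero.1 h4).resolve_right τ.im_ne_zero
  rw [h5, Complex.ofReal_zero, zero_mul] at h3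
  have h6 : (B 1 0 * (A 1 1 - A 0 0) - A 1 0 * (B 1 1 - B 0 0) : ℤ) = 0 := by exact_mod_cast h5
  have h7 : (B 1 0 * A 0 1 - A 1 0 * B 0 1 : ℤ) = 0 := by exact_mod_cast h3.symm
  exact ⟨sub_eq_zero.1 h7, sub_eq_zero.1 h6⟩

lemma jf_charpoly (hA : 0 < A.det) (hf : mob A τ = τ) :
    jf A τ ^ 2 - (A 0 0 + A 1 1) * jf A τ + A.det = 0 := by
  rw [mob_eq_self_iff hA] at hf
  rw [jf, Matrix.det_fin_two]
  push_cast
  linear_combination (A 1 0 : ℂ) * hf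

lemma traceless_sq (h : A 0 0 + A 1 1 = 0) (hA : 0 < A.det) (hf : mob A τ = τ) :
    jf A τ ^ 2 = - A.det := by
  have : (A 0 0 + A 1 1 : ℂ) = 0 := by exact_mod_cast h
  linear_combination jf_charpoly hA hf + jf A τ * this

def ellip (N : ℕ) : M2 := if N = 2 then !![1, -1; 2, -1] else !![1, -1; 3, -2]

lemma exists_ellip (h : Lv N e) : ∃ τ : ℍ, mob (ellip N) τ = τ := by
  rcases h with ⟨rfl, -⟩ | ⟨rfl, -⟩
  · refine ⟨⟨1 / 2 + 1 / 2 * Complex.I, by simp⟩, ?_⟩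
    rw [mob_eq_self_iff (by simp [ellip, Matrix.det_fin_two])]
    simp [ellip]
    linear_combination (1 / 2 : ℂ) * Complex.I_sq
  · refine ⟨⟨1 / 2 + (Real.sqrt 3 / 6 : ℝ) * Complex.I, by simp⟩, ?_⟩
    rw [mob_eq_self_iff (by simp [ellip, Matrix.det_fin_two])]
    have h3 : ((Real.sqrt 3 : ℝ) : ℂ) ^ 2 = 3 := by
      rw [← Complex.ofReal_pow, Real.sq_sqrt (by norm_num)]; simp
    simp [ellip]
    linear_combination (1 / 12 : ℂ) * (Real.sqrt 3 : ℂ) ^ 2 * Complex.I_sq - (1 / 12 : ℂ) * h3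

lemma ellip_G0 (h : Lv N e) : G0 N (ellip N) := by
  rcases h with ⟨rfl, -⟩ | ⟨rfl, -⟩ <;> simp [G0, ellip, Matrix.det_fin_two]

lemma hv_ellip (h : Lv N e) (hf : mob (ellip N) τ = τ) : hv N e τ = - kap N e := by
  have hG := ellip_G0 h
  have h1 := kE_gamma0 h hG.1 hG.2 τ
  rw [hf] at h1
  have h2 := jf_charpoly hG.det_pos hf
  have h3 : jf (ellip N) τ ^ 2 ≠ 1 := by
    rcases h with ⟨rfl, -⟩ | ⟨rfl, -⟩
    all_goals
      simp only [ellip, if_true, if_neg (by norm_num : ¬ (3 : ℕ) = 2), Matrix.det_fin_two_of] at h2 ⊢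
      norm_num at h2
      intro h4
      rw [h4] at h2
      norm_num at h2
    have h5 : jf !![1, -1; 3, -2] τ = - 2 := by linear_combination h2
    rw [h5] at h4
    norm_num at h4
  have h4 : kE N e τ = 0 := by
    have : (jf (ellip N) τ ^ 2 - 1) * kE N e τ = 0 := by linear_combination -h1
    exact (mul_eq_zero.1 this).resolve_left (sub_ne_zero.2 h3)
  have h5 := kE_pow_six h τ
  rw [h4, zero_pow (by norm_num), zero_mul] at h5
  have h6 := (mul_eq_zero.1 h5.symm).resolve_right (dl_ne_zero τ)
  exact eq_neg_of_add_eq_zero_left (eq_zero_of_pow_eq_zero h6)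

lemma hv_ne_of_traceless (h : Lv N e) {p : ℕ} (hp : p.Prime) (hp5 : 5 ≤ p) (hA : A.det = p)
    (ht : A 0 0 + A 1 1 = 0) (hf : mob A τ = τ) : hv N e τ ≠ - kap N e := by
  intro hv
  obtain ⟨σ, hσ⟩ := exists_ellip h
  obtain ⟨G, hG, rfl⟩ := hv_injective h ((hv_ellip h hσ).trans hv.symm)
  have hpos : 0 < A.det := by rw [hA]; exact_mod_cast hp.pos
  set B := G.adjugate * A * G with hB
  have hBdet : B.det = p := by rw [hB, Matrix.det_mul, Matrix.det_mul, hG.1, hG.inv.1, hA]; simp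
  have hBpos : 0 < B.det := by rw [hBdet, ← hA]; exact hpos
  have hBf : mob B σ = σ := by
    rw [hB, mul_assoc, mob_mul hG.inv.det_pos (by rw [Matrix.det_mul, hG.1, mul_one]; exact hpos),
      mob_mul hpos hG.det_pos, hf, mob_inv hG.1]
  have hBt : B 0 0 + B 1 1 = 0 := by
    rw [← Matrix.trace_fin_two] at ht ⊢
    rw [hB, Matrix.trace_mul_cycle, hG.mul_adjugate, one_mul, ht]
  obtain ⟨h1, h2⟩ := fix_proportional hBpos (ellip_G0 h).det_pos hBf hσ
  rw [Matrix.det_fin_two] at hBdet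
  have e1 : B 1 1 = - B 0 0 := by linarith
  have hpz : Prime (p : ℤ) := Nat.prime_iff_prime_int.1 hp
  rcases h with ⟨rfl, -⟩ | ⟨rfl, -⟩ <;> simp [ellip] at h1 h2
  · have e2 : B 0 0 * B 0 0 = p := by
      rw [e1] at h2 hBdet
      have e3 : B 1 0 = 2 * B 0 0 := by linarith
      have e4 : B 0 1 = - B 0 0 := by linarith
      rw [e3, e4] at hBdet
      linarith
    exact hpz.irreducible.not_isSquare ⟨_, e2.symm⟩
  · have e2 : B 0 0 * B 0 0 = 3 * p := by
      rw [e1] at h2 hBdet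
      have e3 : B 1 0 = 2 * B 0 0 := by linarith
      rw [e3] at hBdet h1
      have : B 0 0 * (3 * B 0 1) = B 0 0 * (-(2 * B 0 0)) := by rw [h1]
      linarith
    obtain ⟨m, hm⟩ := hpz.dvd_of_dvd_pow (a := B 0 0) (n := 2) ⟨3, by rw [sq, e2, mul_comm]⟩
    rw [hm] at e2
    have e5 : (p : ℤ) * (m * m) = 3 := by
      refine mul_left_cancel₀ hpz.ne_zero ?_
      linarith
    have := Int.le_of_dvd (by norm_num) (Dvd.intro _ e5)
    omega

/-- Traceless fixed points of prime determinant are not critical for the Hauptmodul. -/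
lemma dq_hv_ne_zero (h : Lv N e) {p : ℕ} (hp : p.Prime) (hp5 : 5 ≤ p) (hA : A.det = p)
    (ht : A 0 0 + A 1 1 = 0) (hf : mob A τ = τ) : dq (hv N e) τ ≠ 0 := by
  intro h0
  have h1 := kE_pow_six h τ
  rw [kE, lg, h0, zero_div, neg_zero, zero_pow (by norm_num), zero_mul] at h1
  have h2 := (mul_eq_zero.1 h1.symm).resolve_right (dl_ne_zero τ)
  exact hv_ne_of_traceless h hp hp5 hA ht hf
    (eq_neg_of_add_eq_zero_left (eq_zero_of_pow_eq_zero h2))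

end

section

open scoped Manifold UpperHalfPlane Topology
open UpperHalfPlane Filter Function.Periodic

section Derivation

variable {A : Type*} [CommRing A] (D : Derivation ℤ A A)

lemma derivation_mul_of_eq {F G a b : A} (hF : D F = a * F) (hG : D G = b * G) :
    D (F * G) = (a + b) * (F * G) := by
  rw [D.leibniz, hF, hG]
  simp only [smul_eq_mul]
  ring

lemma derivation_pow_of_eq {F a : A} (hF : D F = a * F) (n : ℕ) : D (F ^ n) = n * a * F ^ n := by
  induction n with
  | zero => simp
  | succ n ih =>
    rw [pow_succ, derivation_mul_of_eq D ih hF]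
    push_cast
    ring

/-- Partial sums of a power series in `y`. -/
def partSum (c : ℕ → ℤ) (y : A) (K : ℕ) : A := ∑ n ∈ Finset.range K, (c n : A) * y ^ n

lemma derivation_partSum {y ℰ s ℓ : A} {κ ε : ℤ} {c : ℕ → ℤ} (hy : D y = ℰ * s * y)
    (hs : s + κ * y = 1) (hℰ : D ℰ = ℓ * ℰ)
    (hc : ∀ n : ℕ, 144 * ((n : ℤ) + 1) ^ 2 * c (n + 1) = (144 * (n : ℤ) ^ 2 + 144 * n + ε) * κ * c n)
    (K : ℕ) :
    144 * D (D (partSum c y K)) = 144 * ℓ * D (partSum c y K) +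
      ℰ ^ 2 * s * (ε * κ * y * partSum c y K - 144 * (K : A) ^ 2 * c K * y ^ K) := by
  have hDs : D s = - (κ * y * ℰ * s) := by
    have h := congrArg D hs
    simp only [map_add, Derivation.map_one_eq_zero, Derivation.leibniz, Derivation.map_intCast, hy,
      smul_eq_mul] at h
    linear_combination h
  have hy' (n : ℕ) : D (y ^ n) = n * (ℰ * s) * y ^ n := derivation_pow_of_eq D hy n
  induction K with
  | zero => simp [partSum]
  | succ K ih =>
    rw [partSum, Finset.sum_range_succ, ← partSum]
    have hcK : (144 * ((K : A) + 1) ^ 2 * c (K + 1) : A) = (144 * (K : A) ^ 2 + 144 * K + ε) * κ * c K := by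
      exact_mod_cast congrArg (Int.cast : ℤ → A) (hc K)
    simp only [map_add, mul_add, ih, Derivation.leibniz, Derivation.map_intCast, hy', hℰ, hDs, smul_eq_mul,
      Derivation.map_natCast, map_zero]
    push_cast
    have h1 : s = 1 - κ * y := by linear_combination hs
    rw [h1, pow_succ]
    linear_combination (ℰ ^ 2 * (1 - κ * y) * y ^ K * y) * hcK

lemma derivation_wronskian {y ℰ s ℓ w : A} {κ ε : ℤ} {c : ℕ → ℤ} (hy : D y = ℰ * s * y)
    (hs : s + κ * y = 1) (hℰ : D ℰ = ℓ * ℰ)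
    (hc : ∀ n : ℕ, 144 * ((n : ℤ) + 1) ^ 2 * c (n + 1) = (144 * (n : ℤ) ^ 2 + 144 * n + ε) * κ * c n)
    (hℓ : 36 * (2 * D ℓ - ℓ ^ 2) = ε * ℰ ^ 2 * (κ * y) * s) (K : ℕ) (hw : w = partSum c y K) :
    144 * D (2 * D w - w * ℓ) - 72 * ℓ * (2 * D w - w * ℓ) =
      - 288 * ℰ ^ 2 * s * (K : A) ^ 2 * c K * y ^ K := by
  have h := derivation_partSum D hy hs hℰ hc K
  rw [← hw] at h
  have h2 : D (2 : A) = 0 := by simpa using D.map_natCast 2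
  simp only [map_sub, Derivation.leibniz, h2, smul_eq_mul]
  linear_combination 2 * h - 2 * w * hℓ

lemma derivation_square {ℰ ℓ w : A} (hℰ : D ℰ = ℓ * ℰ) :
    D (w ^ 2 - ℰ) - ℓ * (w ^ 2 - ℰ) = w * (2 * D w - w * ℓ) := by
  rw [map_sub, hℰ, pow_two, D.leibniz, smul_eq_mul]
  ring

lemma derivation_schwarz [IsDomain A] {X U Yi ℰ ℓ E L W y : A} {κ : ℤ} {N : ℕ} {a : A}
    (hX : D X = X) (hU : D U = (1 - ℰ) * U) (hℰ : D ℰ = ℓ * ℰ) (hE : D E = a * E)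
    (hY : (U + κ * X) * Yi = 1) (hy : y = X * Yi) (hL : L = 1 + 24 * a)
    (hW : W = L ^ 2 - 12 * D L) (hU0 : U ≠ 0) (hℰ0 : ℰ ≠ 0)
    (h1 : ℰ ^ 6 * U ^ N = (U + κ * X) ^ (N + 1) * E ^ 24)
    (h2 : W * ℰ ^ 4 * U ^ N = (U + κ * X) ^ N * (U + (κ * N ^ 2 : ℤ) * X) * E ^ 24) :
    U * Yi + κ * y = 1 ∧ D y = ℰ * (U * Yi) * y ∧
      36 * (2 * D ℓ - ℓ ^ 2) = (((N : ℤ) + 1) * (11 - N) : ℤ) * ℰ ^ 2 * (κ * y) * (U * Yi) := by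
  have hs : U * Yi + κ * y = 1 := by rw [hy]; linear_combination hY
  have hDY : D (U + κ * X) = (1 - ℰ * (U * Yi)) * (U + κ * X) := by
    simp only [map_add, Derivation.leibniz, Derivation.map_intCast, smul_eq_mul, hU, hX]
    linear_combination (ℰ * U) * hY
  have hY0 : U + κ * X ≠ 0 := fun h => by simp [h] at hY
  have hyY : y * (U + κ * X) = X := by rw [hy]; linear_combination X * hY
  have hDy : D y = ℰ * (U * Yi) * y := by
    have h := congrArg D hyY
    rw [D.leibniz, hDY, hX, smul_eq_mul, smul_eq_mul] at h
    refine mul_right_cancel₀ hY0 ?_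
    linear_combination h - hyY
  refine ⟨hs, hDy, ?_⟩
  have hℓ : 6 * ℓ + N * (1 - ℰ) = (N + 1) * (1 - ℰ * (U * Yi)) + 24 * a := by
    have h3 := derivation_mul_of_eq D (derivation_pow_of_eq D hℰ 6) (derivation_pow_of_eq D hU N)
    have h4 := derivation_mul_of_eq D (derivation_pow_of_eq D hDY (N + 1))
      (derivation_pow_of_eq D hE 24)
    rw [← h1, h3] at h4
    have := mul_right_cancel₀ (mul_ne_zero (pow_ne_zero _ hℰ0) (pow_ne_zero _ hU0)) h4
    push_cast at this
    exact this
  have hL' : L = 6 * ℓ + ℰ * (1 - (N + 1) * (κ * y)) := by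
    rw [hL]
    linear_combination -hℓ + (N + 1) * ℰ * hs
  have hW' : W = ℰ ^ 2 * (U * Yi + N ^ 2 * (κ * y)) := by
    have h3 : W * (U + κ * X) = ℰ ^ 2 * (U + (κ * N ^ 2 : ℤ) * X) := by
      refine mul_right_cancel₀ (mul_ne_zero (pow_ne_zero 4 hℰ0) (pow_ne_zero N hU0)) ?_
      linear_combination (U + κ * X) * h2 - (U + (κ * N ^ 2 : ℤ) * X) * h1
    push_cast at h3
    rw [hy]
    linear_combination Yi * h3 - W * hY
  have h6 : D (6 : A) = 0 := by simpa using D.map_natCast 6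
  have hDL : D L = 6 * D ℓ + ℓ * ℰ * (1 - (N + 1) * (κ * y)) -
      (N + 1) * ℰ * (κ * (ℰ * (U * Yi) * y)) := by
    rw [hL']
    simp only [map_add, map_sub, Derivation.leibniz, Derivation.map_one_eq_zero,
      Derivation.map_natCast, Derivation.map_intCast, hDy, hℰ, smul_eq_mul, h6]
    ring
  rw [hDL, hL', hW'] at hW
  push_cast
  have hs' : U * Yi = 1 - κ * y := by linear_combination hs
  rw [hs'] at hW ⊢
  linear_combination hW

end Derivation

lemma X_pow_dvd_of_deriv {F G : PowerSeries ℤ} {a : ℤ} {K : ℕ} (ha : a ≠ 0)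
    (hF : PowerSeries.constantCoeff F = 0) (hG : PowerSeries.constantCoeff G = 0)
    (h : PowerSeries.X ^ K ∣ (a : PowerSeries ℤ) * dX F - G * F) : PowerSeries.X ^ K ∣ F := by
  rw [PowerSeries.X_pow_dvd_iff] at h ⊢
  intro n
  induction n using Nat.strong_induction_on with
  | _ n ih =>
  intro hn
  rcases Nat.eq_zero_or_pos n with rfl | h0
  · simpa using hF
  have h1 := h n hn
  have h2 : (G * F).coeff n = 0 := by
    rw [PowerSeries.coeff_mul]
    refine Finset.sum_eq_zero fun ij hij => ?_
    rw [Finset.HasAntidiagonal.mem_antidiagonal] at hij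
    rcases Nat.eq_zero_or_pos ij.1 with h3 | h3
    · rw [h3, PowerSeries.coeff_zero_eq_constantCoeff_apply, hG, zero_mul]
    · rw [ih ij.2 (by omega) (by omega), mul_zero]
  rw [map_sub, h2, sub_zero, ← map_intCast (PowerSeries.C (R := ℤ)), PowerSeries.coeff_C_mul,
    coeff_dX] at h1
  have h4 : (n : ℤ) ≠ 0 := by exact_mod_cast h0.ne'
  exact (mul_eq_zero.mp ((mul_eq_zero.mp h1).resolve_left ha)).resolve_left h4

/-- The derivation given by an additive map satisfying the Leibniz rule. -/
def mkDer {A : Type*} [CommRing A] (f : A →+ A) (hf : ∀ a b, f (a * b) = a * f b + b * f a) :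
    Derivation ℤ A A :=
  Derivation.mk' f.toIntLinearMap hf

/-- `dX` as a derivation. -/
def dXDer := mkDer (AddMonoidHom.mk' (dX : PowerSeries ℤ → PowerSeries ℤ) dX_add) fun a b => by
  simp only [AddMonoidHom.mk'_apply, dX, Derivation.leibniz, smul_eq_mul]
  ring

lemma dXDer_apply (F : PowerSeries ℤ) : dXDer F = dX F := rfl

lemma constCoeff_dX (F : PowerSeries ℤ) : PowerSeries.constantCoeff (dX F) = 0 := by
  rw [← PowerSeries.coeff_zero_eq_constantCoeff_apply, coeff_dX]; simp

lemma constCoeff_lgX (F : PowerSeries ℤ) : PowerSeries.constantCoeff (lgX F) = 0 := by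
  rw [lgX, map_mul, constCoeff_dX, zero_mul]

variable {N e : ℕ}

/-- The inverse of `U + κ X`. -/
def hYi (N e : ℕ) : PowerSeries ℤ :=
  PowerSeries.invOfUnit (hU N e + PowerSeries.C (kap N e : ℤ) * PowerSeries.X) 1

lemma mul_hYi : (hU N e + PowerSeries.C (kap N e : ℤ) * PowerSeries.X) * hYi N e = 1 :=
  PowerSeries.mul_invOfUnit _ 1 (by simp [constCoeff_hU])

lemma constCoeff_kEX : PowerSeries.constantCoeff (kEX N e) = 1 := by
  simp [kEX, constCoeff_lgX]

lemma ne_zero_of_constCoeff {F : PowerSeries ℤ} (h : PowerSeries.constantCoeff F = 1) : F ≠ 0 := by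
  rintro rfl
  simp at h

theorem kEX_square_congr (h : Lv N e) {c : ℕ → ℤ} (hc0 : c 0 = 1)
    (hc : ∀ n : ℕ, 144 * ((n : ℤ) + 1) ^ 2 * c (n + 1) =
      (144 * (n : ℤ) ^ 2 + 144 * n + (((N : ℤ) + 1) * (11 - N))) * (kap N e : ℤ) * c n)
    {K : ℕ} (hK : 0 < K) :
    PowerSeries.X ^ K ∣ partSum c (PowerSeries.X * hYi N e) K ^ 2 - kEX N e := by
  have hmul : dXDer (kEX N e) = lgX (kEX N e) * kEX N e := (lgX_mul constCoeff_kEX).symm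
  have hcast (a : ℤ) : PowerSeries.C a = (a : PowerSeries ℤ) := map_intCast _ a
  have hU' : dXDer (hU N e) = (1 - kEX N e) * hU N e := by
    rw [dXDer_apply, ← lgX_mul constCoeff_hU, kEX]; ring
  have hW : wMX = (1 + 24 * lgX eulerPS) ^ 2 - 12 * dXDer (1 + 24 * lgX eulerPS) := by
    rw [dXDer_apply, wMX]
  have key := derivation_schwarz dXDer (X := PowerSeries.X) (U := hU N e) (Yi := hYi N e)
    (E := eulerPS) (a := lgX eulerPS) (κ := kap N e) (N := N) (W := wMX)
    (L := 1 + 24 * lgX eulerPS) dX_X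
    hU' hmul
    (lgX_mul constCoeff_eulerPS).symm (by rw [← hcast]; exact mul_hYi) rfl rfl
    hW
    (ne_zero_of_constCoeff constCoeff_hU) (ne_zero_of_constCoeff constCoeff_kEX)
    (by rw [← hcast]; exact kEX_pow_six h)
    (by rw [← hcast, ← hcast]; exact wMX_mul_kEX_pow_four h)
  obtain ⟨hs, hy, hℓ⟩ := key
  set y := PowerSeries.X * hYi N e with hyd
  set w := partSum c y K with hw
  have hwr := derivation_wronskian dXDer hy hs hmul hc hℓ K hw
  have hXy : PowerSeries.X ^ K ∣ y ^ K := pow_dvd_pow_of_dvd (Dvd.intro _ rfl) K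
  have h1 : PowerSeries.X ^ K ∣ 2 * dXDer w - w * lgX (kEX N e) := by
    refine X_pow_dvd_of_deriv (a := 144) (G := 72 * lgX (kEX N e)) (by norm_num) ?_ ?_ ?_
    · simp [constCoeff_lgX, constCoeff_dX, dXDer_apply]
    · simp [constCoeff_lgX]
    · rw [← dXDer_apply]
      push_cast
      rw [hwr]
      exact hXy.mul_left _
  refine X_pow_dvd_of_deriv (a := 1) (G := lgX (kEX N e)) (by norm_num) ?_ (constCoeff_lgX _) ?_
  · obtain ⟨K, rfl⟩ := Nat.exists_eq_add_of_lt hK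
    rw [zero_add] at hw
    rw [hw, partSum, Finset.sum_range_succ']
    simp [constCoeff_kEX, hyd, hc0, Finset.sum_eq_zero]
  · rw [← dXDer_apply, Int.cast_one, one_mul, derivation_square dXDer hmul]
    exact h1.mul_left _

end

section

open scoped Manifold UpperHalfPlane Topology
open UpperHalfPlane Filter Function.Periodic

/-- The coefficients of the hypergeometric series attached to `Γ₀(N)`. -/
def hg (N n : ℕ) : ℕ :=
  if N = 2 then (4 * n).choose (2 * n) * (2 * n).choose n else (3 * n).choose n * (2 * n).choose n

variable {N e : ℕ}

lemma hg_zero : hg N 0 = 1 := by simp [hg]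

lemma hg_two_mul (n : ℕ) : hg 2 n * ((2 * n).factorial * n.factorial ^ 2) = (4 * n).factorial := by
  have h1 := Nat.choose_mul_factorial_mul_factorial (show 2 * n ≤ 4 * n by omega)
  have h2 := Nat.choose_mul_factorial_mul_factorial (show n ≤ 2 * n by omega)
  rw [show 4 * n - 2 * n = 2 * n by omega] at h1
  rw [show 2 * n - n = n by omega] at h2
  rw [hg, if_pos rfl]
  calc _ = (4 * n).choose (2 * n) * (2 * n).factorial *
        ((2 * n).choose n * n.factorial * n.factorial) := by ring
    _ = _ := by rw [h2, h1]

lemma hg_three_mul (n : ℕ) : hg 3 n * n.factorial ^ 3 = (3 * n).factorial := by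
  have h1 := Nat.choose_mul_factorial_mul_factorial (show n ≤ 3 * n by omega)
  have h2 := Nat.choose_mul_factorial_mul_factorial (show n ≤ 2 * n by omega)
  rw [show 3 * n - n = 2 * n by omega] at h1
  rw [show 2 * n - n = n by omega] at h2
  rw [hg, if_neg (by norm_num)]
  calc _ = (3 * n).choose n * n.factorial *
        ((2 * n).choose n * n.factorial * n.factorial) := by ring
    _ = _ := by rw [h2, h1]

lemma hg_rec (h : Lv N e) (n : ℕ) : 144 * ((n : ℤ) + 1) ^ 2 * hg N (n + 1) =
    (144 * (n : ℤ) ^ 2 + 144 * n + (((N : ℤ) + 1) * (11 - N))) * (kap N e : ℤ) * hg N n := by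
  rcases h with ⟨rfl, rfl⟩ | ⟨rfl, rfl⟩
  · have h1 := hg_two_mul n
    have h2 := hg_two_mul (n + 1)
    rw [show 4 * (n + 1) = 4 * n + 1 + 1 + 1 + 1 by ring, show 2 * (n + 1) = 2 * n + 1 + 1 by ring] at h2
    simp only [Nat.factorial_succ] at h2
    rw [← h1] at h2
    zify at h2
    have h0 : ((2 * n).factorial * n.factorial ^ 2 * ((2 * n + 2) * (2 * n + 1)) : ℤ) ≠ 0 := by
      positivity
    refine mul_right_cancel₀ h0 ?_
    rw [kap]
    push_cast
    linear_combination 144 * h2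
  · have h1 := hg_three_mul n
    have h2 := hg_three_mul (n + 1)
    rw [show 3 * (n + 1) = 3 * n + 1 + 1 + 1 by ring] at h2
    simp only [Nat.factorial_succ] at h2
    rw [← h1] at h2
    zify at h2
    have h0 : (n.factorial ^ 3 * (n + 1) : ℤ) ≠ 0 := by positivity
    refine mul_right_cancel₀ h0 ?_
    rw [kap]
    push_cast
    linear_combination 144 * h2

variable {p : ℕ} [hp : Fact p.Prime]

lemma choose_mul_mul (a b : ℕ) : ((p * a).choose (p * b) : ZMod p) = a.choose b := by
  have h := Choose.choose_modEq_choose_mod_mul_choose_div_nat (p := p) (n := p * a) (k := p * b)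
  simp only [Nat.mul_mod_right, Nat.choose_self, one_mul,
    Nat.mul_div_cancel_left _ hp.out.pos] at h
  exact (ZMod.natCast_eq_natCast_iff _ _ _).mpr h

lemma hg_mul (h : Lv N e) (n : ℕ) : (hg N (p * n) : ZMod p) = hg N n := by
  rcases h with ⟨rfl, rfl⟩ | ⟨rfl, rfl⟩
  · simp only [hg, if_true]
    rw [show 4 * (p * n) = p * (4 * n) by ring, show 2 * (p * n) = p * (2 * n) by ring]
    push_cast
    simp only [choose_mul_mul]
  · simp only [hg, if_neg (show ¬ (3 = 2) by norm_num)]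
    rw [show 3 * (p * n) = p * (3 * n) by ring, show 2 * (p * n) = p * (2 * n) by ring]
    push_cast
    simp only [choose_mul_mul]

lemma natCast_ne_zero_of_lt {r : ℕ} (h0 : 0 < r) (hr : r < p) : (r : ZMod p) ≠ 0 := by
  rw [Ne, ZMod.natCast_eq_zero_iff]
  exact Nat.not_dvd_of_pos_of_lt h0 hr

lemma c144_ne_zero (hp5 : 5 ≤ p) : (144 : ZMod p) ≠ 0 := by
  have h2 : (2 : ZMod p) ≠ 0 := by exact_mod_cast natCast_ne_zero_of_lt (p := p) two_pos (by omega)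
  have h3 : (3 : ZMod p) ≠ 0 := by exact_mod_cast natCast_ne_zero_of_lt (p := p) three_pos (by omega)
  rw [show (144 : ZMod p) = 2 ^ 4 * 3 ^ 2 by norm_num]
  exact mul_ne_zero (pow_ne_zero _ h2) (pow_ne_zero _ h3)

lemma hg_rec_zmod (h : Lv N e) (n : ℕ) : (144 * ((n : ZMod p) + 1) ^ 2 * hg N (n + 1) : ZMod p) =
    (144 * (n : ZMod p) ^ 2 + 144 * n + (((N : ZMod p) + 1) * (11 - N))) * (kap N e : ZMod p) * hg N n := by
  have := congrArg (Int.cast : ℤ → ZMod p) (hg_rec h n)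
  push_cast at this
  exact this

lemma hg_add (h : Lv N e) (hp5 : 5 ≤ p) (n : ℕ) {r : ℕ} (hr : r < p) :
    (hg N (p * n + r) : ZMod p) = hg N n * hg N r := by
  induction r with
  | zero => simp [hg_mul h, hg_zero]
  | succ r ih =>
    have h1 := hg_rec_zmod (p := p) h (p * n + r)
    have h2 := hg_rec_zmod (p := p) h r
    rw [ih (by omega)] at h1
    push_cast at h1
    rw [CharP.cast_eq_zero, zero_mul, zero_add] at h1
    have h3 : ((r : ZMod p) + 1) ≠ 0 := by exact_mod_cast natCast_ne_zero_of_lt (p := p) r.succ_pos hr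
    refine mul_left_cancel₀ (mul_ne_zero (c144_ne_zero hp5) (pow_ne_zero 2 h3)) ?_
    rw [← add_assoc]
    linear_combination h1 - hg N n * h2

/-- The degree `⌊p/4⌋` or `⌊p/3⌋`. -/
def mm (N p : ℕ) : ℕ := p / (6 - N)

lemma mm_zmod (h : Lv N e) (hp5 : 5 ≤ p) :
    (144 * (mm N p : ZMod p) ^ 2 + 144 * mm N p + (((N : ZMod p) + 1) * (11 - N))) = 0 := by
  rcases h with ⟨rfl, rfl⟩ | ⟨rfl, rfl⟩
  · have h1 : p % 2 = 1 := hp.out.eq_two_or_odd.resolve_left (by omega)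
    have h2 : ((4 * mm 2 p + 1 : ℕ) : ZMod p) * (4 * mm 2 p + 3 : ℕ) = 0 := by
      rcases (show 4 * mm 2 p + 1 = p ∨ 4 * mm 2 p + 3 = p by unfold mm; omega) with h3 | h3 <;>
        rw [h3] <;> simp
    push_cast at h2 ⊢
    linear_combination 9 * h2
  · have h1 : ¬ 3 ∣ p := fun h => by
      have := (Nat.prime_dvd_prime_iff_eq Nat.prime_three hp.out).mp h
      omega
    have h2 : ((3 * mm 3 p + 1 : ℕ) : ZMod p) * (3 * mm 3 p + 2 : ℕ) = 0 := by
      rcases (show 3 * mm 3 p + 1 = p ∨ 3 * mm 3 p + 2 = p by unfold mm; omega) with h3 | h3 <;>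
        rw [h3] <;> simp
    push_cast at h2 ⊢
    linear_combination 16 * h2

lemma mm_lt (h : Lv N e) : mm N p < p := by
  refine Nat.div_lt_self hp.out.pos ?_
  rcases h with ⟨rfl, rfl⟩ | ⟨rfl, rfl⟩ <;> norm_num

lemma hg_eq (h : Lv N e) (hp5 : 5 ≤ p) {r : ℕ} (hr : r < p) : (hg N r : ZMod p) =
    (-(kap N e : ZMod p)) ^ r * ((mm N p).choose r * (mm N p + r).choose r : ℕ) := by
  induction r with
  | zero => simp [hg_zero]
  | succ r ih =>
    have h1 := hg_rec_zmod (p := p) h r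
    have h2 := mm_zmod (p := p) h hp5
    have h3 : ((r : ZMod p) + 1) ≠ 0 := by exact_mod_cast natCast_ne_zero_of_lt (p := p) r.succ_pos hr
    refine mul_left_cancel₀ (mul_ne_zero (c144_ne_zero hp5) (pow_ne_zero 2 h3)) ?_
    rw [h1, ih (by omega)]
    set m := mm N p
    have h4 : ((m.choose (r + 1) : ℕ) : ZMod p) * (r + 1) = m.choose r * (m - r) := by
      have := Nat.choose_succ_right_eq m r
      rcases le_or_gt r m with h5 | h5
      · rw [← Nat.cast_sub h5]
        exact_mod_cast congrArg (Nat.cast : ℕ → ZMod p) this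
      · rw [Nat.choose_eq_zero_of_lt h5, Nat.choose_eq_zero_of_lt (by omega)]
        simp
    have h5 : (((m + (r + 1)).choose (r + 1) : ℕ) : ZMod p) * (r + 1) =
        (m + r).choose r * (m + r + 1) := by
      have := Nat.add_one_mul_choose_eq (m + r) r
      have := congrArg (Nat.cast : ℕ → ZMod p) this
      push_cast at this
      rw [← add_assoc]
      linear_combination -this
    push_cast
    rw [pow_succ]
    have h6 := congrArg₂ (· * ·) h4 h5
    linear_combination (144 * (-(kap N e : ZMod p)) ^ r * kap N e) * h6 +
      ((-(kap N e : ZMod p)) ^ r * kap N e * m.choose r * (m + r).choose r) * h2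

section Homogeneous

variable {A : Type*} [CommRing A]

lemma sum_choose_add (m : ℕ) (Z V : A) :
    ∑ r ∈ Finset.range (m + 1), ((m.choose r * (m + r).choose r : ℕ) : A) * Z ^ r * V ^ (m - r) =
      ∑ r ∈ Finset.range (m + 1), ((m.choose r : A)) ^ 2 * Z ^ r * (Z + V) ^ (m - r) := by
  have hv (r : ℕ) : (m + r).choose r = ∑ i ∈ Finset.range (m + 1), m.choose i * r.choose i := by
    rw [Nat.choose_symm_add.symm, Nat.add_choose_eq, Finset.Nat.sum_antidiagonal_eq_sum_range_succ
      (fun i j => m.choose i * r.choose j), ← Finset.sum_range_reflect]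
    refine Finset.sum_congr rfl fun i hi => ?_
    rw [Finset.mem_range] at hi
    rw [show m + 1 - 1 - i = m - i by omega, Nat.choose_symm (by omega),
      show m - (m - i) = i by omega]
  simp_rw [hv, Finset.mul_sum, Nat.cast_sum, Finset.sum_mul]
  rw [Finset.sum_comm]
  refine Finset.sum_congr rfl fun i hi => ?_
  rw [Finset.mem_range] at hi
  rw [add_pow, Finset.mul_sum, ← Finset.sum_range_add_sum_Ico _ (show i ≤ m + 1 by omega),
    Finset.sum_eq_zero, zero_add, Finset.sum_Ico_eq_sum_range, show m + 1 - i = m - i + 1 by omega]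
  · refine Finset.sum_congr rfl fun j hj => ?_
    rw [Finset.mem_range] at hj
    have h1 := Nat.choose_mul (n := m) (k := i + j) (s := i) (by omega)
    rw [show i + j - i = j by omega] at h1
    rw [show m - (i + j) = m - i - j by omega]
    have h2 := congrArg (Nat.cast : ℕ → A) h1
    push_cast at h2 ⊢
    rw [pow_add]
    linear_combination ((m.choose i : A) * Z ^ i * Z ^ j * V ^ (m - i - j)) * h2
  · intro j hj
    rw [Finset.mem_range] at hj
    simp [Nat.choose_eq_zero_of_lt hj]

end Homogeneous

section ModP

variable (p) in
/-- Reduction of power series modulo `p`. -/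
def redX : PowerSeries ℤ →+* PowerSeries (ZMod p) := PowerSeries.map (Int.castRingHom (ZMod p))

lemma redX_X : redX p PowerSeries.X = PowerSeries.X := by simp [redX]

lemma redX_partSum (c : ℕ → ℤ) (y : PowerSeries ℤ) (K : ℕ) :
    redX p (partSum c y K) = ∑ n ∈ Finset.range K, PowerSeries.C (c n : ZMod p) * redX p y ^ n := by
  simp [partSum]

lemma zmod_C_pow (a : ZMod p) : (PowerSeries.C a : PowerSeries (ZMod p)) ^ p = PowerSeries.C a := by
  rw [← map_pow, ZMod.pow_card]

instance : CharP (PowerSeries (ZMod p)) p :=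
  charP_of_injective_ringHom PowerSeries.C_injective p

lemma X_pow_dvd_all {F : PowerSeries (ZMod p)} (h : ∀ K : ℕ, 0 < K → PowerSeries.X ^ K ∣ F) : F = 0 := by
  ext n
  exact PowerSeries.X_pow_dvd_iff.mp (h (n + 1) n.succ_pos) n n.lt_succ_self

/-- The truncated hypergeometric series. -/
def hgT (N e p : ℕ) [Fact p.Prime] : PowerSeries (ZMod p) :=
  ∑ r ∈ Finset.range p, PowerSeries.C (hg N r : ZMod p) * redX p (PowerSeries.X * hYi N e) ^ r

lemma redX_partSum_mul (h : Lv N e) (hp5 : 5 ≤ p) (K : ℕ) :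
    redX p (partSum (fun n => (hg N n : ℤ)) (PowerSeries.X * hYi N e) (p * K)) = hgT N e p *
      redX p (partSum (fun n => (hg N n : ℤ)) (PowerSeries.X * hYi N e) K) ^ p := by
  rw [redX_partSum, redX_partSum, sum_pow_char, hgT]
  induction K with
  | zero => simp
  | succ K ih =>
    rw [mul_add, mul_one, Finset.sum_range_add, ih, Finset.sum_range_succ, mul_add]
    congr 1
    rw [Finset.sum_mul]
    refine Finset.sum_congr rfl fun r hr => ?_
    rw [Finset.mem_range] at hr
    rw [mul_pow, zmod_C_pow, Int.cast_natCast, hg_add h hp5 K hr, map_mul]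
    push_cast
    ring

lemma kEX_eq (h : Lv N e) (hp5 : 5 ≤ p) :
    redX p (kEX N e) = hgT N e p ^ 2 * redX p (kEX N e) ^ p := by
  rw [← sub_eq_zero]
  refine X_pow_dvd_all fun K hK => ?_
  have h1 (K : ℕ) (hK : 0 < K) : PowerSeries.X ^ K ∣
      redX p (partSum (fun n => (hg N n : ℤ)) (PowerSeries.X * hYi N e) K) ^ 2 - redX p (kEX N e) := by
    have := map_dvd (redX p) (kEX_square_congr h (c := fun n => (hg N n : ℤ)) (by simp [hg_zero])
      (hg_rec h) hK)
    simpa [redX_X] using this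
  have h2 := h1 (p * K) (Nat.mul_pos hp.out.pos hK)
  have h3 := pow_dvd_pow_of_dvd (h1 K hK) p
  rw [redX_partSum_mul h hp5] at h2
  rw [sub_pow_char, ← pow_mul, mul_comm K p] at h3
  have h4 := (h3.mul_left (hgT N e p ^ 2)).sub h2
  refine (pow_dvd_pow _ (Nat.le_mul_of_pos_left K hp.out.pos)).trans ?_
  convert h4 using 1
  ring

lemma hgT_mul (h : Lv N e) (hp5 : 5 ≤ p) : hgT N e p ^ 2 * redX p (kEX N e) ^ (p - 1) = 1 := by
  have h1 := kEX_eq (p := p) h hp5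
  have h0 : redX p (kEX N e) ≠ 0 := by
    intro h2
    have := congrArg PowerSeries.constantCoeff h2
    rw [redX, ← PowerSeries.coeff_zero_eq_constantCoeff_apply, PowerSeries.coeff_map,
      PowerSeries.coeff_zero_eq_constantCoeff_apply, constCoeff_kEX] at this
    simp at this
  refine mul_right_cancel₀ h0 ?_
  rw [mul_assoc, ← pow_succ, Nat.sub_add_cancel hp.out.one_le, ← h1, one_mul]

/-- The homogenized polynomial `W`. -/
def hgH (N e p : ℕ) [Fact p.Prime] : PowerSeries (ZMod p) :=
  ∑ r ∈ Finset.range (mm N p + 1), PowerSeries.C (((mm N p).choose r : ZMod p) ^ 2 * (-(kap N e : ZMod p)) ^ r) *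
    PowerSeries.X ^ r * redX p (hU N e) ^ (mm N p - r)

lemma hgH_eq (h : Lv N e) (hp5 : 5 ≤ p) :
    hgH N e p = redX p (hU N e + PowerSeries.C (kap N e : ℤ) * PowerSeries.X) ^ mm N p * hgT N e p := by
  have hm := mm_lt (p := p) h
  set Y := redX p (hU N e + PowerSeries.C (kap N e : ℤ) * PowerSeries.X) with hY
  have hYy : redX p (PowerSeries.X * hYi N e) * Y = PowerSeries.X := by
    rw [hY, ← map_mul, mul_assoc, mul_comm (hYi N e), mul_hYi, mul_one, redX_X]
  have hUY : redX p (hU N e) = PowerSeries.C (-(kap N e : ZMod p)) * PowerSeries.X + Y := by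
    rw [hY, map_add, map_mul, redX_X]
    simp [redX]
  have h1 := sum_choose_add (mm N p) (PowerSeries.C (-(kap N e : ZMod p)) * PowerSeries.X) Y
  rw [← hUY] at h1
  have h2 : hgT N e p = ∑ r ∈ Finset.range (mm N p + 1),
      PowerSeries.C (hg N r : ZMod p) * redX p (PowerSeries.X * hYi N e) ^ r := by
    rw [hgT, ← Finset.sum_range_add_sum_Ico _ (show mm N p + 1 ≤ p by omega), add_eq_left]
    refine Finset.sum_eq_zero fun r hr => ?_
    rw [Finset.mem_Ico] at hr
    rw [hg_eq h hp5 hr.2, Nat.choose_eq_zero_of_lt (by omega)]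
    simp
  rw [hgH, h2, Finset.mul_sum]
  convert h1.symm using 1
  · refine Finset.sum_congr rfl fun r hr => ?_
    simp only [map_mul, map_pow, map_natCast]
    ring
  · refine Finset.sum_congr rfl fun r hr => ?_
    rw [Finset.mem_range] at hr
    rw [hg_eq h hp5 (by omega), ← Nat.add_sub_of_le (show r ≤ mm N p by omega), pow_add]
    simp only [Nat.add_sub_of_le (show r ≤ mm N p by omega)]
    simp only [map_mul, map_pow, map_natCast, mul_pow]
    calc _ = PowerSeries.C (-(kap N e : ZMod p)) ^ r * (((mm N p).choose r * (mm N p + r).choose r : ℕ) : PowerSeries (ZMod p)) *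
          (redX p (PowerSeries.X * hYi N e) * Y) ^ r * Y ^ (mm N p - r) := by rw [map_mul]; ring
      _ = _ := by rw [hYy]; ring

lemma twelve_mm_le (h : Lv N e) (hp5 : 5 ≤ p) : 12 * mm N p ≤ (N + 1) * (p - 1) := by
  rcases h with ⟨rfl, rfl⟩ | ⟨rfl, rfl⟩
  · have h1 : p % 2 = 1 := hp.out.eq_two_or_odd.resolve_left (by omega)
    unfold mm; omega
  · have h1 : ¬ 3 ∣ p := fun h => by
      have := (Nat.prime_dvd_prime_iff_eq Nat.prime_three hp.out).mp h
      omega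
    unfold mm; omega

/-- The complementary exponent. -/
def dd (N p : ℕ) : ℕ := (N + 1) * (p - 1) - 12 * mm N p

theorem hasse_congruence (h : Lv N e) (hp5 : 5 ≤ p) :
    hgH N e p ^ 12 * redX p (hU N e + PowerSeries.C (kap N e : ℤ) * PowerSeries.X) ^ dd N p *
      redX p eulerPS ^ (24 * (p - 1)) = redX p (hU N e) ^ (N * (p - 1)) := by
  have h1 := congrArg (fun F => redX p F ^ (p - 1)) (kEX_pow_six h)
  simp only [map_mul, map_pow, mul_pow, ← pow_mul] at h1
  have h2 := hgT_mul (p := p) h hp5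
  have h3 : (N + 1) * (p - 1) = mm N p * 12 + dd N p := by
    have := twelve_mm_le (p := p) h hp5
    unfold dd; omega
  rw [hgH_eq h hp5, mul_pow, ← pow_mul]
  rw [h3, pow_add] at h1
  have h4 : hgT N e p ^ 12 * redX p (kEX N e) ^ (6 * (p - 1)) = 1 := by
    rw [mul_comm 6, pow_mul, show 12 = 2 * 6 from rfl, pow_mul, ← mul_pow, h2, one_pow]
  calc _ = hgT N e p ^ 12 * (redX p (hU N e + PowerSeries.C (kap N e : ℤ) * PowerSeries.X) ^ (mm N p * 12) *
        redX p (hU N e + PowerSeries.C (kap N e : ℤ) * PowerSeries.X) ^ dd N p *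
      redX p eulerPS ^ (24 * (p - 1))) := by ring
    _ = _ := by rw [← h1, ← mul_assoc, h4, one_mul]

end ModP

end

section

open scoped Manifold UpperHalfPlane Topology
open UpperHalfPlane Filter Function.Periodic

variable {N e p : ℕ} [hp : Fact p.Prime]

lemma qParam_one_eq_pow (τ : ℍ) : qParam 1 τ = qParam p τ ^ p := by
  have : (p : ℂ) ≠ 0 := by exact_mod_cast hp.out.ne_zero
  rw [Function.Periodic.qParam, Function.Periodic.qParam, ← Complex.exp_nat_mul]
  congr 1
  push_cast
  field_simp

lemma HasPS.descend {R : Type*} [CommRing R] [Algebra R ℂ] {f : ℍ → ℂ} {F : PowerSeries R}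
    (hR : Function.Injective (algebraMap R ℂ)) (hf : HasPS p f F)
    (hper : ∀ τ : ℍ, f ((1 : ℝ) +ᵥ τ) = f τ) :
    ∃ G : PowerSeries R, HasPS 1 f G ∧ PowerSeries.expand p hp.out.ne_zero G = F := by
  have hp0 : (0 : ℝ) < p := by exact_mod_cast hp.out.pos
  obtain ⟨F', hF'⟩ := exists_hasPS one_pos hper (hf.mdiff hp0) (hf.bounded hp0)
  have h1 := hF'.of_pow hp.out.ne_zero qParam_one_eq_pow
  have h2 := h1.unique hp0 hf.toComplex Function.injective_id
  let G : PowerSeries R := PowerSeries.mk fun n => F.coeff (p * n)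
  have h3 : PowerSeries.map (algebraMap R ℂ) G = F' := by
    ext n
    have := congrArg (PowerSeries.coeff (p * n)) h2
    rw [PowerSeries.coeff_expand_mul, PowerSeries.coeff_map] at this
    rw [PowerSeries.coeff_map, PowerSeries.coeff_mk, this]
  refine ⟨G, fun τ => ?_, ?_⟩
  · rw [← h3] at hF'
    simpa using hF' τ
  · refine PowerSeries.map_injective _ hR ?_
    rw [PowerSeries.map_expand, h3, h2]

/-- The ring of algebraic integers. -/
abbrev OO : Subalgebra ℤ ℂ := integralClosure ℤ ℂ

lemma OO_injective : Function.Injective (algebraMap OO ℂ) := Subtype.val_injective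

variable (p) in
/-- A root of unity of order `p`. -/
def zet : OO := ⟨Complex.exp (2 * Real.pi * Complex.I / p), by
  refine ⟨Polynomial.X ^ p - Polynomial.C 1,
    Polynomial.monic_X_pow_sub_C 1 hp.out.ne_zero, ?_⟩
  have : (p : ℂ) ≠ 0 := by exact_mod_cast hp.out.ne_zero
  rw [Polynomial.eval₂_sub, Polynomial.eval₂_pow, Polynomial.eval₂_X, ← Complex.exp_nat_mul,
    mul_div_cancel₀ _ this, Complex.exp_two_pi_mul_I]
  simp⟩

lemma zet_pow : zet p ^ p = 1 := by
  have : (p : ℂ) ≠ 0 := by exact_mod_cast hp.out.ne_zero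
  refine Subtype.ext ?_
  rw [SubmonoidClass.coe_pow]
  change Complex.exp (2 * Real.pi * Complex.I / p) ^ p = 1
  rw [← Complex.exp_nat_mul, mul_div_cancel₀ _ this, Complex.exp_two_pi_mul_I]

lemma qParam_al_some (b : ZMod p) (τ : ℍ) :
    qParam 1 (mob (al p (some b)) τ) = algebraMap OO ℂ (zet p ^ b.val) * qParam p τ := by
  have h0 : (0 : ℤ) < 1 * p := by rw [one_mul]; exact_mod_cast hp.out.pos
  rw [al, qParam_tri h0, map_pow, Function.Periodic.qParam]
  change _ = Complex.exp (2 * Real.pi * Complex.I / p) ^ b.val * _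
  rw [← Complex.exp_nat_mul]
  congr 2
  · push_cast
    ring
  · push_cast
    ring

variable {k : Type*} [Field k] [CharP k p] (φ : OO →+* k)

section
variable (k)

/-- Reduction of integral power series. -/
def barX : PowerSeries ℤ →+* PowerSeries k := PowerSeries.map (Int.castRingHom k)

end

lemma map_ofInt (F : PowerSeries ℤ) :
    PowerSeries.map φ (PowerSeries.map (Int.castRingHom OO) F) = barX k F := by
  ext n
  simp [barX]

lemma φ_zet : φ (zet p) = 1 := by
  have h := congrArg φ (zet_pow (p := p))
  rw [map_pow, map_one, ← sub_eq_zero] at h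
  have h2 : (φ (zet p) - 1) ^ p = 0 := by rw [sub_pow_char, one_pow, h]
  exact sub_eq_zero.mp (pow_eq_zero_iff hp.out.ne_zero |>.mp h2)

lemma map_rescale_zet (b : ℕ) (F : PowerSeries OO) :
    PowerSeries.map φ (PowerSeries.rescale (zet p ^ b) F) = PowerSeries.map φ F := by
  ext n
  simp [PowerSeries.coeff_rescale, φ_zet]

omit [CharP k p] in
lemma barX_eq_map (ι : ZMod p →+* k) (F : PowerSeries ℤ) :
    barX k F = PowerSeries.map ι (redX p F) := by
  ext n
  simp [barX, redX]

lemma expand_barX (F : PowerSeries ℤ) :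
    PowerSeries.expand p hp.out.ne_zero (barX k F) = barX k F ^ p := by
  have h1 : PowerSeries.expand p hp.out.ne_zero (redX p F) = redX p F ^ p := by
    rw [PowerSeries.expand, ← MvPowerSeries.map_frobenius_expand p hp.out.ne_zero,
      ZMod.frobenius_zmod, MvPowerSeries.map_id, RingHom.id_apply]
  rw [barX_eq_map (ZMod.castHom dvd_rfl k), ← PowerSeries.map_expand, h1, map_pow]

lemma homPS_injective {n : ℕ} {P P' : Polynomial k} {U : PowerSeries k}
    (hU : PowerSeries.constantCoeff U = 1) (hP : P.natDegree ≤ n) (hP' : P'.natDegree ≤ n)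
    (h : homPS n P U = homPS n P' U) : P = P' := by
  let K := FractionRing (PowerSeries k)
  have hinj : Function.Injective (algebraMap (PowerSeries k) K) := IsFractionRing.injective _ _
  have hX : algebraMap (PowerSeries k) K PowerSeries.X ≠ 0 := by
    rw [Ne, map_eq_zero_iff _ hinj]; exact PowerSeries.X_ne_zero
  rw [← sub_eq_zero]
  refine eval_div_X_injective (algebraMap (PowerSeries k) K) hinj hU ?_
  have h1 := homPS_eq _ hX hP U
  have h2 := homPS_eq _ hX hP' U
  rw [h, h2] at h1
  rw [Polynomial.eval₂_sub, sub_eq_zero]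
  exact (mul_left_cancel₀ (pow_ne_zero n hX) h1).symm

omit hp [CharP k p] in
lemma constCoeff_barX (F : PowerSeries ℤ) :
    PowerSeries.constantCoeff (barX k F) = (PowerSeries.constantCoeff F : ℤ) := by
  rw [← PowerSeries.coeff_zero_eq_constantCoeff_apply, barX, PowerSeries.coeff_map]
  simp

omit hp [CharP k p] in
lemma polynomial_map_eq (h : Lv N e) {n : ℕ} {P : Polynomial OO} {P' : Polynomial k}
    {G : PowerSeries OO} (hP : P.natDegree ≤ n) (hP' : P'.natDegree ≤ n)
    (hG : HasPS 1 (fun τ => qParam 1 τ ^ n * Polynomial.aeval (hv N e τ) P) G)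
    (hbar : PowerSeries.map φ G = homPS n P' (barX k (hU N e))) : P.map φ = P' := by
  have h1 := (homPS_hasPS ((hv_hasPS h).ofInt OO) hP).unique one_pos hG OO_injective
  refine homPS_injective (n := n) (U := barX k (hU N e)) ?_
    (Polynomial.natDegree_map_le.trans hP) hP' ?_
  · rw [constCoeff_barX, constCoeff_hU, Int.cast_one]
  · rw [← hbar, ← h1, homPS_map, map_ofInt]

end

section

open scoped Manifold UpperHalfPlane Topology
open UpperHalfPlane Filter Function.Periodic

variable {N e p : ℕ} [hp : Fact p.Prime]

variable (p) in
/-- The function `p¹² Δ(A τ) / (j(A, τ)¹² Δ(τ))` for a Hecke representative `A`. -/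
def phi (i : Option (ZMod p)) (τ : ℍ) : ℂ :=
  p ^ 12 * dl (mob (al p i) τ) / (jf (al p i) τ ^ 12 * dl τ)

lemma phi_eq {A G : M2} {i : Option (ZMod p)} (hG : G.det = 1) (hA : A = G * al p i) (τ : ℍ) :
    phi p i τ = p ^ 12 * dl (mob A τ) / (jf A τ ^ 12 * dl τ) := by
  have hG' : 0 < G.det := by rw [hG]; exact one_pos
  have hi := det_al_pos i
  have h1 := jf_ne_zero hG' (τ := mob (al p i) τ)
  have h2 := jf_ne_zero hi (τ := τ)
  have h3 := dl_ne_zero (τ := τ)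
  rw [hA, mob_mul hG' hi, jf_mul hG' hi, dl_mob hG, phi]
  field_simp

omit hp in
lemma phi_none (τ : ℍ) : phi p none τ = p ^ 12 * (dl (mob (al p none) τ) / dl τ) := by
  simp [phi, al, jf, tri, mul_div_assoc]

lemma phi_some (b : ZMod p) (τ : ℍ) : phi p (some b) τ = dl (mob (al p (some b)) τ) / dl τ := by
  have : (p : ℂ) ≠ 0 := by exact_mod_cast hp.out.ne_zero
  have h3 := dl_ne_zero (τ := τ)
  simp [phi, al, jf, tri]
  field_simp

variable (p) in
/-- A multiple of the product of `c - phi i τ` over the Hecke representatives. -/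
def Phi (a b c : ℂ) (τ : ℍ) : ℂ := (a - b * (dl (mob (al p none) τ) / dl τ)) *
  ∏ i : ZMod p, (c - dl (mob (al p (some i)) τ) / dl τ)

lemma Phi_eq {a b c : ℂ} (hc : c ≠ 0) (h : a * p ^ 12 = b * c) (τ : ℍ) :
    Phi p a b c τ = a / c * ∏ i, (c - phi p i τ) := by
  rw [Fintype.prod_option, phi_none, Phi, ← mul_assoc]
  simp only [phi_some]
  congr 1
  field_simp
  linear_combination (dl (mob (al p none) τ) / dl τ) * h

lemma Phi_inv {a b c : ℂ} (hc : c ≠ 0) (h : a * p ^ 12 = b * c) : Inv0 1 (Phi p a b c) := by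
  intro A hA hA' τ
  have hA1 : G0 1 A := ⟨hA, hA'⟩
  obtain ⟨π, hπ⟩ := exists_perm (p := p) hp.out.not_dvd_one hA1
  rw [Phi_eq hc h, Phi_eq hc h, ← Equiv.prod_comp π fun i => c - phi p i τ]
  refine congrArg (a / c * ·) (Finset.prod_congr rfl fun i _ => ?_)
  obtain ⟨G, hG, e1⟩ := hπ i
  have hi := det_al_pos i
  have h1 := jf_ne_zero hA1.det_pos (τ := τ)
  have e2 := phi_eq hG.1 e1 τ
  rw [mob_mul hi hA1.det_pos, jf_mul hi hA1.det_pos, mul_pow, mul_assoc (_ ^ 12), ← dl_mob hA] at e2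
  exact congrArg (c - ·) e2.symm

lemma Phi_mdiff (a b c : ℂ) : MDiff (Phi p a b c) := by
  have h1 (i : Option (ZMod p)) : MDiff (fun τ => dl (mob (al p i) τ) / dl τ) := by
    simp only [div_eq_mul_inv]
    exact (MDiff.comp_mob dl_mdiff (det_al_pos i)).mul (mdiff_inv dl_mdiff dl_ne_zero)
  have h2 : MDiff (fun τ => ∏ i : ZMod p, (c - dl (mob (al p (some i)) τ) / dl τ)) := by
    have h3 (i : ZMod p) : MDiff (fun τ => c - dl (mob (al p (some i)) τ) / dl τ) :=
      mdifferentiable_const.sub (h1 _)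
    simp only [UpperHalfPlane.mdifferentiable_iff] at h3 ⊢
    exact DifferentiableOn.fun_finsetProd fun i _ => h3 i
  exact (mdifferentiable_const.sub (mdifferentiable_const.mul (h1 none))).mul h2

lemma eulerInv_hasPS : HasPS 1 (fun τ => (euler τ)⁻¹) eulerInv :=
  euler_hasPS.inv one_pos euler_ne_zero euler_mul_inv

lemma Phi_none_hasPS (a b : OO) :
    HasPS 1 (fun τ => (algebraMap OO ℂ a - algebraMap OO ℂ b * (dl (mob (al p none) τ) / dl τ)))
      (PowerSeries.C a - PowerSeries.C b * (PowerSeries.X ^ (p - 1) * PowerSeries.map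
        (Int.castRingHom OO) (PowerSeries.expand p hp.out.ne_zero (eulerPS ^ 24) * eulerInv ^ 24))) := by
  have h1 := (euler_hasPS.pow 24).comp_expand (mob (al p none)) hp.out.ne_zero (k := 1)
    fun τ => qParam_mul hp.out.pos
  have h2 := (h1.mul (eulerInv_hasPS.pow 24)).ofInt OO
  refine ((HasPS.const a).sub (((HasPS.qpow (p - 1)).mul h2).cmul b)).congr' fun τ => ?_
  have h3 : qParam 1 τ ≠ 0 := Complex.exp_ne_zero _
  have h4 := euler_ne_zero τ
  obtain ⟨m, hm⟩ := Nat.exists_eq_add_of_le' hp.out.one_le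
  rw [dl_eq, dl_eq, show qParam 1 (mob (al p none) τ) = qParam 1 τ ^ p from qParam_mul hp.out.pos, inv_pow]
  congr 2
  rw [hm, Nat.add_sub_cancel]
  field_simp
  ring

lemma Phi_some_hasPS (c : OO) (i : ZMod p) :
    HasPS p (fun τ => qParam p τ ^ (p - 1) *
        (algebraMap OO ℂ c - dl (mob (al p (some i)) τ) / dl τ))
      (PowerSeries.C c * PowerSeries.X ^ (p - 1) - PowerSeries.C (zet p ^ i.val) *
        (PowerSeries.rescale (zet p ^ i.val) (PowerSeries.map (Int.castRingHom OO) (eulerPS ^ 24)) *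
        PowerSeries.expand p hp.out.ne_zero (PowerSeries.map (Int.castRingHom OO) (eulerInv ^ 24)))) := by
  have h1 := ((euler_hasPS.pow 24).ofInt OO).comp_rescale (mob (al p (some i))) (zet p ^ i.val)
    (k := p) (qParam_al_some i)
  have h2 := ((eulerInv_hasPS.pow 24).ofInt OO).of_pow hp.out.ne_zero qParam_one_eq_pow
  refine (((HasPS.const c).mul (HasPS.qpow (p - 1))).sub ((h1.mul h2).cmul (zet p ^ i.val))).congr' fun τ => ?_
  have h3 : qParam p τ ≠ 0 := Complex.exp_ne_zero _
  have h4 := euler_ne_zero τ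
  obtain ⟨m, hm⟩ := Nat.exists_eq_add_of_le' hp.out.one_le
  rw [dl_eq, dl_eq, qParam_al_some, qParam_one_eq_pow (p := p), mul_sub, inv_pow, mul_comm (algebraMap OO ℂ c)]
  congr 1
  rw [show qParam p τ ^ p = qParam p τ * qParam p τ ^ (p - 1) by
    rw [hm, Nat.add_sub_cancel, pow_succ']]
  field_simp

variable {k : Type*} [Field k] [CharP k p] (φ : OO →+* k)

lemma expand_injective {R : Type*} [CommRing R] {F G : PowerSeries R}
    (h : PowerSeries.expand p hp.out.ne_zero F = PowerSeries.expand p hp.out.ne_zero G) : F = G := by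
  ext n
  have := congrArg (PowerSeries.coeff (p * n)) h
  rwa [PowerSeries.coeff_expand_mul, PowerSeries.coeff_expand_mul] at this

lemma barX_euler_mul : barX k eulerPS * barX k eulerInv = 1 := by
  rw [← map_mul, euler_mul_inv, map_one]

lemma Phi_hasPS {a b c : OO} (hc : c ≠ 0) (h : a * p ^ 12 = b * c) (hb : φ b = 0) :
    ∃ G : PowerSeries OO, HasPS 1 (fun τ => qParam 1 τ ^ (p - 1) * Phi p a b c τ) G ∧
      PowerSeries.map φ G = PowerSeries.C (φ a) * (PowerSeries.C (φ c ^ p) * PowerSeries.X ^ (p - 1) -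
        barX k eulerInv ^ (24 * (p - 1))) := by
  have h1 := ((Phi_none_hasPS (p := p) a b).of_pow hp.out.ne_zero qParam_one_eq_pow).mul
    (HasPS.prod Finset.univ fun i _ => Phi_some_hasPS (p := p) c i)
  have h2 := h1.congr' (g := fun τ => qParam 1 τ ^ (p - 1) * Phi p a b c τ) fun τ => by
    rw [Phi, Finset.prod_mul_distrib, Finset.prod_const, Finset.card_univ, ZMod.card,
      qParam_one_eq_pow (p := p), pow_right_comm, mul_left_comm]
    rfl
  have hc' : (c : ℂ) ≠ 0 := by exact_mod_cast hc
  have h' : (a : ℂ) * p ^ 12 = b * c := by exact_mod_cast congrArg (algebraMap OO ℂ) h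
  have hper (τ : ℍ) : qParam 1 ((1 : ℝ) +ᵥ τ) ^ (p - 1) * Phi p a b c ((1 : ℝ) +ᵥ τ) =
      qParam 1 τ ^ (p - 1) * Phi p a b c τ := by
    have h3 := mob_T (τ := τ) 1
    rw [Int.cast_one] at h3
    rw [(HasPS.q (R := ℤ) (h := 1)).vadd one_ne_zero, ← h3,
      (Phi_inv hc' h').apply (G0.T 1)]
  obtain ⟨G, hG, hGe⟩ := h2.descend OO_injective hper
  refine ⟨G, hG, expand_injective (p := p) ?_⟩
  have h4 := barX_euler_mul (k := k)
  rw [← PowerSeries.map_expand, hGe]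
  simp only [map_mul, map_sub, map_prod, PowerSeries.map_expand, map_pow, PowerSeries.map_X,
    PowerSeries.map_C, hb, map_zero, zero_mul, sub_zero, PowerSeries.expand_C, φ_zet, one_pow,
    map_rescale_zet, map_ofInt, expand_barX, PowerSeries.expand_X, map_one, one_mul,
    Finset.prod_const, Finset.card_univ, ZMod.card]
  have : CharP (PowerSeries k) p := charP_of_injective_ringHom PowerSeries.C_injective p
  rw [sub_pow_char, mul_pow]
  have h5 : barX k eulerPS ^ 24 * (barX k eulerInv ^ p) ^ 24 = barX k eulerInv ^ (24 * (p - 1)) := by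
    obtain ⟨m, hm⟩ := Nat.exists_eq_add_of_le' hp.out.one_le
    rw [hm, Nat.add_sub_cancel, ← mul_pow, mul_comm 24, pow_mul, pow_succ' (barX k eulerInv),
      ← mul_assoc, h4, one_mul]
  rw [h5]
  ring

end

section

open scoped Manifold UpperHalfPlane Topology
open UpperHalfPlane Filter Function.Periodic

variable {N e p : ℕ} [hp : Fact p.Prime]

section
variable {k : Type*} [Field k]

lemma homPS_mul {m n : ℕ} {P Q : Polynomial k} (hP : P.natDegree ≤ m) (hQ : Q.natDegree ≤ n)
    (U : PowerSeries k) : homPS (m + n) (P * Q) U = homPS m P U * homPS n Q U := by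
  let K := FractionRing (PowerSeries k)
  have hinj : Function.Injective (algebraMap (PowerSeries k) K) := IsFractionRing.injective _ _
  have hX : algebraMap (PowerSeries k) K PowerSeries.X ≠ 0 := by
    rw [Ne, map_eq_zero_iff _ hinj]; exact PowerSeries.X_ne_zero
  refine hinj ?_
  rw [map_mul, homPS_eq _ hX hP, homPS_eq _ hX hQ,
    homPS_eq _ hX (Polynomial.natDegree_mul_le.trans (add_le_add hP hQ)), Polynomial.eval₂_mul,
    pow_add]
  ring

lemma homPS_pow {n : ℕ} {P : Polynomial k} (hP : P.natDegree ≤ n) (U : PowerSeries k) (m : ℕ) :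
    homPS (m * n) (P ^ m) U = homPS n P U ^ m := by
  induction m with
  | zero => simp [homPS]
  | succ m ih =>
    rw [Nat.succ_mul, pow_succ, pow_succ, homPS_mul _ hP, ih]
    exact Polynomial.natDegree_pow_le.trans (Nat.mul_le_mul_left m hP)

lemma homPS_add (n : ℕ) (P Q : Polynomial k) (U : PowerSeries k) :
    homPS n (P + Q) U = homPS n P U + homPS n Q U := by
  simp [homPS, add_mul, Finset.sum_add_distrib]

lemma homPS_neg (n : ℕ) (P : Polynomial k) (U : PowerSeries k) :
    homPS n (-P) U = -homPS n P U := by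
  simp [homPS]

lemma homPS_sub (n : ℕ) (P Q : Polynomial k) (U : PowerSeries k) :
    homPS n (P - Q) U = homPS n P U - homPS n Q U := by
  rw [sub_eq_add_neg, homPS_add, homPS_neg, sub_eq_add_neg]

lemma homPS_sum {ι : Type*} (s : Finset ι) (n : ℕ) (P : ι → Polynomial k) (U : PowerSeries k) :
    homPS n (∑ i ∈ s, P i) U = ∑ i ∈ s, homPS n (P i) U := by
  classical
  induction s using Finset.induction_on with
  | empty => simp [homPS]
  | insert i s hi ih => rw [Finset.sum_insert hi, Finset.sum_insert hi, homPS_add, ih]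

lemma homPS_monomial {n i : ℕ} (hi : i ≤ n) (c : k) (U : PowerSeries k) :
    homPS n (Polynomial.C c * Polynomial.X ^ i) U =
      PowerSeries.C c * U ^ i * PowerSeries.X ^ (n - i) := by
  rw [homPS, Finset.sum_eq_single_of_mem i (Finset.mem_range.mpr (Nat.lt_succ_of_le hi))]
  · simp
  · intro j _ hj
    simp [Polynomial.coeff_X_pow, hj]

end

variable (N e p) in
/-- The reversed polynomial `W_m(-κ/Z) Z^m` modulo `p`. -/
def revW : Polynomial (ZMod p) := ∑ r ∈ Finset.range (mm N p + 1),
  Polynomial.C (((mm N p).choose r : ZMod p) ^ 2 * (-(kap N e : ZMod p)) ^ r) *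
    Polynomial.X ^ (mm N p - r)

variable (N e p) in
/-- The Hauptmodul form of the supersingular polynomial of level `N`. -/
def revS : Polynomial (ZMod p) :=
  revW N e p ^ 12 * (Polynomial.X + Polynomial.C (kap N e : ZMod p)) ^ dd N p

lemma natDegree_revW : (revW N e p).natDegree ≤ mm N p := by
  refine Polynomial.natDegree_sum_le_of_forall_le _ _ fun r _ => ?_
  exact (Polynomial.natDegree_C_mul_X_pow_le _ _).trans (Nat.sub_le _ _)

lemma homPS_revW : homPS (mm N p) (revW N e p) (redX p (hU N e)) = hgH N e p := by
  rw [revW, homPS_sum, hgH]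
  refine Finset.sum_congr rfl fun r hr => ?_
  have hr' : r ≤ mm N p := Nat.lt_succ_iff.mp (Finset.mem_range.mp hr)
  rw [homPS_monomial (Nat.sub_le _ _), Nat.sub_sub_self hr']
  ring

lemma natDegree_X_add_kap :
    (Polynomial.X + Polynomial.C (kap N e : ZMod p)).natDegree ≤ 1 := by
  rw [Polynomial.natDegree_X_add_C]

lemma homPS_X_add_kap : homPS 1 (Polynomial.X + Polynomial.C (kap N e : ZMod p)) (redX p (hU N e)) =
    redX p (hU N e + PowerSeries.C (kap N e : ℤ) * PowerSeries.X) := by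
  simp [homPS, Finset.sum_range_succ, redX, Polynomial.coeff_X]
  ring

lemma natDegree_revS (h : Lv N e) (hp5 : 5 ≤ p) :
    (revS N e p).natDegree ≤ (N + 1) * (p - 1) := by
  have h1 : 12 * mm N p + dd N p * 1 = (N + 1) * (p - 1) := by
    rw [mul_one, dd]; exact Nat.add_sub_cancel' (twelve_mm_le h hp5)
  rw [← h1]
  exact Polynomial.natDegree_mul_le.trans (add_le_add
    (Polynomial.natDegree_pow_le.trans (Nat.mul_le_mul_left _ natDegree_revW))
    (Polynomial.natDegree_pow_le.trans (Nat.mul_le_mul_left _ natDegree_X_add_kap)))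

lemma homPS_revS (h : Lv N e) (hp5 : 5 ≤ p) :
    homPS ((N + 1) * (p - 1)) (revS N e p) (redX p (hU N e)) = hgH N e p ^ 12 *
      redX p (hU N e + PowerSeries.C (kap N e : ℤ) * PowerSeries.X) ^ dd N p := by
  have h1 : 12 * mm N p + dd N p * 1 = (N + 1) * (p - 1) := by
    rw [mul_one, dd]; exact Nat.add_sub_cancel' (twelve_mm_le h hp5)
  rw [← h1, revS, homPS_mul, homPS_pow natDegree_revW, homPS_pow natDegree_X_add_kap,
    homPS_X_add_kap, homPS_revW]
  · exact Polynomial.natDegree_pow_le.trans (Nat.mul_le_mul_left _ natDegree_revW)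
  · exact Polynomial.natDegree_pow_le.trans (Nat.mul_le_mul_left _ natDegree_X_add_kap)

variable {k : Type*} [Field k] [CharP k p]

lemma homPS_revS_bar (h : Lv N e) (hp5 : 5 ≤ p) :
    homPS ((N + 1) * (p - 1)) ((revS N e p).map (ZMod.castHom dvd_rfl k)) (barX k (hU N e)) =
      barX k eulerInv ^ (24 * (p - 1)) * barX k (hU N e) ^ (N * (p - 1)) := by
  have h1 := congrArg (PowerSeries.map (ZMod.castHom dvd_rfl k)) (hasse_congruence (p := p) h hp5)
  rw [← homPS_revS h hp5, map_mul, map_pow, map_pow, homPS_map] at h1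
  simp only [← barX_eq_map] at h1
  have h4 := barX_euler_mul (k := k)
  rw [← h1, mul_left_comm, ← mul_pow, mul_comm (barX k eulerInv), h4, one_pow, mul_one]

lemma mdiff_pow {f : ℍ → ℂ} (hf : MDiff f) (n : ℕ) : MDiff (fun τ => f τ ^ n) := by
  rw [UpperHalfPlane.mdifferentiable_iff] at hf ⊢
  exact hf.pow n

theorem exists_cm_polynomial (h : Lv N e) (hp5 : 5 ≤ p) (φ : OO →+* k) {a b c : OO} (hc : c ≠ 0)
    (hab : a * p ^ 12 = b * c) (hb : φ b = 0) :
    ∃ Q : Polynomial OO,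
      (∀ τ, Phi p a b c τ * hv N e τ ^ (N * (p - 1)) = Polynomial.aeval (hv N e τ) Q) ∧
      Q.map φ = Polynomial.C (φ a) * (Polynomial.C (φ c ^ p) * Polynomial.X ^ (N * (p - 1)) -
        (revS N e p).map (ZMod.castHom dvd_rfl k)) := by
  obtain ⟨G, hG, hGb⟩ := Phi_hasPS φ hc hab hb
  have hc' : (c : ℂ) ≠ 0 := by exact_mod_cast hc
  have h' : (a : ℂ) * p ^ 12 = b * c := by exact_mod_cast congrArg (algebraMap OO ℂ) hab
  have hinv := Phi_inv hc' h'
  have hG2 := hG.mul (((hv_hasPS h).ofInt OO).pow (N * (p - 1)))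
  have hG3 : HasPS 1 (fun τ => qParam 1 τ ^ ((N + 1) * (p - 1)) *
      (Phi p a b c τ * hv N e τ ^ (N * (p - 1)))) _ := hG2.congr' fun τ => by
    rw [mul_pow, add_mul, one_mul, pow_add]; ring
  have hN' : (0 : ℝ) < N := by exact_mod_cast h.pos
  have hS : IsBoundedAtImInfty (fun τ =>
      Phi p a b c (mob matS τ) * hv N e (mob matS τ) ^ (N * (p - 1))) := by
    have h1 := bdd_mul (bdd_mul (hG.bounded one_pos) (bdd_pow ((hU_inv h).bounded hN') (N * (p - 1))))
      (bdd_const (((N : ℂ) ^ (6 * e)) ^ (N * (p - 1))))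
    refine h1.congr_left fun τ => ?_
    have h3 : qParam N τ ≠ 0 := Complex.exp_ne_zero _
    have h4 := hv_ne_zero (N := N) (e := e) (mob (tri 1 0 N) τ)
    have h5 : qParam 1 τ = qParam N τ ^ N := by
      have : (N : ℂ) ≠ 0 := by exact_mod_cast h.pos.ne'
      rw [Function.Periodic.qParam, Function.Periodic.qParam, ← Complex.exp_nat_mul]
      congr 1
      push_cast
      field_simp
    rw [hinv.apply ⟨det_matS, one_dvd _⟩, hv_S h, h5, ← pow_mul, mul_inv, mul_pow, div_eq_mul_inv,
      mul_pow, inv_pow (qParam N τ)]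
    field_simp
  have hm : MDiff (fun τ => Phi p a b c τ * hv N e τ ^ (N * (p - 1))) :=
    (Phi_mdiff _ _ _).mul (mdiff_pow (hv_mdiff h.pos) (N * (p - 1)))
  obtain ⟨Q, hQd, -, hQ⟩ := exists_polynomial h _ hm (fun A hA hA' τ => by
      rw [hinv A hA (by simp), hv_gamma0 h hA hA']) hS hG3
  have hd : (Polynomial.C (φ c ^ p) * Polynomial.X ^ (N * (p - 1)) -
      (revS N e p).map (ZMod.castHom dvd_rfl k)).natDegree ≤ (N + 1) * (p - 1) := by
    refine (Polynomial.natDegree_sub_le _ _).trans (max_le ?_ ?_)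
    · refine (Polynomial.natDegree_C_mul_X_pow_le _ _).trans ?_
      exact Nat.mul_le_mul_right _ (Nat.le_succ _)
    · exact Polynomial.natDegree_map_le.trans (natDegree_revS h hp5)
  refine ⟨Q, hQ, polynomial_map_eq φ h hQd ((Polynomial.natDegree_C_mul_le _ _).trans hd)
    (hG3.congr' fun τ => by rw [hQ]) ?_⟩
  have h6 : (N + 1) * (p - 1) - N * (p - 1) = p - 1 := by
    rw [add_mul, one_mul, Nat.add_sub_cancel_left]
  have h7 := homPS_mul (m := 0) (P := Polynomial.C (φ a)) (by simp) hd (barX k (hU N e))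
  rw [zero_add] at h7
  rw [map_mul, hGb, map_pow (PowerSeries.map φ), map_ofInt, h7, homPS_sub, homPS_revS_bar h hp5,
    homPS_monomial (Nat.mul_le_mul_right _ (Nat.le_succ _)), h6]
  simp only [homPS, Finset.sum_range_succ, Finset.sum_range_zero, Polynomial.coeff_C_zero]
  ring

end

section

open scoped Manifold UpperHalfPlane Topology
open UpperHalfPlane Filter Function.Periodic

variable {N e p : ℕ} [hp : Fact p.Prime] {A : M2} {τ : ℍ}

lemma ne_zero_of_fix (hA : A.det = p) (hf : mob A τ = τ) : A 1 0 ≠ 0 := by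
  intro hc
  have hA0 : 0 < A.det := by rw [hA]; exact_mod_cast hp.out.pos
  rw [mob_eq_self_iff hA0, hc] at hf
  have h1 := congrArg Complex.im hf
  have h2 : A 1 1 = A 0 0 := by
    simp at h1
    rcases h1 with h1 | h1
    · have : ((A 1 1 - A 0 0 : ℤ) : ℝ) = 0 := by push_cast; linarith
      exact sub_eq_zero.mp (by exact_mod_cast this)
    · exact absurd h1 τ.im_pos.ne'
  rw [Matrix.det_fin_two, hc, h2, mul_zero, sub_zero] at hA
  have h3 := (Nat.prime_iff_prime_int.mp hp.out).irreducible
  rw [← hA] at h3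
  exact h3.not_isSquare ⟨_, rfl⟩

lemma trace_sq_lt (hA : A.det = p) (hf : mob A τ = τ) : (A 0 0 + A 1 1) ^ 2 < 4 * (p : ℤ) := by
  have hc := ne_zero_of_fix hA hf
  have hA0 : 0 < A.det := by rw [hA]; exact_mod_cast hp.out.pos
  rw [mob_eq_self_iff hA0] at hf
  have h1 := congrArg Complex.im hf
  have h2 := congrArg Complex.re hf
  simp [pow_two] at h1 h2
  have hy := τ.im_pos
  have hcR : (A 1 0 : ℝ) ≠ 0 := by exact_mod_cast hc
  have h3 : (A 1 0 : ℝ) * (2 * τ.re) + (A 1 1 - A 0 0) = 0 := by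
    refine mul_right_cancel₀ hy.ne' ?_
    linarith
  have h4 : ((A 1 1 : ℝ) - A 0 0) ^ 2 + 4 * (A 0 1 * A 1 0) = - (2 * A 1 0 * τ.im) ^ 2 := by
    have e1 : (A 1 1 : ℝ) - A 0 0 = - (A 1 0 * (2 * τ.re)) := by linarith
    rw [e1] at h2 ⊢
    linear_combination (-4 * (A 1 0 : ℝ)) * h2
  have h5 : 0 < (2 * (A 1 0 : ℝ) * τ.im) ^ 2 := by positivity
  have h6 : (A 1 1 - A 0 0) ^ 2 + 4 * (A 0 1 * A 1 0) < 0 := by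
    have : (((A 1 1 - A 0 0) ^ 2 + 4 * (A 0 1 * A 1 0) : ℤ) : ℝ) < 0 := by push_cast; linarith
    exact_mod_cast this
  rw [Matrix.det_fin_two] at hA
  linarith [hA]

lemma not_dvd_trace (hp5 : 5 ≤ p) (hA : A.det = p) (hf : mob A τ = τ) (ht : A 0 0 + A 1 1 ≠ 0) :
    ¬ (p : ℤ) ∣ A 0 0 + A 1 1 := by
  rintro ⟨s, hs⟩
  have h1 := trace_sq_lt hA hf
  rw [hs] at h1 ht
  have h2 : s ≠ 0 := right_ne_zero_of_mul ht
  have h3 : 1 ≤ s ^ 2 := by have := sq_pos_of_ne_zero h2; omega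
  have h4 : (5 : ℤ) ≤ p := by exact_mod_cast hp5
  nlinarith [mul_le_mul_of_nonneg_left h3 (sq_nonneg (p : ℤ))]

lemma Phi_eq_zero (hA : A.det = p) (hf : mob A τ = τ) {a b c : ℂ} (hc : c ≠ 0)
    (h : a * p ^ 12 = b * c) (hcA : c = (p / jf A τ) ^ 12) : Phi p a b c τ = 0 := by
  obtain ⟨i, G, hG, hAG⟩ := exists_eq_mul_al (N := 1) hp.out.not_dvd_one hA (one_dvd _)
  rw [Phi_eq hc h, Finset.prod_eq_zero (Finset.mem_univ i), mul_zero]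
  have h3 := dl_ne_zero τ
  rw [phi_eq hG.1 hAG, hf, hcA, div_pow, mul_div_mul_right _ _ h3, sub_self]

variable {k : Type*} [Field k] [CharP k p]

lemma cm_relation (h : Lv N e) (hp5 : 5 ≤ p) (φ : OO →+* k) (hA : A.det = p) (hf : mob A τ = τ)
    {V a b c : OO} (hV : (V : ℂ) = hv N e τ) (hc : c ≠ 0)
    (hab : a * p ^ 12 = b * c) (hb : φ b = 0) (hcA : (c : ℂ) = (p / jf A τ) ^ 12) :
    φ a * (φ c ^ p * φ V ^ (N * (p - 1)) -
      ((revS N e p).map (ZMod.castHom dvd_rfl k)).eval (φ V)) = 0 := by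
  obtain ⟨Q, hQ, hQb⟩ := exists_cm_polynomial h hp5 φ hc hab hb
  have hc' : (c : ℂ) ≠ 0 := by exact_mod_cast hc
  have h' : (a : ℂ) * p ^ 12 = b * c := by exact_mod_cast congrArg (algebraMap OO ℂ) hab
  have h1 := hQ τ
  rw [Phi_eq_zero hA hf hc' h' hcA, zero_mul, ← hV] at h1
  have h2 : Q.eval V = 0 := by
    refine OO_injective ?_
    rw [map_zero, ← Polynomial.aeval_algebraMap_apply_eq_algebraMap_eval]
    exact h1.symm
  have h3 := congrArg φ h2
  rw [map_zero, ← Polynomial.eval_map_apply, hQb] at h3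
  simpa using h3

lemma revS_zero (h : Lv N e) (hp5 : 5 ≤ p) :
    ((revS N e p).map (ZMod.castHom dvd_rfl k)).eval 0 ≠ 0 := by
  rw [← map_zero (ZMod.castHom dvd_rfl k), Polynomial.eval_map_apply, Ne, map_zero, map_eq_zero]
  have hN : (N : ZMod p) ≠ 0 := by
    refine natCast_ne_zero_of_lt h.pos ?_
    rcases h with ⟨rfl, _⟩ | ⟨rfl, _⟩ <;> omega
  have hk : (kap N e : ZMod p) ≠ 0 := by
    rw [kap, Nat.cast_pow]; exact pow_ne_zero _ hN
  have hW : (revW N e p).eval 0 = (-(kap N e : ZMod p)) ^ mm N p := by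
    rw [revW, Polynomial.eval_finsetSum, Finset.sum_range_succ, Finset.sum_eq_zero]
    · simp
    · intro r hr
      have hr' := Finset.mem_range.mp hr
      simp [Nat.sub_ne_zero_of_lt hr']
  rw [revS, Polynomial.eval_mul, Polynomial.eval_pow, Polynomial.eval_pow, hW]
  simp [hk]

lemma exists_jf (hA : A.det = p) (hf : mob A τ = τ) : ∃ l : OO, (l : ℂ) = jf A τ := by
  have hA0 : 0 < A.det := by rw [hA]; exact_mod_cast hp.out.pos
  refine ⟨⟨jf A τ, Polynomial.X ^ 2 - Polynomial.C (A 0 0 + A 1 1) * Polynomial.X +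
    Polynomial.C A.det, by monicity!, ?_⟩, rfl⟩
  have h1 := jf_charpoly hA0 hf
  rw [Polynomial.eval₂_add, Polynomial.eval₂_sub, Polynomial.eval₂_mul, Polynomial.eval₂_pow,
    Polynomial.eval₂_X, Polynomial.eval₂_C, Polynomial.eval₂_C]
  simpa using h1

lemma jf_adjugate : jf A.adjugate τ = A 0 0 + A 1 1 - jf A τ := by
  simp [jf, Matrix.adjugate_fin_two]
  ring

lemma revS_ne_zero_of_trace (h : Lv N e) (hp5 : 5 ≤ p) (φ : OO →+* k) (hA : A.det = p)
    (hf : mob A τ = τ) {V : OO} (hV : (V : ℂ) = hv N e τ) (ht : A 0 0 + A 1 1 ≠ 0) :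
    ((revS N e p).map (ZMod.castHom dvd_rfl k)).eval (φ V) ≠ 0 := by
  have hA0 : 0 < A.det := by rw [hA]; exact_mod_cast hp.out.pos
  intro h0
  have hp0 : (p : ℂ) ≠ 0 := by exact_mod_cast hp.out.ne_zero
  have hφp : φ p = 0 := by rw [map_natCast, CharP.cast_eq_zero]
  have key {B : M2} (hB : B.det = p) (hfB : mob B τ = τ) {c : OO} (hc : c * jf B τ = p)
      (hφ : φ c ≠ 0) : False := by
    have hB0 : 0 < B.det := by rw [hB]; exact_mod_cast hp.out.pos
    have hj := jf_ne_zero hB0 (τ := τ)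
    have h1 := cm_relation (a := c ^ 12) (b := p ^ 12) (c := c ^ 12) h hp5 φ hB hfB hV
      (fun h => hφ (by rw [pow_eq_zero_iff (by norm_num) |>.mp h, map_zero])) (mul_comm _ _)
      (by rw [map_pow, hφp, zero_pow (by norm_num)])
      (by rw [← hc, mul_div_cancel_right₀ _ hj]; rfl)
    rw [h0, sub_zero] at h1
    simp only [mul_eq_zero, map_pow, pow_eq_zero_iff', hφ, false_and, false_or] at h1
    refine revS_zero (N := N) (e := e) (k := k) h hp5 ?_
    rw [h1.1] at h0
    exact h0
  obtain ⟨l, hl⟩ := exists_jf hA hf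
  have h1 := jf_charpoly hA0 hf
  have h2 : ((A 0 0 + A 1 1 : ℤ) - l) * l = (p : OO) := by
    refine Subtype.ext ?_
    push_cast
    rw [hl]
    rw [hA] at h1
    push_cast at h1
    linear_combination -h1
  have h3 : φ (((A 0 0 + A 1 1 : ℤ) : OO) - l) ≠ 0 ∨ φ l ≠ 0 := by
    by_contra! hcon
    have h4 : φ ((A 0 0 + A 1 1 : ℤ) : OO) = 0 := by
      rw [← sub_add_cancel ((A 0 0 + A 1 1 : ℤ) : OO) l, map_add, hcon.1, hcon.2, add_zero]
    rw [map_intCast, CharP.intCast_eq_zero_iff k p] at h4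
    exact not_dvd_trace hp5 hA hf ht h4
  rcases h3 with h3 | h3
  · exact key hA hf (by rw [← hl]; exact_mod_cast congrArg Subtype.val h2) h3
  · have hB : A.adjugate.det = p := by rw [Matrix.det_adjugate]; simp [hA]
    refine key hB ?_ (c := l) ?_ h3
    · rw [mob_eq_self_iff hA0] at hf
      rw [mob_eq_self_iff (by rw [hB, ← hA]; exact hA0)]
      simp [Matrix.adjugate_fin_two]
      linear_combination -hf
    · have := congrArg Subtype.val h2
      push_cast at this
      rw [jf_adjugate, ← hl]
      linear_combination this

lemma revS_eq_zero_of_trace (h : Lv N e) (hp5 : 5 ≤ p) (φ : OO →+* k) (hA : A.det = p)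
    (hf : mob A τ = τ) {V : OO} (hV : (V : ℂ) = hv N e τ) (ht : A 0 0 + A 1 1 = 0) :
    ((revS N e p).map (ZMod.castHom dvd_rfl k)).eval (φ V) = 0 := by
  have hA0 : 0 < A.det := by rw [hA]; exact_mod_cast hp.out.pos
  have hp0 : (p : ℂ) ≠ 0 := by exact_mod_cast hp.out.ne_zero
  have hφp : φ p = 0 := by rw [map_natCast, CharP.cast_eq_zero]
  have h2 := traceless_sq ht hA0 hf
  have h3 : (((p ^ 6 : OO) : OO) : ℂ) = (p / jf A τ) ^ 12 := by
    have : jf A τ ^ 12 = p ^ 6 := by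
      rw [show jf A τ ^ 12 = (jf A τ ^ 2) ^ 6 by ring, h2, hA]; push_cast; ring
    rw [div_pow, this]
    push_cast
    field_simp
  have h1 := cm_relation (a := 1) (b := p ^ 6) (c := p ^ 6) h hp5 φ hA hf hV
    (by exact_mod_cast pow_ne_zero 6 hp.out.ne_zero) (by ring)
    (by rw [map_pow, hφp, zero_pow (by norm_num)]) h3
  rw [map_pow, hφp] at h1
  simpa [hp.out.ne_zero] using h1

end

section

open scoped Manifold UpperHalfPlane Topology
open UpperHalfPlane Filter Function.Periodic

variable {N e p : ℕ} [hp : Fact p.Prime]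

omit hp in
lemma Lv.not_dvd (h : Lv N e) (hp5 : 5 ≤ p) : ¬ p ∣ N := fun hd => by
  have h1 := Nat.le_of_dvd h.pos hd
  rcases h with ⟨rfl, _⟩ | ⟨rfl, _⟩ <;> omega

variable (N e p) in
/-- The diagonal value of the modular equation of level `p` for the Hauptmodul `hv N e`. -/
def Dv (τ : ℍ) : ℂ := ∏ i, (hv N e τ - hv N e (mob (al p i) τ))

lemma Dv_inv (h : Lv N e) (hp5 : 5 ≤ p) : Inv0 N (Dv N e p) := by
  intro A hA hA' τ
  rw [Dv, hv_gamma0 h hA hA']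
  exact prod_comp_al (hv_G0 h) (h.not_dvd hp5) (fun y => hv N e τ - y) A hA hA' τ

lemma Dv_mdiff (h : Lv N e) : MDiff (Dv N e p) := by
  have h3 (i : Option (ZMod p)) : MDiff (fun τ => hv N e τ - hv N e (mob (al p i) τ)) :=
    (hv_mdiff h.pos).sub (MDiff.comp_mob (hv_mdiff h.pos) (det_al_pos i))
  unfold Dv
  simp only [UpperHalfPlane.mdifferentiable_iff] at h3 ⊢
  exact DifferentiableOn.fun_finsetProd fun i _ => h3 i

lemma Dv_S_bounded (h : Lv N e) (hp5 : 5 ≤ p) :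
    IsBoundedAtImInfty (fun τ => Dv N e p (mob matS τ)) :=
  bdd_prod fun i _ => by
    have h1 := bdd_mul (bdd_const (-1)) (hv_al_S_bounded h (h.not_dvd hp5) i)
    refine ((hv_S_bounded h).add h1).congr_left fun τ => ?_
    simp [sub_eq_add_neg]

lemma Dv_none_hasPS (h : Lv N e) :
    HasPS 1 (fun τ => qParam 1 τ ^ p * (hv N e τ - hv N e (mob (al p none) τ)))
      (PowerSeries.map (Int.castRingHom OO)
        (PowerSeries.X ^ (p - 1) * hU N e - PowerSeries.expand p hp.out.ne_zero (hU N e))) := by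
  have h1 := (hv_hasPS h).comp_expand (mob (al p none)) hp.out.ne_zero (k := 1)
    fun τ => qParam_mul hp.out.pos
  refine ((((HasPS.qpow (p - 1)).mul (hv_hasPS h)).sub h1).ofInt OO).congr' fun τ => ?_
  obtain ⟨m, hm⟩ := Nat.exists_eq_add_of_le' hp.out.one_le
  rw [show qParam 1 (mob (al p none) τ) = qParam 1 τ ^ p from qParam_mul hp.out.pos, mul_sub, ← mul_assoc,
    ← pow_succ, Nat.sub_add_cancel hp.out.one_le]

lemma Dv_some_hasPS (h : Lv N e) (b : ZMod p) :
    HasPS p (fun τ => qParam 1 τ * (hv N e τ - hv N e (mob (al p (some b)) τ)))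
      (PowerSeries.map (Int.castRingHom OO) (PowerSeries.expand p hp.out.ne_zero (hU N e)) -
        PowerSeries.C (zet p ^ (b.val * (p - 1))) * (PowerSeries.X ^ (p - 1) *
          PowerSeries.rescale (zet p ^ b.val) (PowerSeries.map (Int.castRingHom OO) (hU N e)))) := by
  have h1 := ((hv_hasPS h).ofInt OO).comp_rescale (mob (al p (some b))) (zet p ^ b.val)
    (k := p) (qParam_al_some b)
  have h2 := ((hv_hasPS h).of_pow hp.out.ne_zero qParam_one_eq_pow).ofInt OO
  refine (h2.sub (((HasPS.qpow (p - 1)).mul h1).cmul (zet p ^ (b.val * (p - 1))))).congr' fun τ => ?_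
  have h3 : algebraMap OO ℂ (zet p ^ (b.val * (p - 1))) * algebraMap OO ℂ (zet p ^ b.val) = 1 := by
    rw [← map_mul, ← pow_add, ← Nat.mul_succ, Nat.succ_eq_add_one,
      Nat.sub_add_cancel hp.out.one_le, mul_comm, pow_mul, zet_pow, one_pow, map_one]
  have h4 : qParam 1 τ = qParam p τ ^ (p - 1) * qParam p τ := by
    rw [← pow_succ, Nat.sub_add_cancel hp.out.one_le, qParam_one_eq_pow (p := p)]
  rw [mul_sub, qParam_al_some]
  congr 1
  rw [h4]
  linear_combination (-(qParam p τ ^ (p - 1) * qParam p τ * hv N e (mob (al p (some b)) τ))) * h3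

variable {k : Type*} [Field k] [CharP k p]

lemma Dv_hasPS (h : Lv N e) (hp5 : 5 ≤ p) (φ : OO →+* k) :
    ∃ G : PowerSeries OO, HasPS 1 (fun τ => qParam 1 τ ^ (2 * p) * Dv N e p τ) G ∧
      PowerSeries.constantCoeff G = -1 ∧
      PowerSeries.map φ G =
        -(barX k (hU N e) ^ p - barX k (hU N e) * PowerSeries.X ^ (p - 1)) ^ 2 := by
  have h1 := ((Dv_none_hasPS (p := p) h).of_pow hp.out.ne_zero qParam_one_eq_pow).mul
    (HasPS.prod Finset.univ fun b _ => Dv_some_hasPS (p := p) h b)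
  have h2 := h1.congr' (g := fun τ => qParam 1 τ ^ (2 * p) * Dv N e p τ) fun τ => by
    rw [Dv, Fintype.prod_option, Finset.prod_mul_distrib, Finset.prod_const, Finset.card_univ,
      ZMod.card, two_mul, pow_add]
    ring
  have hper (τ : ℍ) : qParam 1 ((1 : ℝ) +ᵥ τ) ^ (2 * p) * Dv N e p ((1 : ℝ) +ᵥ τ) =
      qParam 1 τ ^ (2 * p) * Dv N e p τ := by
    have h3 := mob_T (τ := τ) 1
    rw [Int.cast_one] at h3
    rw [(HasPS.q (R := ℤ) (h := 1)).vadd one_ne_zero, ← h3,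
      (Dv_inv h hp5).apply (G0.T 1)]
  obtain ⟨G, hG, hGe⟩ := h2.descend OO_injective hper
  have hp1 : p - 1 ≠ 0 := by omega
  refine ⟨G, hG, ?_, expand_injective (p := p) ?_⟩
  · have h3 := congrArg PowerSeries.constantCoeff hGe
    rw [PowerSeries.constantCoeff_expand] at h3
    rw [h3]
    have h4 : PowerSeries.constantCoeff (PowerSeries.map (Int.castRingHom OO) (hU N e)) = 1 := by
      rw [← PowerSeries.coeff_zero_eq_constantCoeff_apply, PowerSeries.coeff_map,
        PowerSeries.coeff_zero_eq_constantCoeff_apply, constCoeff_hU, map_one]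
    simp [map_mul, map_prod, h4, hp1, PowerSeries.constantCoeff_expand, hp.out.ne_zero]
  · rw [← PowerSeries.map_expand, hGe]
    have h5 : barX k (hU N e) ^ p - barX k (hU N e) * PowerSeries.X ^ (p - 1) =
        barX k (hU N e ^ p - hU N e * PowerSeries.X ^ (p - 1)) := by
      simp [barX]
    rw [h5, map_neg, map_pow, expand_barX]
    simp only [map_mul, map_prod, map_sub, PowerSeries.map_expand, map_pow, PowerSeries.map_X,
      PowerSeries.map_C, φ_zet, one_pow, map_one, one_mul,
      map_rescale_zet, map_ofInt, Finset.prod_const, Finset.card_univ, ZMod.card]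
    have hX : barX k PowerSeries.X = PowerSeries.X := by simp [barX]
    have : CharP (PowerSeries k) p := charP_of_injective_ringHom PowerSeries.C_injective p
    rw [expand_barX, map_pow, expand_barX, ← hX, expand_barX, mul_comm (barX k PowerSeries.X ^ (p - 1)),
      show (barX k PowerSeries.X ^ p) ^ (p - 1) * barX k (hU N e) ^ p - (barX k (hU N e) ^ p) ^ p =
        -(barX k (hU N e) ^ p - barX k (hU N e) * barX k PowerSeries.X ^ (p - 1)) ^ p by
        rw [sub_pow_char, mul_pow, pow_right_comm]; ring]
    ring

theorem exists_Dv_polynomial (h : Lv N e) (hp5 : 5 ≤ p) (φ : OO →+* k) :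
    ∃ Q : Polynomial OO, Q.natDegree ≤ 2 * p ∧ Q.coeff (2 * p) = -1 ∧
      (∀ τ, Dv N e p τ = Polynomial.aeval (hv N e τ) Q) ∧
      Q.map φ = -(Polynomial.X ^ p - Polynomial.X) ^ 2 := by
  obtain ⟨G, hG, hG0, hGb⟩ := Dv_hasPS h hp5 φ
  obtain ⟨Q, hQd, hQc, hQ⟩ := exists_polynomial h _ (Dv_mdiff h) (Dv_inv h hp5) (Dv_S_bounded h hp5) hG
  have h1 : (Polynomial.X ^ p - Polynomial.X : Polynomial k).natDegree ≤ p := by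
    refine (Polynomial.natDegree_sub_le _ _).trans (max_le ?_ ?_)
    · rw [Polynomial.natDegree_X_pow]
    · rw [Polynomial.natDegree_X]; exact hp.out.one_le
  have h2 : homPS p (Polynomial.X ^ p - Polynomial.X) (barX k (hU N e)) =
      barX k (hU N e) ^ p - barX k (hU N e) * PowerSeries.X ^ (p - 1) := by
    have e1 := homPS_monomial (le_refl p) 1 (barX k (hU N e))
    have e2 := homPS_monomial hp.out.one_le 1 (barX k (hU N e))
    rw [map_one, map_one, one_mul, one_mul, Nat.sub_self, pow_zero, mul_one] at e1
    rw [map_one, map_one, one_mul, one_mul, pow_one, pow_one] at e2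
    rw [homPS_sub, e1, e2]
  refine ⟨Q, hQd, hQc.trans hG0, hQ, polynomial_map_eq φ h hQd ?_ (hG.congr' fun τ => by rw [hQ]) ?_⟩
  · rw [Polynomial.natDegree_neg]
    exact Polynomial.natDegree_pow_le.trans (Nat.mul_le_mul_left 2 h1)
  · rw [homPS_neg, homPS_pow h1, h2, hGb]

end

section

open scoped Manifold UpperHalfPlane Topology
open UpperHalfPlane Filter Function.Periodic

variable {N e p : ℕ} [hp : Fact p.Prime] {A B : M2} {τ : ℍ}

lemma det_pos_of_eq (hA : A.det = p) : 0 < A.det := by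
  rw [hA]; exact_mod_cast hp.out.pos

omit hp in
lemma traceless_eq_or_neg_of_pos {n : ℤ} (hn : 0 < n) (hA : A.det = n) (hB : B.det = n)
    (hAt : A 0 0 + A 1 1 = 0) (hBt : B 0 0 + B 1 1 = 0)
    (h1 : mob A τ = τ) (h2 : mob B τ = τ) : B = A ∨ B = -A := by
  obtain ⟨e1, e2⟩ := fix_proportional (hA ▸ hn) (hB ▸ hn) h1 h2
  have hA1 : A 1 1 = - A 0 0 := by linarith
  have hApos : 0 < A.det := hA ▸ hn
  have hB1 : B 1 1 = - B 0 0 := by linarith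
  rw [hA1, hB1] at e2
  have e3 : B 1 0 * A 0 0 = A 1 0 * B 0 0 := by linarith
  rw [Matrix.det_fin_two, hA1] at hA
  rw [Matrix.det_fin_two, hB1] at hB
  have hA0 : A 1 0 ≠ 0 := by
    intro h0
    rw [mob_eq_self_iff hApos, h0, hA1] at h1
    have him := congrArg Complex.im h1
    simp at him
    have : A 0 0 = 0 := by
      have h3 := him.resolve_right τ.im_ne_zero
      norm_cast at h3
      linarith
    rw [this, h0] at hA
    linarith
  have e4 : B 1 0 ^ 2 = A 1 0 ^ 2 := by
    refine mul_right_cancel₀ hn.ne' ?_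
    linear_combination -B 1 0 ^ 2 * hA + A 1 0 ^ 2 * hB -
      (B 1 0 * A 0 0 + A 1 0 * B 0 0) * e3 - B 1 0 * A 1 0 * e1
  rcases sq_eq_sq_iff_eq_or_eq_neg.mp e4 with e5 | e5
  · left
    rw [e5] at e1 e3
    have f1 := mul_left_cancel₀ hA0 e1
    have f3 := mul_left_cancel₀ hA0 e3
    ext i j
    fin_cases i <;> fin_cases j <;> simp [*]
  · right
    rw [e5] at e1 e3
    have f1 : A 0 1 = -B 0 1 := mul_left_cancel₀ hA0 (by linarith)
    have f3 : A 0 0 = -B 0 0 := mul_left_cancel₀ hA0 (by linarith)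
    ext i j
    fin_cases i <;> fin_cases j <;> simp [*]

lemma traceless_eq_or_neg (hA : A.det = p) (hB : B.det = p) (hAt : A 0 0 + A 1 1 = 0)
    (hBt : B 0 0 + B 1 1 = 0) (h1 : mob A τ = τ) (h2 : mob B τ = τ) : B = A ∨ B = -A :=
  traceless_eq_or_neg_of_pos (by exact_mod_cast hp.out.pos) hA hB hAt hBt h1 h2

lemma Dv_eq_zero_iff (h : Lv N e) (hp5 : 5 ≤ p) :
    Dv N e p τ = 0 ↔ ∃ A : M2, A.det = p ∧ (N : ℤ) ∣ A 1 0 ∧ mob A τ = τ := by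
  rw [Dv, Finset.prod_eq_zero_iff]
  constructor
  · rintro ⟨i, -, hi⟩
    obtain ⟨G, hG, hm⟩ := hv_injective h (sub_eq_zero.mp hi).symm
    refine ⟨G * al p i, by rw [Matrix.det_mul, hG.1, det_al, one_mul], ?_, ?_⟩
    · rw [Matrix.mul_apply, Fin.sum_univ_two, al_one_zero]
      simpa using hG.2.mul_right _
    · rw [mob_mul hG.det_pos (det_al_pos i), hm]
  · rintro ⟨A, hA, hc, hf⟩
    obtain ⟨i, G, hG, rfl⟩ := exists_eq_mul_al (h.not_dvd hp5) hA hc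
    refine ⟨i, Finset.mem_univ _, sub_eq_zero.mpr ?_⟩
    conv_lhs => rw [← hf]
    rw [mob_mul hG.det_pos (det_al_pos i), (hv_G0 h).apply hG]

lemma dq_Dv_ne_zero (h : Lv N e) (hp5 : 5 ≤ p) (hA : A.det = p) (hc : (N : ℤ) ∣ A 1 0)
    (hf : mob A τ = τ) (ht : A 0 0 + A 1 1 = 0)
    (hall : ∀ B : M2, B.det = p → mob B τ = τ → B 0 0 + B 1 1 = 0) : dq (Dv N e p) τ ≠ 0 := by
  obtain ⟨i, G, hG, hGA⟩ := exists_eq_mul_al (h.not_dvd hp5) hA hc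
  have h3 (j : Option (ZMod p)) : MDiff (fun τ => hv N e τ - hv N e (mob (al p j) τ)) :=
    (hv_mdiff h.pos).sub (MDiff.comp_mob (hv_mdiff h.pos) (det_al_pos j))
  have h4 : MDiff (fun τ => ∏ j ∈ Finset.univ.erase i, (hv N e τ - hv N e (mob (al p j) τ))) := by
    simp only [UpperHalfPlane.mdifferentiable_iff] at h3 ⊢
    exact DifferentiableOn.fun_finsetProd fun j _ => h3 j
  have e1 : Dv N e p = fun τ => (hv N e τ - hv N e (mob (al p i) τ)) *
      ∏ j ∈ Finset.univ.erase i, (hv N e τ - hv N e (mob (al p j) τ)) := by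
    funext σ
    exact (Finset.mul_prod_erase _ _ (Finset.mem_univ i)).symm
  have e2 (σ : ℍ) : hv N e (mob (al p i) σ) = hv N e (mob A σ) := by
    rw [hGA, mob_mul hG.det_pos (det_al_pos i), (hv_G0 h).apply hG]
  have e3 : hv N e τ - hv N e (mob (al p i) τ) = 0 := by rw [e2, hf, sub_self]
  have hA0 := det_pos_of_eq hA
  have hm : MDiff (fun σ => -1 * hv N e (mob A σ)) :=
    (mdifferentiable_const (c := (-1 : ℂ))).mul (MDiff.comp_mob (hv_mdiff h.pos) hA0)
  have e4 : dq (fun τ => hv N e τ - hv N e (mob (al p i) τ)) τ = 2 * dq (hv N e) τ := by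
    have : (fun τ => hv N e τ - hv N e (mob (al p i) τ)) =
        fun τ => hv N e τ + -1 * hv N e (mob A τ) := by
      funext σ; rw [e2]; ring
    have hj := jf_ne_zero hA0 (τ := τ)
    rw [this, dq_add (hv_mdiff h.pos) hm, dq_mul mdifferentiable_const
      (MDiff.comp_mob (hv_mdiff h.pos) hA0), dq_const, dq_comp_mob (hv_mdiff h.pos) hA0, hf]
    have h5 := traceless_sq ht hA0 hf
    have h6 : (A.det : ℂ) / jf A τ ^ 2 = -1 := by
      rw [div_eq_iff (pow_ne_zero 2 hj), h5]; ring
    rw [h6]; ring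
  rw [e1, dq_mul (h3 i) h4, e3, e4, zero_mul, add_zero]
  refine mul_ne_zero (mul_ne_zero two_ne_zero (dq_hv_ne_zero h hp.out hp5 hA ht hf))
    (Finset.prod_ne_zero_iff.mpr fun j hj h0 => (Finset.ne_of_mem_erase hj) ?_)
  obtain ⟨G', hG', hm'⟩ := hv_injective h (sub_eq_zero.mp h0).symm
  have hB : (G' * al p j).det = p := by rw [Matrix.det_mul, hG'.1, det_al, one_mul]
  have hBf : mob (G' * al p j) τ = τ := by rw [mob_mul hG'.det_pos (det_al_pos j), hm']
  rcases traceless_eq_or_neg hA hB ht (hall _ hB hBf) hf hBf with h7 | h7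
  · refine (al_injective (G := G.adjugate * G') ?_).symm
    rw [mul_assoc, h7, hGA, ← mul_assoc, hG.adjugate_mul, one_mul]
  · refine (al_injective (G := -(G.adjugate * G')) ?_).symm
    rw [neg_mul, mul_assoc, h7, hGA, mul_neg, ← mul_assoc, hG.adjugate_mul, one_mul, neg_neg]

lemma dq_aeval {R : Type*} [CommRing R] [Algebra R ℂ] {f : ℍ → ℂ} (hf : MDiff f)
    (Q : Polynomial R) : dq (fun τ => Polynomial.aeval (f τ) Q) τ =
      Polynomial.aeval (f τ) (Polynomial.derivative Q) * dq f τ := by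
  refine dq_of_hasDerivAt ?_
  have h1 := ((Q.hasDerivAt_aeval ((f ∘ ofComplex) τ)).comp (τ : ℂ) (MDiff.hasDerivAt hf τ))
  refine h1.congr_deriv ?_
  simp only [Function.comp_apply, ofComplex_apply]
  ring

end

section

open scoped Manifold UpperHalfPlane Topology
open UpperHalfPlane Filter Function.Periodic

variable {N e p : ℕ} [hp : Fact p.Prime] {A B : M2} {τ : ℍ}

lemma OO_isIntegral (x : OO) : IsIntegral ℤ (x : ℂ) := x.2

variable (p) in
lemma exists_residue : ∃ (k : Type) (_ : Field k) (_ : CharP k p), Nonempty (OO →+* k) := by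
  have h1 : Ideal.span {(p : OO)} ≠ ⊤ := by
    rw [Ne, Ideal.span_singleton_eq_top]
    rintro ⟨u, hu⟩
    have h2 : (p : ℂ) * ((u⁻¹ : OOˣ) : OO) = 1 := by
      have := congrArg (algebraMap OO ℂ) (u.mul_inv)
      rw [hu, map_mul, map_natCast, map_one] at this
      exact this
    have hp0 : (p : ℂ) ≠ 0 := by exact_mod_cast hp.out.ne_zero
    have h3 : IsIntegral ℤ (algebraMap ℚ ℂ (1 / p)) := by
      have := OO_isIntegral ((u⁻¹ : OOˣ) : OO)
      have h2' : (((u⁻¹ : OOˣ) : OO) : ℂ) = 1 / p := by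
        rw [eq_div_iff hp0, mul_comm]; exact h2
      rw [h2'] at this
      simpa using this
    have h4 : IsIntegral ℤ (1 / p : ℚ) :=
      (isIntegral_algebraMap_iff (algebraMap ℚ ℂ).injective).mp h3
    obtain ⟨z, hz⟩ := IsIntegrallyClosed.isIntegral_iff.mp h4
    have hpq : (p : ℚ) ≠ 0 := by exact_mod_cast hp.out.ne_zero
    rw [eq_div_iff hpq] at hz
    have h5 : z * (p : ℤ) = 1 := by
      have : ((z * (p : ℤ) : ℤ) : ℚ) = 1 := by push_cast; exact hz
      exact_mod_cast this
    have h6 := Int.isUnit_iff.mp (IsUnit.of_mul_eq_one_right _ h5)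
    have := hp.out.two_le
    omega
  obtain ⟨M, hM, hle⟩ := Ideal.exists_le_maximal _ h1
  let _ : Field (OO ⧸ M) := Ideal.Quotient.field M
  refine ⟨OO ⧸ M, inferInstance, ?_, ⟨Ideal.Quotient.mk M⟩⟩
  have h2 : ((p : ℕ) : OO ⧸ M) = 0 := by
    rw [← map_natCast (Ideal.Quotient.mk M), Ideal.Quotient.eq_zero_iff_mem]
    exact hle (Ideal.mem_span_singleton_self _)
  exact (CharP.charP_iff_prime_eq_zero hp.out).mpr h2

/-- A monic polynomial over the ring of algebraic integers splits. -/
lemma exists_roots_OO {P : Polynomial OO} (hP : P.Monic) :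
    ∃ S : Multiset OO, S.map (algebraMap OO ℂ) = (P.map (algebraMap OO ℂ)).roots ∧
      P = (S.map fun x => Polynomial.X - Polynomial.C x).prod := by
  have h1 : ∀ z ∈ (P.map (algebraMap OO ℂ)).roots, ∃ x : OO, algebraMap OO ℂ x = z := by
    intro z hz
    have h2 : IsIntegral OO z := by
      refine ⟨P, hP, ?_⟩
      rw [← Polynomial.eval_map]
      exact (Polynomial.mem_roots'.mp hz).2
    have : Algebra.IsIntegral ℤ OO := integralClosure.AlgebraIsIntegral
    exact ⟨⟨z, isIntegral_trans z h2⟩, rfl⟩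
  obtain ⟨S, hS⟩ : ∃ S : Multiset OO, S.map (algebraMap OO ℂ) = (P.map (algebraMap OO ℂ)).roots :=
    (have : CanLift ℂ OO (algebraMap OO ℂ) fun z => ∃ x : OO, algebraMap OO ℂ x = z := ⟨fun _ h => h⟩
    CanLift.prf (coe := Multiset.map (algebraMap OO ℂ)) _ h1)
  refine ⟨S, hS, Polynomial.map_injective _ OO_injective ?_⟩
  have h3 := (IsAlgClosed.splits (P.map (algebraMap OO ℂ))).eq_prod_roots_of_monic (hP.map _)
  rw [h3, ← hS, Polynomial.map_multiset_prod, Multiset.map_map, Multiset.map_map]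
  refine congrArg Multiset.prod (Multiset.map_congr rfl fun x _ => ?_)
  rw [Function.comp_apply, Function.comp_apply, Polynomial.map_sub, Polynomial.map_X, Polynomial.map_C]

variable {k : Type*} [Field k] [CharP k p]

lemma roots_X_pow_sub_X_sq :
    ((Polynomial.X ^ p - Polynomial.X : Polynomial k) ^ 2).roots =
      2 • (Finset.univ.val.map (ZMod.castHom (dvd_refl p) k)) := by
  have h1 : (Polynomial.X ^ p - Polynomial.X : Polynomial (ZMod p)) =
      ∏ a : ZMod p, (Polynomial.X - Polynomial.C a) := by
    have h0 : (Polynomial.X ^ p - Polynomial.X : Polynomial (ZMod p)).Splits := by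
      have := FiniteField.splits_X_pow_card_sub_X (K := ZMod p) (p := p)
      rwa [Algebra.algebraMap_self, Polynomial.map_id, ZMod.card] at this
    have h3 := FiniteField.roots_X_pow_card_sub_X (ZMod p)
    rw [ZMod.card] at h3
    have h4 : (Polynomial.X ^ p - Polynomial.X : Polynomial (ZMod p)).Monic :=
      Polynomial.monic_X_pow_sub (by
        rw [Polynomial.degree_X]; exact_mod_cast hp.out.one_lt)
    have h5 := h0.eq_prod_roots_of_monic h4
    rwa [h3] at h5
  have h2 := congrArg (Polynomial.map (ZMod.castHom (dvd_refl p) k)) h1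
  rw [Polynomial.map_sub, Polynomial.map_pow, Polynomial.map_X, Polynomial.map_prod] at h2
  simp only [Polynomial.map_sub, Polynomial.map_X, Polynomial.map_C] at h2
  rw [Polynomial.roots_pow, h2]
  refine congrArg (2 • ·) ?_
  rw [← Polynomial.roots_multiset_prod_X_sub_C (Finset.univ.val.map (ZMod.castHom (dvd_refl p) k)),
    Multiset.map_map]
  rfl

end

section

open scoped Manifold UpperHalfPlane Topology
open UpperHalfPlane Filter Function.Periodic

variable {N e p : ℕ} [hp : Fact p.Prime] {A B : M2} {τ : ℍ}

variable (N p) in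
/-- The fixed points of traceless integral matrices of determinant `p` and level `N`. -/
def FixN : Set ℍ :=
  {τ | ∃ A : M2, A.det = p ∧ A 0 0 + A 1 1 = 0 ∧ (N : ℤ) ∣ A 1 0 ∧ mob A τ = τ}

theorem ncard_image_FixN (h : Lv N e) (hp5 : 5 ≤ p) :
    (hv N e '' FixN N p).ncard =
      2 * (Finset.univ.filter fun y : ZMod p => (revS N e p).eval y = 0).card := by
  classical
  obtain ⟨k, _, _, ⟨φ⟩⟩ := exists_residue p
  obtain ⟨Q, hQd, hQc, hQ, hQφ⟩ := exists_Dv_polynomial h hp5 φ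
  have hmon : (-Q).Monic := Polynomial.monic_of_natDegree_le_of_coeff_eq_one (2 * p)
    (by rwa [Polynomial.natDegree_neg]) (by rw [Polynomial.coeff_neg, hQc, neg_neg])
  obtain ⟨S, hS, hSp⟩ := exists_roots_OO hmon
  have hroot (x : OO) : x ∈ S ↔ Polynomial.aeval (x : ℂ) Q = 0 := by
    rw [← Multiset.mem_map_of_injective OO_injective, hS, Polynomial.mem_roots (hmon.map _).ne_zero,
      Polynomial.IsRoot, Polynomial.eval_map, ← Polynomial.aeval_def, map_neg, neg_eq_zero]
    rfl
  have hSφ : S.map φ = 2 • (Finset.univ.val.map (ZMod.castHom (dvd_refl p) k)) := by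
    have h1 := congrArg (Polynomial.map φ) hSp
    rw [Polynomial.map_neg, hQφ, neg_neg, Polynomial.map_multiset_prod, Multiset.map_map] at h1
    have h2 := congrArg Polynomial.roots h1
    rw [roots_X_pow_sub_X_sq] at h2
    rw [h2, ← Polynomial.roots_multiset_prod_X_sub_C (S.map φ), Multiset.map_map]
    simp
  set σ : Polynomial k := (revS N e p).map (ZMod.castHom dvd_rfl k) with hσ
  set T := S.filter fun x => σ.eval (φ x) = 0 with hT
  have hTcard : T.card = 2 * (Finset.univ.filter fun y : ZMod p => (revS N e p).eval y = 0).card := by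
    have h1 : T.map φ = (S.map φ).filter fun y => σ.eval y = 0 := by
      rw [Multiset.filter_map]; rfl
    rw [← Multiset.card_map φ, h1, hSφ, Multiset.filter_nsmul, Multiset.card_nsmul,
      Multiset.filter_map, Multiset.card_map]
    have h2 : ((fun y => σ.eval y = 0) ∘ (ZMod.castHom (dvd_refl p) k)) =
        fun y : ZMod p => (revS N e p).eval y = 0 := by
      funext y
      rw [Function.comp_apply, hσ, Polynomial.eval_map_apply, map_eq_zero]
    simp only [h2]
    rfl
  have hlift {x : OO} (hx : x ∈ T) : ∃ τ, hv N e τ = x ∧ Polynomial.aeval (hv N e τ) Q = 0 ∧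
      ∃ A : M2, A.det = p ∧ A 0 0 + A 1 1 = 0 ∧ (N : ℤ) ∣ A 1 0 ∧ mob A τ = τ := by
    obtain ⟨hxS, hx0⟩ := Multiset.mem_filter.mp hx
    have hx1 : (x : ℂ) ≠ 0 := by
      intro h0
      have h1 : x = 0 := Subtype.ext h0
      rw [h1, map_zero] at hx0
      exact revS_zero h hp5 hx0
    obtain ⟨τ, hτ⟩ := exists_hv_eq h hx1
    have h2 := (hroot x).mp hxS
    rw [← hτ] at h2
    obtain ⟨A, hA, hc, hf⟩ := (Dv_eq_zero_iff h hp5).mp ((hQ τ).trans h2)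
    refine ⟨τ, hτ, h2, A, hA, ?_, hc, hf⟩
    by_contra ht
    exact revS_ne_zero_of_trace h hp5 φ hA hf hτ.symm ht hx0
  have hset : hv N e '' FixN N p = (algebraMap OO ℂ) '' (T.toFinset : Set OO) := by
    ext z
    constructor
    · rintro ⟨τ, ⟨A, hA, ht, hc, hf⟩, rfl⟩
      have h1 : Polynomial.aeval (hv N e τ) Q = 0 := by
        rw [← hQ, Dv_eq_zero_iff h hp5]
        exact ⟨A, hA, hc, hf⟩
      have h2 : hv N e τ ∈ S.map (algebraMap OO ℂ) := by
        rw [hS, Polynomial.mem_roots (hmon.map _).ne_zero, Polynomial.IsRoot, Polynomial.eval_map,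
          ← Polynomial.aeval_def, map_neg, h1, neg_zero]
      obtain ⟨x, hx, hxz⟩ := Multiset.mem_map.mp h2
      refine ⟨x, ?_, hxz⟩
      rw [Finset.mem_coe, Multiset.mem_toFinset, hT, Multiset.mem_filter]
      exact ⟨hx, revS_eq_zero_of_trace h hp5 φ hA hf hxz ht⟩
    · rintro ⟨x, hx, rfl⟩
      rw [Finset.mem_coe, Multiset.mem_toFinset] at hx
      obtain ⟨τ, hτ, -, A, hA⟩ := hlift hx
      exact ⟨τ, ⟨A, hA⟩, hτ⟩
  have hnodup : T.Nodup := by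
    rw [Multiset.nodup_iff_count_le_one]
    intro x
    by_cases hx : x ∈ T
    · obtain ⟨τ, hτ, h0, A, hA, ht, hc, hf⟩ := hlift hx
      obtain ⟨hxS, hx0⟩ := Multiset.mem_filter.mp hx
      refine (Multiset.count_le_of_le x (Multiset.filter_le _ _)).trans ?_
      rw [← Multiset.count_map_eq_count' _ S OO_injective, hS, Polynomial.count_roots]
      by_contra! hlt
      have h1 := ((Polynomial.one_lt_rootMultiplicity_iff_isRoot (hmon.map _).ne_zero).mp hlt).2
      have h2 := dq_Dv_ne_zero h hp5 hA hc hf ht fun B hB hBf => by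
        by_contra htB
        exact revS_ne_zero_of_trace h hp5 φ hB hBf hτ.symm htB hx0
      have h3 : Dv N e p = fun τ => Polynomial.aeval (hv N e τ) Q := funext hQ
      rw [h3, dq_aeval (hv_mdiff h.pos)] at h2
      refine left_ne_zero_of_mul h2 ?_
      rw [Polynomial.derivative_map, Polynomial.IsRoot, Polynomial.eval_map, ← Polynomial.aeval_def,
        Polynomial.derivative_neg, map_neg, neg_eq_zero] at h1
      rw [hτ]
      exact h1
    · rw [Multiset.count_eq_zero_of_notMem hx]; exact zero_le_one
  rw [hset, Set.ncard_image_of_injective _ OO_injective, Set.ncard_coe_finset,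
    Multiset.toFinset_card_of_nodup hnodup, hTcard]

end

section

variable {N e p : ℕ} [hp : Fact p.Prime]

variable (p) in
/-- The roots in `𝔽_p` of `W_m`. -/
def rootsW (m : ℕ) : Finset (ZMod p) := Finset.univ.filter fun y =>
  ∑ r ∈ Finset.range (m + 1), (m.choose r : ZMod p) ^ 2 * y ^ r = 0

lemma kap_zmod_ne_zero (h : Lv N e) (hp5 : 5 ≤ p) : (kap N e : ZMod p) ≠ 0 := by
  have hN : (N : ZMod p) ≠ 0 := by
    refine natCast_ne_zero_of_lt h.pos ?_
    rcases h with ⟨rfl, _⟩ | ⟨rfl, _⟩ <;> omega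
  rw [kap, Nat.cast_pow]; exact pow_ne_zero _ hN

lemma eval_revW (y : ZMod p) : (revW N e p).eval y = ∑ r ∈ Finset.range (mm N p + 1),
    ((mm N p).choose r : ZMod p) ^ 2 * (-(kap N e : ZMod p)) ^ r * y ^ (mm N p - r) := by
  rw [revW, Polynomial.eval_finsetSum]
  simp

lemma eval_revW_eq {y : ZMod p} (hy : y ≠ 0) : (revW N e p).eval y = y ^ mm N p *
    ∑ r ∈ Finset.range (mm N p + 1), ((mm N p).choose r : ZMod p) ^ 2 * (-kap N e / y) ^ r := by
  rw [eval_revW, Finset.mul_sum]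
  refine Finset.sum_congr rfl fun r hr => ?_
  have hr' : r ≤ mm N p := by have := Finset.mem_range.mp hr; omega
  rw [div_pow, pow_sub₀ _ hy hr']
  field_simp

lemma revW_zero_ne (h : Lv N e) (hp5 : 5 ≤ p) : (revW N e p).eval 0 ≠ 0 := by
  rw [eval_revW, Finset.sum_range_succ, Finset.sum_eq_zero]
  · simpa using fun h0 => absurd h0 (kap_zmod_ne_zero h hp5)
  · intro r hr
    have hr' := Finset.mem_range.mp hr
    simp [Nat.sub_ne_zero_of_lt hr']

omit hp in
lemma two_mm_lt (h : Lv N e) (hp5 : 5 ≤ p) : 2 * mm N p < p := by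
  rcases h with ⟨rfl, _⟩ | ⟨rfl, _⟩ <;> unfold mm <;> omega

lemma revW_neg_kap_ne (h : Lv N e) (hp5 : 5 ≤ p) :
    (revW N e p).eval (-(kap N e : ZMod p)) ≠ 0 := by
  have hk := neg_ne_zero.mpr (kap_zmod_ne_zero (p := p) h hp5)
  rw [eval_revW_eq hk, div_self hk]
  refine mul_ne_zero (pow_ne_zero _ hk) ?_
  simp only [one_pow, mul_one]
  have h1 : (∑ r ∈ Finset.range (mm N p + 1), ((mm N p).choose r : ZMod p) ^ 2) =
      ((2 * mm N p).choose (mm N p) : ℕ) := by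
    rw [← Nat.sum_range_choose_sq]
    push_cast
    rfl
  rw [h1, Ne, ZMod.natCast_eq_zero_iff]
  intro hd
  have h2 : (2 * mm N p).choose (mm N p) ∣ (2 * mm N p).factorial := by
    rw [← Nat.choose_mul_factorial_mul_factorial (show mm N p ≤ 2 * mm N p by omega), mul_assoc]
    exact dvd_mul_right _ _
  have := (hp.out.dvd_factorial).mp (hd.trans h2)
  have := two_mm_lt h hp5
  omega

theorem card_roots_revS (h : Lv N e) (hp5 : 5 ≤ p) :
    (Finset.univ.filter fun y : ZMod p => (revS N e p).eval y = 0).card =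
      (rootsW p (mm N p)).card + if dd N p = 0 then 0 else 1 := by
  classical
  have hk := neg_ne_zero.mpr (kap_zmod_ne_zero (p := p) h hp5)
  have h1 : (Finset.univ.filter fun y : ZMod p => (revS N e p).eval y = 0) =
      (Finset.univ.filter fun y : ZMod p => (revW N e p).eval y = 0) ∪
        if dd N p = 0 then ∅ else {-(kap N e : ZMod p)} := by
    ext y
    rw [Finset.mem_union, Finset.mem_filter, Finset.mem_filter, revS, Polynomial.eval_mul,
      Polynomial.eval_pow, Polynomial.eval_pow]
    by_cases hd : dd N p = 0
    · simp [hd]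
    · simp [hd, add_eq_zero_iff_eq_neg]
  have h2 : (Finset.univ.filter fun y : ZMod p => (revW N e p).eval y = 0).card =
      (rootsW p (mm N p)).card := by
    refine Finset.card_bij (fun y _ => -kap N e / y) ?_ ?_ ?_
    · intro y hy
      have hy0 := (Finset.mem_filter.mp hy).2
      have hy1 : y ≠ 0 := fun h0 => revW_zero_ne h hp5 (h0 ▸ hy0)
      rw [eval_revW_eq hy1] at hy0
      exact Finset.mem_filter.mpr ⟨Finset.mem_univ _,
        (mul_eq_zero.mp hy0).resolve_left (pow_ne_zero _ hy1)⟩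
    · intro y _ z _ hyz
      rw [← div_div_cancel₀ hk (b := y), hyz, div_div_cancel₀ hk]
    · intro z hz
      have hz0 := (Finset.mem_filter.mp hz).2
      have hz1 : z ≠ 0 := by
        rintro rfl
        rw [Finset.sum_range_succ'] at hz0
        simp at hz0
      have hy1 : -(kap N e : ZMod p) / z ≠ 0 := div_ne_zero hk hz1
      refine ⟨-kap N e / z, ?_, div_div_cancel₀ hk⟩
      rw [Finset.mem_filter, eval_revW_eq hy1, div_div_cancel₀ hk, hz0, mul_zero]
      exact ⟨Finset.mem_univ _, rfl⟩
  rw [h1, ← h2]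
  split_ifs with hd
  · simp
  · rw [Finset.card_union_of_disjoint, Finset.card_singleton]
    rw [Finset.disjoint_singleton_right, Finset.mem_filter]
    exact fun h0 => revW_neg_kap_ne h hp5 h0.2

end

section

open scoped UpperHalfPlane
open UpperHalfPlane

variable {N e p : ℕ} [hp : Fact p.Prime] {A G : M2} {τ : ℍ}

lemma not_isSquare_three_mul (hp5 : 5 ≤ p) : ¬ IsSquare ((3 * p : ℕ) : ℚ) := by
  rw [Rat.isSquare_natCast_iff]
  rintro ⟨m, hm⟩
  have h1 : p ∣ m := hp.out.dvd_of_dvd_pow (n := 2) ⟨3, by rw [sq, ← hm, mul_comm]⟩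
  obtain ⟨l, rfl⟩ := h1
  have h2 : 3 = p * (l * l) := by
    refine Nat.eq_of_mul_eq_mul_left hp.out.pos ?_
    linarith
  have := Nat.le_of_dvd (by norm_num) (Dvd.intro _ h2.symm)
  omega

/-- The stabiliser of a traceless fixed point in the modular group is trivial. -/
lemma eq_one_or_neg_one_of_fix (hp5 : 5 ≤ p) (hA : A.det = p) (ht : A 0 0 + A 1 1 = 0)
    (hf : mob A τ = τ) (hG : G.det = 1) (hGf : mob G τ = τ) : G = 1 ∨ G = -1 := by
  obtain ⟨e1, e2⟩ := fix_proportional (det_pos_of_eq hA) (by simp [hG]) hf hGf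
  have hA0 := ne_zero_of_fix hA hf
  have hA1 : A 1 1 = - A 0 0 := by linarith
  rw [Matrix.det_fin_two] at hA hG
  rw [hA1] at hA e2
  by_cases hc : G 1 0 = 0
  · rw [hc] at e1 e2 hG
    have f1 : G 0 1 = 0 := by
      refine (mul_eq_zero.mp (?_ : A 1 0 * G 0 1 = 0)).resolve_left hA0
      linarith
    have f2 : G 1 1 = G 0 0 := by
      have := (mul_eq_zero.mp (show A 1 0 * (G 1 1 - G 0 0) = 0 by linarith)).resolve_left hA0
      linarith
    have f3 : G 0 0 * G 0 0 = 1 := by rw [f2] at hG; linarith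
    rcases mul_self_eq_one_iff.mp f3 with f4 | f4
    · left
      ext i j
      fin_cases i <;> fin_cases j <;> simp [*]
    · right
      ext i j
      fin_cases i <;> fin_cases j <;> simp [*]
  · exfalso
    have e3 : G 1 0 ^ 2 * (4 * p) = A 1 0 ^ 2 * (4 - (G 0 0 + G 1 1) ^ 2) := by
      linear_combination -4 * G 1 0 ^ 2 * hA + 4 * A 1 0 ^ 2 * hG - 4 * G 1 0 * A 1 0 * e1 -
        (G 1 0 * (-A 0 0 - A 0 0) + A 1 0 * (G 1 1 - G 0 0)) * e2
    have hpz : (0 : ℤ) < p := by exact_mod_cast hp.out.pos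
    have hc2 : 0 < G 1 0 ^ 2 := by positivity
    have hA2 : 0 < A 1 0 ^ 2 := by positivity
    have e4 : 0 < 4 - (G 0 0 + G 1 1) ^ 2 := by
      by_contra! hle
      have : 0 < G 1 0 ^ 2 * (4 * p) := by positivity
      nlinarith
    have hcq : (G 1 0 : ℚ) ≠ 0 := by exact_mod_cast hc
    have hs : (G 0 0 + G 1 1) ^ 2 = 0 ∨ (G 0 0 + G 1 1) ^ 2 = 1 := by
      have h1 : G 0 0 + G 1 1 < 2 := by nlinarith
      have h2 : -2 < G 0 0 + G 1 1 := by nlinarith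
      generalize G 0 0 + G 1 1 = s at h1 h2
      interval_cases s <;> simp
    rcases hs with hs | hs <;> rw [hs] at e3
    · refine hp.out.prime.irreducible.not_isSquare ?_
      rw [← Rat.isSquare_natCast_iff]
      refine ⟨A 1 0 / G 1 0, ?_⟩
      have e5 : (G 1 0 ^ 2 * (4 * p) : ℚ) = A 1 0 ^ 2 * (4 - 0) := by exact_mod_cast e3
      field_simp
      linarith
    · refine not_isSquare_three_mul hp5 ⟨3 * A 1 0 / (2 * G 1 0), ?_⟩
      have e5 : (G 1 0 ^ 2 * (4 * p) : ℚ) = A 1 0 ^ 2 * (4 - 1) := by exact_mod_cast e3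
      push_cast
      field_simp
      linarith

/-- A complete irredundant system of representatives modulo `SL(2, ℤ)` of the fixed points in the
upper half plane of the integral matrices of trace `t` and determinant `n`. -/
structure Reps (t n : ℤ) (O : Type*) where
  pt : O → ℍ
  mat : O → M2
  det_mat : ∀ o, (mat o).det = n
  tr_mat : ∀ o, mat o 0 0 + mat o 1 1 = t
  fix : ∀ o, mob (mat o) (pt o) = pt o
  complete : ∀ (A : M2) (τ : ℍ), A.det = n → A 0 0 + A 1 1 = t → mob A τ = τ →
    ∃ o, ∃ G : M2, G.det = 1 ∧ mob G (pt o) = τ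
  irredundant : ∀ o o' (G : M2), G.det = 1 → mob G (pt o) = pt o' → o = o'

/-- Coset representatives for `Γ₀(N)` in the modular group, `N` prime. -/
def cosetRep (N : ℕ) : Option (ZMod N) → M2
  | none => 1
  | some b => matS * matT b.val

lemma det_cosetRep (i : Option (ZMod N)) : (cosetRep N i).det = 1 := by
  cases i <;> simp [cosetRep, det_matS, det_matT]

lemma exists_cosetRep (hN : N.Prime) (hA : A.det = 1) :
    ∃ i G, G0 N G ∧ A = G * cosetRep N i := by
  have : NeZero N := ⟨hN.ne_zero⟩
  by_cases hc : (N : ℤ) ∣ A 1 0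
  · exact ⟨none, A, ⟨hA, hc⟩, by simp [cosetRep]⟩
  · obtain ⟨G, b, hG, hGc, rfl⟩ := sl_decomp hN hA hc
    have hb : (N : ℤ) ∣ b - (b : ZMod N).val := by
      rw [← ZMod.intCast_zmod_eq_zero_iff_dvd]
      simp
    obtain ⟨m, hm⟩ := hb
    refine ⟨some (b : ZMod N), G * !![1, 0; -(N * m), 1], ?_, ?_⟩
    · refine G0.mul ⟨hG, hGc⟩ ⟨by simp [Matrix.det_fin_two], by simp⟩
    · rw [cosetRep, mul_assoc, mul_assoc]
      congr 1
      have hm' : b = ((b : ZMod N).val : ℤ) + N * m := by linarith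
      generalize ((b : ZMod N).val : ℤ) = v at hm' ⊢
      rw [hm']
      ext i j
      fin_cases i <;> fin_cases j <;>
        simp [matS, matT, tri, Matrix.mul_apply, Fin.sum_univ_two, add_comm]

lemma cosetRep_injective {i j : Option (ZMod N)} (hN : N.Prime) (hG : G0 N G)
    (h : cosetRep N i = G * cosetRep N j) : i = j := by
  have : NeZero N := ⟨hN.ne_zero⟩
  have h2 : cosetRep N i * (cosetRep N j).adjugate = G := by
    rw [h, mul_assoc, Matrix.mul_adjugate, det_cosetRep, one_smul, mul_one]
  have h3 := hG.2
  rw [← h2] at h3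
  have hN1 := hN.one_lt
  cases i with
  | none =>
    cases j with
    | none => rfl
    | some b =>
      simp [cosetRep, matS, matT, tri, Matrix.mul_apply, Fin.sum_univ_two,
        Matrix.adjugate_fin_two] at h3
      have := Int.le_of_dvd (by norm_num) h3
      omega
  | some a =>
    cases j with
    | none =>
      simp [cosetRep, matS, matT, tri, Matrix.mul_apply, Fin.sum_univ_two] at h3
      have := Int.le_of_dvd (by norm_num) h3
      omega
    | some b =>
      simp [cosetRep, matS, matT, tri, Matrix.mul_apply, Fin.sum_univ_two,
        Matrix.adjugate_fin_two, -ZMod.natCast_val] at h3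
      rw [← ZMod.intCast_zmod_eq_zero_iff_dvd] at h3
      push_cast at h3
      rw [ZMod.natCast_zmod_val, ZMod.natCast_zmod_val] at h3
      rw [eq_of_sub_eq_zero (a := b) (b := a) (by rw [sub_eq_add_neg, h3])]

end

section

open scoped UpperHalfPlane
open UpperHalfPlane

variable {N e p : ℕ} [hp : Fact p.Prime] {A B G : M2} {τ : ℍ}

omit hp in
lemma mul_adjugate_of_det (hG : G.det = 1) : G * G.adjugate = 1 := by
  rw [Matrix.mul_adjugate, hG, one_smul]

omit hp in
lemma adjugate_mul_of_det (hG : G.det = 1) : G.adjugate * G = 1 := by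
  rw [Matrix.adjugate_mul, hG, one_smul]

omit hp in
lemma det_conj (hG : G.det = 1) : (G * A * G.adjugate).det = A.det := by
  rw [Matrix.det_mul, Matrix.det_mul, hG, one_mul, Matrix.det_adjugate, hG, one_pow, mul_one]

omit hp in
lemma tr_conj (hG : G.det = 1) : (G * A * G.adjugate) 0 0 + (G * A * G.adjugate) 1 1 =
    A 0 0 + A 1 1 := by
  rw [← Matrix.trace_fin_two, ← Matrix.trace_fin_two, Matrix.trace_mul_cycle,
    adjugate_mul_of_det hG, one_mul]

omit hp in
lemma mob_conj (hG : G.det = 1) (hA : 0 < A.det) (hf : mob A τ = τ) :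
    mob (G * A * G.adjugate) (mob G τ) = mob G τ := by
  have hG' : G.adjugate.det = 1 := by rw [Matrix.det_adjugate, hG, one_pow]
  rw [mob_mul (by rw [Matrix.det_mul, hG, one_mul]; exact hA) (by simp [hG']), mob_inv hG,
    mob_mul (by simp [hG]) hA, hf]

/-- Indices of the coset representatives carrying a fixed point into level `N`. -/
def Stable (N : ℕ) (A : M2) (i : Option (ZMod N)) : Prop :=
  (N : ℤ) ∣ (cosetRep N i * A * (cosetRep N i).adjugate) 1 0

theorem ncard_image_eq_stable (h : Lv N e) (hp5 : 5 ≤ p) {O : Type*} (S : Reps 0 p O) :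
    (hv N e '' FixN N p).ncard = {x : O × Option (ZMod N) | Stable N (S.mat x.1) x.2}.ncard := by
  have hpos (o : O) : 0 < (S.mat o).det := det_pos_of_eq (S.det_mat o)
  have hRpos (i : Option (ZMod N)) : 0 < (cosetRep N i).det := by simp [det_cosetRep]
  have himg : hv N e '' FixN N p = (fun x : O × Option (ZMod N) =>
      hv N e (mob (cosetRep N x.2) (S.pt x.1))) '' {x | Stable N (S.mat x.1) x.2} := by
    ext z
    constructor
    · rintro ⟨τ, ⟨A, hA, ht, hc, hf⟩, rfl⟩
      obtain ⟨o, B, hB, rfl⟩ := S.complete A τ hA ht hf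
      obtain ⟨i, G, hG, rfl⟩ := exists_cosetRep h.prime hB
      have hσ : mob (G * cosetRep N i) (S.pt o) = mob G (mob (cosetRep N i) (S.pt o)) :=
        mob_mul hG.det_pos (hRpos i)
      refine ⟨(o, i), ?_, by rw [hσ]; exact ((hv_G0 h).apply hG _).symm⟩
      rw [hσ] at hf
      have hGa : G.adjugate.det = 1 := hG.inv.1
      have h1 := mob_conj hGa (det_pos_of_eq hA) hf
      rw [mob_inv hG.1] at h1
      have h2 : (cosetRep N i * S.mat o * (cosetRep N i).adjugate).det = p :=
        (det_conj (det_cosetRep i)).trans (S.det_mat o)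
      have h3 := mob_conj (det_cosetRep i) (hpos o) (S.fix o)
      have h4 : (N : ℤ) ∣ (G.adjugate * A * G.adjugate.adjugate) 1 0 := by
        rw [Matrix.adjugate_adjugate' G]
        simp only [Fintype.card_fin, Matrix.adjugate_fin_two, Matrix.mul_apply, Fin.sum_univ_two]
        simp
        obtain ⟨u, hu⟩ := hG.2
        obtain ⟨v, hv⟩ := hc
        rw [hu, hv]
        exact ⟨-u * A 0 0 * G 0 0 + G 0 0 * v * G 0 0 - u * A 0 1 * (N * u) + G 0 0 * A 1 1 * u,
          by ring⟩
      rcases traceless_eq_or_neg h2 ((det_conj hGa).trans hA)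
        ((tr_conj (det_cosetRep i)).trans (S.tr_mat o)) ((tr_conj hGa).trans ht) h3 h1 with h5 | h5
      · rwa [h5] at h4
      · rw [h5, Matrix.neg_apply, dvd_neg] at h4
        exact h4
    · rintro ⟨⟨o, i⟩, hs, rfl⟩
      exact ⟨_, ⟨_, (det_conj (det_cosetRep i)).trans (S.det_mat o),
        (tr_conj (det_cosetRep i)).trans (S.tr_mat o), hs,
        mob_conj (det_cosetRep i) (hpos o) (S.fix o)⟩, rfl⟩
  rw [himg]
  refine Set.ncard_image_of_injective _ ?_
  rintro ⟨o, i⟩ ⟨o', j⟩ hij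
  obtain ⟨G, hG, hm⟩ := hv_injective h hij
  rw [← mob_mul hG.det_pos (hRpos i)] at hm
  have hGi : (G * cosetRep N i).det = 1 := by rw [Matrix.det_mul, hG.1, det_cosetRep, one_mul]
  have hja : ((cosetRep N j).adjugate).det = 1 := by
    rw [Matrix.det_adjugate, det_cosetRep, one_pow]
  have hm2 : mob ((cosetRep N j).adjugate * (G * cosetRep N i)) (S.pt o) = S.pt o' := by
    rw [mob_mul (by simp [hja]) (by simp [hGi])]
    rw [show mob (G * cosetRep N i) (S.pt o) = mob (cosetRep N j) (S.pt o') from hm,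
      mob_inv (det_cosetRep j)]
  have hdet : ((cosetRep N j).adjugate * (G * cosetRep N i)).det = 1 := by
    rw [Matrix.det_mul, hja, hGi, one_mul]
  obtain rfl := S.irredundant _ _ _ hdet hm2
  have hij' : cosetRep N j = (-G) * cosetRep N i ∨ cosetRep N j = G * cosetRep N i := by
    rcases eq_one_or_neg_one_of_fix hp5 (S.det_mat o) (S.tr_mat o) (S.fix o) hdet hm2 with h1 | h1
    · right
      have := congrArg (cosetRep N j * ·) h1
      simpa [← mul_assoc, mul_adjugate_of_det (det_cosetRep j)] using this.symm
    · left
      have := congrArg (cosetRep N j * ·) h1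
      simp only [← mul_assoc, mul_adjugate_of_det (det_cosetRep j), one_mul, mul_neg, mul_one] at this
      rw [neg_mul, this, neg_neg]
  rcases hij' with h1 | h1
  · rw [cosetRep_injective h.prime (G := -G) ⟨by simp [Matrix.det_neg, hG.1], by simpa using hG.2⟩ h1]
  · rw [cosetRep_injective h.prime hG h1]

end

section

open scoped UpperHalfPlane
open UpperHalfPlane

variable {p : ℕ} [hp : Fact p.Prime] {A : M2}

/-- Stability of a coset in terms of the entries `a`, `b`, `c` modulo `N` of a traceless matrix. -/
def StableMod {R : Type*} [CommRing R] (a b c : R) (i : Option R) : Prop :=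
  i.elim (c = 0) fun t => t ^ 2 * c + t * (a + a) - b = 0

instance {R : Type*} [CommRing R] [DecidableEq R] (a b c : R) : DecidablePred (StableMod a b c) :=
  fun i => by cases i <;> simp only [StableMod, Option.elim] <;> infer_instance

omit hp in
lemma stable_iff {N : ℕ} [NeZero N] (ht : A 0 0 + A 1 1 = 0) (i : Option (ZMod N)) :
    Stable N A i ↔ StableMod (A 0 0 : ZMod N) (A 0 1) (A 1 0) i := by
  have hA1 : A 1 1 = - A 0 0 := by linarith
  rw [Stable, ← ZMod.intCast_zmod_eq_zero_iff_dvd]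
  cases i with
  | none => simp [cosetRep, StableMod]
  | some t =>
    simp only [cosetRep, StableMod, Option.elim, matS, matT, tri, Matrix.mul_apply, Fin.sum_univ_two,
      Matrix.adjugate_fin_two]
    simp [-ZMod.natCast_val, hA1]
    rw [ZMod.natCast_zmod_val]
    refine iff_of_eq (congrArg (· = 0) ?_)
    ring

omit hp in
lemma ncard_prod {O I : Type*} [Fintype O] [Fintype I] (P : O → I → Prop)
    [∀ o, DecidablePred (P o)] :
    {x : O × I | P x.1 x.2}.ncard = ∑ o, (Finset.univ.filter (P o)).card := by
  classical
  rw [← Nat.card_coe_set_eq, Nat.card_eq_fintype_card, Fintype.card_subtype,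
    Finset.card_filter, ← Finset.univ_product_univ, Finset.sum_product]
  simp only [Finset.card_filter, Set.mem_ofPred_eq]

lemma card_stable_two (hp5 : 5 ≤ p) (hA : A.det = p) (ht : A 0 0 + A 1 1 = 0) [DecidablePred (Stable 2 A)] :
    (Finset.univ.filter (Stable 2 A)).card =
      if (2 : ℤ) ∣ A 0 1 ∧ (2 : ℤ) ∣ A 1 0 then 3 else 1 := by
  have key : ∀ a b c : ZMod 2, a * a + b * c = 1 → (Finset.univ.filter (StableMod a b c)).card =
      if b = 0 ∧ c = 0 then 3 else 1 := by decide
  have h1 : ((A 0 0 : ZMod 2)) * A 0 0 + A 0 1 * A 1 0 = 1 := by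
    have hA1 : A 1 1 = - A 0 0 := by linarith
    rw [Matrix.det_fin_two, hA1] at hA
    have h2 := congrArg (Int.cast : ℤ → ZMod 2) hA
    have h3 : (p : ZMod 2) = 1 := by
      rw [ZMod.natCast_eq_one_iff_odd]
      exact hp.out.odd_of_ne_two (by omega)
    push_cast at h2
    rw [h3] at h2
    have h4 : (1 : ZMod 2) = -1 := by decide
    rw [h4, ← h2]
    ring
  have h5 := key _ _ _ h1
  simp only [ZMod.intCast_zmod_eq_zero_iff_dvd] at h5
  exact (congrArg Finset.card (Finset.filter_congr fun i _ => stable_iff ht i)).trans h5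

omit hp in
lemma card_stable_three (hA : A.det = p) (ht : A 0 0 + A 1 1 = 0) (hp3 : p % 3 ≠ 0)
    [DecidablePred (Stable 3 A)] :
    (Finset.univ.filter (Stable 3 A)).card = if p % 3 = 1 then 0 else 2 := by
  have key : ∀ a b c : ZMod 3, (a * a + b * c = 2 → (Finset.univ.filter (StableMod a b c)).card = 0) ∧
      (a * a + b * c = 1 → (Finset.univ.filter (StableMod a b c)).card = 2) := by decide
  have h1 : ((A 0 0 : ZMod 3)) * A 0 0 + A 0 1 * A 1 0 = -p := by
    have hA1 : A 1 1 = - A 0 0 := by linarith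
    rw [Matrix.det_fin_two, hA1] at hA
    have h2 := congrArg (Int.cast : ℤ → ZMod 3) hA
    push_cast at h2
    rw [← h2]
    ring
  have h6 : (Finset.univ.filter (Stable 3 A)).card = (Finset.univ.filter
      (StableMod (A 0 0 : ZMod 3) (A 0 1 : ZMod 3) (A 1 0 : ZMod 3))).card :=
    congrArg Finset.card (Finset.filter_congr fun i _ => stable_iff ht i)
  rw [h6]
  have h7 : (p : ZMod 3) = ((p % 3 : ℕ) : ZMod 3) := by simp
  rw [h7] at h1
  have h8 : p % 3 < 3 := Nat.mod_lt _ (by norm_num)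
  split_ifs with h9
  · rw [h9] at h1
    exact (key _ _ _).1 (h1.trans (by decide))
  · have h10 : p % 3 = 2 := by omega
    rw [h10] at h1
    exact (key _ _ _).2 (h1.trans (by decide))

theorem ncard_level_three (hp5 : 5 ≤ p) {O : Type*} [Fintype O] (S : Reps 0 p O) :
    (hv 3 1 '' FixN 3 p).ncard = Fintype.card O * if p % 3 = 1 then 0 else 2 := by
  classical
  have hp3 : p % 3 ≠ 0 := fun h => by
    have := (Nat.prime_dvd_prime_iff_eq Nat.prime_three hp.out).mp (Nat.dvd_of_mod_eq_zero h)
    omega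
  rw [ncard_image_eq_stable (Or.inr ⟨rfl, rfl⟩) hp5 S, ncard_prod (fun o => Stable 3 (S.mat o)),
    Finset.sum_congr rfl fun o _ => card_stable_three (S.det_mat o) (S.tr_mat o) hp3]
  simp

theorem ncard_level_two (hp5 : 5 ≤ p) {O : Type*} [Fintype O] (S : Reps 0 p O) :
    (hv 2 2 '' FixN 2 p).ncard =
      ∑ o, if (2 : ℤ) ∣ S.mat o 0 1 ∧ (2 : ℤ) ∣ S.mat o 1 0 then 3 else 1 := by
  classical
  rw [ncard_image_eq_stable (Or.inl ⟨rfl, rfl⟩) hp5 S, ncard_prod (fun o => Stable 2 (S.mat o)),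
    Finset.sum_congr rfl fun o _ => card_stable_two hp5 (S.det_mat o) (S.tr_mat o)]

end

section

open scoped UpperHalfPlane
open UpperHalfPlane

variable {p : ℕ} [hp : Fact p.Prime] {A B G : M2} {τ : ℍ}

omit hp in
lemma mob_smul_one {k : ℤ} (hk : 0 < k) : mob (k • (1 : M2)) τ = τ := by
  rw [mob_eq_self_iff (by simp [Matrix.det_fin_two]; positivity)]
  simp

omit hp in
lemma mob_adjugate_mob (hG : 0 < G.det) : mob G.adjugate (mob G τ) = τ := by
  rw [← mob_mul (by simpa [Matrix.det_adjugate] using hG) hG, Matrix.adjugate_mul, mob_smul_one hG]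

omit hp in
lemma mob_conj_of_pos (hG : 0 < G.det) (hA : 0 < A.det) (hf : mob A τ = τ) :
    mob (G * A * G.adjugate) (mob G τ) = mob G τ := by
  have hG' : 0 < G.adjugate.det := by simpa [Matrix.det_adjugate] using hG
  rw [mob_mul (by rw [Matrix.det_mul]; positivity) hG', mob_adjugate_mob hG, mob_mul hG hA, hf]

omit hp in
/-- The points fixed by a matrix are fixed by the matrices in the algebra it generates. -/
lemma mob_eq_self_of_smul_eq {x y z : ℤ} (hx : x ≠ 0) (hA : 0 < A.det) (hB : 0 < B.det)
    (h : ∀ i j, x * B i j = y * A i j + z * (1 : M2) i j) (hf : mob A τ = τ) : mob B τ = τ := by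
  rw [mob_eq_self_iff hA] at hf
  rw [mob_eq_self_iff hB]
  have h00 := congrArg (Int.cast : ℤ → ℂ) (h 0 0)
  have h01 := congrArg (Int.cast : ℤ → ℂ) (h 0 1)
  have h10 := congrArg (Int.cast : ℤ → ℂ) (h 1 0)
  have h11 := congrArg (Int.cast : ℤ → ℂ) (h 1 1)
  simp at h00 h01 h10 h11
  refine (mul_eq_zero.mp (?_ : (x : ℂ) * _ = 0)).resolve_left (by exact_mod_cast hx)
  linear_combination (τ : ℂ) ^ 2 * h10 + (τ : ℂ) * h11 - τ * h00 - h01 + y * hf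

/-- The off-diagonal entries are even. -/
def EvenOff (A : M2) : Prop := (2 : ℤ) ∣ A 0 1 ∧ (2 : ℤ) ∣ A 1 0

instance : DecidablePred EvenOff := fun A => by unfold EvenOff; infer_instance

lemma EvenOff.of_equiv (hE : EvenOff A) (hA : A.det = p) (ht : A 0 0 + A 1 1 = 0)
    (hf : mob A τ = τ) (hB : B.det = p) (hBt : B 0 0 + B 1 1 = 0) (hG : G.det = 1)
    (hBf : mob B (mob G τ) = mob G τ) : EvenOff B := by
  have h1 : EvenOff (G * A * G.adjugate) := by
    obtain ⟨⟨u, hu⟩, ⟨v, hv⟩⟩ := hE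
    have hA1 : A 1 1 = - A 0 0 := by linarith
    simp only [EvenOff, Matrix.adjugate_fin_two, Matrix.mul_apply, Fin.sum_univ_two]
    simp [hu, hv, hA1]
    exact ⟨⟨-(G 0 0 * A 0 0 * G 0 1) - G 0 1 * v * G 0 1 + G 0 0 * u * G 0 0, by ring⟩,
      ⟨G 1 0 * A 0 0 * G 1 1 + G 1 1 * v * G 1 1 - G 1 0 * u * G 1 0, by ring⟩⟩
  rcases traceless_eq_or_neg ((det_conj hG).trans hA) hB ((tr_conj hG).trans ht) hBt
    (mob_conj hG (det_pos_of_eq hA) hf) hBf with rfl | rfl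
  · exact h1
  · simpa [EvenOff] using h1

/-- Conjugation by `al 2 k` brings `A` to a matrix congruent to `2` modulo `4`. -/
def Good (A : M2) (k : Option (ZMod 2)) : Prop :=
  ∀ i j, (4 : ℤ) ∣ (al 2 k * A * (al 2 k).adjugate) i j + 2 * (1 : M2) i j

/-- The condition `Good` on the entries modulo `4` of a traceless matrix. -/
def GoodMod (a b c : ZMod 4) : Option (ZMod 2) → Prop
  | none => 2 * a = 2 ∧ c = 0
  | some t => 2 * (a + t.val * c) = 2 ∧ b - 2 * t.val * a - t.val ^ 2 * c = 0

instance (a b c : ZMod 4) : DecidablePred (GoodMod a b c) :=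
  fun i => by cases i <;> simp only [GoodMod] <;> infer_instance

omit hp in
lemma good_iff (ht : A 0 0 + A 1 1 = 0) (k : Option (ZMod 2)) :
    Good A k ↔ GoodMod (A 0 0) (A 0 1) (A 1 0) k := by
  have hA1 : A 1 1 = - A 0 0 := by linarith
  have h4 : (4 : ZMod 4) = 0 := by decide
  have h40 : (4 : ℤ) = ((4 : ℕ) : ℤ) := rfl
  simp only [Good, h40, ← ZMod.intCast_zmod_eq_zero_iff_dvd, Fin.forall_fin_two]
  cases k with
  | none =>
    simp only [al, tri, GoodMod, Matrix.mul_apply, Fin.sum_univ_two, Matrix.adjugate_fin_two]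
    simp [hA1]
    generalize (A 0 0 : ZMod 4) = a
    generalize (A 0 1 : ZMod 4) = b
    generalize (A 1 0 : ZMod 4) = c
    revert a b c
    decide
  | some t =>
    simp only [al, tri, GoodMod, Matrix.mul_apply, Fin.sum_univ_two, Matrix.adjugate_fin_two]
    simp [hA1, -ZMod.natCast_val]
    generalize (A 0 0 : ZMod 4) = a
    generalize (A 0 1 : ZMod 4) = b
    generalize (A 1 0 : ZMod 4) = c
    generalize (t.val : ZMod 4) = t
    revert a b c t
    decide

omit hp in
lemma exists_unique_good (hp4 : p % 4 = 3) (hA : A.det = p) (ht : A 0 0 + A 1 1 = 0)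
    (hE : ¬ EvenOff A) : ∃ k, Good A k ∧ ∀ k', Good A k' → k' = k := by
  have key : ∀ a b c : ZMod 4, a * a + b * c = 1 → ¬ (2 * b = 0 ∧ 2 * c = 0) →
      ∃ k, GoodMod a b c k ∧ ∀ k', GoodMod a b c k' → k' = k := by decide
  simp only [good_iff ht]
  refine key _ _ _ ?_ ?_
  · have hA1 : A 1 1 = - A 0 0 := by linarith
    rw [Matrix.det_fin_two, hA1] at hA
    have h2 := congrArg (Int.cast : ℤ → ZMod 4) hA
    have h3 : (p : ZMod 4) = -1 := by
      have : (p : ZMod 4) = ((p % 4 : ℕ) : ZMod 4) := by simp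
      rw [this, hp4]
      decide
    push_cast at h2
    rw [h3] at h2
    linear_combination -h2
  · have h2 (x : ℤ) : (2 : ZMod 4) * x = 0 ↔ (2 : ℤ) ∣ x := by
      rw [show (2 : ZMod 4) * x = ((2 * x : ℤ) : ZMod 4) by push_cast; rfl,
        ZMod.intCast_zmod_eq_zero_iff_dvd, show ((4 : ℕ) : ℤ) = 2 * 2 by norm_num]
      exact mul_dvd_mul_iff_left two_ne_zero
    rw [h2, h2]
    exact hE

lemma Good.exists_fix {n : ℤ} (hn : 4 * n = 1 + p) {k : Option (ZMod 2)} (h : Good A k)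
    (hA : A.det = p) (ht : A 0 0 + A 1 1 = 0) (hf : mob A τ = τ) :
    ∃ B : M2, B.det = n ∧ B 0 0 + B 1 1 = 1 ∧ mob B (mob (al 2 k) τ) = mob (al 2 k) τ := by
  have hpz : (0 : ℤ) < p := by exact_mod_cast hp.out.pos
  have hPf := mob_conj_of_pos (det_al_pos k) (det_pos_of_eq hA) hf
  have hPd : (al 2 k * A * (al 2 k).adjugate).det = 4 * p := by
    rw [Matrix.det_mul, Matrix.det_mul, Matrix.det_adjugate, det_al, hA]
    simp
    ring
  have hPt : (al 2 k * A * (al 2 k).adjugate) 0 0 + (al 2 k * A * (al 2 k).adjugate) 1 1 = 0 := by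
    rw [← Matrix.trace_fin_two, Matrix.trace_mul_cycle, Matrix.adjugate_mul, smul_mul_assoc, one_mul,
      Matrix.trace_smul, Matrix.trace_fin_two, ht, smul_zero]
  rw [Good] at h
  generalize al 2 k * A * (al 2 k).adjugate = P at *
  choose B hB using h
  have h00 := hB 0 0
  have h01 := hB 0 1
  have h10 := hB 1 0
  have h11 := hB 1 1
  simp at h00 h01 h10 h11
  have hBd : (Matrix.of B).det = n := by
    rw [Matrix.det_fin_two] at hPd ⊢
    simp only [Matrix.of_apply]
    refine mul_left_cancel₀ (a := (16 : ℤ)) (by norm_num) ?_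
    linear_combination -4 * (B 1 1) * h00 - (P 0 0 + 2) * h11 + 4 * B 1 0 * h01 + P 0 1 * h10 +
      hPd + 2 * hPt - 4 * hn
  refine ⟨Matrix.of B, hBd, ?_, ?_⟩
  · simp only [Matrix.of_apply]
    linarith
  · refine mob_eq_self_of_smul_eq (x := 4) (y := 1) (z := 2) (by norm_num) (by rw [hPd]; positivity)
      (by rw [hBd]; linarith) (fun i j => ?_) hPf
    rw [Matrix.of_apply, ← hB i j, one_mul]

lemma good_of_fix {n : ℤ} (hn : 4 * n = 1 + p) {k : Option (ZMod 2)} (hA : A.det = p)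
    (ht : A 0 0 + A 1 1 = 0) (hf : mob A τ = τ) (hB : B.det = n) (hBt : B 0 0 + B 1 1 = 1)
    (hBf : mob B (mob (al 2 k) τ) = mob (al 2 k) τ) : Good A k := by
  have hpz : (0 : ℤ) < p := by exact_mod_cast hp.out.pos
  have hPf := mob_conj_of_pos (det_al_pos k) (det_pos_of_eq hA) hf
  have hPd : (al 2 k * A * (al 2 k).adjugate).det = 4 * p := by
    rw [Matrix.det_mul, Matrix.det_mul, Matrix.det_adjugate, det_al, hA]
    simp
    ring
  have hPt : (al 2 k * A * (al 2 k).adjugate) 0 0 + (al 2 k * A * (al 2 k).adjugate) 1 1 = 0 := by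
    rw [← Matrix.trace_fin_two, Matrix.trace_mul_cycle, Matrix.adjugate_mul, smul_mul_assoc, one_mul,
      Matrix.trace_smul, Matrix.trace_fin_two, ht, smul_zero]
  rw [Good]
  generalize al 2 k * A * (al 2 k).adjugate = P at *
  rw [Matrix.det_fin_two] at hB
  set Q : M2 := !![4 * B 0 0 - 2, 4 * B 0 1; 4 * B 1 0, 4 * B 1 1 - 2] with hQ
  have hQd : Q.det = 4 * p := by
    simp [hQ, Matrix.det_fin_two]
    linear_combination 16 * hB - 8 * hBt + 4 * hn
  have hBpos : 0 < B.det := by rw [Matrix.det_fin_two]; linarith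
  have hQf : mob Q (mob (al 2 k) τ) = mob (al 2 k) τ := by
    refine mob_eq_self_of_smul_eq (x := 1) (y := 4) (z := -2) (by norm_num) hBpos
      (by rw [hQd]; positivity) (fun i j => ?_) hBf
    fin_cases i <;> fin_cases j <;> simp [hQ] <;> ring
  rcases traceless_eq_or_neg_of_pos (by positivity) hQd hPd (by simp [hQ]; linarith) hPt hQf hPf
    with h | h
  · rw [h, Fin.forall_fin_two, Fin.forall_fin_two, Fin.forall_fin_two]
    simp [hQ]
  · rw [h, Fin.forall_fin_two, Fin.forall_fin_two, Fin.forall_fin_two]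
    simp [hQ]
    omega

end

section

open scoped UpperHalfPlane
open UpperHalfPlane

variable {p : ℕ} [hp : Fact p.Prime] {A B G : M2} {τ : ℍ} {n : ℤ}

/-- The matrix `2 * B - 1`. -/
def dbl (B : M2) : M2 := !![2 * B 0 0 - 1, 2 * B 0 1; 2 * B 1 0, 2 * B 1 1 - 1]

/-- The matrix `2 * B - 1` transported by `al 2 j`. -/
def der (B : M2) (j : Option (ZMod 2)) : M2 :=
  let P := al 2 j * B * (al 2 j).adjugate
  !![P 0 0 - 1, P 0 1; P 1 0, P 1 1 - 1]

omit hp in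
lemma det_dbl (hn : 4 * n = 1 + p) (hB : B.det = n) (ht : B 0 0 + B 1 1 = 1) :
    (dbl B).det = p := by
  rw [Matrix.det_fin_two] at hB
  simp [dbl, Matrix.det_fin_two]
  linear_combination 4 * hB - 2 * ht + hn

omit hp in
lemma tr_dbl (ht : B 0 0 + B 1 1 = 1) : dbl B 0 0 + dbl B 1 1 = 0 := by
  simp [dbl]
  linarith

lemma mob_dbl (hn : 4 * n = 1 + p) (hB : B.det = n) (ht : B 0 0 + B 1 1 = 1)
    (hf : mob B τ = τ) : mob (dbl B) τ = τ := by
  have hpz : (0 : ℤ) < p := by exact_mod_cast hp.out.pos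
  refine mob_eq_self_of_smul_eq (x := 1) (y := 2) (z := -1) one_ne_zero (by rw [hB]; linarith)
    (det_pos_of_eq (det_dbl hn hB ht)) (fun i j => ?_) hf
  fin_cases i <;> fin_cases j <;> simp [dbl] <;> ring

omit hp in
lemma evenOff_dbl : EvenOff (dbl B) := by simp [EvenOff, dbl]

omit hp in
lemma conj_al (j : Option (ZMod 2)) :
    (al 2 j * B * (al 2 j).adjugate).det = 4 * B.det ∧
      (al 2 j * B * (al 2 j).adjugate) 0 0 + (al 2 j * B * (al 2 j).adjugate) 1 1 =
        2 * (B 0 0 + B 1 1) := by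
  constructor
  · rw [Matrix.det_mul, Matrix.det_mul, Matrix.det_adjugate, det_al]
    simp
    ring
  · rw [← Matrix.trace_fin_two, Matrix.trace_mul_cycle, Matrix.adjugate_mul, smul_mul_assoc, one_mul,
      Matrix.trace_smul, Matrix.trace_fin_two, det_al]
    simp

omit hp in
lemma det_der (hn : 4 * n = 1 + p) (hB : B.det = n) (ht : B 0 0 + B 1 1 = 1) (j) :
    (der B j).det = p := by
  obtain ⟨h1, h2⟩ := conj_al (B := B) j
  rw [der]
  generalize al 2 j * B * (al 2 j).adjugate = P at *
  rw [hB, Matrix.det_fin_two] at h1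
  rw [ht] at h2
  simp [Matrix.det_fin_two]
  linear_combination h1 - h2 + hn

omit hp in
lemma tr_der (ht : B 0 0 + B 1 1 = 1) (j) : der B j 0 0 + der B j 1 1 = 0 := by
  obtain ⟨-, h2⟩ := conj_al (B := B) j
  simp [der]
  linarith

lemma mob_der (hn : 4 * n = 1 + p) (hB : B.det = n) (ht : B 0 0 + B 1 1 = 1)
    (hf : mob B τ = τ) (j) : mob (der B j) (mob (al 2 j) τ) = mob (al 2 j) τ := by
  have hpz : (0 : ℤ) < p := by exact_mod_cast hp.out.pos
  have hBpos : 0 < B.det := by rw [hB]; linarith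
  refine mob_eq_self_of_smul_eq (x := 1) (y := 1) (z := -1) one_ne_zero (by
    rw [(conj_al j).1]; positivity) (det_pos_of_eq (det_der hn hB ht j)) (fun i k => ?_)
    (mob_conj_of_pos (det_al_pos j) hBpos hf)
  fin_cases i <;> fin_cases k <;> simp [der] <;> ring

/-- A matrix of determinant two is `al 2 k` up to the modular group. -/
lemma exists_eq_mul_al_two (h : A.det = 2) : ∃ k G, G.det = 1 ∧ A = G * al 2 k := by
  obtain ⟨k, G, hG, h⟩ := exists_eq_mul_al (p := 2) (N := 1) (by norm_num) (by exact_mod_cast h)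
    (by simp)
  exact ⟨k, G, hG.1, h⟩

lemma exists_eq_dbl (hn : 4 * n = 1 + p) (hA : A.det = p) (ht : A 0 0 + A 1 1 = 0)
    (hE : EvenOff A) (hp2 : p % 2 = 1) (hf : mob A τ = τ) :
    ∃ B : M2, B.det = n ∧ B 0 0 + B 1 1 = 1 ∧ mob B τ = τ := by
  have hpz : (0 : ℤ) < p := by exact_mod_cast hp.out.pos
  have hApos := det_pos_of_eq hA
  obtain ⟨⟨u, hu⟩, ⟨v, hv⟩⟩ := hE
  rw [Matrix.det_fin_two, hu, hv] at hA
  have hodd : Odd (A 0 0) := by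
    by_contra h
    rw [Int.not_odd_iff_even] at h
    obtain ⟨w, hw⟩ := h
    have : (2 : ℤ) ∣ p := ⟨w * A 1 1 - u * (2 * v), by rw [← hA, hw]; ring⟩
    omega
  obtain ⟨w, hw⟩ := hodd
  have hdet : (!![w + 1, u; v, -w] : M2).det = n := by
    simp [Matrix.det_fin_two]
    have : A 1 1 = -(2 * w + 1) := by linarith
    rw [hw, this] at hA
    linarith
  refine ⟨!![w + 1, u; v, -w], hdet, by simp, ?_⟩
  refine mob_eq_self_of_smul_eq (x := 2) (y := 1) (z := 1) two_ne_zero hApos (by rw [hdet]; linarith)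
    (fun i j => ?_) hf
  fin_cases i <;> fin_cases j <;> simp <;> linarith

end

section

open scoped UpperHalfPlane
open UpperHalfPlane

variable {p : ℕ} [hp : Fact p.Prime] {A B B' G : M2} {τ τ' : ℍ} {n : ℤ}

/-- Transport back along `al 2 j`, up to the modular group. -/
lemma exists_al_of_good (hn : 4 * n = 1 + p) (hp4 : p % 4 = 3) (hA : A.det = p)
    (ht : A 0 0 + A 1 1 = 0) (hf : mob A τ = τ) (hE : ¬ EvenOff A) {O : Type*} (S : Reps 1 n O) :
    ∃ o j, ∃ G : M2, G.det = 1 ∧ mob G (mob (al 2 j) (S.pt o)) = τ := by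
  obtain ⟨k, hk, -⟩ := exists_unique_good hp4 hA ht hE
  obtain ⟨B, hB, hBt, hBf⟩ := hk.exists_fix hn hA ht hf
  obtain ⟨o, G, hG, h⟩ := S.complete B _ hB hBt hBf
  have hadj : (al 2 k).adjugate.det = 2 := by simp [Matrix.det_adjugate, det_al]
  obtain ⟨j, G', hG', h'⟩ := exists_eq_mul_al_two (A := (al 2 k).adjugate * G)
    (by rw [Matrix.det_mul, hadj, hG, mul_one])
  refine ⟨o, j, G', hG', ?_⟩
  rw [← mob_mul (by simp [hG']) (det_al_pos j), ← h', mob_mul (by simp [hadj]) (by simp [hG]), h,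
    mob_adjugate_mob (det_al_pos k)]

/-- The curves off the maximal order determine a neighbour on the maximal order. -/
lemma exists_conj_of_not_evenOff (hn : 4 * n = 1 + p) (hp4 : p % 4 = 3) (hB : B.det = n)
    (hBt : B 0 0 + B 1 1 = 1) (hf : mob B τ = τ) (hB' : B'.det = n) (hBt' : B' 0 0 + B' 1 1 = 1)
    (hf' : mob B' τ' = τ') {j j' : Option (ZMod 2)} (hE : ¬ EvenOff (der B j)) (hG : G.det = 1)
    (h : mob G (mob (al 2 j) τ) = mob (al 2 j') τ') :
    ∃ G' : M2, G'.det = 1 ∧ (al 2 j').adjugate * G = G' * (al 2 j).adjugate ∧ mob G' τ = τ' := by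
  have hpz : (0 : ℤ) < p := by exact_mod_cast hp.out.pos
  have hnpos : 0 < n := by linarith
  have hadj (k) : (al 2 k).adjugate.det = 2 := by simp [Matrix.det_adjugate, det_al]
  obtain ⟨k₀, -, hk₀⟩ := exists_unique_good hp4 (det_der hn hB hBt j) (tr_der hBt j) hE
  have hdf := mob_der hn hB hBt hf j
  have hgood {D C : M2} {ρ : ℍ} (hD : D.det = 2) (hC : C.det = n) (hCt : C 0 0 + C 1 1 = 1)
      (hCf : mob C ρ = ρ) (hρ : mob D (mob (al 2 j) τ) = ρ) :
      ∃ G₁ : M2, G₁.det = 1 ∧ D = G₁ * al 2 k₀ := by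
    obtain ⟨k, G₁, hG₁, rfl⟩ := exists_eq_mul_al_two hD
    rw [mob_mul (by simp [hG₁]) (det_al_pos k)] at hρ
    have h1 : G₁.adjugate.det = 1 := by rw [Matrix.det_adjugate, hG₁, one_pow]
    have h2 : mob (al 2 k) (mob (al 2 j) τ) = mob G₁.adjugate ρ := by rw [← hρ, mob_inv hG₁]
    obtain rfl := hk₀ k (good_of_fix hn (det_der hn hB hBt j) (tr_der hBt j) hdf
      ((det_conj h1).trans hC) ((tr_conj h1).trans hCt) (by
        rw [h2]
        exact mob_conj h1 (by rwa [hC]) hCf))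
    exact ⟨G₁, hG₁, rfl⟩
  obtain ⟨G₁, hG₁, e1⟩ := hgood (hadj j) hB hBt hf (mob_adjugate_mob (det_al_pos j))
  obtain ⟨G₂, hG₂, e2⟩ := hgood (D := (al 2 j').adjugate * G)
    (by rw [Matrix.det_mul, hadj, hG, mul_one]) hB' hBt' hf' (by
      rw [mob_mul (by simp [hadj]) (by simp [hG]), h, mob_adjugate_mob (det_al_pos j')])
  have e3 : (al 2 j').adjugate * G = G₂ * G₁.adjugate * (al 2 j).adjugate := by
    rw [e1, e2, mul_assoc G₂, ← mul_assoc G₁.adjugate, adjugate_mul_of_det hG₁, one_mul]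
  have hdet : (G₂ * G₁.adjugate).det = 1 := by
    rw [Matrix.det_mul, Matrix.det_adjugate, hG₁, hG₂, one_pow, mul_one]
  refine ⟨G₂ * G₁.adjugate, hdet, e3, ?_⟩
  rw [← mob_adjugate_mob (det_al_pos j') (τ := τ'), ← h, ← mob_mul (A := (al 2 j').adjugate)
    (by simp [hadj]) (by simp [hG]), e3,
    mob_mul (A := G₂ * G₁.adjugate) (by rw [hdet]; norm_num) (by rw [hadj]; norm_num),
    mob_adjugate_mob (det_al_pos j)]

/-- The fixed points of traceless matrices of determinant `p`, for `p` congruent to `3` modulo `4`,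
in terms of the fixed points of matrices of trace one. -/
def derivedReps (hp5 : 5 ≤ p) (hn : 4 * n = 1 + p) (hp4 : p % 4 = 3) {O : Type*} (S : Reps 1 n O) :
    Reps 0 p (O ⊕ {x : O × Option (ZMod 2) // ¬ EvenOff (der (S.mat x.1) x.2)}) where
  pt := Sum.elim S.pt fun x => mob (al 2 x.1.2) (S.pt x.1.1)
  mat := Sum.elim (fun o => dbl (S.mat o)) fun x => der (S.mat x.1.1) x.1.2
  det_mat := by
    rintro (o | x)
    · exact det_dbl hn (S.det_mat o) (S.tr_mat o)
    · exact det_der hn (S.det_mat _) (S.tr_mat _) _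
  tr_mat := by
    rintro (o | x)
    · exact tr_dbl (S.tr_mat o)
    · exact tr_der (S.tr_mat _) _
  fix := by
    rintro (o | x)
    · exact mob_dbl hn (S.det_mat o) (S.tr_mat o) (S.fix o)
    · exact mob_der hn (S.det_mat _) (S.tr_mat _) (S.fix _) _
  complete := by
    intro A τ hA ht hf
    by_cases hE : EvenOff A
    · obtain ⟨B, hB, hBt, hBf⟩ := exists_eq_dbl hn hA ht hE (by omega) hf
      obtain ⟨o, G, hG, h⟩ := S.complete B τ hB hBt hBf
      exact ⟨.inl o, G, hG, h⟩
    · obtain ⟨o, j, G, hG, h⟩ := exists_al_of_good hn hp4 hA ht hf hE S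
      refine ⟨.inr ⟨(o, j), fun hE' => hE ?_⟩, G, hG, h⟩
      exact hE'.of_equiv (det_der hn (S.det_mat o) (S.tr_mat o) j) (tr_der (S.tr_mat o) j)
        (mob_der hn (S.det_mat o) (S.tr_mat o) (S.fix o) j) hA ht hG (by rwa [h])
  irredundant := by
    have hmix (o : O) (x : {x : O × Option (ZMod 2) // ¬ EvenOff (der (S.mat x.1) x.2)}) (G : M2)
        (hG : G.det = 1) (h : mob G (S.pt o) = mob (al 2 x.1.2) (S.pt x.1.1)) : False :=
      x.2 (evenOff_dbl.of_equiv (det_dbl hn (S.det_mat o) (S.tr_mat o)) (tr_dbl (S.tr_mat o))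
        (mob_dbl hn (S.det_mat o) (S.tr_mat o) (S.fix o)) (det_der hn (S.det_mat _) (S.tr_mat _) _)
        (tr_der (S.tr_mat _) _) hG (by
          rw [h]
          exact mob_der hn (S.det_mat _) (S.tr_mat _) (S.fix _) _))
    rintro (o | x) (o' | x') G hG h
    · rw [S.irredundant o o' G hG h]
    · exact (hmix o x' G hG h).elim
    · refine (hmix o' x G.adjugate (by rw [Matrix.det_adjugate, hG, one_pow]) ?_).elim
      rw [← show mob G (mob (al 2 x.1.2) (S.pt x.1.1)) = S.pt o' from h, mob_inv hG]
    · obtain ⟨⟨o, j⟩, hE⟩ := x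
      obtain ⟨⟨o', j'⟩, hE'⟩ := x'
      obtain ⟨G', hG', e, hm⟩ := exists_conj_of_not_evenOff hn hp4 (S.det_mat o) (S.tr_mat o)
        (S.fix o) (S.det_mat o') (S.tr_mat o') (S.fix o') hE hG h
      obtain rfl := S.irredundant o o' G' hG' hm
      have h1 : al 2 j' = G * al 2 j ∨ al 2 j' = (-G) * al 2 j := by
        have e' : al 2 j' * ((al 2 j').adjugate * G) * al 2 j = (2 : ℤ) • (G * al 2 j) := by
          rw [← mul_assoc, Matrix.mul_adjugate, det_al, smul_mul_assoc, one_mul, smul_mul_assoc]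
          rfl
        rw [e] at e'
        have e'' (x : ℤ) : al 2 j' * (x • (al 2 j).adjugate) * al 2 j = (2 : ℤ) • x • al 2 j' := by
          rw [mul_smul_comm, smul_mul_assoc, mul_assoc, Matrix.adjugate_mul, det_al, mul_smul_comm,
            mul_one, smul_comm]
          rfl
        rcases eq_one_or_neg_one_of_fix hp5 (det_dbl hn (S.det_mat o) (S.tr_mat o))
          (tr_dbl (S.tr_mat o)) (mob_dbl hn (S.det_mat o) (S.tr_mat o) (S.fix o)) hG' hm with rfl | rfl
        · left
          have h2 := e'' 1
          rw [one_smul, one_smul, ← one_mul (al 2 j).adjugate, e'] at h2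
          exact (smul_right_injective _ (two_ne_zero (α := ℤ)) h2).symm
        · right
          have h2 := e'' (-1)
          rw [neg_one_smul, neg_one_smul, ← one_mul (al 2 j).adjugate, ← neg_mul, e'] at h2
          have h3 : G * al 2 j = -al 2 j' := smul_right_injective _ (two_ne_zero (α := ℤ)) h2
          rw [neg_mul, h3, neg_neg]
      obtain rfl : j' = j := h1.elim (fun h1 => al_injective h1) fun h1 => al_injective h1
      rfl

end

section

open scoped UpperHalfPlane
open UpperHalfPlane

variable {p : ℕ} [hp : Fact p.Prime] {A B : M2} {n : ℤ}

/-- The condition `EvenOff (der B j)` on the entries modulo `2`. -/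
def EvenMod (a b c d : ZMod 2) : Option (ZMod 2) → Prop
  | none => c = 0
  | some t => b + t * d - t * a - t ^ 2 * c = 0

instance (a b c d : ZMod 2) : DecidablePred (EvenMod a b c d) :=
  fun i => by cases i <;> simp only [EvenMod] <;> infer_instance

omit hp in
lemma evenOff_der_iff (j : Option (ZMod 2)) :
    EvenOff (der B j) ↔ EvenMod (B 0 0) (B 0 1) (B 1 0) (B 1 1) j := by
  have h20 : (2 : ℤ) = ((2 : ℕ) : ℤ) := rfl
  have h4 : (2 : ZMod 2) = 0 := by decide
  simp only [EvenOff, h20, ← ZMod.intCast_zmod_eq_zero_iff_dvd]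
  cases j with
  | none =>
    simp only [der, al, tri, EvenMod, Matrix.mul_apply, Fin.sum_univ_two, Matrix.adjugate_fin_two]
    simp [h4]
  | some t =>
    simp only [der, al, tri, EvenMod, Matrix.mul_apply, Fin.sum_univ_two, Matrix.adjugate_fin_two]
    simp [h4, -ZMod.natCast_val]
    rw [ZMod.natCast_zmod_val]
    generalize (B 0 0 : ZMod 2) = a
    generalize (B 0 1 : ZMod 2) = b
    generalize (B 1 0 : ZMod 2) = c
    generalize (B 1 1 : ZMod 2) = d
    revert a b c d t
    decide

omit hp in
lemma card_not_evenOff_der (hn : 4 * n = 1 + p) (hB : B.det = n) (ht : B 0 0 + B 1 1 = 1) :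
    (Finset.univ.filter fun j => ¬ EvenOff (der B j)).card = if p % 8 = 3 then 3 else 1 := by
  have key : ∀ a b c d : ZMod 2, a + d = 1 →
      (a * d - b * c = 1 → (Finset.univ.filter fun j => ¬ EvenMod a b c d j).card = 3) ∧
      (a * d - b * c = 0 → (Finset.univ.filter fun j => ¬ EvenMod a b c d j).card = 1) := by decide
  rw [Matrix.det_fin_two] at hB
  have h1 := congrArg (Int.cast : ℤ → ZMod 2) hB
  have h2 := congrArg (Int.cast : ℤ → ZMod 2) ht
  push_cast at h1 h2
  simp only [evenOff_der_iff]
  split_ifs with h8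
  · refine (key _ _ _ _ h2).1 (h1.trans ?_)
    have : ((n : ℤ) : ZMod 2) = ((1 : ℤ) : ZMod 2) := by
      rw [ZMod.intCast_eq_intCast_iff']
      push_cast
      omega
    simpa using this
  · refine (key _ _ _ _ h2).2 (h1.trans ?_)
    rw [ZMod.intCast_zmod_eq_zero_iff_dvd]
    push_cast
    omega

variable {O : Type*} [Fintype O]

omit hp in
lemma card_not_evenOff (hn : 4 * n = 1 + p) (S : Reps 1 n O) :
    Fintype.card {x : O × Option (ZMod 2) // ¬ EvenOff (der (S.mat x.1) x.2)} =
      Fintype.card O * if p % 8 = 3 then 3 else 1 := by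
  classical
  rw [← Nat.card_eq_fintype_card]
  refine (ncard_prod fun o j => ¬ EvenOff (der (S.mat o) j)).trans ?_
  rw [Finset.sum_congr rfl fun o _ => card_not_evenOff_der hn (S.det_mat o) (S.tr_mat o)]
  simp

theorem ncard_level_two_of_mod_four_eq_one (hp5 : 5 ≤ p) (hp4 : p % 4 = 1) (S : Reps 0 p O) :
    (hv 2 2 '' FixN 2 p).ncard = Fintype.card O := by
  rw [ncard_level_two hp5 S, Finset.sum_congr rfl fun o _ => if_neg ?_]
  · simp
  · rintro ⟨⟨u, hu⟩, ⟨v, hv⟩⟩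
    have h1 := S.det_mat o
    have h2 : S.mat o 1 1 = - S.mat o 0 0 := by linarith [S.tr_mat o]
    rw [Matrix.det_fin_two, hu, hv, h2] at h1
    rcases Int.emod_two_eq_zero_or_one (S.mat o 0 0) with h3 | h3
    · obtain ⟨w, hw⟩ := Int.dvd_of_emod_eq_zero h3
      have : (4 : ℤ) ∣ p := ⟨-(w * w) - u * v, by rw [← h1, hw]; ring⟩
      omega
    · obtain ⟨w, hw⟩ : ∃ w, S.mat o 0 0 = 2 * w + 1 := ⟨S.mat o 0 0 / 2, by omega⟩
      have : (4 : ℤ) ∣ p + 1 := ⟨-(w * w) - w - u * v, by rw [← h1, hw]; ring⟩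
      omega

theorem ncard_level_two_of_mod_four_eq_three (hp5 : 5 ≤ p) (hn : 4 * n = 1 + p) (hp4 : p % 4 = 3)
    (S : Reps 1 n O) :
    (hv 2 2 '' FixN 2 p).ncard = Fintype.card O * if p % 8 = 3 then 6 else 4 := by
  classical
  have h1 := ncard_level_two hp5 (derivedReps hp5 hn hp4 S)
  rw [Fintype.sum_sum_type] at h1
  have h2 (o : O) : (if (2 : ℤ) ∣ (derivedReps hp5 hn hp4 S).mat (.inl o) 0 1 ∧
      (2 : ℤ) ∣ (derivedReps hp5 hn hp4 S).mat (.inl o) 1 0 then 3 else 1) = 3 :=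
    if_pos (evenOff_dbl (B := S.mat o))
  have h3 (x : {x : O × Option (ZMod 2) // ¬ EvenOff (der (S.mat x.1) x.2)}) :
      (if (2 : ℤ) ∣ (derivedReps hp5 hn hp4 S).mat (.inr x) 0 1 ∧
      (2 : ℤ) ∣ (derivedReps hp5 hn hp4 S).mat (.inr x) 1 0 then 3 else 1) = 1 :=
    if_neg x.2
  rw [h1, Finset.sum_congr rfl fun o _ => h2 o, Finset.sum_congr rfl fun x _ => h3 x]
  simp only [Finset.sum_const, Finset.card_univ, card_not_evenOff hn S, smul_eq_mul]
  split_ifs <;> ring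

theorem ncard_level_three_of_mod_four_eq_three (hp5 : 5 ≤ p) (hn : 4 * n = 1 + p)
    (hp4 : p % 4 = 3) (S : Reps 1 n O) :
    (hv 3 1 '' FixN 3 p).ncard =
      Fintype.card O * (if p % 8 = 3 then 4 else 2) * if p % 3 = 1 then 0 else 2 := by
  classical
  rw [ncard_level_three hp5 (derivedReps hp5 hn hp4 S), Fintype.card_sum, card_not_evenOff hn S]
  split_ifs <;> ring

end

section

open scoped UpperHalfPlane nonZeroDivisors
open UpperHalfPlane

/-- An embedded imaginary quadratic order generated by a root of `X ^ 2 - t * X + n`. -/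
structure QuadGen (R : Type*) [CommRing R] (t n : ℤ) where
  w : R
  emb : R →+* ℂ
  sq : w * w = t * w - n
  im_pos : 0 < (emb w).im
  exists_rep : ∀ x : R, ∃ a b : ℤ, x = a + b * w

namespace QuadGen

variable {R : Type*} [CommRing R] {t n c d : ℤ} (Q : QuadGen R t n)

lemma eq_zero_of_add_mul {a b : ℤ} (h : (a + b * Q.w : R) = 0) : a = 0 ∧ b = 0 := by
  have h1 := congrArg Q.emb h
  simp only [map_add, map_mul, map_intCast, map_zero] at h1
  have h2 := congrArg Complex.im h1
  simp [Q.im_pos.ne'] at h2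
  rw [h2] at h1
  simpa [h2] using h1

lemma emb_injective : Function.Injective Q.emb := by
  rw [injective_iff_map_eq_zero]
  intro x hx
  obtain ⟨a, b, rfl⟩ := Q.exists_rep x
  simp only [map_add, map_mul, map_intCast] at hx
  have h2 := congrArg Complex.im hx
  simp [Q.im_pos.ne'] at h2
  rw [h2] at hx ⊢
  have : a = 0 := by simpa using hx
  simp [this]

include Q in
lemma intCast_ne_zero (hc : c ≠ 0) : (c : R) ≠ 0 := fun h =>
  hc (Q.eq_zero_of_add_mul (a := c) (b := 0) (by simpa using h)).1

/-- The ideal generated by `c` and `w - d`. -/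
def idl (c d : ℤ) : Ideal R := Ideal.span {(c : R), Q.w - d}

lemma mem_idl (h : c ∣ d ^ 2 - t * d + n) {x : R} :
    x ∈ Q.idl c d ↔ ∃ u v : ℤ, x = u * (Q.w - d) + v * c := by
  obtain ⟨k, hk⟩ := h
  have hkR := congrArg (Int.cast : ℤ → R) hk
  push_cast at hkR
  rw [idl, Ideal.mem_span_pair]
  constructor
  · rintro ⟨x, y, rfl⟩
    obtain ⟨a, b, rfl⟩ := Q.exists_rep x
    obtain ⟨a', b', rfl⟩ := Q.exists_rep y
    refine ⟨b * c + a' + b' * (t - d), a + b * d - b' * k, ?_⟩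
    push_cast
    linear_combination (b' : R) * Q.sq - b' * hkR
  · rintro ⟨u, v, rfl⟩
    exact ⟨v, u, by ring⟩

include Q in
lemma norm_pos (d : ℤ) : 0 < d ^ 2 - t * d + n := by
  have h1 := congrArg Q.emb Q.sq
  simp only [map_sub, map_mul, map_intCast] at h1
  have hi := congrArg Complex.im h1
  have hr := congrArg Complex.re h1
  simp at hi hr
  have hp := Q.im_pos
  set x := (Q.emb Q.w).re
  set y := (Q.emb Q.w).im
  have ht : (t : ℝ) = 2 * x := by
    refine mul_right_cancel₀ hp.ne' ?_
    linarith
  rw [ht] at hr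
  have : (0 : ℝ) < (d : ℝ) ^ 2 - t * d + n := by
    rw [ht]
    nlinarith [sq_nonneg ((d : ℝ) - x), mul_pos hp hp]
  exact_mod_cast this

/-- Every ideal is a multiple of one of the ideals `idl c d`. -/
lemma exists_eq_span_mul_idl {I : Ideal R} (hI : I ≠ ⊥) :
    ∃ g c d : ℤ, g ≠ 0 ∧ 0 < c ∧ c ∣ d ^ 2 - t * d + n ∧ I = Ideal.span {(g : R)} * Q.idl c d := by
  let J : Ideal ℤ :=
    { carrier := {b | ∃ a : ℤ, (a + b * Q.w : R) ∈ I}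
      zero_mem' := ⟨0, by simp⟩
      add_mem' := by
        rintro b b' ⟨a, ha⟩ ⟨a', ha'⟩
        refine ⟨a + a', ?_⟩
        convert I.add_mem ha ha' using 1
        push_cast
        ring
      smul_mem' := by
        rintro r b ⟨a, ha⟩
        refine ⟨r * a, ?_⟩
        convert I.mul_mem_left (r : R) ha using 1
        push_cast [smul_eq_mul]
        ring }
  have hJ (b : ℤ) : b ∈ J ↔ ∃ a : ℤ, (a + b * Q.w : R) ∈ I := Iff.rfl
  obtain ⟨g, hg⟩ := IsPrincipalIdealRing.principal J
  have hgJ (b : ℤ) : b ∈ J ↔ g ∣ b := by rw [hg]; exact Ideal.mem_span_singleton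
  obtain ⟨m, hm⟩ := IsPrincipalIdealRing.principal (I.comap (Int.castRingHom R))
  have hmI (b : ℤ) : (b : R) ∈ I ↔ m ∣ b := by
    have : (b : R) ∈ I ↔ b ∈ I.comap (Int.castRingHom R) := Iff.rfl
    rw [this, hm]
    exact Ideal.mem_span_singleton
  have hmul {a b : ℤ} (h : (a + b * Q.w : R) ∈ I) : a + b * t ∈ J := by
    refine ⟨-b * n, ?_⟩
    convert I.mul_mem_left Q.w h using 1
    push_cast
    linear_combination -(b : R) * Q.sq
  have hg0 : g ≠ 0 := by
    rintro rfl
    obtain ⟨x, hx, hx0⟩ := Submodule.exists_mem_ne_zero_of_ne_bot hI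
    obtain ⟨a, b, rfl⟩ := Q.exists_rep x
    have h1 : b = 0 := zero_dvd_iff.mp ((hgJ b).mp ⟨a, hx⟩)
    have h2 := zero_dvd_iff.mp ((hgJ _).mp (hmul hx))
    have h3 : a = 0 := by simpa [h1] using h2
    simp [h1, h3] at hx0
  obtain ⟨a, ha⟩ := (hJ g).mp ((hgJ g).mpr dvd_rfl)
  obtain ⟨d, hd⟩ : g ∣ -a := by
    have h1 := (hgJ _).mp (hmul ha)
    rw [dvd_neg]
    exact (dvd_add_left (Dvd.intro _ rfl)).mp h1
  have hd' : a = -(g * d) := by linarith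
  obtain ⟨c, hc⟩ : g ∣ m := by
    have h1 : (m : R) ∈ I := (hmI m).mpr dvd_rfl
    have h2 := (hgJ _).mp (hmul (a := m) (b := 0) (by simpa using h1))
    simpa using h2
  have hwd : (g * (Q.w - d) : R) ∈ I := by
    convert ha using 1
    rw [hd']
    push_cast
    ring
  have hnorm : c ∣ d ^ 2 - t * d + n := by
    have h1 : ((g * (d ^ 2 - t * d + n) : ℤ) : R) ∈ I := by
      convert I.mul_mem_left (t - d - Q.w) hwd using 1
      push_cast
      linear_combination (g : R) * Q.sq
    rw [hmI, hc] at h1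
    exact (mul_dvd_mul_iff_left hg0).mp h1
  have hc0 : c ≠ 0 := fun h => by
    rw [h, zero_dvd_iff] at hnorm
    exact (Q.norm_pos d).ne' hnorm
  have habs : ((|c| : ℤ) : R) = c ∨ ((|c| : ℤ) : R) = -c := by
    rcases abs_choice c with h | h <;> rw [h] <;> simp
  refine ⟨g, |c|, d, hg0, abs_pos.mpr hc0, (abs_dvd c _).mpr hnorm, le_antisymm ?_ ?_⟩
  · intro x hx
    obtain ⟨a', b, rfl⟩ := Q.exists_rep x
    obtain ⟨v, rfl⟩ := (hgJ b).mp ⟨a', hx⟩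
    have h1 : ((a' + v * g * d : ℤ) : R) ∈ I := by
      convert I.sub_mem hx (I.mul_mem_left (v : R) hwd) using 1
      push_cast
      ring
    obtain ⟨u, hu⟩ := (hmI _).mp h1
    rw [Ideal.mem_span_singleton_mul]
    refine ⟨u * c + v * (Q.w - d), Ideal.add_mem _ (Ideal.mul_mem_left _ _ ?_)
      (Ideal.mul_mem_left _ _ (Ideal.subset_span (by simp))), ?_⟩
    · rcases habs with h | h
      · rw [← h]; exact Ideal.subset_span (by simp)
      · rw [← neg_mem_iff, ← h]; exact Ideal.subset_span (by simp)
    · have hu' := congrArg (Int.cast : ℤ → R) hu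
      rw [hc] at hu'
      push_cast at hu' ⊢
      linear_combination -hu'
  · rw [idl, Ideal.span_mul_span', Ideal.span_le]
    rintro _ ⟨_, rfl, y, hy, rfl⟩
    rcases hy with rfl | rfl
    · have h1 : (g * c : R) ∈ I := by
        have := (hmI m).mpr dvd_rfl
        rw [hc] at this
        exact_mod_cast this
      rcases habs with h | h
      · simpa [h] using h1
      · simpa [h] using h1
    · exact hwd

end QuadGen

end

section

open scoped UpperHalfPlane nonZeroDivisors
open UpperHalfPlane

namespace QuadGen

variable {R : Type*} [CommRing R] {t n c d : ℤ} (Q : QuadGen R t n)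

/-- The point `(w - d) / c` of the upper half plane. -/
def point (d : ℤ) (hc : 0 < c) : ℍ :=
  ⟨(Q.emb Q.w - d) / c, by
    have hc' : (0 : ℝ) < c := by exact_mod_cast hc
    have h : ((Q.emb Q.w - d) / c).im = (Q.emb Q.w).im / c := by
      rw [← Complex.ofReal_intCast c, Complex.div_ofReal_im]
      simp
    rw [h]
    exact div_pos Q.im_pos hc'⟩

lemma coe_point (hc : 0 < c) : (Q.point d hc : ℂ) = (Q.emb Q.w - d) / c := rfl

lemma mul_point (hc : 0 < c) : (c : ℂ) * Q.point d hc = Q.emb (Q.w - d) := by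
  have : (c : ℂ) ≠ 0 := by exact_mod_cast hc.ne'
  rw [coe_point, map_sub, map_intCast]
  field_simp

/-- The matrix of multiplication by `w` on the ideal `idl c d`. -/
def mulMat (t n c d : ℤ) : M2 := !![t - d, -((d ^ 2 - t * d + n) / c); c, d]

lemma det_mulMat (h : c ∣ d ^ 2 - t * d + n) : (mulMat t n c d).det = n := by
  obtain ⟨k, hk⟩ := h
  by_cases hc : c = 0
  · subst hc
    simp [mulMat, Matrix.det_fin_two]
    linarith
  · simp [mulMat, Matrix.det_fin_two, hk, hc]
    linarith

include Q in
lemma det_pos : 0 < n := by simpa using Q.norm_pos 0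

lemma emb_sq : Q.emb Q.w * Q.emb Q.w = t * Q.emb Q.w - n := by
  simpa using congrArg Q.emb Q.sq

lemma mob_mulMat (hc : 0 < c) (h : c ∣ d ^ 2 - t * d + n) :
    mob (mulMat t n c d) (Q.point d hc) = Q.point d hc := by
  rw [mob_eq_self_iff (by rw [det_mulMat h]; exact Q.det_pos), coe_point]
  obtain ⟨k, hk⟩ := h
  have hc' : (c : ℂ) ≠ 0 := by exact_mod_cast hc.ne'
  have hkC := congrArg (Int.cast : ℤ → ℂ) hk
  push_cast at hkC
  simp [mulMat, hk, hc.ne']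
  field_simp
  linear_combination Q.emb_sq - hkC

/-- A fixed point is determined by the lower row of a matrix fixing it. -/
lemma eq_point {A : M2} {τ : ℍ} (hA : A.det = n) (ht : A 0 0 + A 1 1 = t) (hf : mob A τ = τ)
    (hc : 0 < A 1 0) : τ = Q.point (A 1 1) hc ∧ A 1 0 ∣ A 1 1 ^ 2 - t * A 1 1 + n := by
  have hc' : (A 1 0 : ℂ) ≠ 0 := by exact_mod_cast hc.ne'
  have hch := jf_charpoly (by rw [hA]; exact Q.det_pos) hf
  have h1 : (jf A τ - Q.emb Q.w) * (jf A τ + Q.emb Q.w - t) = 0 := by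
    have ht' := congrArg (Int.cast : ℤ → ℂ) ht
    rw [hA] at hch
    push_cast at hch ht'
    linear_combination hch - Q.emb_sq + jf A τ * ht'
  have him : (jf A τ).im = A 1 0 * τ.im := by simp [jf]
  have hcR : (0 : ℝ) < A 1 0 := by exact_mod_cast hc
  have h2 : jf A τ = Q.emb Q.w := by
    refine sub_eq_zero.mp ((mul_eq_zero.mp h1).resolve_right fun h => ?_)
    have := congrArg Complex.im h
    simp [him] at this
    have h3 := Q.im_pos
    have h4 := mul_pos hcR τ.im_pos
    linarith
  constructor
  · rw [UpperHalfPlane.ext_iff, coe_point, ← h2, jf]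
    field_simp
    ring
  · rw [Matrix.det_fin_two] at hA
    exact ⟨-A 0 1, by rw [← hA, ← ht]; ring⟩

lemma exists_mat_pos {A : M2} {τ : ℍ} (hA : A.det = n) (ht : A 0 0 + A 1 1 = t)
    (hf : mob A τ = τ) : ∃ c d : ℤ, ∃ hc : 0 < c, c ∣ d ^ 2 - t * d + n ∧ τ = Q.point d hc := by
  have hpos := Q.det_pos
  have hApos : 0 < A.det := by rwa [hA]
  rcases lt_trichotomy (A 1 0) 0 with h | h | h
  · have had : A.adjugate.det = n := by simp [Matrix.det_adjugate, hA]
    have hf' : mob A.adjugate τ = τ := by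
      have := mob_adjugate_mob hApos (τ := τ)
      rwa [hf] at this
    have h1 := Q.eq_point had (by simp [Matrix.adjugate_fin_two]; linarith) hf'
      (by simp [Matrix.adjugate_fin_two]; exact h)
    exact ⟨_, _, _, h1.2, h1.1⟩
  · exfalso
    rw [mob_eq_self_iff hApos, h] at hf
    have him := congrArg Complex.im hf
    simp [τ.im_ne_zero] at him
    have h2 : A 1 1 = A 0 0 := by
      have : (A 1 1 : ℝ) = A 0 0 := by linarith
      exact_mod_cast this
    have h3 := Q.norm_pos (A 0 0)
    rw [Matrix.det_fin_two, h, h2] at hA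
    rw [← hA, ← ht, h2] at h3
    linarith
  · have h1 := Q.eq_point hA ht hf h
    exact ⟨_, _, _, h1.2, h1.1⟩

end QuadGen

end

section

open scoped UpperHalfPlane nonZeroDivisors
open UpperHalfPlane

namespace QuadGen

variable {R : Type*} [CommRing R] {t n c d c' d' : ℤ} (Q : QuadGen R t n)

lemma eq_zero_of_mul_add_mul (hc : 0 < c) {a b : ℤ} (h : (a * (Q.w - d) + b * c : R) = 0) :
    a = 0 ∧ b = 0 := by
  have h1 : ((b * c - a * d : ℤ) + a * Q.w : R) = 0 := by
    rw [← h]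
    push_cast
    ring
  obtain ⟨h2, rfl⟩ := Q.eq_zero_of_add_mul h1
  simpa [hc.ne'] using h2

lemma exists_coeff (h : c' ∣ d' ^ 2 - t * d' + n) {x y z : R}
    (hI : Ideal.span {x} * Q.idl c' d' = Ideal.span {y} * Q.idl c d) (hz : z ∈ Q.idl c d) :
    ∃ u v : ℤ, y * z = x * (u * (Q.w - d') + v * c') := by
  have h1 : y * z ∈ Ideal.span {x} * Q.idl c' d' := by
    rw [hI]
    exact Ideal.mul_mem_mul (Ideal.mem_span_singleton_self y) hz
  obtain ⟨z', hz', h2⟩ := Ideal.mem_span_singleton_mul.mp h1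
  obtain ⟨u, v, rfl⟩ := (Q.mem_idl h).mp hz'
  exact ⟨u, v, h2.symm⟩

lemma left_mem_idl : Q.w - d ∈ Q.idl c d := Ideal.subset_span (by simp)

lemma right_mem_idl : (c : R) ∈ Q.idl c d := Ideal.subset_span (by simp)

lemma exists_mob_eq [IsDomain R] (hc : 0 < c) (hc' : 0 < c') (h : c ∣ d ^ 2 - t * d + n)
    (h' : c' ∣ d' ^ 2 - t * d' + n) {x y : R} (hx : x ≠ 0)
    (hI : Ideal.span {x} * Q.idl c' d' = Ideal.span {y} * Q.idl c d) :
    ∃ G : M2, G.det = 1 ∧ mob G (Q.point d' hc') = Q.point d hc := by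
  obtain ⟨p₁, p₂, e1⟩ := Q.exists_coeff h' hI Q.left_mem_idl
  obtain ⟨p₃, p₄, e2⟩ := Q.exists_coeff h' hI Q.right_mem_idl
  obtain ⟨q₁, q₂, e3⟩ := Q.exists_coeff h hI.symm Q.left_mem_idl
  obtain ⟨q₃, q₄, e4⟩ := Q.exists_coeff h hI.symm Q.right_mem_idl
  have f1 := Q.eq_zero_of_mul_add_mul hc' (d := d') (a := q₁ * p₁ + q₂ * p₃ - 1)
    (b := q₁ * p₂ + q₂ * p₄) (mul_left_cancel₀ hx (by
      push_cast
      linear_combination -e3 - q₁ * e1 - q₂ * e2))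
  have f2 := Q.eq_zero_of_mul_add_mul hc' (d := d') (a := q₃ * p₁ + q₄ * p₃)
    (b := q₃ * p₂ + q₄ * p₄ - 1) (mul_left_cancel₀ hx (by
      push_cast
      linear_combination -e4 - q₃ * e1 - q₄ * e2))
  have hdet : (q₁ * q₄ - q₂ * q₃) * (p₁ * p₄ - p₂ * p₃) = 1 := by
    linear_combination (q₃ * p₂ + q₄ * p₄) * f1.1 + f2.2 - (q₃ * p₁ + q₄ * p₃) * f1.2
  have hX : Q.emb x ≠ 0 := fun h0 => hx (Q.emb_injective (by rw [h0, map_zero]))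
  have hcC : (c : ℂ) ≠ 0 := by exact_mod_cast hc.ne'
  have hcC' : (c' : ℂ) ≠ 0 := by exact_mod_cast hc'.ne'
  have g1 := congrArg Q.emb e1
  have g2 := congrArg Q.emb e2
  rw [map_mul, map_mul, map_add, map_mul, map_mul, map_intCast, map_intCast, map_intCast,
    ← Q.mul_point hc, ← Q.mul_point hc'] at g1
  rw [map_mul, map_mul, map_add, map_mul, map_mul, map_intCast, map_intCast, map_intCast, map_intCast,
    ← Q.mul_point hc'] at g2
  generalize Q.point d hc = τ at *
  generalize Q.point d' hc' = τ' at *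
  have key : (τ : ℂ) * (p₃ * τ' + p₄) = p₁ * τ' + p₂ := by
    refine mul_left_cancel₀ (mul_ne_zero hX hcC') ?_
    linear_combination g1 - τ * g2
  rcases Int.eq_one_or_neg_one_of_mul_eq_one' hdet with ⟨-, hd⟩ | ⟨-, hd⟩
  · have hG : (!![p₁, p₂; p₃, p₄] : M2).det = 1 := by rw [Matrix.det_fin_two_of, hd]
    refine ⟨_, hG, ?_⟩
    have hGpos : 0 < (!![p₁, p₂; p₃, p₄] : M2).det := by rw [hG]; norm_num
    rw [UpperHalfPlane.ext_iff, coe_mob hGpos, div_eq_iff (jf_ne_zero hGpos)]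
    simpa [jf] using key.symm
  · exfalso
    have hr := congrArg Complex.re key
    have hi := congrArg Complex.im key
    simp at hr hi
    have hdR : (p₁ * p₄ - p₂ * p₃ : ℝ) = -1 := by exact_mod_cast hd
    have h1 : τ.im * ((p₃ * τ'.re + p₄) ^ 2 + (p₃ * τ'.im) ^ 2) = -τ'.im := by
      linear_combination (p₃ * τ'.re + p₄) * hi - p₃ * τ'.im * hr + τ'.im * hdR
    have h2 := τ'.im_pos
    have h3 : 0 ≤ τ.im * ((p₃ * τ'.re + p₄) ^ 2 + (p₃ * τ'.im) ^ 2) :=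
      mul_nonneg τ.im_pos.le (by positivity)
    linarith

lemma span_mul_idl_eq (hc : 0 < c) (hc' : 0 < c') {G : M2}
    (hG : G.det = 1) (h : mob G (Q.point d hc) = Q.point d' hc') :
    Ideal.span {(c' : R)} * Q.idl c d =
      Ideal.span {(G 1 0 * (Q.w - d) + G 1 1 * c : R)} * Q.idl c' d' := by
  have hcC : (c : ℂ) ≠ 0 := by exact_mod_cast hc.ne'
  have hGpos : 0 < G.det := by rw [hG]; norm_num
  rw [UpperHalfPlane.ext_iff, coe_mob hGpos, div_eq_iff (jf_ne_zero hGpos), jf] at h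
  have m1 := Q.mul_point (d := d) hc
  have m2 := Q.mul_point (d := d') hc'
  have e : (G 1 0 * (Q.w - d) + G 1 1 * c) * (Q.w - d') =
      c' * (G 0 0 * (Q.w - d) + G 0 1 * c) := by
    apply Q.emb_injective
    rw [map_mul, map_mul, map_add, map_add, map_mul, map_mul, map_mul, map_mul, map_intCast,
      map_intCast, map_intCast, map_intCast, map_intCast, map_intCast, ← m1, ← m2]
    linear_combination -(c : ℂ) * c' * h
  have hspan : Q.idl c d = Ideal.span {(G 1 0 * (Q.w - d) + G 1 1 * c : R),
      (G 0 0 * (Q.w - d) + G 0 1 * c : R)} := by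
    have hd := congrArg (Int.cast : ℤ → R) hG
    rw [Matrix.det_fin_two] at hd
    push_cast at hd
    refine le_antisymm (Ideal.span_le.mpr ?_) (Ideal.span_le.mpr ?_)
    · rintro _ (rfl | rfl)
      · exact Ideal.mem_span_pair.mpr ⟨G 0 0, -G 1 0, by linear_combination (c : R) * hd⟩
      · exact Ideal.mem_span_pair.mpr ⟨-G 0 1, G 1 1, by linear_combination (Q.w - d) * hd⟩
    · rintro _ (rfl | rfl)
      · exact Ideal.mem_span_pair.mpr ⟨G 1 1, G 1 0, by ring⟩
      · exact Ideal.mem_span_pair.mpr ⟨G 0 1, G 0 0, by ring⟩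
  rw [hspan, idl, Ideal.span_mul_span', Ideal.span_mul_span', Set.singleton_mul, Set.singleton_mul,
    Set.image_pair, Set.image_pair, e, mul_comm (c' : R) (G 1 0 * (Q.w - d) + G 1 1 * c)]

section ClassGroup

variable [IsDedekindDomain R]

/-- The ideal `idl c d` as a nonzero ideal. -/
def nzIdl (hc : 0 < c) (d : ℤ) : (Ideal R)⁰ :=
  ⟨Q.idl c d, mem_nonZeroDivisors_of_ne_zero fun h => Q.intCast_ne_zero hc.ne' (by
    have := Q.right_mem_idl (c := c) (d := d)
    rwa [h] at this)⟩

lemma exists_mk0_eq (g : ClassGroup R) : ∃ c d : ℤ, ∃ hc : 0 < c, c ∣ d ^ 2 - t * d + n ∧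
    ClassGroup.mk0 (Q.nzIdl hc d) = g := by
  obtain ⟨I, rfl⟩ := ClassGroup.mk0_surjective g
  obtain ⟨g, c, d, hg, hc, h, hI⟩ := Q.exists_eq_span_mul_idl (nonZeroDivisors.ne_zero I.2)
  refine ⟨c, d, hc, h, ClassGroup.mk0_eq_mk0_iff.mpr
    ⟨g, 1, Q.intCast_ne_zero hg, one_ne_zero, ?_⟩⟩
  rw [Ideal.span_singleton_one, Ideal.top_mul, hI]
  rfl

/-- The fixed points of the matrices of trace `t` and determinant `n` are classified by the class
group. -/
def reps : Reps t n (ClassGroup R) where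
  pt g := Q.point (Q.exists_mk0_eq g).choose_spec.choose
    (Q.exists_mk0_eq g).choose_spec.choose_spec.choose
  mat g := mulMat t n (Q.exists_mk0_eq g).choose (Q.exists_mk0_eq g).choose_spec.choose
  det_mat g := det_mulMat (Q.exists_mk0_eq g).choose_spec.choose_spec.choose_spec.1
  tr_mat g := by simp [mulMat]
  fix g := Q.mob_mulMat _ (Q.exists_mk0_eq g).choose_spec.choose_spec.choose_spec.1
  complete A τ hA ht hf := by
    obtain ⟨c, d, hc, h, rfl⟩ := Q.exists_mat_pos hA ht hf
    refine ⟨ClassGroup.mk0 (Q.nzIdl hc d), ?_⟩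
    obtain ⟨h', hg⟩ := (Q.exists_mk0_eq (ClassGroup.mk0 (Q.nzIdl hc d))).choose_spec.choose_spec.choose_spec
    obtain ⟨x, y, hx, -, hI⟩ := ClassGroup.mk0_eq_mk0_iff.mp hg
    exact Q.exists_mob_eq hc _ h h' hx hI
  irredundant g g' G hG h := by
    rw [← (Q.exists_mk0_eq g).choose_spec.choose_spec.choose_spec.2,
      ← (Q.exists_mk0_eq g').choose_spec.choose_spec.choose_spec.2, ClassGroup.mk0_eq_mk0_iff]
    have hc := (Q.exists_mk0_eq g).choose_spec.choose_spec.choose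
    refine ⟨_, _, Q.intCast_ne_zero (Q.exists_mk0_eq g').choose_spec.choose_spec.choose.ne', ?_,
      Q.span_mul_idl_eq _ _ hG h⟩
    intro h0
    obtain ⟨h1, h2⟩ := Q.eq_zero_of_mul_add_mul hc h0
    rw [Matrix.det_fin_two, h1, h2] at hG
    simp at hG

end ClassGroup

end QuadGen

end

section

/-- The field generated by `Complex.I * √d`. -/
abbrev sqrtNegField (d : ℕ) : IntermediateField ℚ ℂ :=
  IntermediateField.adjoin ℚ {(Complex.I * Real.sqrt d : ℂ)}

variable {p : ℕ}

lemma I_mul_sqrt_sq (d : ℕ) : (Complex.I * Real.sqrt d : ℂ) * (Complex.I * Real.sqrt d : ℂ) = -d := by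
  rw [mul_mul_mul_comm, Complex.I_mul_I, ← Complex.ofReal_mul, Real.mul_self_sqrt (Nat.cast_nonneg d)]
  simp

lemma I_mul_sqrt_mem (d : ℕ) : (Complex.I * Real.sqrt d : ℂ) ∈ sqrtNegField d :=
  IntermediateField.mem_adjoin_simple_self ℚ _

lemma exists_rat_of_mem {d : ℕ} {x : ℂ} (hx : x ∈ sqrtNegField d) :
    ∃ a b : ℚ, x = a + b * (Complex.I * Real.sqrt d) := by
  have hsq := I_mul_sqrt_sq d
  set α := (Complex.I * Real.sqrt d : ℂ)
  induction hx using IntermediateField.adjoin_induction with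
  | mem x hx => exact ⟨0, 1, by simpa using hx⟩
  | algebraMap x => exact ⟨x, 0, by simp⟩
  | add x y _ _ h1 h2 =>
    obtain ⟨a, b, rfl⟩ := h1
    obtain ⟨a', b', rfl⟩ := h2
    exact ⟨a + a', b + b', by push_cast; ring⟩
  | inv x _ h1 =>
    obtain ⟨a, b, rfl⟩ := h1
    by_cases h0 : (a + b * α : ℂ) = 0
    · exact ⟨0, 0, by rw [h0]; simp⟩
    · have h1 : (a + b * α) * (a - b * α) = ((a ^ 2 + d * b ^ 2 : ℚ) : ℂ) := by
        push_cast
        linear_combination -(b : ℂ) ^ 2 * hsq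
      by_cases h2 : (a ^ 2 + d * b ^ 2 : ℚ) = 0
      · refine ⟨0, 0, ?_⟩
        have h3 : a = 0 := by
          have : (0 : ℚ) ≤ d * b ^ 2 := by positivity
          nlinarith
        rw [h2, h3] at h1
        rw [h3] at h0
        simp at h1 h0
        exact absurd h1 (by simp [h0])
      · refine ⟨a / (a ^ 2 + d * b ^ 2), -b / (a ^ 2 + d * b ^ 2), ?_⟩
        have h3 : ((a ^ 2 + d * b ^ 2 : ℚ) : ℂ) ≠ 0 := by exact_mod_cast h2
        apply inv_eq_of_mul_eq_one_right
        apply mul_right_cancel₀ h3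
        rw [one_mul]
        refine Eq.trans ?_ h1
        have h4 (u : ℚ) : ((u / (a ^ 2 + d * b ^ 2) : ℚ) : ℂ) * ((a ^ 2 + d * b ^ 2 : ℚ) : ℂ) = u := by
          rw [← Rat.cast_mul, div_mul_cancel₀ _ h2]
        have h5 := h4 (-b)
        rw [Rat.cast_neg] at h5
        linear_combination (a + b * α) * h4 a + (a + b * α) * α * h5
  | mul x y _ _ h1 h2 =>
    obtain ⟨a, b, rfl⟩ := h1
    obtain ⟨a', b', rfl⟩ := h2
    exact ⟨a * a' - d * b * b', a * b' + b * a', by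
      push_cast
      linear_combination (b : ℂ) * b' * hsq⟩

lemma exists_int_of_isIntegral {q : ℚ} (h : IsIntegral ℤ (q : ℂ)) : ∃ m : ℤ, q = m := by
  have h1 : IsIntegral ℤ q := by
    rw [← isIntegral_algebraMap_iff (B := ℂ) (algebraMap ℚ ℂ).injective]
    simpa using h
  obtain ⟨m, hm⟩ := IsIntegrallyClosed.isIntegral_iff.mp h1
  exact ⟨m, by simpa using hm.symm⟩

lemma exists_int_of_sq {q : ℚ} {m : ℤ} (h : q ^ 2 = m) : ∃ r : ℤ, q = r := by
  have h1 : IsIntegral ℤ q := IsIntegral.of_pow (n := 2) two_pos (by rw [h]; exact isIntegral_algebraMap)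
  obtain ⟨r, hr⟩ := IsIntegrallyClosed.isIntegral_iff.mp h1
  exact ⟨r, by simpa using hr.symm⟩

lemma exists_int_of_prime_mul_sq (hp : p.Prime) {q : ℚ} {s : ℤ} (h : p * q ^ 2 = s) :
    ∃ r : ℤ, q = r := by
  have hpQ : (p : ℚ) ≠ 0 := by exact_mod_cast hp.ne_zero
  obtain ⟨r, hr⟩ := exists_int_of_sq (q := p * q) (m := p * s) (by push_cast; rw [← h]; ring)
  have h1 : r ^ 2 = p * s := by
    have : (r : ℚ) ^ 2 = p * s := by rw [← hr, ← h]; ring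
    exact_mod_cast this
  obtain ⟨u, rfl⟩ := (Nat.prime_iff_prime_int.mp hp).dvd_of_dvd_pow (Dvd.intro _ h1.symm)
  exact ⟨u, mul_left_cancel₀ hpQ (by rw [hr]; push_cast; ring)⟩

/-- Twice the coordinates of an integral element are integers. -/
lemma exists_half_int (hp : p.Prime) {x : ℂ} (hx : x ∈ sqrtNegField p) (hi : IsIntegral ℤ x) :
    ∃ m q k : ℤ, m ^ 2 + p * q ^ 2 = 4 * k ∧ 2 * x = m + q * (Complex.I * Real.sqrt p) := by
  obtain ⟨a, b, rfl⟩ := exists_rat_of_mem hx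
  have hsq := I_mul_sqrt_sq p
  have hconj : (starRingEnd ℂ) (a + b * (Complex.I * Real.sqrt p)) =
      a - b * (Complex.I * Real.sqrt p) := by
    simp [sub_eq_add_neg]
  have hi' : IsIntegral ℤ (a - b * (Complex.I * Real.sqrt p) : ℂ) := by
    rw [← hconj]
    exact map_isIntegral_int (starRingEnd ℂ) hi
  generalize (Complex.I * Real.sqrt p : ℂ) = α at *
  obtain ⟨m, hm⟩ := exists_int_of_isIntegral (q := 2 * a) (by
    have h : ((2 * a : ℚ) : ℂ) = a + b * α + (a - b * α) := by
      push_cast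
      ring
    rw [h]
    exact hi.add hi')
  obtain ⟨k, hk⟩ := exists_int_of_isIntegral (q := a ^ 2 + p * b ^ 2) (by
    have h : ((a ^ 2 + p * b ^ 2 : ℚ) : ℂ) = (a + b * α) * (a - b * α) := by
      push_cast
      linear_combination (b : ℂ) ^ 2 * hsq
    rw [h]
    exact hi.mul hi')
  obtain ⟨q, hq⟩ := exists_int_of_prime_mul_sq hp (q := 2 * b) (s := 4 * k - m ^ 2) (by
    push_cast
    rw [← hk, ← hm]
    ring)
  refine ⟨m, q, k, ?_, ?_⟩
  · have : (m ^ 2 + p * q ^ 2 : ℚ) = 4 * k := by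
      rw [← hm, ← hq, ← hk]
      ring
    exact_mod_cast this
  · have hm' := congrArg (Rat.cast : ℚ → ℂ) hm
    have hq' := congrArg (Rat.cast : ℚ → ℂ) hq
    push_cast at hm' hq'
    rw [← hm', ← hq']
    ring

open NumberField in
/-- The inclusion of the integers of a subfield of the complex numbers. -/
def ringOfIntegersEmb (K : IntermediateField ℚ ℂ) : 𝓞 K →+* ℂ :=
  (algebraMap K ℂ).comp (algebraMap (𝓞 K) K)

lemma ringOfIntegersEmb_injective (K : IntermediateField ℚ ℂ) :
    Function.Injective (ringOfIntegersEmb K) :=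
  (algebraMap K ℂ).injective.comp NumberField.RingOfIntegers.coe_injective

lemma exists_ringOfIntegersEmb_eq {K : IntermediateField ℚ ℂ} {w : ℂ} {t n : ℤ} (hw : w ∈ K)
    (hsq : w * w = t * w - n) : ∃ z, ringOfIntegersEmb K z = w := by
  refine ⟨⟨⟨w, hw⟩, ?_⟩, rfl⟩
  rw [mem_integralClosure_iff, ← isIntegral_algebraMap_iff (B := ℂ) (algebraMap K ℂ).injective]
  refine ⟨Polynomial.X ^ 2 - Polynomial.C t * Polynomial.X + Polynomial.C n, by monicity!, ?_⟩
  change Polynomial.eval₂ _ w _ = 0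
  simp only [Polynomial.eval₂_add, Polynomial.eval₂_sub, Polynomial.eval₂_mul,
    Polynomial.eval₂_pow, Polynomial.eval₂_X]
  rw [Polynomial.eval₂_C, Polynomial.eval₂_C, eq_intCast, eq_intCast]
  linear_combination hsq

open NumberField in
/-- A generator of the ring of integers of a subfield of the complex numbers. -/
def quadGen {K : IntermediateField ℚ ℂ} {w : ℂ} {t n : ℤ} (hw : w ∈ K) (hsq : w * w = t * w - n)
    (him : 0 < w.im) (hgen : ∀ x ∈ K, IsIntegral ℤ x → ∃ a b : ℤ, x = a + b * w) :
    QuadGen (𝓞 K) t n where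
  w := (exists_ringOfIntegersEmb_eq hw hsq).choose
  emb := ringOfIntegersEmb K
  sq := by
    apply ringOfIntegersEmb_injective K
    rw [map_mul, map_sub, map_mul, map_intCast, map_intCast,
      (exists_ringOfIntegersEmb_eq hw hsq).choose_spec]
    exact hsq
  im_pos := by rwa [(exists_ringOfIntegersEmb_eq hw hsq).choose_spec]
  exists_rep x := by
    obtain ⟨a, b, h⟩ := hgen x x.1.2 (map_isIntegral_int (algebraMap K ℂ) x.2)
    refine ⟨a, b, ?_⟩
    apply ringOfIntegersEmb_injective K
    rw [map_add, map_mul, map_intCast, map_intCast,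
      (exists_ringOfIntegersEmb_eq hw hsq).choose_spec]
    exact h

lemma exists_repr_of_mod_four_eq_one (hp : p.Prime) (hp4 : p % 4 = 1) {x : ℂ}
    (hx : x ∈ sqrtNegField p) (hi : IsIntegral ℤ x) :
    ∃ a b : ℤ, x = a + b * (Complex.I * Real.sqrt p) := by
  obtain ⟨m, q, k, h1, h2⟩ := exists_half_int hp hx hi
  have h3 : 2 ∣ m ∧ 2 ∣ q := by
    have h4 : (m ^ 2 + p * q ^ 2) % 4 = 0 := by omega
    have h5 : (p : ℤ) % 4 = 1 := by omega
    rw [Int.add_emod, Int.mul_emod, h5, pow_two, pow_two, Int.mul_emod m, Int.mul_emod q] at h4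
    have hm : m % 4 = 0 ∨ m % 4 = 1 ∨ m % 4 = 2 ∨ m % 4 = 3 := by omega
    have hq : q % 4 = 0 ∨ q % 4 = 1 ∨ q % 4 = 2 ∨ q % 4 = 3 := by omega
    rcases hm with hm | hm | hm | hm <;> rcases hq with hq | hq | hq | hq <;>
      rw [hm, hq] at h4 <;> omega
  obtain ⟨⟨a, rfl⟩, ⟨b, rfl⟩⟩ := h3
  refine ⟨a, b, mul_left_cancel₀ (two_ne_zero' ℂ) ?_⟩
  rw [h2]
  push_cast
  ring

lemma exists_repr_of_mod_four_eq_three (hp : p.Prime) (hp4 : p % 4 = 3) {x : ℂ}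
    (hx : x ∈ sqrtNegField p) (hi : IsIntegral ℤ x) :
    ∃ a b : ℤ, x = a + b * ((1 + Complex.I * Real.sqrt p) / 2) := by
  obtain ⟨m, q, k, h1, h2⟩ := exists_half_int hp hx hi
  have h3 : 2 ∣ m - q := by
    have h4 : (m ^ 2 + p * q ^ 2) % 2 = 0 := by omega
    have h5 : (p : ℤ) % 2 = 1 := by omega
    rw [Int.add_emod, Int.mul_emod, h5, pow_two, pow_two, Int.mul_emod m, Int.mul_emod q] at h4
    have hm : m % 2 = 0 ∨ m % 2 = 1 := by omega
    have hq : q % 2 = 0 ∨ q % 2 = 1 := by omega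
    rcases hm with hm | hm <;> rcases hq with hq | hq <;> rw [hm, hq] at h4 <;> omega
  obtain ⟨a, ha⟩ := h3
  obtain rfl : m = 2 * a + q := by omega
  refine ⟨a, q, mul_left_cancel₀ (two_ne_zero' ℂ) ?_⟩
  rw [h2]
  push_cast
  ring

end

section

lemma exists_fintype_card_eq_classNumber (d : ℕ) {t n : ℤ}
    (Q : QuadGen (NumberField.RingOfIntegers (sqrtNegField d)) t n) :
    ∃ (O : Type) (_ : Fintype O), Fintype.card O = classNumberSqrtNeg d ∧ Nonempty (Reps t n O) := by
  have : FiniteDimensional ℚ (sqrtNegField d) :=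
    IntermediateField.adjoin.finiteDimensional
      ⟨X ^ 2 + C (d : ℚ), monic_X_pow_add_C _ (by norm_num), by
        have h := I_mul_sqrt_sq d
        rw [← pow_two] at h
        simp [h]⟩
  have : NumberField (sqrtNegField d) := ⟨⟩
  exact ⟨ClassGroup (NumberField.RingOfIntegers (sqrtNegField d)), inferInstance, rfl, ⟨Q.reps⟩⟩

variable {p}

lemma exists_reps_of_mod_four_eq_one (hp4 : p % 4 = 1) :
    ∃ (O : Type) (_ : Fintype O), Fintype.card O = classNumberSqrtNeg p ∧
      Nonempty (Reps 0 p O) := by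
  have hp : p.Prime := Fact.out
  refine exists_fintype_card_eq_classNumber p (quadGen (I_mul_sqrt_mem p) ?_ ?_ fun x hx hi =>
    exists_repr_of_mod_four_eq_one hp hp4 hx hi)
  · rw [I_mul_sqrt_sq]
    simp
  · simpa using hp.pos

lemma exists_reps_of_mod_four_eq_three {n : ℤ} (hn : 4 * n = 1 + p) (hp4 : p % 4 = 3) :
    ∃ (O : Type) (_ : Fintype O), Fintype.card O = classNumberSqrtNeg p ∧
      Nonempty (Reps 1 n O) := by
  have hp : p.Prime := Fact.out
  refine exists_fintype_card_eq_classNumber p (quadGen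
    (w := (1 + Complex.I * Real.sqrt p) / 2) ?_ ?_ ?_ fun x hx hi =>
    exists_repr_of_mod_four_eq_three hp hp4 hx hi)
  · have h2 : ((2 : ℚ) : ℂ) = 2 := by norm_num
    rw [← h2]
    exact div_mem (add_mem (one_mem _) (I_mul_sqrt_mem p)) ((sqrtNegField p).algebraMap_mem 2)
  · have h1 : (4 : ℂ) * n = 1 + p := by exact_mod_cast hn
    push_cast
    linear_combination I_mul_sqrt_sq p / 4 + h1 / 4
  · simpa using hp.pos

lemma N1_eq_card_rootsW (m : ℕ) : N1 p m = (rootsW p m).card := by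
  have h (y : ZMod p) : ((W m).map (Int.castRingHom (ZMod p))).eval y =
      ∑ r ∈ Finset.range (m + 1), (m.choose r : ZMod p) ^ 2 * y ^ r := by
    simp [W, Polynomial.map_sum, Polynomial.eval_finsetSum]
  have h0 : (W m).map (Int.castRingHom (ZMod p)) ≠ 0 := by
    intro h1
    have h2 := h 0
    rw [h1, Finset.sum_range_succ'] at h2
    simp at h2
  rw [N1]
  congr 1
  ext y
  rw [Multiset.mem_toFinset, mem_roots h0, IsRoot.def, h, rootsW, Finset.mem_filter]
  simp

lemma ncard_eq_two_mul_add {N e : ℕ} (h : Lv N e) (hp5 : 5 ≤ p) :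
    (hv N e '' FixN N p).ncard = 2 * (N1 p (p / (6 - N)) + if dd N p = 0 then 0 else 1) := by
  rw [ncard_image_FixN h hp5, card_roots_revS h hp5, N1_eq_card_rootsW]
  rfl

lemma legendreSym_neg_one (hp5 : 5 ≤ p) :
    legendreSym p (-1) = if p % 4 = 1 then 1 else -1 := by
  have hp : p.Prime := Fact.out
  have hodd : p % 2 = 1 := hp.eq_two_or_odd.resolve_left (by omega)
  rw [legendreSym.at_neg_one (by omega), ZMod.χ₄_nat_eq_if_mod_four]
  simp [hodd]

lemma legendreSym_neg_two (hp5 : 5 ≤ p) :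
    legendreSym p (-2) = if p % 8 = 1 ∨ p % 8 = 3 then 1 else -1 := by
  have hp : p.Prime := Fact.out
  have hodd : p % 2 = 1 := hp.eq_two_or_odd.resolve_left (by omega)
  rw [legendreSym.at_neg_two (by omega), ZMod.χ₈'_nat_eq_if_mod_eight]
  simp [hodd]

lemma legendreSym_neg_three (hp5 : 5 ≤ p) :
    legendreSym p (-3) = if p % 3 = 1 then 1 else -1 := by
  have hp : p.Prime := Fact.out
  have hodd : p % 2 = 1 := hp.eq_two_or_odd.resolve_left (by omega)
  have hp3 : p % 3 ≠ 0 := fun h => by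
    have := (Nat.prime_dvd_prime_iff_eq Nat.prime_three hp).mp (Nat.dvd_of_mod_eq_zero h)
    omega
  have h3 : legendreSym p 3 = if p % 4 = 1 then legendreSym 3 p else - legendreSym 3 p := by
    split_ifs with h
    · exact_mod_cast (legendreSym.quadratic_reciprocity_one_mod_four (p := p) (q := 3) h
        (by norm_num)).symm
    · exact_mod_cast legendreSym.quadratic_reciprocity_three_mod_four (p := 3) (q := p)
        (by norm_num) (by omega)
  have h4 : legendreSym 3 p = if p % 3 = 1 then 1 else -1 := by
    rw [legendreSym.mod]
    have h5 : (p : ℤ) % (3 : ℕ) = 1 ∨ (p : ℤ) % (3 : ℕ) = 2 := by omega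
    rcases h5 with h5 | h5
    · rw [h5, if_pos (by omega)]; decide
    · rw [h5, if_neg (by omega)]; decide
  rw [show (-3 : ℤ) = -1 * 3 by norm_num, legendreSym.mul, h3, legendreSym_neg_one hp5, h4]
  split_ifs <;> simp

end

end BM

/-- Brillhart–Morton: for every prime p ≥ 5,
N₁(p, ⌊p/4⌋) = (1/4)·(2 + (1 − (−1|p))·(4 + (−2|p)))·h(√−p) − ε, and
N₁(p, ⌊p/3⌋) = δ·(2L(p) − 1), where
L(p) = (1/4)·(2 + (1 − (−1|p))·(2 + (−2|p)))·h(√−p). -/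
theorem brillhart_morton_number_of_linear_factors (hp : 5 ≤ p) :
    (N1 p (p / 4) : ℚ) =
        1 / 4 * (2 + (1 - (legendreSym p (-1) : ℚ)) * (4 + (legendreSym p (-2) : ℚ))) *
            (classNumberSqrtNeg p : ℚ) - (eps p : ℚ)
      ∧ (N1 p (p / 3) : ℚ) =
          (del p : ℚ) *
            (2 * (1 / 4 * (2 + (1 - (legendreSym p (-1) : ℚ)) * (2 + (legendreSym p (-2) : ℚ))) *
                (classNumberSqrtNeg p : ℚ)) - 1) := by
  have hpp : p.Prime := Fact.out
  have hodd : p % 2 = 1 := hpp.eq_two_or_odd.resolve_left (by omega)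
  have hp3 : p % 3 ≠ 0 := fun h => by
    have := (Nat.prime_dvd_prime_iff_eq Nat.prime_three hpp).mp (Nat.dvd_of_mod_eq_zero h)
    omega
  have h2 := BM.ncard_eq_two_mul_add (p := p) (N := 2) (e := 2) (Or.inl ⟨rfl, rfl⟩) hp
  have h3 := BM.ncard_eq_two_mul_add (p := p) (N := 3) (e := 1) (Or.inr ⟨rfl, rfl⟩) hp
  have hd2 : BM.dd 2 p = 0 ↔ p % 4 = 1 := by
    unfold BM.dd BM.mm
    omega
  have hd3 : BM.dd 3 p = 0 ↔ p % 3 = 1 := by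
    unfold BM.dd BM.mm
    omega
  simp only [hd2, Nat.reduceSub] at h2
  simp only [hd3, Nat.reduceSub] at h3
  have he : eps p = if p % 4 = 1 then 0 else 1 := by
    rw [eps, BM.legendreSym_neg_one hp]
    split_ifs <;> rfl
  have hdel : del p = if p % 3 = 1 then 0 else 1 := by
    rw [del, BM.legendreSym_neg_three hp]
    split_ifs <;> rfl
  rw [he, hdel, BM.legendreSym_neg_one hp, BM.legendreSym_neg_two hp]
  rcases (by omega : p % 4 = 1 ∨ p % 4 = 3) with h4 | h4
  · obtain ⟨O, _, hO, ⟨S⟩⟩ := BM.exists_reps_of_mod_four_eq_one h4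
    rw [BM.ncard_level_two_of_mod_four_eq_one hp h4 S, hO, if_pos h4] at h2
    rw [BM.ncard_level_three hp S, hO] at h3
    have h2' : (classNumberSqrtNeg p : ℚ) = 2 * N1 p (p / 4) := by exact_mod_cast h2
    rw [if_pos h4, if_pos h4]
    refine ⟨by push_cast; linear_combination -h2' / 2, ?_⟩
    by_cases h3m : p % 3 = 1
    · rw [if_pos h3m, if_pos h3m] at h3
      have h3' : N1 p (p / 3) = 0 := by omega
      simp [h3', h3m]
    · rw [if_neg h3m, if_neg h3m] at h3
      have h3' : (classNumberSqrtNeg p : ℚ) * 2 = 2 * (N1 p (p / 3) + 1) := by exact_mod_cast h3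
      rw [if_neg h3m]
      push_cast
      linear_combination -h3' / 2
  · obtain ⟨n, hn⟩ : ∃ n : ℤ, 4 * n = 1 + p := ⟨(1 + p) / 4, by omega⟩
    obtain ⟨O, _, hO, ⟨S⟩⟩ := BM.exists_reps_of_mod_four_eq_three hn h4
    have h4' : ¬ p % 4 = 1 := by omega
    rw [BM.ncard_level_two_of_mod_four_eq_three hp hn h4 S, hO, if_neg h4'] at h2
    rw [BM.ncard_level_three_of_mod_four_eq_three hp hn h4 S, hO] at h3
    rw [if_neg h4', if_neg h4']
    rcases (by omega : p % 8 = 3 ∨ p % 8 = 7) with h8 | h8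
    · rw [if_pos (Or.inr h8)]
      rw [if_pos h8] at h2 h3
      have h2' : (classNumberSqrtNeg p : ℚ) * 6 = 2 * (N1 p (p / 4) + 1) := by exact_mod_cast h2
      refine ⟨by push_cast; linear_combination -h2' / 2, ?_⟩
      by_cases h3m : p % 3 = 1
      · rw [if_pos h3m, if_pos h3m] at h3
        have h3' : N1 p (p / 3) = 0 := by omega
        simp [h3', h3m]
      · rw [if_neg h3m, if_neg h3m] at h3
        have h3' : (classNumberSqrtNeg p : ℚ) * 4 * 2 = 2 * (N1 p (p / 3) + 1) := by
          exact_mod_cast h3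
        rw [if_neg h3m]
        push_cast
        linear_combination -h3' / 2
    · rw [if_neg (by omega)]
      rw [if_neg (by omega : ¬ p % 8 = 3)] at h2 h3
      have h2' : (classNumberSqrtNeg p : ℚ) * 4 = 2 * (N1 p (p / 4) + 1) := by exact_mod_cast h2
      refine ⟨by push_cast; linear_combination -h2' / 2, ?_⟩
      by_cases h3m : p % 3 = 1
      · rw [if_pos h3m, if_pos h3m] at h3
        have h3' : N1 p (p / 3) = 0 := by omega
        simp [h3', h3m]
      · rw [if_neg h3m, if_neg h3m] at h3
        have h3' : (classNumberSqrtNeg p : ℚ) * 2 * 2 = 2 * (N1 p (p / 3) + 1) := by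
          exact_mod_cast h3
        rw [if_neg h3m]
        push_cast
        linear_combination -h3' / 2
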